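/- Suppose |1−χ| = O(ε), Re < Re₀ and ε ≤ ε₂. Then for all t ∈ [0,T]: (i) ε²A₃(t) ≤ C(ε²A₃(0) + A₁(0) + A₂(0) + ε⁻²A₀(0)); and (ii) ε²‖∇²ψ(t)‖²_{L²} + ‖∇²θ(t)‖²_{L²} ≤ C(ε²A₃(0) + A₁(0) + A₂(0) + ε⁻²A₀(0)), where C depends only on Re, Pr, μ′/μ and γ. -/

import Mathlib

noncomputable section

open MeasureTheory Real Filter Topology

namespace Couette

/-- The periodic cell of the horizontally periodic layer `Ω = 𝕊¹ × (0,1)`. -/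
def Ω : Set (ℝ × ℝ) := {x : ℝ × ℝ | x.1 ∈ Set.Ioo 0 (2 * π) ∧ x.2 ∈ Set.Ioo 0 1}

variable {F : Type*} [NormedAddCommGroup F] [NormedSpace ℝ F]

/-- Partial derivative in the horizontal direction `x₁`. -/
def d1 (f : ℝ × ℝ → F) (x : ℝ × ℝ) : F := fderiv ℝ f x (1, 0)

/-- Partial derivative in the vertical direction `x₂`. -/
def d2 (f : ℝ × ℝ → F) (x : ℝ × ℝ) : F := fderiv ℝ f x (0, 1)

/-- Time derivative of a time-dependent field. -/
def dt (f : ℝ → ℝ × ℝ → F) (t : ℝ) (x : ℝ × ℝ) : F := deriv (fun s => f s x) t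

/-- Divergence of a (two-dimensional) vector field. -/
def divv (v : ℝ × ℝ → ℝ × ℝ) (x : ℝ × ℝ) : ℝ :=
  d1 (fun y => (v y).1) x + d2 (fun y => (v y).2) x

/-- Gradient of a scalar field. -/
def grad (f : ℝ × ℝ → ℝ) (x : ℝ × ℝ) : ℝ × ℝ := (d1 f x, d2 f x)

/-- Laplacian. -/
def lap (f : ℝ × ℝ → F) (x : ℝ × ℝ) : F := d1 (d1 f) x + d2 (d2 f) x

/-- Euclidean inner product on `ℝ²`. -/
def dot (a b : ℝ × ℝ) : ℝ := a.1 * b.1 + a.2 * b.2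

/-- The contraction `𝔇(v) : 𝔇(w)` of deformation tensors, where
`𝔇(v) = (∇v + (∇v)ᵀ)/2`. -/
def defContract (v w : ℝ × ℝ → ℝ × ℝ) (x : ℝ × ℝ) : ℝ :=
  d1 (fun y => (v y).1) x * d1 (fun y => (w y).1) x
    + d2 (fun y => (v y).2) x * d2 (fun y => (w y).2) x
    + 2 * ((d1 (fun y => (v y).2) x + d2 (fun y => (v y).1) x) / 2)
        * ((d1 (fun y => (w y).2) x + d2 (fun y => (w y).1) x) / 2)

/-- Squared `L²(Ω)` norm of the `j`-th spatial derivative. -/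
def dSq (j : ℕ) (f : ℝ × ℝ → F) : ℝ := ∫ x in Ω, ‖iteratedFDeriv ℝ j f x‖ ^ 2

/-- Squared `L²(Ω)` norm. -/
def L2Sq (f : ℝ × ℝ → F) : ℝ := dSq 0 f

/-- Squared `Hᵏ(Ω)` norm. -/
def HSq (k : ℕ) (f : ℝ × ℝ → F) : ℝ := ∑ j ∈ Finset.range (k + 1), dSq j f

/-- `L∞(Ω)` (sup) norm. -/
def LinfSup (f : ℝ × ℝ → F) : ℝ := ⨆ x ∈ Ω, ‖f x‖

/-- Membership in the Sobolev space `Hᵏ(Ω)`. -/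
def MemH (k : ℕ) (f : ℝ × ℝ → F) : Prop :=
  ∀ j ≤ k, IntegrableOn (fun x => ‖iteratedFDeriv ℝ j f x‖ ^ 2) Ω

/-- Continuity in time, with values in `Hᵏ(Ω)`, on the time set `s`. -/
def ContInH (k : ℕ) (f : ℝ → ℝ × ℝ → F) (s : Set ℝ) : Prop :=
  (∀ t ∈ s, MemH k (f t)) ∧
    ∀ t₀ ∈ s, Tendsto (fun t => HSq k (fun x => f t x - f t₀ x)) (nhdsWithin t₀ s) (nhds 0)

/-- Square integrability in time, with values in `Hᵏ(Ω)`, on the time set `s`. -/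
def L2InH (k : ℕ) (f : ℝ → ℝ × ℝ → F) (s : Set ℝ) : Prop :=
  IntegrableOn (fun t => HSq k (f t)) s

/-- Temperature `𝒯̃` of the non-dimensional plane Couette flow
(here `C_p = γ/(γ-1)`, the gas constant being normalized to `R = 1`). -/
def tT (γ Pr ε χ : ℝ) (x : ℝ × ℝ) : ℝ :=
  χ + (1 - χ) * x.2 - ε ^ 2 * Pr / (2 * (γ / (γ - 1))) * (x.2 ^ 2 - x.2)

/-- Density `ρ̃ = 𝒯̃⁻¹` of the plane Couette flow. -/
def tρ (γ Pr ε χ : ℝ) (x : ℝ × ℝ) : ℝ := (tT γ Pr ε χ x)⁻¹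

/-- Velocity `ũ = (x₂, 0)` of the plane Couette flow. -/
def tu (x : ℝ × ℝ) : ℝ × ℝ := (x.2, 0)

/-- Total density `ρ = ρ̃ + φ`. -/
def pρ (γ Pr ε χ : ℝ) (φ : ℝ → ℝ × ℝ → ℝ) (t : ℝ) (x : ℝ × ℝ) : ℝ := tρ γ Pr ε χ x + φ t x

/-- Total temperature `𝒯 = 𝒯̃ + θ`. -/
def pT (γ Pr ε χ : ℝ) (θ : ℝ → ℝ × ℝ → ℝ) (t : ℝ) (x : ℝ × ℝ) : ℝ := tT γ Pr ε χ x + θ t x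

/-- Total velocity `u = ũ + ψ`. -/
def pu (ψ : ℝ → ℝ × ℝ → ℝ × ℝ) (t : ℝ) (x : ℝ × ℝ) : ℝ × ℝ := tu x + ψ t x

/-- A classical solution `(φ, ψ, θ) = (ρ - ρ̃, u - ũ, 𝒯 - 𝒯̃)` of the perturbation
system around the plane Couette flow on `Ω × [0,T]`, with non-slip and isothermal
boundary conditions and periodicity in `x₁`.  Here `μ = 1/Re`, `μ' = r·μ`
(`r = μ'/μ = ν'/ν`), and `κ = C_p/(Re·Pr)` with `C_p = γ/(γ-1)`. -/
structure PerturbSol (γ Pr r Re ε χ T : ℝ) where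
  φ : ℝ → ℝ × ℝ → ℝ
  ψ : ℝ → ℝ × ℝ → ℝ × ℝ
  θ : ℝ → ℝ × ℝ → ℝ
  mass_eq : ∀ t ∈ Set.Icc (0 : ℝ) T, ∀ x ∈ Ω,
    dt φ t x + dot (pu ψ t x) (grad (φ t) x) + pρ γ Pr ε χ φ t x * divv (ψ t) x
      + dot (ψ t x) (grad (tρ γ Pr ε χ) x) = 0
  mom_eq1 : ∀ t ∈ Set.Icc (0 : ℝ) T, ∀ x ∈ Ω,
    pρ γ Pr ε χ φ t x * ((dt ψ t x).1 + dot (pu ψ t x) (grad (fun y => (ψ t y).1) x)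
        + dot (ψ t x) (grad (fun y => (tu y).1) x))
      + (ε ^ 2)⁻¹ * d1 (fun y => pρ γ Pr ε χ φ t y * pT γ Pr ε χ θ t y) x
      - Re⁻¹ * lap (fun y => (ψ t y).1) x
      - (Re⁻¹ + r * Re⁻¹) * d1 (divv (ψ t)) x = 0
  mom_eq2 : ∀ t ∈ Set.Icc (0 : ℝ) T, ∀ x ∈ Ω,
    pρ γ Pr ε χ φ t x * ((dt ψ t x).2 + dot (pu ψ t x) (grad (fun y => (ψ t y).2) x)
        + dot (ψ t x) (grad (fun y => (tu y).2) x))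
      + (ε ^ 2)⁻¹ * d2 (fun y => pρ γ Pr ε χ φ t y * pT γ Pr ε χ θ t y) x
      - Re⁻¹ * lap (fun y => (ψ t y).2) x
      - (Re⁻¹ + r * Re⁻¹) * d2 (divv (ψ t)) x = 0
  energy_eq : ∀ t ∈ Set.Icc (0 : ℝ) T, ∀ x ∈ Ω,
    pρ γ Pr ε χ φ t x / (γ - 1) * (dt θ t x + dot (pu ψ t x) (grad (θ t) x)
        + dot (ψ t x) (grad (tT γ Pr ε χ) x))
      + pρ γ Pr ε χ φ t x * pT γ Pr ε χ θ t x * divv (ψ t) x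
      - γ / (γ - 1) / (Re * Pr) * lap (θ t) x
      = ε ^ 2 * (2 * Re⁻¹ * defContract (ψ t) (ψ t) x
          + 4 * Re⁻¹ * defContract tu (ψ t) x + r * Re⁻¹ * (divv (ψ t) x) ^ 2)
  bc_ψ : ∀ t ∈ Set.Icc (0 : ℝ) T, ∀ x : ℝ × ℝ, (x.2 = 0 ∨ x.2 = 1) → ψ t x = 0
  bc_θ : ∀ t ∈ Set.Icc (0 : ℝ) T, ∀ x : ℝ × ℝ, (x.2 = 0 ∨ x.2 = 1) → θ t x = 0
  periodic_φ : ∀ t x, φ t (x.1 + 2 * π, x.2) = φ t x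
  periodic_ψ : ∀ t x, ψ t (x.1 + 2 * π, x.2) = ψ t x
  periodic_θ : ∀ t x, θ t (x.1 + 2 * π, x.2) = θ t x

/-- Smoothness (in time and space) of a solution of the perturbation system. -/
def SmoothSol {γ Pr r Re ε χ T : ℝ} (S : PerturbSol γ Pr r Re ε χ T) : Prop :=
  ContDiff ℝ (⊤ : ℕ∞) (Function.uncurry S.φ) ∧ ContDiff ℝ (⊤ : ℕ∞) (Function.uncurry S.ψ) ∧
    ContDiff ℝ (⊤ : ℕ∞) (Function.uncurry S.θ)

/-- Standing hypotheses on a solution of the perturbation system: initial regularity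
`(φ₀, ψ₀, θ₀) ∈ H³`, zero average of the initial density perturbation, and the
compatibility conditions `∂tψ(0) = ∂tθ(0) = 0` on `∂Ω`. -/
def StdHyp {γ Pr r Re ε χ T : ℝ} (S : PerturbSol γ Pr r Re ε χ T) : Prop :=
  MemH 3 (S.φ 0) ∧ MemH 3 (S.ψ 0) ∧ MemH 3 (S.θ 0) ∧
    (∫ x in Ω, S.φ 0 x) = 0 ∧
    ∀ x : ℝ × ℝ, (x.2 = 0 ∨ x.2 = 1) → dt S.ψ 0 x = 0 ∧ dt S.θ 0 x = 0

/-- The energy functional `A₀`. -/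
def A0 (ε : ℝ) (φ : ℝ → ℝ × ℝ → ℝ) (ψ : ℝ → ℝ × ℝ → ℝ × ℝ) (θ : ℝ → ℝ × ℝ → ℝ)
    (t : ℝ) : ℝ :=
  (⨆ s ∈ Set.Icc (0 : ℝ) t,
      (L2Sq (ψ s) + (ε ^ 2)⁻¹ * L2Sq (φ s) + (ε ^ 2)⁻¹ * L2Sq (θ s)))
    + ∫ s in (0 : ℝ)..t, (HSq 1 (ψ s) + (ε ^ 2)⁻¹ * HSq 1 (θ s))

/-- The energy functional `A₁`. -/
def A1 (ε : ℝ) (φ : ℝ → ℝ × ℝ → ℝ) (ψ : ℝ → ℝ × ℝ → ℝ × ℝ) (θ : ℝ → ℝ × ℝ → ℝ)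
    (t : ℝ) : ℝ :=
  (⨆ s ∈ Set.Icc (0 : ℝ) t, (dSq 1 (ψ s) + (ε ^ 2)⁻¹ * dSq 1 (θ s)))
    + ∫ s in (0 : ℝ)..t, (L2Sq (dt ψ s) + (ε ^ 2)⁻¹ * L2Sq (dt θ s))

/-- The energy functional `A₂`. -/
def A2 (ε : ℝ) (φ : ℝ → ℝ × ℝ → ℝ) (ψ : ℝ → ℝ × ℝ → ℝ × ℝ) (θ : ℝ → ℝ × ℝ → ℝ)
    (t : ℝ) : ℝ :=
  (ε ^ 2)⁻¹ * (⨆ s ∈ Set.Icc (0 : ℝ) t, dSq 1 (φ s))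
    + (∫ s in (0 : ℝ)..t, ((ε ^ 4)⁻¹ * HSq 1 (φ s) + (ε ^ 2)⁻¹ * L2Sq (dt φ s)))
    + ∫ s in (0 : ℝ)..t, (HSq 2 (ψ s) + (ε ^ 2)⁻¹ * HSq 2 (θ s))

/-- The energy functional `A₃`. -/
def A3 (ε : ℝ) (φ : ℝ → ℝ × ℝ → ℝ) (ψ : ℝ → ℝ × ℝ → ℝ × ℝ) (θ : ℝ → ℝ × ℝ → ℝ)
    (t : ℝ) : ℝ :=
  (⨆ s ∈ Set.Icc (0 : ℝ) t,
      ((ε ^ 2)⁻¹ * L2Sq (dt φ s) + L2Sq (dt ψ s) + (ε ^ 2)⁻¹ * L2Sq (dt θ s)))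
    + ∫ s in (0 : ℝ)..t, (dSq 1 (dt ψ s) + (ε ^ 2)⁻¹ * dSq 1 (dt θ s))

/-- The energy functional `A₄`. -/
def A4 (ε : ℝ) (φ : ℝ → ℝ × ℝ → ℝ) (ψ : ℝ → ℝ × ℝ → ℝ × ℝ) (θ : ℝ → ℝ × ℝ → ℝ)
    (t : ℝ) : ℝ :=
  (⨆ s ∈ Set.Icc (0 : ℝ) t,
      ((ε ^ 2)⁻¹ * dSq 2 (φ s) + dSq 2 (ψ s) + (ε ^ 2)⁻¹ * dSq 2 (θ s)))
    + ∫ s in (0 : ℝ)..t, ((ε ^ 4)⁻¹ * HSq 2 (φ s) + HSq 3 (ψ s) + (ε ^ 2)⁻¹ * HSq 3 (θ s))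

/-- The energy functional `A₅`. -/
def A5 (ε : ℝ) (φ : ℝ → ℝ × ℝ → ℝ) (ψ : ℝ → ℝ × ℝ → ℝ × ℝ) (θ : ℝ → ℝ × ℝ → ℝ)
    (t : ℝ) : ℝ :=
  (⨆ s ∈ Set.Icc (0 : ℝ) t,
      ((ε ^ 2)⁻¹ * dSq 3 (φ s) + (dSq 3 (ψ s) + dSq 1 (dt ψ s))
        + (ε ^ 2)⁻¹ * (dSq 3 (θ s) + dSq 1 (dt θ s))))
    + ∫ s in (0 : ℝ)..t, (L2Sq (dt (dt ψ) s) + (ε ^ 2)⁻¹ * L2Sq (dt (dt θ) s))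

/-- The total weighted energy functional `N(t)`. -/
def Nfun (ε : ℝ) (φ : ℝ → ℝ × ℝ → ℝ) (ψ : ℝ → ℝ × ℝ → ℝ × ℝ) (θ : ℝ → ℝ × ℝ → ℝ)
    (t : ℝ) : ℝ :=
  (ε ^ 2)⁻¹ * A0 ε φ ψ θ t + A1 ε φ ψ θ t + A2 ε φ ψ θ t
    + ε ^ 2 * A3 ε φ ψ θ t + ε ^ 2 * A4 ε φ ψ θ t + ε ^ 4 * A5 ε φ ψ θ t

/-- The relative entropy
`η = (ε²ρ/𝒯̃)|ψ|² + (ρ/(γ-1))(𝒯/𝒯̃ - ln(𝒯/𝒯̃) - 1) + ρ(τ/τ̃ - ln(τ/τ̃) - 1)`,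
where `τ = 1/ρ`, `τ̃ = 1/ρ̃`. -/
def relEnt (γ Pr ε χ : ℝ) (φ θ : ℝ → ℝ × ℝ → ℝ) (ψ : ℝ → ℝ × ℝ → ℝ × ℝ)
    (t : ℝ) (x : ℝ × ℝ) : ℝ :=
  ε ^ 2 * pρ γ Pr ε χ φ t x / tT γ Pr ε χ x * ‖ψ t x‖ ^ 2
    + pρ γ Pr ε χ φ t x / (γ - 1) *
        (pT γ Pr ε χ θ t x / tT γ Pr ε χ x
          - Real.log (pT γ Pr ε χ θ t x / tT γ Pr ε χ x) - 1)
    + pρ γ Pr ε χ φ t x *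
        ((pρ γ Pr ε χ φ t x)⁻¹ / (tρ γ Pr ε χ x)⁻¹
          - Real.log ((pρ γ Pr ε χ φ t x)⁻¹ / (tρ γ Pr ε χ x)⁻¹) - 1)

/-- A classical solution `(ρ, u, 𝒯)` of the non-dimensional full compressible
Navier–Stokes system on `Ω × (0,∞)`, with non-slip and isothermal boundary
conditions and periodicity in `x₁`. -/
structure FullSol (γ Pr r Re ε χ : ℝ) where
  rho : ℝ → ℝ × ℝ → ℝ
  vel : ℝ → ℝ × ℝ → ℝ × ℝ
  temp : ℝ → ℝ × ℝ → ℝ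
  mass_eq : ∀ t ∈ Set.Ioi (0 : ℝ), ∀ x ∈ Ω,
    dt rho t x + divv (fun y => rho t y • vel t y) x = 0
  mom_eq1 : ∀ t ∈ Set.Ioi (0 : ℝ), ∀ x ∈ Ω,
    rho t x * ((dt vel t x).1 + dot (vel t x) (grad (fun y => (vel t y).1) x))
      + (ε ^ 2)⁻¹ * d1 (fun y => rho t y * temp t y) x
      = Re⁻¹ * lap (fun y => (vel t y).1) x + (Re⁻¹ + r * Re⁻¹) * d1 (divv (vel t)) x
  mom_eq2 : ∀ t ∈ Set.Ioi (0 : ℝ), ∀ x ∈ Ω,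
    rho t x * ((dt vel t x).2 + dot (vel t x) (grad (fun y => (vel t y).2) x))
      + (ε ^ 2)⁻¹ * d2 (fun y => rho t y * temp t y) x
      = Re⁻¹ * lap (fun y => (vel t y).2) x + (Re⁻¹ + r * Re⁻¹) * d2 (divv (vel t)) x
  energy_eq : ∀ t ∈ Set.Ioi (0 : ℝ), ∀ x ∈ Ω,
    rho t x / (γ - 1) * (dt temp t x + dot (vel t x) (grad (temp t) x))
      + rho t x * temp t x * divv (vel t) x
      = γ / (γ - 1) / (Re * Pr) * lap (temp t) x
        + ε ^ 2 * (2 * Re⁻¹ * defContract (vel t) (vel t) x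
            + r * Re⁻¹ * (divv (vel t) x) ^ 2)
  bc_top : ∀ t ∈ Set.Ioi (0 : ℝ), ∀ x : ℝ × ℝ, x.2 = 1 →
    vel t x = (1, 0) ∧ temp t x = 1
  bc_bot : ∀ t ∈ Set.Ioi (0 : ℝ), ∀ x : ℝ × ℝ, x.2 = 0 →
    vel t x = 0 ∧ temp t x = χ
  periodic_rho : ∀ t x, rho t (x.1 + 2 * π, x.2) = rho t x
  periodic_vel : ∀ t x, vel t (x.1 + 2 * π, x.2) = vel t x
  periodic_temp : ∀ t x, temp t (x.1 + 2 * π, x.2) = temp t x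

/-- `∂tφ(0)`, defined from the initial data by taking `t = 0` in the mass equation
of the perturbation system. -/
def dtφ0 (γ Pr ε χ : ℝ) (φ₀ : ℝ × ℝ → ℝ) (ψ₀ : ℝ × ℝ → ℝ × ℝ) (x : ℝ × ℝ) : ℝ :=
  -(dot (tu x + ψ₀ x) (grad φ₀ x) + (tρ γ Pr ε χ x + φ₀ x) * divv ψ₀ x
      + dot (ψ₀ x) (grad (tρ γ Pr ε χ) x))

/-- `∂tψ(0)`, defined from the initial data by taking `t = 0` in the momentum
equation of the perturbation system. -/
def dtψ0 (γ Pr r Re ε χ : ℝ) (φ₀ θ₀ : ℝ × ℝ → ℝ) (ψ₀ : ℝ × ℝ → ℝ × ℝ)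
    (x : ℝ × ℝ) : ℝ × ℝ :=
  ((tρ γ Pr ε χ x + φ₀ x)⁻¹ *
      (Re⁻¹ * lap (fun y => (ψ₀ y).1) x + (Re⁻¹ + r * Re⁻¹) * d1 (divv ψ₀) x
        - (ε ^ 2)⁻¹ * d1 (fun y => (tρ γ Pr ε χ y + φ₀ y) * (tT γ Pr ε χ y + θ₀ y)) x)
      - dot (tu x + ψ₀ x) (grad (fun y => (ψ₀ y).1) x)
      - dot (ψ₀ x) (grad (fun y => (tu y).1) x),
   (tρ γ Pr ε χ x + φ₀ x)⁻¹ *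
      (Re⁻¹ * lap (fun y => (ψ₀ y).2) x + (Re⁻¹ + r * Re⁻¹) * d2 (divv ψ₀) x
        - (ε ^ 2)⁻¹ * d2 (fun y => (tρ γ Pr ε χ y + φ₀ y) * (tT γ Pr ε χ y + θ₀ y)) x)
      - dot (tu x + ψ₀ x) (grad (fun y => (ψ₀ y).2) x)
      - dot (ψ₀ x) (grad (fun y => (tu y).2) x))

/-- `∂tθ(0)`, defined from the initial data by taking `t = 0` in the temperature
equation of the perturbation system. -/
def dtθ0 (γ Pr r Re ε χ : ℝ) (φ₀ θ₀ : ℝ × ℝ → ℝ) (ψ₀ : ℝ × ℝ → ℝ × ℝ)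
    (x : ℝ × ℝ) : ℝ :=
  (γ - 1) * (tρ γ Pr ε χ x + φ₀ x)⁻¹ *
      (γ / (γ - 1) / (Re * Pr) * lap θ₀ x
        - (tρ γ Pr ε χ x + φ₀ x) * (tT γ Pr ε χ x + θ₀ x) * divv ψ₀ x
        + ε ^ 2 * (2 * Re⁻¹ * defContract ψ₀ ψ₀ x + 4 * Re⁻¹ * defContract tu ψ₀ x
            + r * Re⁻¹ * (divv ψ₀ x) ^ 2))
    - dot (tu x + ψ₀ x) (grad θ₀ x) - dot (ψ₀ x) (grad (tT γ Pr ε χ) x)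


set_option linter.all false
/-- Space-time. -/
abbrev Pt := ℝ × (ℝ × ℝ)

/-- The algebra of smooth functions on space-time. -/
def Sm : Subalgebra ℝ (Pt → ℝ) where
  carrier := {f | ContDiff ℝ (⊤ : ℕ∞) f}
  mul_mem' := by
    intro a b ha hb
    rw [Set.mem_setOf_eq] at *
    exact ha.mul hb
  add_mem' := by
    intro a b ha hb
    rw [Set.mem_setOf_eq] at *
    exact ha.add hb
  algebraMap_mem' := by
    intro r
    rw [Set.mem_setOf_eq]
    exact contDiff_const

theorem mem_Sm {f : Pt → ℝ} : f ∈ Sm ↔ ContDiff ℝ (⊤ : ℕ∞) f := Iff.rfl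

theorem Sm_smooth (f : Sm) : ContDiff ℝ (⊤ : ℕ∞) f.1 := mem_Sm.1 f.2

theorem Sm_cont (f : Sm) : Continuous f.1 := (Sm_smooth f).continuous

theorem Sm_diff (f : Sm) : Differentiable ℝ f.1 := (Sm_smooth f).differentiable (by simp)

/-- Directional derivative. -/
def Dd (e : Pt) (f : Sm) : Sm :=
  ⟨fun p => fderiv ℝ f.1 p e, by
    rw [mem_Sm]
    have h : ContDiff ℝ (⊤ : ℕ∞) (fderiv ℝ f.1) := (Sm_smooth f).fderiv_right (by simp)
    exact h.clm_apply contDiff_const⟩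

/-- Constants. -/
def cst (c : ℝ) : Sm := algebraMap ℝ Sm c

def Dt (f : Sm) : Sm := Dd (1, (0, 0)) f
def D1 (f : Sm) : Sm := Dd (0, (1, 0)) f
def D2 (f : Sm) : Sm := Dd (0, (0, 1)) f

theorem ev_mul (f g : Sm) (p : Pt) : (f * g).1 p = f.1 p * g.1 p := rfl
theorem ev_add (f g : Sm) (p : Pt) : (f + g).1 p = f.1 p + g.1 p := rfl
theorem ev_sub (f g : Sm) (p : Pt) : (f - g).1 p = f.1 p - g.1 p := rfl
theorem ev_neg (f : Sm) (p : Pt) : (-f).1 p = -f.1 p := rfl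
theorem ev_pow (f : Sm) (n : ℕ) (p : Pt) : (f ^ n).1 p = f.1 p ^ n := rfl
theorem ev_cst (c : ℝ) (p : Pt) : (cst c).1 p = c := rfl
theorem ev_zero (p : Pt) : (0 : Sm).1 p = 0 := rfl
theorem ev_one (p : Pt) : (1 : Sm).1 p = 1 := rfl

theorem Sm.ext' {f g : Sm} (h : ∀ p, f.1 p = g.1 p) : f = g := Subtype.ext (funext h)

theorem Dd_add (e : Pt) (f g : Sm) : Dd e (f + g) = Dd e f + Dd e g := by
  apply Sm.ext'; intro p
  change fderiv ℝ (f.1 + g.1) p e = fderiv ℝ f.1 p e + fderiv ℝ g.1 p e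
  rw [fderiv_add (Sm_diff f p) (Sm_diff g p)]; rfl

theorem Dd_sub (e : Pt) (f g : Sm) : Dd e (f - g) = Dd e f - Dd e g := by
  apply Sm.ext'; intro p
  change fderiv ℝ (f.1 - g.1) p e = fderiv ℝ f.1 p e - fderiv ℝ g.1 p e
  rw [fderiv_sub (Sm_diff f p) (Sm_diff g p)]; rfl

theorem Dd_neg (e : Pt) (f : Sm) : Dd e (-f) = -Dd e f := by
  apply Sm.ext'; intro p
  change fderiv ℝ (-f.1) p e = -fderiv ℝ f.1 p e
  rw [fderiv_neg]; rfl

theorem Dd_mul (e : Pt) (f g : Sm) : Dd e (f * g) = f * Dd e g + g * Dd e f := by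
  apply Sm.ext'; intro p
  change fderiv ℝ (f.1 * g.1) p e = f.1 p * fderiv ℝ g.1 p e + g.1 p * fderiv ℝ f.1 p e
  rw [fderiv_mul (Sm_diff f p) (Sm_diff g p)]; rfl

theorem Dd_cst (e : Pt) (c : ℝ) : Dd e (cst c) = 0 := by
  apply Sm.ext'; intro p
  change fderiv ℝ (fun _ => c) p e = 0
  simp

theorem Dd_comm (e e' : Pt) (f : Sm) : Dd e (Dd e' f) = Dd e' (Dd e f) := by
  have h : ContDiff ℝ (⊤ : ℕ∞) (fderiv ℝ f.1) := (Sm_smooth f).fderiv_right (by simp)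
  have key : ∀ (a b : Pt) (p : Pt), (Dd a (Dd b f)).1 p = fderiv ℝ (fderiv ℝ f.1) p a b := by
    intro a b p
    change fderiv ℝ (fun q => fderiv ℝ f.1 q b) p a = _
    rw [fderiv_clm_apply (h.differentiable (by simp) p) (by fun_prop)]
    simp
  apply Sm.ext'; intro p
  rw [key, key]
  have hs : IsSymmSndFDerivAt ℝ f.1 p := by
    apply ContDiffAt.isSymmSndFDerivAt ((Sm_smooth f).contDiffAt)
    rw [minSmoothness_of_isRCLikeNormedField]
    have h2 : ((2 : ℕ∞) : WithTop ℕ∞) ≤ ((⊤ : ℕ∞) : WithTop ℕ∞) := WithTop.coe_le_coe.2 le_top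
    exact h2
  exact hs e e'

theorem Dt_add (f g : Sm) : Dt (f + g) = Dt f + Dt g := Dd_add _ f g
theorem D1_add (f g : Sm) : D1 (f + g) = D1 f + D1 g := Dd_add _ f g
theorem D2_add (f g : Sm) : D2 (f + g) = D2 f + D2 g := Dd_add _ f g
theorem Dt_sub (f g : Sm) : Dt (f - g) = Dt f - Dt g := Dd_sub _ f g
theorem D1_sub (f g : Sm) : D1 (f - g) = D1 f - D1 g := Dd_sub _ f g
theorem D2_sub (f g : Sm) : D2 (f - g) = D2 f - D2 g := Dd_sub _ f g
theorem Dt_neg (f : Sm) : Dt (-f) = -Dt f := Dd_neg _ f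
theorem D1_neg (f : Sm) : D1 (-f) = -D1 f := Dd_neg _ f
theorem D2_neg (f : Sm) : D2 (-f) = -D2 f := Dd_neg _ f
theorem Dt_mul (f g : Sm) : Dt (f * g) = f * Dt g + g * Dt f := Dd_mul _ f g
theorem D1_mul (f g : Sm) : D1 (f * g) = f * D1 g + g * D1 f := Dd_mul _ f g
theorem D2_mul (f g : Sm) : D2 (f * g) = f * D2 g + g * D2 f := Dd_mul _ f g
theorem Dt_cst (c : ℝ) : Dt (cst c) = 0 := Dd_cst _ c
theorem D1_cst (c : ℝ) : D1 (cst c) = 0 := Dd_cst _ c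
theorem D2_cst (c : ℝ) : D2 (cst c) = 0 := Dd_cst _ c
/-- Commutations in canonical order `D1`, `D2`, `Dt`. -/
theorem D2_D1 (f : Sm) : D2 (D1 f) = D1 (D2 f) := Dd_comm _ _ f
theorem Dt_D1 (f : Sm) : Dt (D1 f) = D1 (Dt f) := Dd_comm _ _ f
theorem Dt_D2 (f : Sm) : Dt (D2 f) = D2 (Dt f) := Dd_comm _ _ f

/-! Horizontal periodicity. -/

def Per (f : Sm) : Prop := ∀ t x y, f.1 (t, (x + 2 * π, y)) = f.1 (t, (x, y))

theorem Per.mul {f g : Sm} (hf : Per f) (hg : Per g) : Per (f * g) := fun t x y => by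
  rw [ev_mul, ev_mul, hf, hg]
theorem Per.add {f g : Sm} (hf : Per f) (hg : Per g) : Per (f + g) := fun t x y => by
  rw [ev_add, ev_add, hf, hg]
theorem Per.sub {f g : Sm} (hf : Per f) (hg : Per g) : Per (f - g) := fun t x y => by
  rw [ev_sub, ev_sub, hf, hg]
theorem Per.neg {f : Sm} (hf : Per f) : Per (-f) := fun t x y => by
  rw [ev_neg, ev_neg, hf]
theorem Per.cst (c : ℝ) : Per (cst c) := fun t x y => rfl
theorem Per.Dd {f : Sm} (hf : Per f) (e : Pt) : Per (Dd e f) := fun t x y => by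
  change fderiv ℝ f.1 (t, (x + 2 * π, y)) e = fderiv ℝ f.1 (t, (x, y)) e
  have h1 : f.1 = fun q => f.1 (q + (0, (2 * π, 0))) := by
    funext q; obtain ⟨t, x, y⟩ := q
    simpa using (hf t x y).symm
  have h2 := fderiv_comp_add_right (𝕜 := ℝ) (f := f.1) (x := (t, (x, y))) (0, (2 * π, 0))
  rw [← h1] at h2
  rw [h2]; simp
theorem Per.Dt {f : Sm} (hf : Per f) : Per (Dt f) := hf.Dd _
theorem Per.D1 {f : Sm} (hf : Per f) : Per (D1 f) := hf.Dd _
theorem Per.D2 {f : Sm} (hf : Per f) : Per (D2 f) := hf.Dd _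

/-! Vanishing on the walls at time `t`. -/

def W0 (t : ℝ) (f : Sm) : Prop := ∀ x, f.1 (t, (x, 0)) = 0 ∧ f.1 (t, (x, 1)) = 0

theorem W0.mulr {t : ℝ} {f : Sm} (hf : W0 t f) (g : Sm) : W0 t (f * g) := fun x => by
  simp [ev_mul, (hf x).1, (hf x).2]
theorem W0.mull {t : ℝ} {f : Sm} (hf : W0 t f) (g : Sm) : W0 t (g * f) := fun x => by
  simp [ev_mul, (hf x).1, (hf x).2]
theorem W0.add {t : ℝ} {f g : Sm} (hf : W0 t f) (hg : W0 t g) : W0 t (f + g) := fun x => by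
  simp [ev_add, (hf x).1, (hf x).2, (hg x).1, (hg x).2]
theorem W0.sub {t : ℝ} {f g : Sm} (hf : W0 t f) (hg : W0 t g) : W0 t (f - g) := fun x => by
  simp [ev_sub, (hf x).1, (hf x).2, (hg x).1, (hg x).2]
theorem W0.neg {t : ℝ} {f : Sm} (hf : W0 t f) : W0 t (-f) := fun x => by
  simp [ev_neg, (hf x).1, (hf x).2]

theorem D1_hasDeriv (f : Sm) (t x y : ℝ) :
    HasDerivAt (fun s => f.1 (t, (s, y))) ((D1 f).1 (t, (x, y))) x := by
  have h := (Sm_diff f (t, (x, y))).hasFDerivAt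
  have h2 : HasDerivAt (fun s : ℝ => (t, (s, y))) ((0 : ℝ), ((1 : ℝ), (0 : ℝ))) x := by
    apply HasDerivAt.prodMk (hasDerivAt_const _ _)
    exact HasDerivAt.prodMk (hasDerivAt_id _) (hasDerivAt_const _ _)
  exact h.comp_hasDerivAt x h2

theorem D2_hasDeriv (f : Sm) (t x y : ℝ) :
    HasDerivAt (fun s => f.1 (t, (x, s))) ((D2 f).1 (t, (x, y))) y := by
  have h := (Sm_diff f (t, (x, y))).hasFDerivAt
  have h2 : HasDerivAt (fun s : ℝ => (t, (x, s))) ((0 : ℝ), ((0 : ℝ), (1 : ℝ))) y := by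
    apply HasDerivAt.prodMk (hasDerivAt_const _ _)
    exact HasDerivAt.prodMk (hasDerivAt_const _ _) (hasDerivAt_id _)
  exact h.comp_hasDerivAt y h2

theorem Dt_hasDeriv (f : Sm) (t : ℝ) (x : ℝ × ℝ) :
    HasDerivAt (fun s => f.1 (s, x)) ((Dt f).1 (t, x)) t := by
  have h := (Sm_diff f (t, x)).hasFDerivAt
  have h2 : HasDerivAt (fun s : ℝ => (s, x)) ((1 : ℝ), ((0 : ℝ), (0 : ℝ))) t := by
    exact HasDerivAt.prodMk (hasDerivAt_id _) (hasDerivAt_const _ _)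
  exact h.comp_hasDerivAt t h2

theorem W0.D1 {t : ℝ} {f : Sm} (hf : W0 t f) : W0 t (D1 f) := fun x => by
  constructor
  · have h := D1_hasDeriv f t x 0
    have e : (fun s => f.1 (t, (s, 0))) = fun _ => 0 := funext fun s => (hf s).1
    rw [e] at h
    exact h.unique (hasDerivAt_const _ _)
  · have h := D1_hasDeriv f t x 1
    have e : (fun s => f.1 (t, (s, 1))) = fun _ => 0 := funext fun s => (hf s).2
    rw [e] at h
    exact h.unique (hasDerivAt_const _ _)

theorem W0.Dt {T : ℝ} (hT : 0 < T) {f : Sm} (hf : ∀ t ∈ Set.Icc 0 T, W0 t f) :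
    ∀ t ∈ Set.Icc 0 T, W0 t (Dt f) := by
  have key : ∀ x : ℝ × ℝ, (∀ t ∈ Set.Icc 0 T, f.1 (t, x) = 0) →
      ∀ t ∈ Set.Icc 0 T, (Couette.Dt f).1 (t, x) = 0 := by
    intro x h t ht
    have h1 := (Dt_hasDeriv f t x).hasDerivWithinAt (s := Set.Icc 0 T)
    have h2 : HasDerivWithinAt (fun s => f.1 (s, x)) 0 (Set.Icc 0 T) t :=
      (hasDerivWithinAt_const t (Set.Icc 0 T) (0 : ℝ)).congr (fun s hs => h s hs) (h t ht)
    exact (uniqueDiffOn_Icc hT t ht).eq_deriv _ h1 h2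
  intro t ht x
  exact ⟨key (x, 0) (fun s hs => (hf s hs x).1) t ht, key (x, 1) (fun s hs => (hf s hs x).2) t ht⟩

/-! The integral over `Ω` at fixed time. -/

theorem Ω_eq : Ω = Set.Ioo 0 (2 * π) ×ˢ Set.Ioo 0 1 := rfl

theorem Ω_open : IsOpen Ω := by rw [Ω_eq]; exact isOpen_Ioo.prod isOpen_Ioo

theorem Ω_meas : MeasurableSet Ω := Ω_open.measurableSet

/-- The closed cell. -/
def Ωc : Set (ℝ × ℝ) := Set.Icc 0 (2 * π) ×ˢ Set.Icc 0 1

theorem Ω_sub : Ω ⊆ Ωc := by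
  rw [Ω_eq]; exact Set.prod_mono Set.Ioo_subset_Icc_self Set.Ioo_subset_Icc_self

theorem Ωc_compact : IsCompact Ωc := isCompact_Icc.prod isCompact_Icc

theorem Ω_closure : closure Ω = Ωc := by
  rw [Ω_eq, closure_prod_eq, closure_Ioo (by positivity), closure_Ioo (by norm_num)]; rfl

theorem intOn_of_cont {g : ℝ × ℝ → ℝ} (hg : Continuous g) : IntegrableOn g Ω :=
  (hg.continuousOn.integrableOn_compact Ωc_compact).mono_set Ω_sub

instance : IsFiniteMeasure (volume.restrict Ω) := by
  constructor
  rw [Measure.restrict_apply_univ]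
  exact lt_of_le_of_lt (measure_mono Ω_sub) Ωc_compact.measure_lt_top

def I (f : Sm) (t : ℝ) : ℝ := ∫ x in Ω, f.1 (t, x)

theorem Sm_contx (f : Sm) (t : ℝ) : Continuous fun x => f.1 (t, x) :=
  (Sm_cont f).comp (by fun_prop)

theorem Sm_intOn (f : Sm) (t : ℝ) : IntegrableOn (fun x => f.1 (t, x)) Ω :=
  intOn_of_cont (Sm_contx f t)

theorem I_add (f g : Sm) (t : ℝ) : I (f + g) t = I f t + I g t :=
  integral_add (Sm_intOn f t) (Sm_intOn g t)
theorem I_sub (f g : Sm) (t : ℝ) : I (f - g) t = I f t - I g t :=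
  integral_sub (Sm_intOn f t) (Sm_intOn g t)
theorem I_neg (f : Sm) (t : ℝ) : I (-f) t = - I f t :=
  integral_neg (fun x => f.1 (t, x))
theorem I_cst_mul (c : ℝ) (f : Sm) (t : ℝ) : I (cst c * f) t = c * I f t :=
  integral_const_mul c (fun x => f.1 (t, x))

theorem I_mono {f g : Sm} {t : ℝ} (h : ∀ x ∈ Ω, f.1 (t, x) ≤ g.1 (t, x)) : I f t ≤ I g t :=
  setIntegral_mono_on (Sm_intOn f t) (Sm_intOn g t) Ω_meas h

theorem I_congr {f g : Sm} {t : ℝ} (h : ∀ x ∈ Ω, f.1 (t, x) = g.1 (t, x)) : I f t = I g t :=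
  setIntegral_congr_fun Ω_meas h

theorem I_nonneg {f : Sm} {t : ℝ} (h : ∀ x ∈ Ω, 0 ≤ f.1 (t, x)) : 0 ≤ I f t :=
  setIntegral_nonneg Ω_meas h

theorem I_sq_nonneg (f : Sm) (t : ℝ) : 0 ≤ I (f ^ 2) t :=
  I_nonneg fun x _ => by rw [ev_pow]; positivity

theorem I_iter (g : ℝ × ℝ → ℝ) (hg : Continuous g) :
    ∫ x in Ω, g x = ∫ x in (0)..(2 * π), ∫ y in (0 : ℝ)..1, g (x, y) := by
  rw [Ω_eq, Measure.volume_eq_prod, setIntegral_prod]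
  · rw [intervalIntegral.integral_of_le (by positivity), integral_Ioc_eq_integral_Ioo]
    apply setIntegral_congr_fun measurableSet_Ioo
    intro x _
    dsimp only
    rw [intervalIntegral.integral_of_le (by norm_num), integral_Ioc_eq_integral_Ioo]
  · exact intOn_of_cont hg

theorem I_div (f g : Sm) (t : ℝ) (hf : Per f) (hg : W0 t g) : I (D1 f + D2 g) t = 0 := by
  have h2 : (2 * π : ℝ) = 0 + 2 * π := by ring
  unfold I
  rw [I_iter _ (Sm_contx (D1 f + D2 g) t)]
  have := integral2_divergence_prod_of_hasFDerivAt_off_countable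
    (fun x : ℝ × ℝ => f.1 (t, x)) (fun x : ℝ × ℝ => g.1 (t, x))
    (fun x => (fderiv ℝ f.1 (t, x)).comp (ContinuousLinearMap.inr ℝ ℝ (ℝ × ℝ)))
    (fun x => (fderiv ℝ g.1 (t, x)).comp (ContinuousLinearMap.inr ℝ ℝ (ℝ × ℝ)))
    0 0 (2 * π) 1 ∅ Set.countable_empty (Sm_contx f t).continuousOn (Sm_contx g t).continuousOn
    (fun x _ => (Sm_diff f (t, x)).hasFDerivAt.comp x (hasFDerivAt_prodMk_right t x))
    (fun x _ => (Sm_diff g (t, x)).hasFDerivAt.comp x (hasFDerivAt_prodMk_right t x))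
    (by
      apply ContinuousOn.integrableOn_compact
      · exact isCompact_uIcc.prod isCompact_uIcc
      · exact (Sm_contx (D1 f + D2 g) t).continuousOn)
  refine Eq.trans ?_ (this.trans ?_)
  · rfl
  · have e1 : ∀ x, g.1 (t, (x, 1)) = 0 := fun x => (hg x).2
    have e0 : ∀ x, g.1 (t, (x, 0)) = 0 := fun x => (hg x).1
    have e2 : ∀ y, f.1 (t, (2 * π, y)) = f.1 (t, (0, y)) := fun y => by
      conv_lhs => rw [h2]
      exact hf t 0 y
    simp [e1, e0, e2]

theorem Per_zero : Per 0 := fun _ _ _ => rfl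
theorem W0_zero (t : ℝ) : W0 t 0 := fun _ => ⟨rfl, rfl⟩

theorem Dd_zero (e : Pt) : Dd e 0 = 0 := by
  have := Dd_sub e 0 0
  simpa using this

theorem I_D1 (f : Sm) (t : ℝ) (hf : Per f) : I (D1 f) t = 0 := by
  have := I_div f 0 t hf (W0_zero t)
  rwa [D2, Dd_zero, add_zero] at this

theorem I_D2 (g : Sm) (t : ℝ) (hg : W0 t g) : I (D2 g) t = 0 := by
  have := I_div 0 g t Per_zero hg
  rwa [D1, Dd_zero, zero_add] at this

/-- Integrating a local inequality in divergence form. -/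
theorem I_le_of_local {G f g h : Sm} {t : ℝ} (hf : Per f) (hg : W0 t g)
    (hl : ∀ x ∈ Ω, G.1 (t, x) ≤ (D1 f).1 (t, x) + (D2 g).1 (t, x) + h.1 (t, x)) :
    I G t ≤ I h t := by
  have h1 : I G t ≤ I (D1 f + D2 g + h) t := I_mono hl
  rwa [I_add, I_div f g t hf hg, zero_add] at h1

theorem I_hasDeriv (f : Sm) (t : ℝ) : HasDerivAt (I f) (I (Dt f) t) t := by
  have hK : IsCompact (Set.Icc (t - 1) (t + 1) ×ˢ Ωc) := isCompact_Icc.prod Ωc_compact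
  obtain ⟨C, hC⟩ := hK.exists_bound_of_continuousOn (f := (Dt f).1) (Sm_cont (Dt f)).continuousOn
  refine (hasDerivAt_integral_of_dominated_loc_of_deriv_le (μ := volume.restrict Ω)
    (F := fun s x => f.1 (s, x)) (F' := fun s x => (Dt f).1 (s, x)) (x₀ := t)
    (s := Set.Icc (t - 1) (t + 1)) (bound := fun _ => C) (Icc_mem_nhds (by linarith) (by linarith))
    (Eventually.of_forall fun s => (Sm_intOn f s).aestronglyMeasurable) (Sm_intOn f t)
    (Sm_intOn (Dt f) t).aestronglyMeasurable ?_ (integrable_const C) ?_).2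
  · filter_upwards [ae_restrict_mem Ω_meas] with x hx s hs
    exact hC (s, x) ⟨hs, Ω_sub hx⟩
  · exact Eventually.of_forall fun x s _ => Dt_hasDeriv f s x

theorem I_cont (f : Sm) : Continuous (I f) :=
  continuous_iff_continuousAt.2 fun t => (I_hasDeriv f t).continuousAt

/-- If `G` vanishes in the space-time cylinder then so do its derivatives. -/
theorem Dd_vanish {T : ℝ} (hT : 0 < T) {G : Sm}
    (hG : ∀ t ∈ Set.Icc 0 T, ∀ x ∈ Ω, G.1 (t, x) = 0) (e : Pt) :
    ∀ t ∈ Set.Icc 0 T, ∀ x ∈ Ω, (Dd e G).1 (t, x) = 0 := by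
  have hop : IsOpen (Set.Ioo 0 T ×ˢ Ω) := isOpen_Ioo.prod Ω_open
  have h1 : ∀ p ∈ Set.Ioo 0 T ×ˢ Ω, (Dd e G).1 p = 0 := by
    intro p hp
    have : G.1 =ᶠ[𝓝 p] fun _ => 0 := by
      filter_upwards [hop.mem_nhds hp] with q hq
      exact hG q.1 (Set.Ioo_subset_Icc_self hq.1) q.2 hq.2
    change fderiv ℝ G.1 p e = 0
    rw [this.fderiv_eq]; simp
  have hcl : closure (Set.Ioo 0 T ×ˢ Ω) ⊆ {p | (Dd e G).1 p = 0} :=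
    closure_minimal h1 (isClosed_eq (Sm_cont (Dd e G)) continuous_const)
  intro t ht x hx
  apply hcl
  rw [closure_prod_eq, closure_Ioo hT.ne]
  exact ⟨ht, subset_closure hx⟩

theorem vanish_closure {t : ℝ} {G : Sm} (hG : ∀ x ∈ Ω, G.1 (t, x) = 0) :
    ∀ x ∈ Ωc, G.1 (t, x) = 0 := by
  have hcl : closure Ω ⊆ {x | G.1 (t, x) = 0} :=
    closure_minimal hG (isClosed_eq (Sm_contx G t) continuous_const)
  intro x hx
  rw [← Ω_closure] at hx
  exact hcl hx

/-- The vertical coordinate as a smooth function. -/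
def Yc : Sm := ⟨fun p => p.2.2, by rw [mem_Sm]; exact contDiff_snd.comp contDiff_snd⟩

theorem ev_Yc (t x y : ℝ) : Yc.1 (t, (x, y)) = y := rfl
theorem Per_Yc : Per Yc := fun _ _ _ => rfl

theorem Dd_Yc (e : Pt) : Dd e Yc = cst e.2.2 := by
  apply Sm.ext'; intro p
  change fderiv ℝ (fun q : Pt => q.2.2) p e = e.2.2
  have : HasFDerivAt (fun q : Pt => q.2.2)
    ((ContinuousLinearMap.snd ℝ ℝ ℝ).comp (ContinuousLinearMap.snd ℝ ℝ (ℝ × ℝ))) p :=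
    ((ContinuousLinearMap.snd ℝ ℝ ℝ).comp (ContinuousLinearMap.snd ℝ ℝ (ℝ × ℝ))).hasFDerivAt
  rw [this.fderiv]; rfl

theorem cst_zero : cst 0 = 0 := by apply Sm.ext'; intro p; rfl
theorem cst_one : cst 1 = 1 := by apply Sm.ext'; intro p; rfl

theorem Dt_Yc : Dt Yc = 0 := by rw [Dt, Dd_Yc]; exact cst_zero
theorem D1_Yc : D1 Yc = 0 := by rw [D1, Dd_Yc]; exact cst_zero
theorem D2_Yc : D2 Yc = 1 := by rw [D2, Dd_Yc]; exact cst_one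

/-- Dirichlet Poincare inequality. -/
theorem poincareD {f : Sm} {t : ℝ} (hf : W0 t f) : I (f ^ 2) t ≤ 4 * I ((D2 f) ^ 2) t := by
  have h : I (f ^ 2) t ≤ I (cst (1/2) * f ^ 2 + cst 2 * (D2 f) ^ 2) t := by
    apply I_le_of_local (f := 0) (g := Yc * f * f) Per_zero ((hf.mull Yc).mulr f)
    rintro ⟨x, y⟩ hx
    have hy : y ∈ Set.Ioo 0 1 := hx.2
    have e0 : D1 0 = 0 := Dd_zero _
    rw [D2_mul, D2_mul, D2_Yc, e0]
    simp only [ev_mul, ev_add, ev_pow, ev_cst, ev_one, ev_zero, ev_Yc]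
    set a := f.1 (t, (x, y))
    set b := (D2 f).1 (t, (x, y))
    have hyy : y ^ 2 ≤ 1 := by nlinarith [hy.1, hy.2]
    nlinarith [sq_nonneg (a + 2 * y * b), mul_nonneg (sub_nonneg.2 hyy) (sq_nonneg b)]
  rw [I_add, I_cst_mul, I_cst_mul] at h
  linarith

/-! One-dimensional facts. -/

theorem cs1 {g : ℝ → ℝ} (hg : Continuous g) {p q : ℝ} (hpq : q ≤ p) :
    (∫ s in q..p, g s) ^ 2 ≤ (p - q) * ∫ s in q..p, g s ^ 2 := by
  rcases hpq.eq_or_lt with h | h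
  · subst h; simp
  · have hd : 0 < p - q := by linarith
    set D := ∫ s in q..p, g s with hD
    have h0 : 0 ≤ ∫ s in q..p, (g s - D / (p - q)) ^ 2 :=
      intervalIntegral.integral_nonneg hpq fun s _ => sq_nonneg _
    have h1 : ∫ s in q..p, (g s - D / (p - q)) ^ 2 =
        (∫ s in q..p, g s ^ 2) - 2 * (D / (p - q)) * D + (p - q) * (D / (p - q)) ^ 2 := by
      have : ∀ s, (g s - D / (p - q)) ^ 2
          = g s ^ 2 - 2 * (D / (p - q)) * g s + (D / (p - q)) ^ 2 := fun s => by ring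
      simp only [this]
      rw [intervalIntegral.integral_add, intervalIntegral.integral_sub,
        intervalIntegral.integral_const_mul, intervalIntegral.integral_const, smul_eq_mul]
      all_goals exact Continuous.intervalIntegrable (by fun_prop) _ _
    rw [h1] at h0
    have h2 : (p - q) * ((∫ s in q..p, g s ^ 2) - 2 * (D / (p - q)) * D
        + (p - q) * (D / (p - q)) ^ 2) = (p - q) * (∫ s in q..p, g s ^ 2) - D ^ 2 := by
      field_simp; ring
    have := mul_nonneg hd.le h0
    rw [h2] at this
    linarith

theorem int_mono_dom {g : ℝ → ℝ} (hg : Continuous g) (h0 : ∀ s, 0 ≤ g s) {a b q p : ℝ}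
    (h1 : a ≤ q) (h2 : q ≤ p) (h3 : p ≤ b) : ∫ s in q..p, g s ≤ ∫ s in a..b, g s := by
  apply intervalIntegral.integral_mono_interval h1 h2 h3
  · exact Eventually.of_forall fun s => h0 s
  · exact hg.intervalIntegrable _ _

theorem osc1 {h h' : ℝ → ℝ} (hd : ∀ s, HasDerivAt h (h' s) s) (hc : Continuous h') {L p q : ℝ}
    (hp : p ∈ Set.Icc 0 L) (hq : q ∈ Set.Icc 0 L) :
    (h p - h q) ^ 2 ≤ L * ∫ s in (0 : ℝ)..L, h' s ^ 2 := by
  have key : ∀ p ∈ Set.Icc 0 L, ∀ q ∈ Set.Icc 0 L, q ≤ p →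
      (h p - h q) ^ 2 ≤ L * ∫ s in (0 : ℝ)..L, h' s ^ 2 := by
    intro p hp q hq hpq
    have e : ∫ s in q..p, h' s = h p - h q :=
      intervalIntegral.integral_eq_sub_of_hasDerivAt (fun s _ => hd s) (hc.intervalIntegrable _ _)
    rw [← e]
    refine (cs1 hc hpq).trans ?_
    have h1 : ∫ s in q..p, h' s ^ 2 ≤ ∫ s in (0 : ℝ)..L, h' s ^ 2 :=
      int_mono_dom (by fun_prop) (fun s => sq_nonneg _) hq.1 hpq hp.2
    have h2 : 0 ≤ ∫ s in q..p, h' s ^ 2 :=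
      intervalIntegral.integral_nonneg hpq fun s _ => sq_nonneg _
    have := hq.1; have := hp.2
    apply mul_le_mul _ h1 h2 (by linarith)
    linarith
  rcases le_total q p with h1 | h1
  · exact key p hp q hq h1
  · have := key q hq p hp h1
    nlinarith

theorem agmon1 {h h' : ℝ → ℝ} (hd : ∀ s, HasDerivAt h (h' s) s) (hc : Continuous h') {L p l : ℝ}
    (hL : 1 ≤ L) (hl : 0 < l) (hp : p ∈ Set.Icc 0 L) :
    h p ^ 2 ≤ (1 + l) * (∫ s in (0 : ℝ)..L, h s ^ 2) + l⁻¹ * ∫ s in (0 : ℝ)..L, h' s ^ 2 := by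
  have hhc : Continuous h := continuous_iff_continuousAt.2 fun s => (hd s).continuousAt
  set J := l * (∫ s in (0 : ℝ)..L, h s ^ 2) + l⁻¹ * ∫ s in (0 : ℝ)..L, h' s ^ 2 with hJ
  have hJ' : J = ∫ s in (0 : ℝ)..L, (l * h s ^ 2 + l⁻¹ * h' s ^ 2) := by
    rw [intervalIntegral.integral_add, intervalIntegral.integral_const_mul,
      intervalIntegral.integral_const_mul]
    all_goals exact Continuous.intervalIntegrable (by fun_prop) _ _
  have hpt : ∀ s, |2 * h s * h' s| ≤ l * h s ^ 2 + l⁻¹ * h' s ^ 2 := by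
    intro s
    have hli : 0 < l⁻¹ := inv_pos.2 hl
    have e1 : l * l⁻¹ = 1 := mul_inv_cancel₀ hl.ne'
    rw [abs_le]
    constructor
    · have : l * h s ^ 2 + l⁻¹ * h' s ^ 2 + 2 * h s * h' s = l⁻¹ * (l * h s + h' s) ^ 2 := by
        field_simp; ring
      have := mul_nonneg hli.le (sq_nonneg (l * h s + h' s))
      linarith
    · have : l * h s ^ 2 + l⁻¹ * h' s ^ 2 - 2 * h s * h' s = l⁻¹ * (l * h s - h' s) ^ 2 := by
        field_simp; ring
      have := mul_nonneg hli.le (sq_nonneg (l * h s - h' s))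
      linarith
  have key : ∀ q ∈ Set.Icc 0 L, h p ^ 2 ≤ h q ^ 2 + J := by
    intro q hq
    have e : ∫ s in q..p, 2 * h s * h' s = h p ^ 2 - h q ^ 2 := by
      apply intervalIntegral.integral_eq_sub_of_hasDerivAt (f := fun s => h s ^ 2)
      · intro s _
        have := (hd s).fun_pow 2
        simpa using this
      · exact Continuous.intervalIntegrable (by fun_prop) _ _
    have h1 : |∫ s in q..p, 2 * h s * h' s| ≤ J := by
      rw [hJ']
      rcases le_total q p with hqp | hqp
      · refine (intervalIntegral.abs_integral_le_integral_abs hqp).trans ?_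
        refine (intervalIntegral.integral_mono_on hqp (Continuous.intervalIntegrable (by fun_prop) _ _)
          (Continuous.intervalIntegrable (by fun_prop) _ _) fun s _ => hpt s).trans ?_
        exact int_mono_dom (by fun_prop) (fun s => (abs_nonneg _).trans (hpt s)) hq.1 hqp hp.2
      · rw [intervalIntegral.integral_symm, abs_neg]
        refine (intervalIntegral.abs_integral_le_integral_abs hqp).trans ?_
        refine (intervalIntegral.integral_mono_on hqp (Continuous.intervalIntegrable (by fun_prop) _ _)
          (Continuous.intervalIntegrable (by fun_prop) _ _) fun s _ => hpt s).trans ?_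
        exact int_mono_dom (by fun_prop) (fun s => (abs_nonneg _).trans (hpt s)) hp.1 hqp hq.2
    have := le_abs_self (∫ s in q..p, 2 * h s * h' s)
    linarith
  have h2 : ∫ q in (0 : ℝ)..L, h p ^ 2 ≤ ∫ q in (0 : ℝ)..L, (h q ^ 2 + J) := by
    apply intervalIntegral.integral_mono_on (by linarith) (Continuous.intervalIntegrable (by fun_prop) _ _)
      (Continuous.intervalIntegrable (by fun_prop) _ _)
    exact key
  rw [intervalIntegral.integral_add (Continuous.intervalIntegrable (by fun_prop) _ _)
    (Continuous.intervalIntegrable (by fun_prop) _ _), intervalIntegral.integral_const,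
    intervalIntegral.integral_const, smul_eq_mul, smul_eq_mul, sub_zero] at h2
  have h3 : 0 ≤ ∫ s in (0 : ℝ)..L, h s ^ 2 :=
    intervalIntegral.integral_nonneg (by linarith) fun s _ => sq_nonneg _
  have h4 : h p ^ 2 - J ≤ ∫ s in (0 : ℝ)..L, h s ^ 2 := by
    by_contra hcon
    push Not at hcon
    nlinarith
  rw [hJ] at h4
  linarith

theorem I_iter' (f : Sm) (t : ℝ) :
    I f t = ∫ x in (0)..(2 * π), ∫ y in (0 : ℝ)..1, f.1 (t, (x, y)) :=
  I_iter _ (Sm_contx f t)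

theorem cont_in_y {g : ℝ × ℝ → ℝ} (hg : Continuous g) :
    Continuous fun x => ∫ y in (0 : ℝ)..1, g (x, y) :=
  intervalIntegral.continuous_parametric_intervalIntegral_of_continuous' (f := fun x y => g (x, y)) hg 0 1

theorem one_le_2pi : 1 ≤ 2 * π := by linarith [Real.pi_gt_three]

theorem agmon (f : Sm) {t l : ℝ} (hl : 0 < l) {x : ℝ × ℝ} (hx : x ∈ Ωc) :
    f.1 (t, x) ^ 2 ≤ (1 + l) * ((1 + l) * I (f ^ 2) t + l⁻¹ * I ((D2 f) ^ 2) t)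
      + l⁻¹ * ((1 + l) * I ((D1 f) ^ 2) t + l⁻¹ * I ((D1 (D2 f)) ^ 2) t) := by
  obtain ⟨x, y⟩ := x
  have hli : 0 < l⁻¹ := inv_pos.2 hl
  -- vertical estimate integrated
  have vert : ∀ g : Sm, ∫ s in (0)..(2 * π), g.1 (t, (s, y)) ^ 2
      ≤ (1 + l) * I (g ^ 2) t + l⁻¹ * I ((D2 g) ^ 2) t := by
    intro g
    rw [I_iter', I_iter', ← intervalIntegral.integral_const_mul,
      ← intervalIntegral.integral_const_mul, ← intervalIntegral.integral_add]
    · apply intervalIntegral.integral_mono_on (by positivity)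
      · apply Continuous.intervalIntegrable
        exact ((Sm_cont g).comp (by fun_prop)).pow 2
      · apply Continuous.intervalIntegrable
        exact (continuous_const.mul (cont_in_y (Sm_contx (g ^ 2) t))).add
          (continuous_const.mul (cont_in_y (Sm_contx ((D2 g) ^ 2) t)))
      · intro s _
        exact agmon1 (h := fun r => g.1 (t, (s, r))) (fun r => D2_hasDeriv g t s r)
          ((Sm_cont (D2 g)).comp (by fun_prop)) le_rfl hl hx.2
    · exact ((continuous_const.mul (cont_in_y (Sm_contx (g ^ 2) t)))).intervalIntegrable _ _
    · exact ((continuous_const.mul (cont_in_y (Sm_contx ((D2 g) ^ 2) t)))).intervalIntegrable _ _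
  have h1 := agmon1 (h := fun r => f.1 (t, (r, y))) (fun r => D1_hasDeriv f t r y)
    ((Sm_cont (D1 f)).comp (by fun_prop)) one_le_2pi hl hx.1
  have h2 := vert f
  have h3 := vert (D1 f)
  rw [D2_D1] at h3
  refine h1.trans ?_
  gcongr

/-- Poincare inequality for mean-zero periodic functions. -/
theorem poincareM (f : Sm) {t : ℝ} (h0 : I f t = 0) :
    I (f ^ 2) t ≤ 100 * (I ((D1 f) ^ 2) t + I ((D2 f) ^ 2) t) := by
  have hpi := Real.pi_gt_three
  have hpi4 := Real.pi_lt_d2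
  set A : ℝ → ℝ := fun y => (2 * π) * ∫ s in (0)..(2 * π), (D1 f).1 (t, (s, y)) ^ 2 with hA
  set B : ℝ → ℝ := fun z => ∫ r in (0 : ℝ)..1, (D2 f).1 (t, (z, r)) ^ 2 with hB
  have cA : Continuous A := by
    apply continuous_const.mul
    exact intervalIntegral.continuous_parametric_intervalIntegral_of_continuous'
      (f := fun y s => (D1 f).1 (t, (s, y)) ^ 2) (((Sm_cont (D1 f)).comp (by fun_prop)).pow 2) 0 (2 * π)
  have cB : Continuous B := cont_in_y (Sm_contx ((D2 f) ^ 2) t)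
  have IB : ∫ z in Ω, B z.1 = I ((D2 f) ^ 2) t := by
    rw [I_iter (fun z : ℝ × ℝ => B z.1) (by fun_prop), I_iter']
    simp [hB, ev_pow]
  have IA : ∫ z in Ω, A z.2 = (2 * π) ^ 2 * I ((D1 f) ^ 2) t := by
    rw [I_iter (fun z : ℝ × ℝ => A z.2) (by fun_prop), I_iter']
    change ∫ x in (0)..(2 * π), (∫ y in (0 : ℝ)..1, A y) = _
    rw [intervalIntegral.integral_const, smul_eq_mul, sub_zero]
    have hsw : ∫ x in (0)..(2 * π), ∫ y in (0 : ℝ)..1, ((D1 f) ^ 2).1 (t, (x, y))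
        = ∫ y in (0 : ℝ)..1, ∫ x in (0)..(2 * π), ((D1 f) ^ 2).1 (t, (x, y)) := by
      apply intervalIntegral_intervalIntegral_swap
      exact ((Sm_contx ((D1 f) ^ 2) t).continuousOn.integrableOn_compact
        (isCompact_uIcc.prod isCompact_uIcc)).mono_set
          (Set.prod_mono Set.uIoc_subset_uIcc Set.uIoc_subset_uIcc)
    rw [hsw, hA, intervalIntegral.integral_const_mul]
    simp only [ev_pow]
    ring
  clear_value A B
  have hvol : ∫ z in Ω, (1 : ℝ) = 2 * π := by
    rw [I_iter (fun z : ℝ × ℝ => (1 : ℝ)) (by fun_prop)]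
    simp
  have I2 := I_sq_nonneg (D2 f) t
  have I1 := I_sq_nonneg (D1 f) t
  have pt : ∀ x ∈ Ω, (f ^ 2).1 (t, x) ≤ 2 * A x.2 + I ((D2 f) ^ 2) t := by
    intro x hx
    have hx' := Ω_sub hx
    have h1 : ∀ z ∈ Ω, f.1 (t, x) ^ 2 - 2 * f.1 (t, x) * f.1 (t, z) + (f ^ 2).1 (t, z)
        ≤ 2 * A x.2 + 2 * B z.1 := by
      intro z hz
      have hz' := Ω_sub hz
      have a1 := osc1 (h := fun r => f.1 (t, (r, x.2))) (fun r => D1_hasDeriv f t r x.2)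
        ((Sm_cont (D1 f)).comp (by fun_prop)) hx'.1 hz'.1
      have a2 := osc1 (h := fun r => f.1 (t, (z.1, r))) (fun r => D2_hasDeriv f t z.1 r)
        ((Sm_cont (D2 f)).comp (by fun_prop)) hx'.2 hz'.2
      rw [one_mul] at a2
      simp only [hA, hB, ev_pow]
      change (f.1 (t, x) - f.1 (t, (z.1, x.2))) ^ 2 ≤ _ at a1
      change (f.1 (t, (z.1, x.2)) - f.1 (t, z)) ^ 2 ≤ _ at a2
      nlinarith [sq_nonneg (f.1 (t, x) - f.1 (t, (z.1, x.2)) - (f.1 (t, (z.1, x.2)) - f.1 (t, z)))]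
    have h2 : ∫ z in Ω, (f.1 (t, x) ^ 2 * 1 - 2 * f.1 (t, x) * f.1 (t, z) + (f ^ 2).1 (t, z))
        ≤ ∫ z in Ω, (2 * A x.2 * 1 + 2 * B z.1) := by
      apply setIntegral_mono_on _ _ Ω_meas
      · intro z hz; have := h1 z hz; linarith
      · apply intOn_of_cont
        have c1 := Sm_contx f t
        have c2 := Sm_contx (f ^ 2) t
        exact (continuous_const.sub (continuous_const.mul c1)).add c2
      · apply intOn_of_cont; fun_prop
    have c1 := Sm_contx f t
    have c2 := Sm_contx (f ^ 2) t
    rw [integral_add, integral_sub, integral_const_mul, integral_const_mul, integral_add,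
      integral_const_mul, integral_const_mul, IB, hvol] at h2
    · change f.1 (t, x) ^ 2 * (2 * π) - 2 * f.1 (t, x) * I f t + I (f ^ 2) t ≤ _ at h2
      rw [h0] at h2
      have := I_sq_nonneg f t
      rw [ev_pow]
      by_contra hcon
      push Not at hcon
      nlinarith
    all_goals first
      | exact intOn_of_cont (by fun_prop)
      | exact intOn_of_cont (continuous_const.mul c1)
      | exact intOn_of_cont (continuous_const.sub (continuous_const.mul c1))
  have h3 : I (f ^ 2) t ≤ ∫ x in Ω, (2 * A x.2 + I ((D2 f) ^ 2) t * 1) := by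
    apply setIntegral_mono_on _ _ Ω_meas
    · intro x hx; have := pt x hx; linarith
    · exact Sm_intOn _ t
    · apply intOn_of_cont; fun_prop
  rw [integral_add, integral_const_mul, integral_const_mul, IA, hvol] at h3
  · have : (2 * π) ^ 2 ≤ 40 := by nlinarith
    nlinarith
  all_goals exact intOn_of_cont (by fun_prop)

/-- Vertical rescaling `y ↦ c + l y`. -/
def cmp (c l : ℝ) (f : Sm) : Sm :=
  ⟨fun p => f.1 (p.1, (p.2.1, c + l * p.2.2)), by
    rw [mem_Sm]
    exact (Sm_smooth f).comp (by fun_prop)⟩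

theorem cmp_ev (c l : ℝ) (f : Sm) (t x y : ℝ) : (cmp c l f).1 (t, (x, y)) = f.1 (t, (x, c + l * y)) :=
  rfl

theorem Per_cmp {c l : ℝ} {f : Sm} (hf : Per f) : Per (cmp c l f) := fun t x y => hf t x _

theorem cmp_hasF (c l : ℝ) (f : Sm) (p : Pt) (e : Pt) :
    (Dd e (cmp c l f)).1 p = fderiv ℝ f.1 (p.1, (p.2.1, c + l * p.2.2)) (e.1, (e.2.1, l * e.2.2)) := by
  have h1 : HasFDerivAt (fun p : Pt => ((p.1, (p.2.1, c + l * p.2.2)) : Pt))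
      ((ContinuousLinearMap.fst ℝ ℝ (ℝ × ℝ)).prod
        (((ContinuousLinearMap.fst ℝ ℝ ℝ).comp (ContinuousLinearMap.snd ℝ ℝ (ℝ × ℝ))).prod
        (l • ((ContinuousLinearMap.snd ℝ ℝ ℝ).comp (ContinuousLinearMap.snd ℝ ℝ (ℝ × ℝ)))))) p := by
    apply HasFDerivAt.prodMk hasFDerivAt_fst
    apply HasFDerivAt.prodMk
    · exact ((ContinuousLinearMap.fst ℝ ℝ ℝ).comp (ContinuousLinearMap.snd ℝ ℝ (ℝ × ℝ))).hasFDerivAt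
    · apply HasFDerivAt.const_add
      apply HasFDerivAt.const_mul
      exact ((ContinuousLinearMap.snd ℝ ℝ ℝ).comp (ContinuousLinearMap.snd ℝ ℝ (ℝ × ℝ))).hasFDerivAt
  have h2 := (Sm_diff f (p.1, (p.2.1, c + l * p.2.2))).hasFDerivAt.comp p h1
  change fderiv ℝ (f.1 ∘ fun p : Pt => ((p.1, (p.2.1, c + l * p.2.2)) : Pt)) p e = _
  rw [h2.fderiv]
  rfl

theorem D1_cmp (c l : ℝ) (f : Sm) : D1 (cmp c l f) = cmp c l (D1 f) := by
  apply Sm.ext'; intro p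
  rw [D1, cmp_hasF]
  simp only [mul_zero]
  rfl

theorem D2_cmp (c l : ℝ) (f : Sm) : D2 (cmp c l f) = cst l * cmp c l (D2 f) := by
  apply Sm.ext'; intro p
  rw [D2, cmp_hasF, ev_mul, ev_cst]
  have : ((0 : ℝ), ((0 : ℝ), l * 1)) = l • ((0 : ℝ), ((0 : ℝ), (1 : ℝ))) := by simp
  change fderiv ℝ f.1 _ ((0 : ℝ), ((0 : ℝ), l * 1)) = _
  rw [this, map_smul]
  rfl

theorem I_cmp {c l : ℝ} (hc : 0 ≤ c) (hl : 0 < l) (hcl : c + l ≤ 1) (f : Sm) (t : ℝ) :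
    I ((cmp c l f) ^ 2) t ≤ l⁻¹ * I (f ^ 2) t := by
  rw [I_iter', I_iter', ← intervalIntegral.integral_const_mul]
  apply intervalIntegral.integral_mono_on (by positivity)
  · exact (cont_in_y (Sm_contx ((cmp c l f) ^ 2) t)).intervalIntegrable _ _
  · exact (continuous_const.mul (cont_in_y (Sm_contx (f ^ 2) t))).intervalIntegrable _ _
  · intro x _
    have e : ∫ y in (0 : ℝ)..1, ((cmp c l f) ^ 2).1 (t, (x, y))
        = ∫ y in (0 : ℝ)..1, (fun s => (f ^ 2).1 (t, (x, s))) (c + l * y) := by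
      rfl
    rw [e, intervalIntegral.integral_comp_add_mul (fun s => (f ^ 2).1 (t, (x, s))) hl.ne' c, smul_eq_mul]
    apply mul_le_mul_of_nonneg_left _ (inv_pos.2 hl).le
    apply int_mono_dom
    · exact (Sm_cont (f ^ 2)).comp (by fun_prop)
    · intro s; rw [ev_pow]; positivity
    · linarith
    · linarith
    · linarith

/-! A small calculus of bounds `|x| ≤ M^k ε^m σ^n`. -/

structure BC (ε σ M : ℝ) : Prop where
  e0 : 0 < ε
  e1 : ε ≤ 1
  s0 : 0 ≤ σ
  m2 : 2 ≤ M

def Bd (ε σ M : ℝ) (k : ℕ) (m : ℤ) (n : ℕ) (x : ℝ) : Prop :=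
  BC ε σ M ∧ |x| ≤ M ^ k * ε ^ m * σ ^ n

namespace Bd
variable {ε σ M x y z u v : ℝ} {k k' k₁ k₂ k₃ n n' n₁ n₂ n₃ : ℕ} {m m' m₁ m₂ m₃ : ℤ}

theorem mul (hx : Bd ε σ M k m n x) (hy : Bd ε σ M k' m' n' y) :
    Bd ε σ M (k + k') (m + m') (n + n') (x * y) := by
  refine ⟨hx.1, ?_⟩
  obtain ⟨⟨e0, e1, s0, m2⟩, hx⟩ := hx
  rw [abs_mul, pow_add, pow_add, zpow_add₀ e0.ne']
  calc |x| * |y| ≤ (M ^ k * ε ^ m * σ ^ n) * (M ^ k' * ε ^ m' * σ ^ n') :=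
        mul_le_mul hx hy.2 (abs_nonneg _) (by positivity)
    _ = _ := by ring

theorem add (hx : Bd ε σ M k m n x) (hy : Bd ε σ M k' m n y) :
    Bd ε σ M (k + k' + 1) m n (x + y) := by
  refine ⟨hx.1, ?_⟩
  obtain ⟨⟨e0, e1, s0, m2⟩, hx⟩ := hx
  have h1 : (1 : ℝ) ≤ M := by linarith
  have a1 : M ^ k ≤ M ^ (k + k') := pow_le_pow_right₀ h1 (by omega)
  have a2 : M ^ k' ≤ M ^ (k + k') := pow_le_pow_right₀ h1 (by omega)
  have a3 : 0 ≤ ε ^ m * σ ^ n := by positivity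
  have a4 : 0 ≤ M ^ (k + k') := by positivity
  have hM : M ^ k + M ^ k' ≤ M ^ (k + k' + 1) := by
    rw [pow_succ]; nlinarith
  calc |x + y| ≤ |x| + |y| := abs_add_le _ _
    _ ≤ M ^ k * ε ^ m * σ ^ n + M ^ k' * ε ^ m * σ ^ n := add_le_add hx hy.2
    _ = (M ^ k + M ^ k') * (ε ^ m * σ ^ n) := by ring
    _ ≤ M ^ (k + k' + 1) * (ε ^ m * σ ^ n) := mul_le_mul_of_nonneg_right hM a3
    _ = _ := by ring

theorem neg (hx : Bd ε σ M k m n x) : Bd ε σ M k m n (-x) := ⟨hx.1, by rw [abs_neg]; exact hx.2⟩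

theorem sub (hx : Bd ε σ M k m n x) (hy : Bd ε σ M k' m n y) :
    Bd ε σ M (k + k' + 1) m n (x - y) := by
  rw [sub_eq_add_neg]; exact hx.add hy.neg

theorem w (hx : Bd ε σ M k m n x) (h : m' ≤ m) : Bd ε σ M k m' n x := by
  refine ⟨hx.1, hx.2.trans ?_⟩
  obtain ⟨⟨e0, e1, s0, m2⟩, hx⟩ := hx
  have : ε ^ m ≤ ε ^ m' := zpow_le_zpow_right_of_le_one₀ e0 e1 h
  gcongr

theorem m3 (hx : Bd ε σ M k m n x) (hy : Bd ε σ M k₁ m₁ n₁ y) (hz : Bd ε σ M k₂ m₂ n₂ z) :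
    Bd ε σ M (k + k₁ + k₂) (m + m₁ + m₂) (n + n₁ + n₂) (x * y * z) := (hx.mul hy).mul hz

theorem m4 (hx : Bd ε σ M k m n x) (hy : Bd ε σ M k₁ m₁ n₁ y) (hz : Bd ε σ M k₂ m₂ n₂ z)
    (hu : Bd ε σ M k₃ m₃ n₃ u) :
    Bd ε σ M (k + k₁ + k₂ + k₃) (m + m₁ + m₂ + m₃) (n + n₁ + n₂ + n₃) (x * y * z * u) :=
  (hx.m3 hy hz).mul hu

theorem m5 (hx : Bd ε σ M k m n x) (hy : Bd ε σ M k₁ m₁ n₁ y) (hz : Bd ε σ M k₂ m₂ n₂ z)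
    (hu : Bd ε σ M k₃ m₃ n₃ u) (hv : Bd ε σ M k' m' n' v) :
    Bd ε σ M (k + k₁ + k₂ + k₃ + k') (m + m₁ + m₂ + m₃ + m') (n + n₁ + n₂ + n₃ + n')
      (x * y * z * u * v) :=
  (hx.m4 hy hz hu).mul hv

theorem sq (hx : Bd ε σ M k m n x) : Bd ε σ M (k + k) (m + m) (n + n) (x ^ 2) := by
  rw [pow_two]; exact hx.mul hx

theorem kk (hx : Bd ε σ M k m n x) (h : k ≤ k') : Bd ε σ M k' m n x := by
  refine ⟨hx.1, hx.2.trans ?_⟩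
  obtain ⟨⟨e0, e1, s0, m2⟩, hx⟩ := hx
  have : M ^ k ≤ M ^ k' := pow_le_pow_right₀ (by linarith) h
  gcongr

/-- The final form of an error estimate. -/
theorem fin (hx : Bd ε σ M k 1 2 x) : x ≤ M ^ k * ε * σ ^ 2 := by
  have := (le_abs_self x).trans hx.2
  simpa using this

end Bd

theorem bd_c {ε σ M c : ℝ} (h : BC ε σ M) (hc : |c| ≤ M) : Bd ε σ M 1 0 0 c := ⟨h, by simpa using hc⟩
theorem bd_e1 {ε σ M : ℝ} (h : BC ε σ M) : Bd ε σ M 0 1 0 ε :=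
  ⟨h, by simp [abs_of_pos h.e0]⟩
theorem bd_e2 {ε σ M : ℝ} (h : BC ε σ M) : Bd ε σ M 0 2 0 (ε ^ 2) :=
  ⟨h, by rw [abs_of_pos (pow_pos h.e0 2)]; simp⟩
theorem bd_i2 {ε σ M : ℝ} (h : BC ε σ M) : Bd ε σ M 0 (-2) 0 ((ε ^ 2)⁻¹) :=
  ⟨h, by rw [abs_of_pos (inv_pos.2 (pow_pos h.e0 2))]; simp [zpow_neg]⟩
theorem bd_i4 {ε σ M : ℝ} (h : BC ε σ M) : Bd ε σ M 0 (-4) 0 ((ε ^ 4)⁻¹) :=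
  ⟨h, by rw [abs_of_pos (inv_pos.2 (pow_pos h.e0 4))]; simp [zpow_neg]⟩

theorem bd_L0 {ε σ M K x : ℝ} (h : BC ε σ M) (hK : K ≤ M) (hx : |x| ≤ K) : Bd ε σ M 1 0 0 x :=
  bd_c h (hx.trans hK)
theorem bd_L1 {ε σ M K x : ℝ} (h : BC ε σ M) (hK : K ≤ M) (hx : |x| ≤ K * ε) :
    Bd ε σ M 1 1 0 x := by
  refine ⟨h, hx.trans ?_⟩
  have := h.e0
  simp; gcongr
theorem bd_Lm {ε σ M K x : ℝ} (h : BC ε σ M) (hK : K ≤ M) (hx : |x| ≤ K * ε⁻¹) :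
    Bd ε σ M 1 (-1) 0 x := by
  refine ⟨h, hx.trans ?_⟩
  have := h.e0
  simp; gcongr

theorem bd_s0 {ε σ M x : ℝ} (h : BC ε σ M) (hx : x ^ 2 ≤ σ ^ 2) : Bd ε σ M 0 0 1 x := by
  refine ⟨h, ?_⟩
  simpa using abs_le_of_sq_le_sq hx h.s0
theorem bd_s1 {ε σ M x : ℝ} (h : BC ε σ M) (hx : (ε ^ 2)⁻¹ * x ^ 2 ≤ σ ^ 2) : Bd ε σ M 0 1 1 x := by
  refine ⟨h, ?_⟩
  have e0 := h.e0
  have s0 := h.s0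
  have h1 : x ^ 2 ≤ (ε * σ) ^ 2 := by
    rw [inv_mul_le_iff₀ (by positivity)] at hx
    linarith [mul_pow ε σ 2]
  have := abs_le_of_sq_le_sq h1 (by positivity)
  simpa using this
theorem bd_s2 {ε σ M x : ℝ} (h : BC ε σ M) (hx : (ε ^ 4)⁻¹ * x ^ 2 ≤ σ ^ 2) : Bd ε σ M 0 2 1 x := by
  refine ⟨h, ?_⟩
  have e0 := h.e0
  have s0 := h.s0
  have h1 : x ^ 2 ≤ (ε ^ 2 * σ) ^ 2 := by
    rw [inv_mul_le_iff₀ (by positivity)] at hx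
    have : (ε ^ 2 * σ) ^ 2 = ε ^ 4 * σ ^ 2 := by ring
    linarith
  have := abs_le_of_sq_le_sq h1 (by positivity)
  simp
  norm_cast
theorem bd_sm {ε σ M x : ℝ} (h : BC ε σ M) (hx : ε ^ 2 * x ^ 2 ≤ σ ^ 2) : Bd ε σ M 0 (-1) 1 x := by
  refine ⟨h, ?_⟩
  have e0 := h.e0
  have s0 := h.s0
  have h1 : (ε * x) ^ 2 ≤ σ ^ 2 := by rw [mul_pow]; exact hx
  have h2 := abs_le_of_sq_le_sq h1 s0
  rw [abs_mul, abs_of_pos e0] at h2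
  simp
  rw [le_inv_mul_iff₀ e0]; exact h2

/-! The abstract flow. -/

/-- Values of a scalar field and its derivatives at a point. -/
structure Q where
  f : ℝ
  f1 : ℝ
  f2 : ℝ
  ft : ℝ
  f11 : ℝ
  f12 : ℝ
  f22 : ℝ
  f1t : ℝ
  f2t : ℝ

def jq (f : Sm) (p : Pt) : Q :=
  ⟨f.1 p, (D1 f).1 p, (D2 f).1 p, (Dt f).1 p, (D1 (D1 f)).1 p, (D1 (D2 f)).1 p, (D2 (D2 f)).1 p,
    (D1 (Dt f)).1 p, (D2 (Dt f)).1 p⟩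

structure FD where
  ε : ℝ
  T : ℝ
  φ : Sm
  v : Sm
  w : Sm
  θ : Sm
  R : Sm
  τ : Sm

namespace FD
variable (F : FD)
def ρ : Sm := F.R + F.φ
def Tm : Sm := F.τ + F.θ
def U : Sm := Yc + F.v
def d : Sm := D1 F.v + D2 F.w
def F1 : Sm := Dt F.v + F.U * D1 F.v + F.w * D2 F.v + F.w
def F2 : Sm := Dt F.w + F.U * D1 F.w + F.w * D2 F.w
def F3 : Sm := Dt F.θ + F.U * D1 F.θ + F.w * D2 F.θ + F.w * D2 F.τ
def GM : Sm := Dt F.φ + F.U * D1 F.φ + F.w * D2 F.φ + F.ρ * F.d + F.w * D2 F.R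
def P : Sm := F.ρ * F.Tm
def G1 (a b : ℝ) : Sm := F.ρ * F.F1 + cst ((F.ε ^ 2)⁻¹) * D1 F.P
  - cst a * (D1 (D1 F.v) + D2 (D2 F.v)) - cst b * D1 F.d
def G2 (a b : ℝ) : Sm := F.ρ * F.F2 + cst ((F.ε ^ 2)⁻¹) * D2 F.P
  - cst a * (D1 (D1 F.w) + D2 (D2 F.w)) - cst b * D2 F.d
def Qd (a b : ℝ) : Sm := cst (2 * a) * (D1 F.v * D1 F.v + D2 F.w * D2 F.w)
  + cst a * ((D1 F.w + D2 F.v) * (D1 F.w + D2 F.v)) + cst (2 * a) * (D1 F.w + D2 F.v)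
  + cst (b - a) * (F.d * F.d)
def GT (a b κ g : ℝ) : Sm := cst g * (F.ρ * F.F3) + F.ρ * F.Tm * F.d
  - cst κ * (D1 (D1 F.θ) + D2 (D2 F.θ)) - cst (F.ε ^ 2) * F.Qd a b
/-- dissipation density -/
def s : Sm :=
  cst ((F.ε ^ 2)⁻¹) * (F.v ^ 2 + F.w ^ 2 + (D1 F.v) ^ 2 + (D2 F.v) ^ 2 + (D1 F.w) ^ 2 + (D2 F.w) ^ 2)
  + cst ((F.ε ^ 4)⁻¹) * (F.θ ^ 2 + (D1 F.θ) ^ 2 + (D2 F.θ) ^ 2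
      + F.φ ^ 2 + (D1 F.φ) ^ 2 + (D2 F.φ) ^ 2)
  + ((D1 (D1 F.v)) ^ 2 + (D1 (D2 F.v)) ^ 2 + (D1 (D1 F.w)) ^ 2 + (D1 (D2 F.w)) ^ 2)
  + cst ((F.ε ^ 2)⁻¹) * ((D1 (D1 F.θ)) ^ 2 + (D1 (D2 F.θ)) ^ 2)
  + cst (F.ε ^ 2) * ((D1 (Dt F.v)) ^ 2 + (D2 (Dt F.v)) ^ 2 + (D1 (Dt F.w)) ^ 2 + (D2 (Dt F.w)) ^ 2)
  + ((D1 (Dt F.θ)) ^ 2 + (D2 (Dt F.θ)) ^ 2)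
  + ((Dt F.v) ^ 2 + (Dt F.w) ^ 2) + cst ((F.ε ^ 2)⁻¹) * (Dt F.θ) ^ 2
/-- energy norm density -/
def nrm : Sm :=
  cst ((F.ε ^ 2)⁻¹) * (F.v ^ 2 + F.w ^ 2) + cst ((F.ε ^ 4)⁻¹) * (F.φ ^ 2 + F.θ ^ 2)
  + ((D1 F.v) ^ 2 + (D2 F.v) ^ 2 + (D1 F.w) ^ 2 + (D2 F.w) ^ 2)
  + cst ((F.ε ^ 2)⁻¹) * ((D1 F.θ) ^ 2 + (D2 F.θ) ^ 2 + (D1 F.φ) ^ 2 + (D2 F.φ) ^ 2)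
  + cst (F.ε ^ 2) * ((Dt F.v) ^ 2 + (Dt F.w) ^ 2) + (Dt F.φ) ^ 2 + (Dt F.θ) ^ 2
end FD

/-- constants -/
structure Cs (a b κ g K M : ℝ) : Prop where
  m2 : 2 ≤ M
  k1 : 1 ≤ K
  km : K ≤ M
  a0 : 0 < a
  b0 : 0 < b
  κ0 : 0 < κ
  g0 : 0 < g
  am : a ≤ M
  bm : b ≤ M
  bam : |b - a| ≤ M
  κm : κ ≤ M
  gm : g ≤ M
  abm : (a + b)⁻¹ ≤ M

structure Flow (a b κ g K M : ℝ) (F : FD) : Prop where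
  cs : Cs a b κ g K M
  e0 : 0 < F.ε
  e1 : F.ε ≤ 1
  hT : 0 ≤ F.T
  pφ : Per F.φ
  pv : Per F.v
  pw : Per F.w
  pθ : Per F.θ
  pR : Per F.R
  pτ : Per F.τ
  R1 : D1 F.R = 0
  Rt : Dt F.R = 0
  τ1 : D1 F.τ = 0
  τt : Dt F.τ = 0
  wv : ∀ t ∈ Set.Icc 0 F.T, W0 t F.v
  ww : ∀ t ∈ Set.Icc 0 F.T, W0 t F.w
  wθ : ∀ t ∈ Set.Icc 0 F.T, W0 t F.θ
  Rτ : ∀ t ∈ Set.Icc 0 F.T, ∀ x ∈ Ω, (F.R * F.τ).1 (t, x) = 1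
  gM : ∀ t ∈ Set.Icc 0 F.T, ∀ x ∈ Ω, F.GM.1 (t, x) = 0
  g1 : ∀ t ∈ Set.Icc 0 F.T, ∀ x ∈ Ω, (F.G1 a b).1 (t, x) = 0
  g2 : ∀ t ∈ Set.Icc 0 F.T, ∀ x ∈ Ω, (F.G2 a b).1 (t, x) = 0
  gT : ∀ t ∈ Set.Icc 0 F.T, ∀ x ∈ Ω, (F.GT a b κ g).1 (t, x) = 0
  Rb : ∀ t ∈ Set.Icc 0 F.T, ∀ x ∈ Ω, 1 / 2 ≤ F.R.1 (t, x) ∧ F.R.1 (t, x) ≤ 2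
  τb : ∀ t ∈ Set.Icc 0 F.T, ∀ x ∈ Ω, 1 / 2 ≤ F.τ.1 (t, x) ∧ F.τ.1 (t, x) ≤ 2
  ρb : ∀ t ∈ Set.Icc 0 F.T, ∀ x ∈ Ω, 1 / 4 ≤ F.ρ.1 (t, x) ∧ F.ρ.1 (t, x) ≤ 4
  Tb : ∀ t ∈ Set.Icc 0 F.T, ∀ x ∈ Ω, 1 / 4 ≤ F.Tm.1 (t, x) ∧ F.Tm.1 (t, x) ≤ 4
  Lφ : ∀ t ∈ Set.Icc 0 F.T, ∀ x ∈ Ω, |F.φ.1 (t, x)| ≤ K * F.ε ∧ |F.θ.1 (t, x)| ≤ K * F.ε ∧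
    |(D2 F.R).1 (t, x)| ≤ K * F.ε ∧ |(D2 F.τ).1 (t, x)| ≤ K * F.ε ∧
    |(D2 (D2 F.R)).1 (t, x)| ≤ K * F.ε
  L0 : ∀ t ∈ Set.Icc 0 F.T, ∀ x ∈ Ω, |(D1 F.φ).1 (t, x)| ≤ K ∧ |(D2 F.φ).1 (t, x)| ≤ K ∧
    |(D1 F.θ).1 (t, x)| ≤ K ∧ |(D2 F.θ).1 (t, x)| ≤ K ∧ |F.v.1 (t, x)| ≤ K ∧ |F.w.1 (t, x)| ≤ K
  Lm : ∀ t ∈ Set.Icc 0 F.T, ∀ x ∈ Ω, |(D1 F.v).1 (t, x)| ≤ K * F.ε⁻¹ ∧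
    |(D2 F.v).1 (t, x)| ≤ K * F.ε⁻¹ ∧ |(D1 F.w).1 (t, x)| ≤ K * F.ε⁻¹ ∧
    |(D2 F.w).1 (t, x)| ≤ K * F.ε⁻¹
  mean : 0 < F.T → ∀ t ∈ Set.Icc 0 F.T, I F.φ t = 0

/-- background values -/
structure Bg where
  ε : ℝ
  i : ℝ
  σ : ℝ
  y : ℝ
  R : ℝ
  τ : ℝ
  R2 : ℝ
  τ2 : ℝ
  R22 : ℝ

/-- pointwise hypotheses -/
structure JB (a b κ g K M : ℝ) (B : Bg) (φ v w θ : Q) : Prop where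
  cs : Cs a b κ g K M
  bc : BC B.ε B.σ M
  iε : B.i * B.ε ^ 2 = 1
  i0 : 0 < B.i
  i : Bd B.ε B.σ M 0 (-2) 0 B.i
  e : Bd B.ε B.σ M 0 1 0 B.ε
  aB : Bd B.ε B.σ M 1 0 0 a
  bB : Bd B.ε B.σ M 1 0 0 b
  ba : Bd B.ε B.σ M 1 0 0 (b - a)
  κB : Bd B.ε B.σ M 1 0 0 κ
  gB : Bd B.ε B.σ M 1 0 0 g
  iab : Bd B.ε B.σ M 1 0 0 ((a + b)⁻¹)
  y : Bd B.ε B.σ M 1 0 0 B.y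
  Rτ : B.R * B.τ = 1
  Rl : 1 / 2 ≤ B.R
  Ru : B.R ≤ 2
  τl : 1 / 2 ≤ B.τ
  τu : B.τ ≤ 2
  ρl : 1 / 4 ≤ B.R + φ.f
  ρu : B.R + φ.f ≤ 4
  Tl : 1 / 4 ≤ B.τ + θ.f
  Tu : B.τ + θ.f ≤ 4
  R2τ : B.R2 * B.τ + B.R * B.τ2 = 0
  R2K : |B.R2| ≤ K * B.ε
  τ2K : |B.τ2| ≤ K * B.ε
  θK : |θ.f| ≤ K * B.ε
  φK : |φ.f| ≤ K * B.ε
  vK : |v.f| ≤ K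
  wK : |w.f| ≤ K
  φ1K : |φ.f1| ≤ K
  φ2K : |φ.f2| ≤ K
  θ1K : |θ.f1| ≤ K
  θ2K : |θ.f2| ≤ K
  v1K : |v.f1| ≤ K * B.ε⁻¹
  v2K : |v.f2| ≤ K * B.ε⁻¹
  w1K : |w.f1| ≤ K * B.ε⁻¹
  w2K : |w.f2| ≤ K * B.ε⁻¹
  R : Bd B.ε B.σ M 1 0 0 B.R
  τ : Bd B.ε B.σ M 1 0 0 B.τ
  R2 : Bd B.ε B.σ M 1 1 0 B.R2
  τ2 : Bd B.ε B.σ M 1 1 0 B.τ2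
  R22 : Bd B.ε B.σ M 1 1 0 B.R22
  vL : Bd B.ε B.σ M 1 0 0 v.f
  vs : Bd B.ε B.σ M 0 1 1 v.f
  v1L : Bd B.ε B.σ M 1 (-1) 0 v.f1
  v1s : Bd B.ε B.σ M 0 1 1 v.f1
  v2L : Bd B.ε B.σ M 1 (-1) 0 v.f2
  v2s : Bd B.ε B.σ M 0 1 1 v.f2
  v11 : Bd B.ε B.σ M 0 0 1 v.f11
  v12 : Bd B.ε B.σ M 0 0 1 v.f12
  vt : Bd B.ε B.σ M 0 0 1 v.ft
  v1t : Bd B.ε B.σ M 0 (-1) 1 v.f1t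
  v2t : Bd B.ε B.σ M 0 (-1) 1 v.f2t
  wL : Bd B.ε B.σ M 1 0 0 w.f
  ws : Bd B.ε B.σ M 0 1 1 w.f
  w1L : Bd B.ε B.σ M 1 (-1) 0 w.f1
  w1s : Bd B.ε B.σ M 0 1 1 w.f1
  w2L : Bd B.ε B.σ M 1 (-1) 0 w.f2
  w2s : Bd B.ε B.σ M 0 1 1 w.f2
  w11 : Bd B.ε B.σ M 0 0 1 w.f11
  w12 : Bd B.ε B.σ M 0 0 1 w.f12
  wt : Bd B.ε B.σ M 0 0 1 w.ft
  w1t : Bd B.ε B.σ M 0 (-1) 1 w.f1t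
  w2t : Bd B.ε B.σ M 0 (-1) 1 w.f2t
  θL : Bd B.ε B.σ M 1 1 0 θ.f
  θs : Bd B.ε B.σ M 0 2 1 θ.f
  θ1L : Bd B.ε B.σ M 1 0 0 θ.f1
  θ1s : Bd B.ε B.σ M 0 2 1 θ.f1
  θ2L : Bd B.ε B.σ M 1 0 0 θ.f2
  θ2s : Bd B.ε B.σ M 0 2 1 θ.f2
  θ11 : Bd B.ε B.σ M 0 1 1 θ.f11
  θ12 : Bd B.ε B.σ M 0 1 1 θ.f12
  θt : Bd B.ε B.σ M 0 1 1 θ.ft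
  θ1t : Bd B.ε B.σ M 0 0 1 θ.f1t
  θ2t : Bd B.ε B.σ M 0 0 1 θ.f2t
  φL : Bd B.ε B.σ M 1 1 0 φ.f
  φs : Bd B.ε B.σ M 0 2 1 φ.f
  φ1L : Bd B.ε B.σ M 1 0 0 φ.f1
  φ1s : Bd B.ε B.σ M 0 2 1 φ.f1
  φ2L : Bd B.ε B.σ M 1 0 0 φ.f2
  φ2s : Bd B.ε B.σ M 0 2 1 φ.f2
  eM : φ.ft + (B.y + v.f) * φ.f1 + w.f * φ.f2 + (B.R + φ.f) * (v.f1 + w.f2) + w.f * B.R2 = 0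
  e1 : (B.R + φ.f) * (v.ft + (B.y + v.f) * v.f1 + w.f * v.f2 + w.f)
    + B.i * ((B.R + φ.f) * θ.f1 + (B.τ + θ.f) * φ.f1) - a * (v.f11 + v.f22)
    - b * (v.f11 + w.f12) = 0
  e2 : (B.R + φ.f) * (w.ft + (B.y + v.f) * w.f1 + w.f * w.f2)
    + B.i * ((B.R + φ.f) * (B.τ2 + θ.f2) + (B.τ + θ.f) * (B.R2 + φ.f2)) - a * (w.f11 + w.f22)
    - b * (v.f12 + w.f22) = 0
  eT : g * ((B.R + φ.f) * (θ.ft + (B.y + v.f) * θ.f1 + w.f * θ.f2 + w.f * B.τ2))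
    + (B.R + φ.f) * (B.τ + θ.f) * (v.f1 + w.f2) - κ * (θ.f11 + θ.f22)
    - B.ε ^ 2 * (2 * a * (v.f1 * v.f1 + w.f2 * w.f2) + a * ((w.f1 + v.f2) * (w.f1 + v.f2))
      + 2 * a * (w.f1 + v.f2) + (b - a) * ((v.f1 + w.f2) * (v.f1 + w.f2))) = 0

def FD.bg (F : FD) (p : Pt) : Bg :=
  ⟨F.ε, (F.ε ^ 2)⁻¹, √(F.s.1 p), Yc.1 p, F.R.1 p, F.τ.1 p, (D2 F.R).1 p, (D2 F.τ).1 p,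
    (D2 (D2 F.R)).1 p⟩

theorem FD.s_nonneg (F : FD) (p : Pt) : 0 ≤ F.s.1 p := by
  simp only [FD.s, ev_add, ev_mul, ev_cst, ev_pow]
  positivity

theorem Dt_Yc' : Dt Yc = 0 := Dt_Yc
theorem Flow.vanish {a b κ g K M : ℝ} {F : FD} (h : Flow a b κ g K M F) {t : ℝ}
    (ht : t ∈ Set.Icc 0 F.T) {x : ℝ × ℝ} (hx : x ∈ Ω) :
    (D2 F.R).1 (t, x) * F.τ.1 (t, x) + F.R.1 (t, x) * (D2 F.τ).1 (t, x) = 0 := by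
  have h1 : HasDerivAt (fun y => (F.R * F.τ).1 (t, (x.1, y))) ((D2 (F.R * F.τ)).1 (t, x)) x.2 :=
    D2_hasDeriv _ t x.1 x.2
  have h2 : (fun y => (F.R * F.τ).1 (t, (x.1, y))) =ᶠ[𝓝 x.2] fun _ => 1 := by
    have : Set.Ioo (0:ℝ) 1 ∈ 𝓝 x.2 := Ioo_mem_nhds hx.2.1 hx.2.2
    filter_upwards [this] with y hy
    exact h.Rτ t ht (x.1, y) ⟨hx.1, hy⟩
  have h3 := (h1.congr_of_eventuallyEq h2.symm).unique (hasDerivAt_const x.2 (1:ℝ))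
  rw [D2_mul, ev_add, ev_mul, ev_mul] at h3
  linarith

theorem Flow.jb {a b κ g K M : ℝ} {F : FD} (h : Flow a b κ g K M F) {t : ℝ}
    (ht : t ∈ Set.Icc 0 F.T) {x : ℝ × ℝ} (hx : x ∈ Ω) :
    JB a b κ g K M (F.bg (t, x)) (jq F.φ (t, x)) (jq F.v (t, x)) (jq F.w (t, x))
      (jq F.θ (t, x)) := by
  have e0 := h.e0
  have cs := h.cs
  have hbc : BC F.ε (√(F.s.1 (t, x))) M := ⟨h.e0, h.e1, Real.sqrt_nonneg _, h.cs.m2⟩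
  have hs : √(F.s.1 (t, x)) ^ 2 = F.s.1 (t, x) := Real.sq_sqrt (F.s_nonneg _)
  obtain ⟨l1, l2, l3, l4, l5⟩ := h.Lφ t ht x hx
  obtain ⟨n1, n2, n3, n4, n5, n6⟩ := h.L0 t ht x hx
  obtain ⟨k1, k2, k3, k4⟩ := h.Lm t ht x hx
  have hM := h.gM t ht x hx
  have h1 := h.g1 t ht x hx
  have h2 := h.g2 t ht x hx
  have hT := h.gT t ht x hx
  have hR := h.Rb t ht x hx
  have hτ := h.τb t ht x hx
  have hρ := h.ρb t ht x hx
  have hTm := h.Tb t ht x hx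
  have hv := h.vanish ht hx
  have hRτ := h.Rτ t ht x hx
  have km := cs.km
  have hK0 : 0 ≤ K := by linarith [cs.k1]
  have am := cs.m2
  simp only [FD.GM, FD.G1, FD.G2, FD.GT, FD.Qd, FD.P, FD.F1, FD.F2, FD.F3, FD.d, FD.U, FD.ρ, FD.Tm,
    D1_add, D2_add, D1_mul, D2_mul, D2_D1, ev_add, ev_mul, ev_sub, ev_cst, h.R1, h.τ1, ev_zero]
    at hM h1 h2 hT hρ hTm hRτ
  generalize hsp : √(F.s.1 (t, x)) = σ at *
  simp only [FD.s, ev_add, ev_mul, ev_pow, ev_cst] at hs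
  have hbg : F.bg (t, x) = ⟨F.ε, (F.ε ^ 2)⁻¹, σ, Yc.1 (t, x), F.R.1 (t, x), F.τ.1 (t, x),
    (D2 F.R).1 (t, x), (D2 F.τ).1 (t, x), (D2 (D2 F.R)).1 (t, x)⟩ := by rw [FD.bg, hsp]
  rw [hbg]
  have hy0 := hx.2.1
  have hy1 := hx.2.2
  have hyc : Yc.1 (t, x) = x.2 := ev_Yc t x.1 x.2
  have i2 : 0 ≤ (F.ε ^ 2)⁻¹ := by positivity
  have i4 : 0 ≤ (F.ε ^ 4)⁻¹ := by positivity
  have p2 : 0 ≤ F.ε ^ 2 := by positivity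
  have P0 : ∀ z : ℝ, 0 ≤ z ^ 2 := fun z => sq_nonneg z
  have P1 : ∀ z : ℝ, 0 ≤ (F.ε ^ 2)⁻¹ * z ^ 2 := fun z => by positivity
  have P2 : ∀ z : ℝ, 0 ≤ (F.ε ^ 4)⁻¹ * z ^ 2 := fun z => by positivity
  have P3 : ∀ z : ℝ, 0 ≤ F.ε ^ 2 * z ^ 2 := fun z => by positivity
  simp only [mul_add] at hs
  simp only [jq]
  generalize F.v.1 (t, x) = v at *
  generalize (D1 F.v).1 (t, x) = v1 at *
  generalize (D2 F.v).1 (t, x) = v2 at *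
  generalize (Dt F.v).1 (t, x) = vt at *
  generalize (D1 (D1 F.v)).1 (t, x) = v11 at *
  generalize (D1 (D2 F.v)).1 (t, x) = v12 at *
  generalize (D1 (Dt F.v)).1 (t, x) = v1t at *
  generalize (D2 (Dt F.v)).1 (t, x) = v2t at *
  generalize F.w.1 (t, x) = w at *
  generalize (D1 F.w).1 (t, x) = w1 at *
  generalize (D2 F.w).1 (t, x) = w2 at *
  generalize (Dt F.w).1 (t, x) = wt at *
  generalize (D1 (D1 F.w)).1 (t, x) = w11 at *
  generalize (D1 (D2 F.w)).1 (t, x) = w12 at *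
  generalize (D1 (Dt F.w)).1 (t, x) = w1t at *
  generalize (D2 (Dt F.w)).1 (t, x) = w2t at *
  generalize F.θ.1 (t, x) = θ at *
  generalize (D1 F.θ).1 (t, x) = θ1 at *
  generalize (D2 F.θ).1 (t, x) = θ2 at *
  generalize (Dt F.θ).1 (t, x) = θt at *
  generalize (D1 (D1 F.θ)).1 (t, x) = θ11 at *
  generalize (D1 (D2 F.θ)).1 (t, x) = θ12 at *
  generalize (D1 (Dt F.θ)).1 (t, x) = θ1t at *
  generalize (D2 (Dt F.θ)).1 (t, x) = θ2t at *
  generalize F.φ.1 (t, x) = φ at *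
  generalize (D1 F.φ).1 (t, x) = φ1 at *
  generalize (D2 F.φ).1 (t, x) = φ2 at *
  generalize (Dt F.φ).1 (t, x) = φt at *
  generalize (D1 (D1 F.φ)).1 (t, x) = φ11 at *
  generalize (D1 (D2 F.φ)).1 (t, x) = φ12 at *
  generalize (D1 (Dt F.φ)).1 (t, x) = φ1t at *
  generalize (D2 (Dt F.φ)).1 (t, x) = φ2t at *
  generalize F.R.1 (t, x) = R at *
  generalize F.τ.1 (t, x) = τ at *
  generalize F.ε = ε at *
  have Sv : (ε ^ 2)⁻¹ * v ^ 2 ≤ σ ^ 2 ∧ (ε ^ 2)⁻¹ * v1 ^ 2 ≤ σ ^ 2 ∧ (ε ^ 2)⁻¹ * v2 ^ 2 ≤ σ ^ 2 ∧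
      v11 ^ 2 ≤ σ ^ 2 ∧ v12 ^ 2 ≤ σ ^ 2 ∧ vt ^ 2 ≤ σ ^ 2 ∧ ε ^ 2 * v1t ^ 2 ≤ σ ^ 2 ∧
      ε ^ 2 * v2t ^ 2 ≤ σ ^ 2 ∧ 
      (ε ^ 2)⁻¹ * w ^ 2 ≤ σ ^ 2 ∧ (ε ^ 2)⁻¹ * w1 ^ 2 ≤ σ ^ 2 ∧ (ε ^ 2)⁻¹ * w2 ^ 2 ≤ σ ^ 2 ∧
      w11 ^ 2 ≤ σ ^ 2 ∧ w12 ^ 2 ≤ σ ^ 2 ∧ wt ^ 2 ≤ σ ^ 2 ∧ ε ^ 2 * w1t ^ 2 ≤ σ ^ 2 ∧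
      ε ^ 2 * w2t ^ 2 ≤ σ ^ 2 ∧ 
      (ε ^ 4)⁻¹ * θ ^ 2 ≤ σ ^ 2 ∧ (ε ^ 4)⁻¹ * θ1 ^ 2 ≤ σ ^ 2 ∧ (ε ^ 4)⁻¹ * θ2 ^ 2 ≤ σ ^ 2 ∧
      (ε ^ 2)⁻¹ * θ11 ^ 2 ≤ σ ^ 2 ∧ (ε ^ 2)⁻¹ * θ12 ^ 2 ≤ σ ^ 2 ∧ (ε ^ 2)⁻¹ * θt ^ 2 ≤ σ ^ 2 ∧
      θ1t ^ 2 ≤ σ ^ 2 ∧ θ2t ^ 2 ≤ σ ^ 2 ∧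
      (ε ^ 4)⁻¹ * φ ^ 2 ≤ σ ^ 2 ∧ (ε ^ 4)⁻¹ * φ1 ^ 2 ≤ σ ^ 2 ∧ (ε ^ 4)⁻¹ * φ2 ^ 2 ≤ σ ^ 2 := by
    have q1 := P1 v
    have q2 := P1 v1
    have q3 := P1 v2
    have q4 := P0 v11
    have q5 := P0 v12
    have q6 := P0 vt
    have q7 := P3 v1t
    have q8 := P3 v2t
    have r1 := P1 w
    have r2 := P1 w1
    have r3 := P1 w2
    have r4 := P0 w11
    have r5 := P0 w12
    have r6 := P0 wt
    have r7 := P3 w1t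
    have r8 := P3 w2t
    have s1 := P2 θ
    have s2 := P2 θ1
    have s3 := P2 θ2
    have s4 := P1 θ11
    have s5 := P1 θ12
    have s6 := P1 θt
    have s7 := P0 θ1t
    have s8 := P0 θ2t
    have t1 := P2 φ
    have t2 := P2 φ1
    have t3 := P2 φ2
    clear P0 P1 P2 P3
    generalize (ε ^ 2)⁻¹ * v ^ 2 = x1 at *
    refine ⟨?_, ?_, ?_, ?_, ?_, ?_, ?_, ?_, ?_, ?_, ?_, ?_, ?_, ?_, ?_, ?_, ?_, ?_, ?_, ?_, ?_, ?_,
      ?_, ?_, ?_, ?_, ?_⟩ <;> linarith only [hs, q1, q2, q3, q4, q5, q6, q7, q8, r1, r2, r3, r4, r5,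
        r6, r7, r8, s1, s2, s3, s4, s5, s6, s7, s8, t1, t2, t3]
  obtain ⟨v_0, v_1, v_2, v_11, v_12, v_t, v_1t, v_2t, w_0, w_1, w_2, w_11, w_12, w_t, w_1t, w_2t,
    θ_0, θ_1, θ_2, θ_11, θ_12, θ_t, θ_1t, θ_2t, φ_0, φ_1, φ_2⟩ := Sv
  exact {
    cs := cs
    bc := hbc
    iε := inv_mul_cancel₀ (by positivity)
    i0 := by positivity
    i := bd_i2 hbc
    e := bd_e1 hbc
    aB := bd_c hbc (by rw [abs_of_pos cs.a0]; exact cs.am)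
    bB := bd_c hbc (by rw [abs_of_pos cs.b0]; exact cs.bm)
    ba := bd_c hbc cs.bam
    κB := bd_c hbc (by rw [abs_of_pos cs.κ0]; exact cs.κm)
    gB := bd_c hbc (by rw [abs_of_pos cs.g0]; exact cs.gm)
    iab := bd_c hbc (by rw [abs_of_pos (inv_pos.2 (add_pos cs.a0 cs.b0))]; exact cs.abm)
    y := bd_c hbc (by simp only [hyc]; rw [abs_of_pos hy0]; linarith)
    Rτ := hRτ
    Rl := hR.1
    Ru := hR.2
    τl := hτ.1
    τu := hτ.2
    ρl := hρ.1
    ρu := hρ.2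
    Tl := hTm.1
    Tu := hTm.2
    R2τ := hv
    R2K := l3
    τ2K := l4
    θK := l2
    φK := l1
    vK := n5
    wK := n6
    φ1K := n1
    φ2K := n2
    θ1K := n3
    θ2K := n4
    v1K := k1
    v2K := k2
    w1K := k3
    w2K := k4
    R := bd_c hbc (abs_le.2 ⟨by linarith [hR.1], by linarith [hR.2]⟩)
    τ := bd_c hbc (abs_le.2 ⟨by linarith [hτ.1], by linarith [hτ.2]⟩)
    R2 := bd_L1 hbc km l3
    τ2 := bd_L1 hbc km l4
    R22 := bd_L1 hbc km l5
    vL := bd_L0 hbc km n5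
    vs := bd_s1 hbc v_0
    v1L := bd_Lm hbc km k1
    v1s := bd_s1 hbc v_1
    v2L := bd_Lm hbc km k2
    v2s := bd_s1 hbc v_2
    v11 := bd_s0 hbc v_11
    v12 := bd_s0 hbc v_12
    vt := bd_s0 hbc v_t
    v1t := bd_sm hbc v_1t
    v2t := bd_sm hbc v_2t
    wL := bd_L0 hbc km n6
    ws := bd_s1 hbc w_0
    w1L := bd_Lm hbc km k3
    w1s := bd_s1 hbc w_1
    w2L := bd_Lm hbc km k4
    w2s := bd_s1 hbc w_2
    w11 := bd_s0 hbc w_11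
    w12 := bd_s0 hbc w_12
    wt := bd_s0 hbc w_t
    w1t := bd_sm hbc w_1t
    w2t := bd_sm hbc w_2t
    θL := bd_L1 hbc km l2
    θs := bd_s2 hbc θ_0
    θ1L := bd_L0 hbc km n3
    θ1s := bd_s2 hbc θ_1
    θ2L := bd_L0 hbc km n4
    θ2s := bd_s2 hbc θ_2
    θ11 := bd_s1 hbc θ_11
    θ12 := bd_s1 hbc θ_12
    θt := bd_s1 hbc θ_t
    θ1t := bd_s0 hbc θ_1t
    θ2t := bd_s0 hbc θ_2t
    φL := bd_L1 hbc km l1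
    φs := bd_s2 hbc φ_0
    φ1L := bd_L0 hbc km n1
    φ1s := bd_s2 hbc φ_1
    φ2L := bd_L0 hbc km n2
    φ2s := bd_s2 hbc φ_2
    eM := by linear_combination hM
    e1 := by linear_combination h1
    e2 := by linear_combination h2
    eT := by linear_combination hT }

theorem Bd.cv {ε σ M x : ℝ} {k n : ℕ} {m : ℤ} (hx : Bd ε σ M k m n x) (m' : ℤ) (n' : ℕ)
    (h : m' ≤ m) (hn : n = n') : Bd ε σ M k m' n' x := by
  subst hn; exact hx.w h
theorem bd_n {ε σ M c : ℝ} (h : BC ε σ M) (hc : |c| ≤ 2) : Bd ε σ M 1 0 0 c :=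
  bd_c h (hc.trans h.m2)
theorem bd_pow2 {ε σ M x : ℝ} {k n : ℕ} {m : ℤ} (h : Bd ε σ M k m n (x * x)) :
    Bd ε σ M k m n (x ^ 2) := by rw [pow_two]; exact h


theorem JB.φts0 : ∃ k : ℕ, ∀ {a b κ g K M : ℝ} {B : Bg} {φ v w θ : Q} (h : JB a b κ g K M B φ v w θ), Bd B.ε B.σ M k 1 1 φ.ft :=
  ⟨_, fun {_ _ _ _ _ _ B φ v w _} h => by
    rw [show φ.ft = (-(((((B.y + v.f) * φ.f1) + (w.f * φ.f2)) + ((B.R + φ.f) * (v.f1 + w.f2))) + (w.f * B.R2)))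
      by linear_combination h.eM]
    exact (Bd.cv (Bd.neg (Bd.add (Bd.cv (Bd.add (Bd.cv (Bd.add (Bd.cv (Bd.mul (Bd.add (Bd.cv h.y (0) 0 (by decide) rfl) (Bd.cv h.vL (0) 0 (by decide) rfl)) h.φ1s) (2) 1 (by decide) rfl) (Bd.cv (Bd.mul h.wL h.φ2s) (2) 1 (by decide) rfl)) (1) 1 (by decide) rfl) (Bd.cv (Bd.mul (Bd.add (Bd.cv h.R (0) 0 (by decide) rfl) (Bd.cv h.φL (0) 0 (by decide) rfl)) (Bd.add (Bd.cv h.v1s (1) 1 (by decide) rfl) (Bd.cv h.w2s (1) 1 (by decide) rfl))) (1) 1 (by decide) rfl)) (1) 1 (by decide) rfl) (Bd.cv (Bd.mul h.ws h.R2) (1) 1 (by decide) rfl))) (1) 1 (by decide) rfl)⟩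

theorem JB.φtL0 : ∃ k : ℕ, ∀ {a b κ g K M : ℝ} {B : Bg} {φ v w θ : Q} (h : JB a b κ g K M B φ v w θ), Bd B.ε B.σ M k (-1) 0 φ.ft :=
  ⟨_, fun {_ _ _ _ _ _ B φ v w _} h => by
    rw [show φ.ft = (-(((((B.y + v.f) * φ.f1) + (w.f * φ.f2)) + ((B.R + φ.f) * (v.f1 + w.f2))) + (w.f * B.R2)))
      by linear_combination h.eM]
    exact (Bd.cv (Bd.neg (Bd.add (Bd.cv (Bd.add (Bd.cv (Bd.add (Bd.cv (Bd.mul (Bd.add (Bd.cv h.y (0) 0 (by decide) rfl) (Bd.cv h.vL (0) 0 (by decide) rfl)) h.φ1L) (0) 0 (by decide) rfl) (Bd.cv (Bd.mul h.wL h.φ2L) (0) 0 (by decide) rfl)) (-1) 0 (by decide) rfl) (Bd.cv (Bd.mul (Bd.add (Bd.cv h.R (0) 0 (by decide) rfl) (Bd.cv h.φL (0) 0 (by decide) rfl)) (Bd.add (Bd.cv h.v1L (-1) 0 (by decide) rfl) (Bd.cv h.w2L (-1) 0 (by decide) rfl))) (-1) 0 (by decide) rfl)) (-1) 0 (by decide)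 rfl) (Bd.cv (Bd.mul h.wL h.R2) (-1) 0 (by decide) rfl))) (-1) 0 (by decide) rfl)⟩

structure LF where
  Φ : Sm
  V : Sm
  W : Sm
  Θ : Sm
def FD.i (F : FD) : ℝ := (F.ε ^ 2)⁻¹
def FD.gψ (F : FD) : Sm := (D1 F.v) ^ 2 + (D2 F.v) ^ 2 + (D1 F.w) ^ 2 + (D2 F.w) ^ 2
def FD.gθ (F : FD) : Sm := (D1 F.θ) ^ 2 + (D2 F.θ) ^ 2
theorem FD.jφ (F : FD) (p : Pt) : (F.φ).1 p = (jq F.φ p).f := rfl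
theorem FD.jφ1 (F : FD) (p : Pt) : (D1 F.φ).1 p = (jq F.φ p).f1 := rfl
theorem FD.jφ2 (F : FD) (p : Pt) : (D2 F.φ).1 p = (jq F.φ p).f2 := rfl
theorem FD.jφt (F : FD) (p : Pt) : (Dt F.φ).1 p = (jq F.φ p).ft := rfl
theorem FD.jφ11 (F : FD) (p : Pt) : (D1 (D1 F.φ)).1 p = (jq F.φ p).f11 := rfl
theorem FD.jφ12 (F : FD) (p : Pt) : (D1 (D2 F.φ)).1 p = (jq F.φ p).f12 := rfl
theorem FD.jφ22 (F : FD) (p : Pt) : (D2 (D2 F.φ)).1 p = (jq F.φ p).f22 := rfl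
theorem FD.jφ1t (F : FD) (p : Pt) : (D1 (Dt F.φ)).1 p = (jq F.φ p).f1t := rfl
theorem FD.jφ2t (F : FD) (p : Pt) : (D2 (Dt F.φ)).1 p = (jq F.φ p).f2t := rfl
theorem FD.jv (F : FD) (p : Pt) : (F.v).1 p = (jq F.v p).f := rfl
theorem FD.jv1 (F : FD) (p : Pt) : (D1 F.v).1 p = (jq F.v p).f1 := rfl
theorem FD.jv2 (F : FD) (p : Pt) : (D2 F.v).1 p = (jq F.v p).f2 := rfl
theorem FD.jvt (F : FD) (p : Pt) : (Dt F.v).1 p = (jq F.v p).ft := rfl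
theorem FD.jv11 (F : FD) (p : Pt) : (D1 (D1 F.v)).1 p = (jq F.v p).f11 := rfl
theorem FD.jv12 (F : FD) (p : Pt) : (D1 (D2 F.v)).1 p = (jq F.v p).f12 := rfl
theorem FD.jv22 (F : FD) (p : Pt) : (D2 (D2 F.v)).1 p = (jq F.v p).f22 := rfl
theorem FD.jv1t (F : FD) (p : Pt) : (D1 (Dt F.v)).1 p = (jq F.v p).f1t := rfl
theorem FD.jv2t (F : FD) (p : Pt) : (D2 (Dt F.v)).1 p = (jq F.v p).f2t := rfl
theorem FD.jw (F : FD) (p : Pt) : (F.w).1 p = (jq F.w p).f := rfl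
theorem FD.jw1 (F : FD) (p : Pt) : (D1 F.w).1 p = (jq F.w p).f1 := rfl
theorem FD.jw2 (F : FD) (p : Pt) : (D2 F.w).1 p = (jq F.w p).f2 := rfl
theorem FD.jwt (F : FD) (p : Pt) : (Dt F.w).1 p = (jq F.w p).ft := rfl
theorem FD.jw11 (F : FD) (p : Pt) : (D1 (D1 F.w)).1 p = (jq F.w p).f11 := rfl
theorem FD.jw12 (F : FD) (p : Pt) : (D1 (D2 F.w)).1 p = (jq F.w p).f12 := rfl
theorem FD.jw22 (F : FD) (p : Pt) : (D2 (D2 F.w)).1 p = (jq F.w p).f22 := rfl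
theorem FD.jw1t (F : FD) (p : Pt) : (D1 (Dt F.w)).1 p = (jq F.w p).f1t := rfl
theorem FD.jw2t (F : FD) (p : Pt) : (D2 (Dt F.w)).1 p = (jq F.w p).f2t := rfl
theorem FD.jθ (F : FD) (p : Pt) : (F.θ).1 p = (jq F.θ p).f := rfl
theorem FD.jθ1 (F : FD) (p : Pt) : (D1 F.θ).1 p = (jq F.θ p).f1 := rfl
theorem FD.jθ2 (F : FD) (p : Pt) : (D2 F.θ).1 p = (jq F.θ p).f2 := rfl
theorem FD.jθt (F : FD) (p : Pt) : (Dt F.θ).1 p = (jq F.θ p).ft := rfl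
theorem FD.jθ11 (F : FD) (p : Pt) : (D1 (D1 F.θ)).1 p = (jq F.θ p).f11 := rfl
theorem FD.jθ12 (F : FD) (p : Pt) : (D1 (D2 F.θ)).1 p = (jq F.θ p).f12 := rfl
theorem FD.jθ22 (F : FD) (p : Pt) : (D2 (D2 F.θ)).1 p = (jq F.θ p).f22 := rfl
theorem FD.jθ1t (F : FD) (p : Pt) : (D1 (Dt F.θ)).1 p = (jq F.θ p).f1t := rfl
theorem FD.jθ2t (F : FD) (p : Pt) : (D2 (Dt F.θ)).1 p = (jq F.θ p).f2t := rfl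
theorem LF.jΦ (L : LF) (p : Pt) : (L.Φ).1 p = (jq L.Φ p).f := rfl
theorem LF.jΦ1 (L : LF) (p : Pt) : (D1 L.Φ).1 p = (jq L.Φ p).f1 := rfl
theorem LF.jΦ2 (L : LF) (p : Pt) : (D2 L.Φ).1 p = (jq L.Φ p).f2 := rfl
theorem LF.jΦt (L : LF) (p : Pt) : (Dt L.Φ).1 p = (jq L.Φ p).ft := rfl
theorem LF.jΦ11 (L : LF) (p : Pt) : (D1 (D1 L.Φ)).1 p = (jq L.Φ p).f11 := rfl
theorem LF.jΦ12 (L : LF) (p : Pt) : (D1 (D2 L.Φ)).1 p = (jq L.Φ p).f12 := rfl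
theorem LF.jΦ22 (L : LF) (p : Pt) : (D2 (D2 L.Φ)).1 p = (jq L.Φ p).f22 := rfl
theorem LF.jΦ1t (L : LF) (p : Pt) : (D1 (Dt L.Φ)).1 p = (jq L.Φ p).f1t := rfl
theorem LF.jΦ2t (L : LF) (p : Pt) : (D2 (Dt L.Φ)).1 p = (jq L.Φ p).f2t := rfl
theorem LF.jV (L : LF) (p : Pt) : (L.V).1 p = (jq L.V p).f := rfl
theorem LF.jV1 (L : LF) (p : Pt) : (D1 L.V).1 p = (jq L.V p).f1 := rfl
theorem LF.jV2 (L : LF) (p : Pt) : (D2 L.V).1 p = (jq L.V p).f2 := rfl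
theorem LF.jVt (L : LF) (p : Pt) : (Dt L.V).1 p = (jq L.V p).ft := rfl
theorem LF.jV11 (L : LF) (p : Pt) : (D1 (D1 L.V)).1 p = (jq L.V p).f11 := rfl
theorem LF.jV12 (L : LF) (p : Pt) : (D1 (D2 L.V)).1 p = (jq L.V p).f12 := rfl
theorem LF.jV22 (L : LF) (p : Pt) : (D2 (D2 L.V)).1 p = (jq L.V p).f22 := rfl
theorem LF.jV1t (L : LF) (p : Pt) : (D1 (Dt L.V)).1 p = (jq L.V p).f1t := rfl
theorem LF.jV2t (L : LF) (p : Pt) : (D2 (Dt L.V)).1 p = (jq L.V p).f2t := rfl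
theorem LF.jW (L : LF) (p : Pt) : (L.W).1 p = (jq L.W p).f := rfl
theorem LF.jW1 (L : LF) (p : Pt) : (D1 L.W).1 p = (jq L.W p).f1 := rfl
theorem LF.jW2 (L : LF) (p : Pt) : (D2 L.W).1 p = (jq L.W p).f2 := rfl
theorem LF.jWt (L : LF) (p : Pt) : (Dt L.W).1 p = (jq L.W p).ft := rfl
theorem LF.jW11 (L : LF) (p : Pt) : (D1 (D1 L.W)).1 p = (jq L.W p).f11 := rfl
theorem LF.jW12 (L : LF) (p : Pt) : (D1 (D2 L.W)).1 p = (jq L.W p).f12 := rfl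
theorem LF.jW22 (L : LF) (p : Pt) : (D2 (D2 L.W)).1 p = (jq L.W p).f22 := rfl
theorem LF.jW1t (L : LF) (p : Pt) : (D1 (Dt L.W)).1 p = (jq L.W p).f1t := rfl
theorem LF.jW2t (L : LF) (p : Pt) : (D2 (Dt L.W)).1 p = (jq L.W p).f2t := rfl
theorem LF.jΘ (L : LF) (p : Pt) : (L.Θ).1 p = (jq L.Θ p).f := rfl
theorem LF.jΘ1 (L : LF) (p : Pt) : (D1 L.Θ).1 p = (jq L.Θ p).f1 := rfl
theorem LF.jΘ2 (L : LF) (p : Pt) : (D2 L.Θ).1 p = (jq L.Θ p).f2 := rfl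
theorem LF.jΘt (L : LF) (p : Pt) : (Dt L.Θ).1 p = (jq L.Θ p).ft := rfl
theorem LF.jΘ11 (L : LF) (p : Pt) : (D1 (D1 L.Θ)).1 p = (jq L.Θ p).f11 := rfl
theorem LF.jΘ12 (L : LF) (p : Pt) : (D1 (D2 L.Θ)).1 p = (jq L.Θ p).f12 := rfl
theorem LF.jΘ22 (L : LF) (p : Pt) : (D2 (D2 L.Θ)).1 p = (jq L.Θ p).f22 := rfl
theorem LF.jΘ1t (L : LF) (p : Pt) : (D1 (Dt L.Θ)).1 p = (jq L.Θ p).f1t := rfl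
theorem LF.jΘ2t (L : LF) (p : Pt) : (D2 (Dt L.Θ)).1 p = (jq L.Θ p).f2t := rfl
theorem FD.jbR (F : FD) (p : Pt) : (F.R).1 p = (F.bg p).R := rfl
theorem FD.jbτ (F : FD) (p : Pt) : (F.τ).1 p = (F.bg p).τ := rfl
theorem FD.jbR2 (F : FD) (p : Pt) : (D2 F.R).1 p = (F.bg p).R2 := rfl
theorem FD.jbτ2 (F : FD) (p : Pt) : (D2 F.τ).1 p = (F.bg p).τ2 := rfl
theorem FD.jbR22 (F : FD) (p : Pt) : (D2 (D2 F.R)).1 p = (F.bg p).R22 := rfl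
theorem FD.jby (F : FD) (p : Pt) : (Yc).1 p = (F.bg p).y := rfl
theorem FD.jbi (F : FD) (p : Pt) : F.i = (F.bg p).i := rfl
theorem FD.jbe (F : FD) (p : Pt) : F.ε = (F.bg p).ε := rfl
theorem FD.jbs (F : FD) (p : Pt) : F.s.1 p = (F.bg p).σ ^ 2 := (Real.sq_sqrt (F.s_nonneg p)).symm
theorem E0_small : ∃ k : ℕ, ∀ {a b κ g K M : ℝ} {B : Bg} {φ v w θ : Q} (h : JB a b κ g K M B φ v w θ),
    (B.i * ((((((((((((1 / 2) * (B.R + φ.f)) * ((v.f * v.f) + (w.f * w.f))) * w.f) * B.R2) - ((a * B.R2) * ((v.f * v.f2) + (w.f * w.f2)))) - (((b * B.R2) * w.f) * (v.f1 + w.f2))) + ((((((B.i * g) * (B.R + φ.f)) * B.R) * B.R2) * w.f) * (θ.f * θ.f))) - ((((((2 * κ) * B.i) * B.R) * B.R2) * θ.f) * θ.f2)) + (((B.R * B.R) * θ.f) * ((((2 * a) * ((v.f1 * v.f1) + (w.f2 * w.f2))) + (a * ((w.f1 + v.f2) * (w.f1 + v.f2)))) + ((b - a) * ((v.f1 + w.f2)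 * (v.f1 + w.f2)))))) + (2 * ((((B.R * B.R) * θ.f) * a) * (w.f1 + v.f2)))) + ((((1 / 3) * B.i) * (((B.τ * φ.f) * (B.τ * φ.f)) * (B.τ * φ.f))) * ((B.R * (v.f1 + w.f2)) + (w.f * B.R2)))))
      ≤ M ^ k * B.ε * B.σ ^ 2 :=
  ⟨_, fun {_ _ _ _ _ _ _ _ _ _ _} h => Bd.fin (Bd.cv (Bd.mul h.i (Bd.add (Bd.cv (Bd.add (Bd.cv (Bd.add (Bd.cv (Bd.sub (Bd.cv (Bd.add (Bd.cv (Bd.sub (Bd.cv (Bd.sub (Bd.cv (Bd.mul (Bd.mul (Bd.mul (Bd.mul (bd_n h.bc (by norm_num)) (Bd.add (Bd.cv h.R (0) 0 (by decide) rfl) (Bd.cv h.φL (0) 0 (by decide) rfl))) (Bd.add (Bd.cv (Bd.mul h.vL h.vs) (1) 1 (by decide) rfl) (Bd.cv (Bd.mul h.wL h.ws) (1) 1 (by decide) rfl))) h.ws) h.R2) (3) 2 (by decide) rfl) (Bd.cv (Bd.mul (Bd.mul h.aB h.R2) (Bd.add (Bd.cv (Bd.mul h.vs h.v2s) (2) 2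 (by decide) rfl) (Bd.cv (Bd.mul h.ws h.w2s) (2) 2 (by decide) rfl))) (3) 2 (by decide) rfl)) (3) 2 (by decide) rfl) (Bd.cv (Bd.mul (Bd.mul (Bd.mul h.bB h.R2) h.ws) (Bd.add (Bd.cv h.v1s (1) 1 (by decide) rfl) (Bd.cv h.w2s (1) 1 (by decide) rfl))) (3) 2 (by decide) rfl)) (3) 2 (by decide) rfl) (Bd.cv (Bd.mul (Bd.mul (Bd.mul (Bd.mul (Bd.mul (Bd.mul h.i h.gB) (Bd.add (Bd.cv h.R (0) 0 (by decide) rfl) (Bd.cv h.φL (0) 0 (by decide) rfl))) h.R) h.R2) h.wL) (Bd.mul h.θs h.θs)) (3) 2 (by decide) rfl)) (3) 2 (by decide) rfl) (Bd.cv (Bd.mul (Bd.mul (Bd.mul (Bd.mul (Bd.mul (Bd.mul (bd_n h.bc (by norm_num)) h.κB) h.i) h.R) h.R2) h.θs) h.θ2s) (3) 2 (by decide) rfl)) (3) 2 (by decide) rfl) (Bd.cv (Bd.mul (Bd.mul (Bd.mul h.R h.R) h.θL) (Bd.add (Bd.cv (Bd.add (Bd.cv (Bd.mul (Bd.mul (bd_n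 h.bc (by norm_num)) h.aB) (Bd.add (Bd.cv (Bd.mul h.v1s h.v1s) (2) 2 (by decide) rfl) (Bd.cv (Bd.mul h.w2s h.w2s) (2) 2 (by decide) rfl))) (2) 2 (by decide) rfl) (Bd.cv (Bd.mul h.aB (Bd.mul (Bd.add (Bd.cv h.w1s (1) 1 (by decide) rfl) (Bd.cv h.v2s (1) 1 (by decide) rfl)) (Bd.add (Bd.cv h.w1s (1) 1 (by decide) rfl) (Bd.cv h.v2s (1) 1 (by decide) rfl)))) (2) 2 (by decide) rfl)) (2) 2 (by decide) rfl) (Bd.cv (Bd.mul h.ba (Bd.mul (Bd.add (Bd.cv h.v1s (1) 1 (by decide) rfl) (Bd.cv h.w2s (1) 1 (by decide) rfl)) (Bd.add (Bd.cv h.v1s (1) 1 (by decide) rfl) (Bd.cv h.w2s (1) 1 (by decide) rfl)))) (2) 2 (by decide) rfl))) (3) 2 (by decide) rfl)) (3) 2 (by decide) rfl) (Bd.cv (Bd.mul (bd_n h.bc (by norm_num)) (Bd.mul (Bd.mul (Bd.mul (Bd.mul h.R h.R) h.θs) h.aB) (Bd.add (Bd.cv h.w1s (1) 1 (by decide) rfl)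 (Bd.cv h.v2s (1) 1 (by decide) rfl)))) (3) 2 (by decide) rfl)) (3) 2 (by decide) rfl) (Bd.cv (Bd.mul (Bd.mul (Bd.mul (bd_n h.bc (by norm_num)) h.i) (Bd.mul (Bd.mul (Bd.mul h.τ h.φL) (Bd.mul h.τ h.φL)) (Bd.mul h.τ h.φs))) (Bd.add (Bd.cv (Bd.mul h.R (Bd.add (Bd.cv h.v1s (1) 1 (by decide) rfl) (Bd.cv h.w2s (1) 1 (by decide) rfl))) (1) 1 (by decide) rfl) (Bd.cv (Bd.mul h.ws h.R2) (1) 1 (by decide) rfl))) (3) 2 (by decide) rfl))) (1) 2 (by decide) rfl)⟩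

theorem E0_star {a b κ g K M : ℝ} {B : Bg} {φ v w θ : Q} (h : JB a b κ g K M B φ v w θ) : (((((((-(B.R + φ.f)) * B.R) * v.f) * w.f) + ((((B.i * (B.R + φ.f)) * θ.f) * w.f) * B.R2)) - (((((((B.i * g) * (B.R + φ.f)) * B.R) * B.R) * θ.f) * w.f) * B.τ2)) - (((((B.i * B.R) * B.R) * (B.R + φ.f)) * (θ.f * θ.f)) * (v.f1 + w.f2)))
    ≤ (4 + 2 * K + 8 * g * K + 16 * K) * (B.i * θ.f ^ 2 + v.f ^ 2 + w.f ^ 2 + v.f1 ^ 2 + w.f2 ^ 2) := by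
  have hi := h.i0
  have he := h.bc.e0
  have hK : 0 ≤ K := by linarith [h.cs.k1]
  have hg := h.cs.g0
  have key : ∀ c z : ℝ, 0 ≤ c → B.i * (c * B.ε * |θ.f| * |z|) ≤ c / 2 * (B.i * θ.f ^ 2 + z ^ 2) := by
    intro c z hc
    have h1 : B.i * (B.ε * |θ.f| * |z|) ≤ 1 / 2 * (B.i * θ.f ^ 2 + z ^ 2) := by
      have h2 := mul_nonneg hi.le (sq_nonneg (|θ.f| - B.ε * |z|))
      have h3 : B.i * (|θ.f| - B.ε * |z|) ^ 2
          = B.i * |θ.f| ^ 2 - 2 * (B.i * (B.ε * |θ.f| * |z|)) + (B.i * B.ε ^ 2) * |z| ^ 2 := by ring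
      rw [h.iε, sq_abs, sq_abs] at h3
      linarith
    calc B.i * (c * B.ε * |θ.f| * |z|) = c * (B.i * (B.ε * |θ.f| * |z|)) := by ring
      _ ≤ c * (1 / 2 * (B.i * θ.f ^ 2 + z ^ 2)) := mul_le_mul_of_nonneg_left h1 hc
      _ = _ := by ring
  have hR : |B.R| ≤ 2 := abs_le.2 ⟨by linarith [h.Rl], h.Ru⟩
  have hρ : |B.R + φ.f| ≤ 4 := abs_le.2 ⟨by linarith [h.ρl], h.ρu⟩
  have t1 : -(B.R + φ.f) * B.R * v.f * w.f ≤ 4 * (v.f ^ 2 + w.f ^ 2) := by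
    have : |(B.R + φ.f) * B.R * (v.f * w.f)| ≤ 4 * 2 * (1 / 2 * (v.f ^ 2 + w.f ^ 2)) := by
      rw [abs_mul, abs_mul]
      have : |v.f * w.f| ≤ 1 / 2 * (v.f ^ 2 + w.f ^ 2) :=
        abs_le.2 ⟨by nlinarith [sq_nonneg (v.f + w.f)], by nlinarith [sq_nonneg (v.f - w.f)]⟩
      gcongr
    have := (neg_le_abs _).trans this
    linarith
  have t2 : B.i * (B.R + φ.f) * θ.f * w.f * B.R2 ≤ 2 * K * (B.i * θ.f ^ 2 + w.f ^ 2) := by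
    refine (le_abs_self _).trans ?_
    have : |B.i * (B.R + φ.f) * θ.f * w.f * B.R2| ≤ B.i * ((4 * K) * B.ε * |θ.f| * |w.f|) := by
      simp only [abs_mul, abs_of_pos hi]
      calc B.i * |B.R + φ.f| * |θ.f| * |w.f| * |B.R2|
          ≤ B.i * 4 * |θ.f| * |w.f| * (K * B.ε) := by gcongr; exact h.R2K
        _ = _ := by ring
    have := this.trans (key _ w.f (by positivity))
    linarith
  have t3 : -(B.i * g * (B.R + φ.f) * B.R * B.R * θ.f * w.f * B.τ2)
      ≤ 8 * g * K * (B.i * θ.f ^ 2 + w.f ^ 2) := by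
    refine (neg_le_abs _).trans ?_
    have : |B.i * g * (B.R + φ.f) * B.R * B.R * θ.f * w.f * B.τ2|
        ≤ B.i * ((16 * g * K) * B.ε * |θ.f| * |w.f|) := by
      simp only [abs_mul, abs_of_pos hi, abs_of_pos hg]
      calc B.i * g * |B.R + φ.f| * |B.R| * |B.R| * |θ.f| * |w.f| * |B.τ2|
          ≤ B.i * g * 4 * 2 * 2 * |θ.f| * |w.f| * (K * B.ε) := by gcongr; exact h.τ2K
        _ = _ := by ring
    have := this.trans (key _ w.f (by positivity))
    linarith
  have t4 : -(B.i * B.R * B.R * (B.R + φ.f) * (θ.f * θ.f) * (v.f1 + w.f2))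
      ≤ 8 * K * (B.i * θ.f ^ 2 + (v.f1 + w.f2) ^ 2) := by
    refine (neg_le_abs _).trans ?_
    have : |B.i * B.R * B.R * (B.R + φ.f) * (θ.f * θ.f) * (v.f1 + w.f2)|
        ≤ B.i * ((16 * K) * B.ε * |θ.f| * |v.f1 + w.f2|) := by
      simp only [abs_mul, abs_of_pos hi]
      calc B.i * |B.R| * |B.R| * |B.R + φ.f| * (|θ.f| * |θ.f|) * |v.f1 + w.f2|
          ≤ B.i * 2 * 2 * 4 * (|θ.f| * (K * B.ε)) * |v.f1 + w.f2| := by gcongr; exact h.θK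
        _ = _ := by ring
    have := this.trans (key _ (v.f1 + w.f2) (by positivity))
    linarith
  have n1 : 0 ≤ B.i * θ.f ^ 2 := by positivity
  have n2 := sq_nonneg v.f
  have n3 := sq_nonneg w.f
  have n4 : (v.f1 + w.f2) ^ 2 ≤ 2 * (v.f1 ^ 2 + w.f2 ^ 2) := by nlinarith [sq_nonneg (v.f1 - w.f2)]
  have n5 : 0 ≤ v.f1 ^ 2 + w.f2 ^ 2 := by positivity
  have hgK : 0 ≤ g * K := by positivity
  generalize B.i * θ.f ^ 2 = X at *
  generalize v.f1 ^ 2 = Y1 at *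
  generalize w.f2 ^ 2 = Y2 at *
  generalize (v.f1 + w.f2) ^ 2 = D at *
  have hKD : K * D ≤ K * (2 * (Y1 + Y2)) := mul_le_mul_of_nonneg_left n4 hK
  have w1 : 0 ≤ K * X := by positivity
  have w2 : 0 ≤ g * K * X := by positivity
  have w3 : 0 ≤ K * v.f ^ 2 := by positivity
  have w4 : 0 ≤ K * w.f ^ 2 := by positivity
  have w5 : 0 ≤ g * K * v.f ^ 2 := by positivity
  have w6 : 0 ≤ g * K * w.f ^ 2 := by positivity
  have w7 : 0 ≤ K * (Y1 + Y2) := by positivity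
  have w8 : 0 ≤ g * K * (Y1 + Y2) := by positivity
  linarith

theorem E0_pt : ∃ k : ℕ, ∀ {a b κ g K M : ℝ} {B : Bg} {φ v w θ : Q} (h : JB a b κ g K M B φ v w θ),
    B.i * ((((((((((((((1 / 2) * (B.R + φ.f)) * ((v.f * v.f) + (w.f * w.f))) * w.f) * B.R2) - ((a * B.R2) * ((v.f * v.f2) + (w.f * w.f2)))) - (((b * B.R2) * w.f) * (v.f1 + w.f2))) + ((((((B.i * g) * (B.R + φ.f)) * B.R) * B.R2) * w.f) * (θ.f * θ.f))) - ((((((2 * κ) * B.i) * B.R) * B.R2) * θ.f) * θ.f2)) + (((B.R * B.R) * θ.f) * ((((2 * a) * ((v.f1 * v.f1) + (w.f2 * w.f2))) + (a * ((w.f1 + v.f2) * (w.f1 + v.f2)))) + ((b - a) * ((v.f1 + w.f2) * (v.f1 + w.f2)))))) + (2 * ((((B.R * B.R) * θ.f) * a) * (w.f1 + v.f2)))) + ((((1 / 3) * B.i) * (((B.τ * φ.f) * (B.τ * φ.f)) * (B.τ * φ.f))) * ((B.R * (v.f1 + w.f2)) + (w.f * B.R2)))) + (((((((-(B.R + φ.f))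 * B.R) * v.f) * w.f) + ((((B.i * (B.R + φ.f)) * θ.f) * w.f) * B.R2)) - (((((((B.i * g) * (B.R + φ.f)) * B.R) * B.R) * θ.f) * w.f) * B.τ2)) - (((((B.i * B.R) * B.R) * (B.R + φ.f)) * (θ.f * θ.f)) * (v.f1 + w.f2))))
     - (a * B.R * (v.f1 ^ 2 + v.f2 ^ 2 + w.f1 ^ 2 + w.f2 ^ 2) + b * B.R * (v.f1 + w.f2) ^ 2
        + κ * B.i * B.R ^ 2 * (θ.f1 ^ 2 + θ.f2 ^ 2)))
    ≤ -(a / 2 * (B.i * (v.f1 ^ 2 + v.f2 ^ 2 + w.f1 ^ 2 + w.f2 ^ 2))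
       + κ / 4 * (B.i * (B.i * (θ.f1 ^ 2 + θ.f2 ^ 2))))
      + (4 + 2 * K + 8 * g * K + 16 * K) * (B.i * (B.i * θ.f ^ 2 + v.f ^ 2 + w.f ^ 2 + v.f1 ^ 2 + w.f2 ^ 2))
      + M ^ k * B.ε * B.σ ^ 2 := by
  obtain ⟨k, hk⟩ := E0_small
  refine ⟨k, fun {a b κ g K M B φ v w θ} h => ?_⟩
  have h1 := hk h
  have hi := h.i0
  have h2 := mul_le_mul_of_nonneg_left (E0_star h) hi.le
  have hR := h.Rl
  have d1 : a / 2 * (v.f1 ^ 2 + v.f2 ^ 2 + w.f1 ^ 2 + w.f2 ^ 2)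
      ≤ a * B.R * (v.f1 ^ 2 + v.f2 ^ 2 + w.f1 ^ 2 + w.f2 ^ 2) := by
    have := h.cs.a0
    have : a / 2 ≤ a * B.R := by nlinarith
    gcongr
  have d2 : 0 ≤ b * B.R * (v.f1 + w.f2) ^ 2 := by
    have := h.cs.b0
    have : 0 ≤ B.R := by linarith
    positivity
  have d3 : κ / 4 * (B.i * (θ.f1 ^ 2 + θ.f2 ^ 2)) ≤ κ * B.i * B.R ^ 2 * (θ.f1 ^ 2 + θ.f2 ^ 2) := by
    have := h.cs.κ0
    have h5 : 1 / 4 ≤ B.R ^ 2 := by nlinarith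
    calc κ / 4 * (B.i * (θ.f1 ^ 2 + θ.f2 ^ 2)) = κ * B.i * (1 / 4) * (θ.f1 ^ 2 + θ.f2 ^ 2) := by ring
      _ ≤ _ := by gcongr
  have h3 := mul_le_mul_of_nonneg_left (add_le_add (add_le_add d1 d2) d3) hi.le
  linear_combination h1 + h2 + h3

def FD.e0 (F : FD) (g : ℝ) : Sm := (cst (1 / 2)) * (((F.ρ) * (F.R)) * (F.v * F.v + (F.w * F.w))) + ((cst F.i) * ((cst (1 / 2)) * ((F.τ) * ((F.φ) * (F.φ))) - ((cst (1 / 6)) * (((F.τ) * (F.τ)) * (((F.φ) * (F.φ)) * (F.φ)))))) + ((((cst (1 / 2)) * (cst F.i)) * (cst g)) * (((F.ρ) * ((F.R) * (F.R))) * ((F.θ) * (F.θ))))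

def FD.f01 (F : FD) (a b κ g : ℝ) : Sm := -((F.U) * (F.e0 g)) - ((cst F.i) * (((F.R) * ((F.ρ) * (F.Tm) - (cst 1))) * F.v)) + ((cst a) * ((F.R) * (F.v * (D1 F.v) + (F.w * (D1 F.w))))) + ((cst b) * (((F.R) * F.v) * (F.d))) + (((cst κ) * (cst F.i)) * (((F.R) * (F.R)) * ((F.θ) * (D1 F.θ))))
def FD.f02 (F : FD) (a b κ g : ℝ) : Sm := -(F.w * (F.e0 g)) - (F.w * ((cst F.i) * ((F.R) * ((F.ρ) * (F.Tm) - (cst 1))))) + (F.v * ((cst a) * ((F.R) * (D2 F.v))) + (F.w * ((cst a) * ((F.R) * (D2 F.w))))) + (F.w * ((cst b) * ((F.R) * (F.d)))) + ((F.θ) * (((cst κ) * (cst F.i)) * (((F.R) * (F.R)) * (D2 F.θ))))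

theorem JB.R2e {a b κ g K M : ℝ} {B : Bg} {φ v w θ : Q} (h : JB a b κ g K M B φ v w θ) : B.R2 = - B.R ^ 2 * B.τ2 := by
  linear_combination B.R * h.R2τ - B.R2 * h.Rτ

theorem E0_int : ∃ k : ℕ, ∀ {a b κ g K M : ℝ} {F : FD} (hF : Flow a b κ g K M F) {t : ℝ}
    (ht : t ∈ Set.Icc 0 F.T),
    I (cst F.i * Dt (F.e0 g) + (cst (a / 2) * (cst F.i * F.gψ) + cst (κ / 4) * (cst F.i * (cst F.i * F.gθ)))) t
    ≤ I (cst (4 + 2 * K + 8 * g * K + 16 * K) * (cst F.i * (cst F.i * F.θ ^ 2 + F.v ^ 2 + F.w ^ 2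
      + (D1 F.v) ^ 2 + (D2 F.w) ^ 2)) + cst (M ^ k) * cst F.ε * F.s) t := by
  obtain ⟨k, hk⟩ := E0_pt
  refine ⟨k, fun {a b κ g K M F} hF {t} ht => ?_⟩
  have hv := hF.wv t ht
  have hw := hF.ww t ht
  have hθ := hF.wθ t ht
  refine I_le_of_local (f := cst F.i * F.f01 a b κ g) (g := F.f02 a b κ g * cst F.i) ?_ ?_ ?_
  · unfold FD.f01 FD.e0 FD.U FD.ρ FD.Tm FD.d
    repeat' first
      | exact hF.pv | exact hF.pw | exact hF.pθ | exact hF.pφ | exact hF.pR | exact hF.pτ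
      | exact Per.cst _ | exact Per_Yc | apply Per.sub | apply Per.neg | apply Per.add
      | apply Per.mul | apply Per.D1 | apply Per.D2 | apply Per.Dt
  · unfold FD.f02
    repeat' first
      | exact hv | exact hw | exact hθ | apply W0.sub | apply W0.neg | apply W0.add
      | apply W0.mulr
  · intro x hx
    have h := hF.jb ht hx
    have hE := hk h
    have hR2 := h.R2e
    simp only [FD.e0, FD.f01, FD.f02, FD.U, FD.ρ, FD.Tm, FD.d, FD.gψ, FD.gθ, Dt_add, Dt_sub, Dt_neg, Dt_mul, Dt_cst, D1_add, D1_sub, D1_neg, D1_mul, D1_cst, D2_add, D2_sub, D2_neg, D2_mul, D2_cst, D2_D1, Dt_D1, Dt_D2, D1_Yc, D2_Yc, Dt_Yc, ev_add, ev_sub, ev_neg, ev_mul, ev_pow, ev_cst, ev_zero, ev_one, hF.R1, hF.Rt, hF.τ1, hF.τt]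
    simp only [mul_zero, zero_mul, add_zero, zero_add, sub_zero]
    simp only [FD.jφ, FD.jφ1, FD.jφ2, FD.jφt, FD.jφ11, FD.jφ12, FD.jφ22, FD.jφ1t, FD.jφ2t, FD.jv, FD.jv1, FD.jv2, FD.jvt, FD.jv11, FD.jv12, FD.jv22, FD.jv1t, FD.jv2t, FD.jw, FD.jw1, FD.jw2, FD.jwt, FD.jw11, FD.jw12, FD.jw22, FD.jw1t, FD.jw2t, FD.jθ, FD.jθ1, FD.jθ2, FD.jθt, FD.jθ11, FD.jθ12, FD.jθ22, FD.jθ1t, FD.jθ2t, FD.jbR, FD.jbτ, FD.jbR2, FD.jbτ2, FD.jbR22, FD.jby F (t, x), FD.jbs, FD.jbi F (t, x), FD.jbe F (t, x)]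
    generalize jq F.φ (t, x) = φ at *
    generalize jq F.v (t, x) = v at *
    generalize jq F.w (t, x) = w at *
    generalize jq F.θ (t, x) = θ at *
    generalize F.bg (t, x) = B at *
    linear_combination hE + B.i * ((B.R * v.f)) * h.e1 + B.i * ((B.R * w.f)) * h.e2 + B.i * ((((B.i * B.R) * B.R) * θ.f)) * h.eT + B.i * ((((((1 / 2) * B.R) * ((v.f * v.f) + (w.f * w.f))) + ((((((1 / 2) * B.i) * g) * B.R) * B.R) * (θ.f * θ.f))) + (B.i * ((B.τ * φ.f) - ((1 / 2) * ((B.τ * φ.f) * (B.τ * φ.f))))))) * h.eM + B.i * (1*B.R*B.i*w.f*B.τ + (-1)*B.i*w.f + (1/2)*B.i*w.f*B.τ^2*φ.f^2 + (-1/3)*B.i*w.f*B.τ^3*φ.f^3) * hR2 + B.i * (1*B.R*B.i*v.f1 + (-1)*B.R*B.i*v.f1*θ.f*φ.f + (-1/2)*B.R*B.i*w.f*B.τ*B.τ2*φ.f^2 + (1/3)*B.R*B.i*w.f*B.τ^2*B.τ2*φ.f^3 + 1*B.R*B.i*w.f2 + (-1)*B.R*B.i*w.f2*θ.f*φ.f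 + (-1)*B.R^2*B.i*v.f1*θ.f + (-1)*B.R^2*B.i*w.f*B.τ2 + (-1)*B.R^2*B.i*w.f2*θ.f + (1/2)*B.i*v.f1*B.τ*φ.f^2 + (-1/3)*B.i*v.f1*B.τ^2*φ.f^3 + (1/3)*B.i*w.f*B.τ*B.τ2*φ.f^3 + (-1/2)*B.i*w.f*B.τ2*φ.f^2 + (1/2)*B.i*w.f2*B.τ*φ.f^2 + (-1/3)*B.i*w.f2*B.τ^2*φ.f^3) * h.Rτ + B.i * ((-2)*B.R^2*a*v.f1*w.f2*θ.f + 1*B.R^2*a*v.f1^2*θ.f + 2*B.R^2*a*v.f2*w.f1*θ.f + 2*B.R^2*a*v.f2*θ.f + 1*B.R^2*a*v.f2^2*θ.f + 2*B.R^2*a*w.f1*θ.f + 1*B.R^2*a*w.f1^2*θ.f + 1*B.R^2*a*w.f2^2*θ.f + 2*B.R^2*b*v.f1*w.f2*θ.f + 1*B.R^2*b*v.f1^2*θ.f + 1*B.R^2*b*w.f2^2*θ.f) * h.iε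


structure LB (k : ℕ) (a b κ g K M : ℝ) (B : Bg) (φ v w θ Φ V W Θ : Q) : Prop where
  jb : JB a b κ g K M B φ v w θ
  ΦL : Bd B.ε B.σ M k 0 0 Φ.f
  Φs : Bd B.ε B.σ M k 2 1 Φ.f
  Vs : Bd B.ε B.σ M 0 1 1 V.f
  Ws : Bd B.ε B.σ M 0 1 1 W.f
  Θs : Bd B.ε B.σ M 0 2 1 Θ.f
  V1 : Bd B.ε B.σ M 0 0 1 V.f1
  V2 : Bd B.ε B.σ M 0 0 1 V.f2
  W1 : Bd B.ε B.σ M 0 0 1 W.f1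
  W2 : Bd B.ε B.σ M 0 0 1 W.f2
  Θ1 : Bd B.ε B.σ M 0 1 1 Θ.f1
  Θ2 : Bd B.ε B.σ M 0 1 1 Θ.f2
  lM : ((((((Φ.ft + ((B.y + v.f) * Φ.f1)) + (w.f * Φ.f2)) + (Φ.f * (v.f1 + w.f2))) + ((B.R + φ.f) * (V.f1 + W.f2))) + (V.f * φ.f1)) + (W.f * (φ.f2 + B.R2))) = 0
  l1 : ((((((B.R + φ.f) * (((((V.ft + ((B.y + v.f) * V.f1)) + (w.f * V.f2)) + (V.f * v.f1)) + (W.f * v.f2)) + W.f)) + (Φ.f * (((v.ft + ((B.y + v.f) * v.f1)) + (w.f * v.f2)) + w.f))) + (B.i * (((((B.τ + θ.f) * Φ.f1) + (θ.f1 * Φ.f)) + ((B.R + φ.f) * Θ.f1)) + (φ.f1 * Θ.f)))) - (a * (V.f11 + V.f22))) - (b * (V.f11 + W.f12))) = 0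
  l2 : ((((((B.R + φ.f) * ((((W.ft + ((B.y + v.f) * W.f1)) + (w.f * W.f2)) + (V.f * w.f1)) + (W.f * w.f2))) + (Φ.f * ((w.ft + ((B.y + v.f) * w.f1)) + (w.f * w.f2)))) + (B.i * (((((B.τ + θ.f) * Φ.f2) + ((B.τ2 + θ.f2) * Φ.f)) + ((B.R + φ.f) * Θ.f2)) + ((B.R2 + φ.f2) * Θ.f)))) - (a * (W.f11 + W.f22))) - (b * (V.f12 + W.f22))) = 0
  lT : ((((((g * ((B.R + φ.f) * (((((Θ.ft + ((B.y + v.f) * Θ.f1)) + (w.f * Θ.f2)) + (V.f * θ.f1)) + (W.f * θ.f2)) + (W.f * B.τ2)))) + (g * (Φ.f * (((θ.ft + ((B.y + v.f) * θ.f1)) + (w.f * θ.f2)) + (w.f * B.τ2))))) + (((B.R + φ.f) * (B.τ + θ.f)) * (V.f1 + W.f2))) + (((Φ.f * (B.τ + θ.f)) + ((B.R + φ.f) * Θ.f)) * (v.f1 + w.f2))) - (κ * (Θ.f11 + Θ.f22))) - ((B.ε * B.ε) * ((((2 * (2 * (a * ((v.f1 * V.f1) + (w.f2 * W.f2)))))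 + (2 * (a * ((w.f1 + v.f2) * (W.f1 + V.f2))))) + (2 * (a * (W.f1 + V.f2)))) + (2 * ((b - a) * ((v.f1 + w.f2) * (V.f1 + W.f2))))))) = 0

theorem ED_err (k : ℕ) : ∃ k' : ℕ, ∀ {a b κ g K M : ℝ} {B : Bg} {φ v w θ Φ V W Θ : Q} (H : LB k a b κ g K M B φ v w θ Φ V W Θ),
    ((((((((((((((((((1 / 2) * (B.R + φ.f)) * ((V.f * V.f) + (W.f * W.f))) * w.f) * B.R2) - ((B.R * (B.R + φ.f)) * (((V.f * ((V.f * v.f1) + (W.f * v.f2))) + (W.f * ((V.f * w.f1) + (W.f * w.f2)))) + (V.f * W.f)))) - ((B.R * Φ.f) * ((V.f * (((v.ft + ((B.y + v.f) * v.f1)) + (w.f * v.f2)) + w.f)) + (W.f * ((w.ft + ((B.y + v.f) * w.f1)) + (w.f * w.f2)))))) - (((B.i * B.τ) * Φ.f) * (((φ.f * (V.f1 + W.f2)) + (V.f * φ.f1)) + (W.f * φ.f2)))) - (B.i * (((((1 / 2) * B.τ) * (Φ.f * Φ.f)) * (v.f1 + w.f2)) - ((((1 / 2) * w.f) * B.τ2)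 * (Φ.f * Φ.f))))) + (((B.i * θ.f) * Φ.f) * ((B.R * (V.f1 + W.f2)) + (W.f * B.R2)))) + ((((B.i * (B.R + φ.f)) * Θ.f) * W.f) * B.R2)) - ((((((B.i * B.R) * B.R) * (B.R + φ.f)) * θ.f) * Θ.f) * (V.f1 + W.f2))) + ((((((B.i * g) * (B.R + φ.f)) * B.R) * B.R2) * w.f) * (Θ.f * Θ.f))) - ((((B.i * B.R) * B.R) * Θ.f) * ((((g * (B.R + φ.f)) * (((V.f * θ.f1) + (W.f * θ.f2)) + (W.f * B.τ2))) + ((g * Φ.f) * (((θ.ft + ((B.y + v.f) * θ.f1)) + (w.f * θ.f2)) + (w.f * B.τ2)))) + (((Φ.f * (B.τ + θ.f)) + ((B.R + φ.f) * Θ.f)) * (v.f1 + w.f2))))) - ((((((2 * κ) * B.i) * B.R) * B.R2) * Θ.f) * Θ.f2)) + (((B.R * B.R) * Θ.f) * ((((2 * (2 * (a * ((v.f1 * V.f1) + (w.f2 * W.f2))))) + (2 * (a * ((w.f1 + v.f2) * (W.f1 + V.f2))))) + (2 * (a * (W.f1 + V.f2)))) + (2 * ((b - a) * ((v.f1 +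 w.f2) * (V.f1 + W.f2))))))) - ((a * B.R2) * ((V.f * V.f2) + (W.f * W.f2)))) - (((b * B.R2) * W.f) * (V.f1 + W.f2)))
      ≤ M ^ k' * B.ε * B.σ ^ 2 :=
  ⟨_, fun {_ _ _ _ _ _ _ _ _ _ _ _ _ _ _} H => have h := H.jb; Bd.fin (Bd.cv (Bd.sub (Bd.cv (Bd.sub (Bd.cv (Bd.add (Bd.cv (Bd.sub (Bd.cv (Bd.sub (Bd.cv (Bd.add (Bd.cv (Bd.sub (Bd.cv (Bd.add (Bd.cv (Bd.add (Bd.cv (Bd.sub (Bd.cv (Bd.sub (Bd.cv (Bd.sub (Bd.cv (Bd.sub (Bd.cv (Bd.mul (Bd.mul (Bd.mul (Bd.mul (bd_n h.bc (by norm_num)) (Bd.add (Bd.cv h.R (0) 0 (by decide) rfl) (Bd.cv h.φL (0) 0 (by decide) rfl))) (Bd.add (Bd.cv (Bd.mul H.Vs H.Vs) (2) 2 (by decide) rfl) (Bd.cv (Bd.mul H.Ws H.Ws) (2) 2 (by decide) rfl))) h.wL) h.R2) (1) 2 (by decide) rfl) (Bd.cv (Bd.mul (Bd.mul h.R (Bd.add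 (Bd.cv h.R (0) 0 (by decide) rfl) (Bd.cv h.φL (0) 0 (by decide) rfl))) (Bd.add (Bd.cv (Bd.add (Bd.cv (Bd.mul H.Vs (Bd.add (Bd.cv (Bd.mul H.Vs h.v1L) (0) 1 (by decide) rfl) (Bd.cv (Bd.mul H.Ws h.v2L) (0) 1 (by decide) rfl))) (1) 2 (by decide) rfl) (Bd.cv (Bd.mul H.Ws (Bd.add (Bd.cv (Bd.mul H.Vs h.w1L) (0) 1 (by decide) rfl) (Bd.cv (Bd.mul H.Ws h.w2L) (0) 1 (by decide) rfl))) (1) 2 (by decide) rfl)) (1) 2 (by decide) rfl) (Bd.cv (Bd.mul H.Vs H.Ws) (1) 2 (by decide) rfl))) (1) 2 (by decide) rfl)) (1) 2 (by decide) rfl) (Bd.cv (Bd.mul (Bd.mul h.R H.ΦL) (Bd.add (Bd.cv (Bd.mul H.Vs (Bd.add (Bd.cv (Bd.add (Bd.cv (Bd.add (Bd.cv h.vt (0) 1 (by decide) rfl) (Bd.cv (Bd.mul (Bd.add (Bd.cv h.y (0) 0 (by decide) rfl) (Bd.cv h.vL (0) 0 (by decide) rfl)) h.v1s) (0) 1 (by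 decide) rfl)) (0) 1 (by decide) rfl) (Bd.cv (Bd.mul h.wL h.v2s) (0) 1 (by decide) rfl)) (0) 1 (by decide) rfl) (Bd.cv h.ws (0) 1 (by decide) rfl))) (1) 2 (by decide) rfl) (Bd.cv (Bd.mul H.Ws (Bd.add (Bd.cv (Bd.add (Bd.cv h.wt (0) 1 (by decide) rfl) (Bd.cv (Bd.mul (Bd.add (Bd.cv h.y (0) 0 (by decide) rfl) (Bd.cv h.vL (0) 0 (by decide) rfl)) h.w1s) (0) 1 (by decide) rfl)) (0) 1 (by decide) rfl) (Bd.cv (Bd.mul h.wL h.w2s) (0) 1 (by decide) rfl))) (1) 2 (by decide) rfl))) (1) 2 (by decide) rfl)) (1) 2 (by decide) rfl) (Bd.cv (Bd.mul (Bd.mul (Bd.mul h.i h.τ) H.Φs) (Bd.add (Bd.cv (Bd.add (Bd.cv (Bd.mul h.φL (Bd.add (Bd.cv H.V1 (0) 1 (by decide) rfl) (Bd.cv H.W2 (0) 1 (by decide) rfl))) (1) 1 (by decide) rfl) (Bd.cv (Bd.mul H.Vs h.φ1L) (1) 1 (by decide) rfl)) (1) 1 (by decide) rfl) (Bd.cv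 (Bd.mul H.Ws h.φ2L) (1) 1 (by decide) rfl))) (1) 2 (by decide) rfl)) (1) 2 (by decide) rfl) (Bd.cv (Bd.mul h.i (Bd.sub (Bd.cv (Bd.mul (Bd.mul (Bd.mul (bd_n h.bc (by norm_num)) h.τ) (Bd.mul H.ΦL H.Φs)) (Bd.add (Bd.cv h.v1s (1) 1 (by decide) rfl) (Bd.cv h.w2s (1) 1 (by decide) rfl))) (3) 2 (by decide) rfl) (Bd.cv (Bd.mul (Bd.mul (Bd.mul (bd_n h.bc (by norm_num)) h.wL) h.τ2) (Bd.mul H.Φs H.Φs)) (3) 2 (by decide) rfl))) (1) 2 (by decide) rfl)) (1) 2 (by decide) rfl) (Bd.cv (Bd.mul (Bd.mul (Bd.mul h.i h.θL) H.Φs) (Bd.add (Bd.cv (Bd.mul h.R (Bd.add (Bd.cv H.V1 (0) 1 (by decide) rfl) (Bd.cv H.W2 (0) 1 (by decide) rfl))) (0) 1 (by decide) rfl) (Bd.cv (Bd.mul H.Ws h.R2) (0) 1 (by decide) rfl))) (1) 2 (by decide) rfl)) (1) 2 (by decide) rfl) (Bd.cv (Bd.mul (Bd.mul (Bd.mul (Bd.mul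 h.i (Bd.add (Bd.cv h.R (0) 0 (by decide) rfl) (Bd.cv h.φL (0) 0 (by decide) rfl))) H.Θs) H.Ws) h.R2) (1) 2 (by decide) rfl)) (1) 2 (by decide) rfl) (Bd.cv (Bd.mul (Bd.mul (Bd.mul (Bd.mul (Bd.mul (Bd.mul h.i h.R) h.R) (Bd.add (Bd.cv h.R (0) 0 (by decide) rfl) (Bd.cv h.φL (0) 0 (by decide) rfl))) h.θL) H.Θs) (Bd.add (Bd.cv H.V1 (0) 1 (by decide) rfl) (Bd.cv H.W2 (0) 1 (by decide) rfl))) (1) 2 (by decide) rfl)) (1) 2 (by decide) rfl) (Bd.cv (Bd.mul (Bd.mul (Bd.mul (Bd.mul (Bd.mul (Bd.mul h.i h.gB) (Bd.add (Bd.cv h.R (0) 0 (by decide) rfl) (Bd.cv h.φL (0) 0 (by decide) rfl))) h.R) h.R2) h.wL) (Bd.mul H.Θs H.Θs)) (1) 2 (by decide) rfl)) (1) 2 (by decide) rfl) (Bd.cv (Bd.mul (Bd.mul (Bd.mul (Bd.mul h.i h.R) h.R) H.Θs) (Bd.add (Bd.cv (Bd.add (Bd.cv (Bd.mul (Bd.mul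 h.gB (Bd.add (Bd.cv h.R (0) 0 (by decide) rfl) (Bd.cv h.φL (0) 0 (by decide) rfl))) (Bd.add (Bd.cv (Bd.add (Bd.cv (Bd.mul H.Vs h.θ1L) (1) 1 (by decide) rfl) (Bd.cv (Bd.mul H.Ws h.θ2L) (1) 1 (by decide) rfl)) (1) 1 (by decide) rfl) (Bd.cv (Bd.mul H.Ws h.τ2) (1) 1 (by decide) rfl))) (1) 1 (by decide) rfl) (Bd.cv (Bd.mul (Bd.mul h.gB H.ΦL) (Bd.add (Bd.cv (Bd.add (Bd.cv (Bd.add (Bd.cv h.θt (1) 1 (by decide) rfl) (Bd.cv (Bd.mul (Bd.add (Bd.cv h.y (0) 0 (by decide) rfl) (Bd.cv h.vL (0) 0 (by decide) rfl)) h.θ1s) (1) 1 (by decide) rfl)) (1) 1 (by decide) rfl) (Bd.cv (Bd.mul h.wL h.θ2s) (1) 1 (by decide) rfl)) (1) 1 (by decide) rfl) (Bd.cv (Bd.mul h.ws h.τ2) (1) 1 (by decide) rfl))) (1) 1 (by decide) rfl)) (1) 1 (by decide) rfl) (Bd.cv (Bd.mul (Bd.add (Bd.cv (Bd.mul H.Φs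 (Bd.add (Bd.cv h.τ (0) 0 (by decide) rfl) (Bd.cv h.θL (0) 0 (by decide) rfl))) (2) 1 (by decide) rfl) (Bd.cv (Bd.mul (Bd.add (Bd.cv h.R (0) 0 (by decide) rfl) (Bd.cv h.φL (0) 0 (by decide) rfl)) H.Θs) (2) 1 (by decide) rfl)) (Bd.add (Bd.cv h.v1L (-1) 0 (by decide) rfl) (Bd.cv h.w2L (-1) 0 (by decide) rfl))) (1) 1 (by decide) rfl))) (1) 2 (by decide) rfl)) (1) 2 (by decide) rfl) (Bd.cv (Bd.mul (Bd.mul (Bd.mul (Bd.mul (Bd.mul (Bd.mul (bd_n h.bc (by norm_num)) h.κB) h.i) h.R) h.R2) H.Θs) H.Θ2) (1) 2 (by decide) rfl)) (1) 2 (by decide) rfl) (Bd.cv (Bd.mul (Bd.mul (Bd.mul h.R h.R) H.Θs) (Bd.add (Bd.cv (Bd.add (Bd.cv (Bd.add (Bd.cv (Bd.mul (bd_n h.bc (by norm_num)) (Bd.mul (bd_n h.bc (by norm_num)) (Bd.mul h.aB (Bd.add (Bd.cv (Bd.mul h.v1L H.V1) (-1) 1 (by decide) rfl) (Bd.cv (Bd.mul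 h.w2L H.W2) (-1) 1 (by decide) rfl))))) (-1) 1 (by decide) rfl) (Bd.cv (Bd.mul (bd_n h.bc (by norm_num)) (Bd.mul h.aB (Bd.mul (Bd.add (Bd.cv h.w1L (-1) 0 (by decide) rfl) (Bd.cv h.v2L (-1) 0 (by decide) rfl)) (Bd.add (Bd.cv H.W1 (0) 1 (by decide) rfl) (Bd.cv H.V2 (0) 1 (by decide) rfl))))) (-1) 1 (by decide) rfl)) (-1) 1 (by decide) rfl) (Bd.cv (Bd.mul (bd_n h.bc (by norm_num)) (Bd.mul h.aB (Bd.add (Bd.cv H.W1 (0) 1 (by decide) rfl) (Bd.cv H.V2 (0) 1 (by decide) rfl)))) (-1) 1 (by decide) rfl)) (-1) 1 (by decide) rfl) (Bd.cv (Bd.mul (bd_n h.bc (by norm_num)) (Bd.mul h.ba (Bd.mul (Bd.add (Bd.cv h.v1L (-1) 0 (by decide) rfl) (Bd.cv h.w2L (-1) 0 (by decide) rfl)) (Bd.add (Bd.cv H.V1 (0) 1 (by decide) rfl) (Bd.cv H.W2 (0) 1 (by decide) rfl))))) (-1) 1 (by decide) rfl))) (1) 2 (by decide) rfl)) (1) 2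 (by decide) rfl) (Bd.cv (Bd.mul (Bd.mul h.aB h.R2) (Bd.add (Bd.cv (Bd.mul H.Vs H.V2) (1) 2 (by decide) rfl) (Bd.cv (Bd.mul H.Ws H.W2) (1) 2 (by decide) rfl))) (1) 2 (by decide) rfl)) (1) 2 (by decide) rfl) (Bd.cv (Bd.mul (Bd.mul (Bd.mul h.bB h.R2) H.Ws) (Bd.add (Bd.cv H.V1 (0) 1 (by decide) rfl) (Bd.cv H.W2 (0) 1 (by decide) rfl))) (1) 2 (by decide) rfl)) (1) 2 (by decide) rfl)⟩
def LF.e (L : LF) (F : FD) (g : ℝ) : Sm := (cst (1 / 2)) * (((F.ρ) * (F.R)) * ((L.V) * (L.V) + ((L.W) * (L.W)))) + (((cst (1 / 2)) * (cst F.i)) * ((F.τ) * ((L.Φ) * (L.Φ)))) + ((((cst (1 / 2)) * (cst F.i)) * (cst g)) * (((F.ρ) * ((F.R) * (F.R))) * ((L.Θ) * (L.Θ))))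

def LF.f1 (L : LF) (F : FD) (a b κ g : ℝ) : Sm := -((F.U) * (L.e F g)) - ((cst F.i) * (((F.R) * (L.V)) * ((F.Tm) * (L.Φ) + ((F.ρ) * (L.Θ))))) + ((cst a) * ((F.R) * ((L.V) * (D1 L.V) + ((L.W) * (D1 L.W))))) + ((cst b) * (((F.R) * (L.V)) * (D1 L.V + (D2 L.W)))) + (((cst κ) * (cst F.i)) * (((F.R) * (F.R)) * ((L.Θ) * (D1 L.Θ))))
def LF.f2 (L : LF) (F : FD) (a b κ g : ℝ) : Sm := -(F.w * (L.e F g)) - ((L.W) * ((cst F.i) * ((F.R) * ((F.Tm) * (L.Φ) + ((F.ρ) * (L.Θ)))))) + ((L.V) * ((cst a) * ((F.R) * (D2 L.V))) + ((L.W) * ((cst a) * ((F.R) * (D2 L.W))))) + ((L.W) * ((cst b) * ((F.R) * (D1 L.V + (D2 L.W))))) + ((L.Θ) * (((cst κ) * (cst F.i)) * (((F.R) * (F.R)) * (D2 L.Θ))))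
def LF.dψ (L : LF) : Sm := (D1 L.V) ^ 2 + (D2 L.V) ^ 2 + (D1 L.W) ^ 2 + (D2 L.W) ^ 2
def LF.dθ (L : LF) : Sm := (D1 L.Θ) ^ 2 + (D2 L.Θ) ^ 2

theorem ED_diss {a b κ g K M : ℝ} {B : Bg} {φ v w θ : Q} (h : JB a b κ g K M B φ v w θ) (V1 V2 W1 W2 Θ1 Θ2 : ℝ) :
    a / 2 * (V1 ^ 2 + V2 ^ 2 + W1 ^ 2 + W2 ^ 2) ≤ a * B.R * (V1 ^ 2 + V2 ^ 2 + W1 ^ 2 + W2 ^ 2) ∧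
    0 ≤ b * B.R * (V1 + W2) ^ 2 ∧
    κ / 4 * (B.i * (Θ1 ^ 2 + Θ2 ^ 2)) ≤ κ * B.i * B.R ^ 2 * (Θ1 ^ 2 + Θ2 ^ 2) := by
  have hi := h.i0
  have hR := h.Rl
  have d1 : a / 2 * (V1 ^ 2 + V2 ^ 2 + W1 ^ 2 + W2 ^ 2)
      ≤ a * B.R * (V1 ^ 2 + V2 ^ 2 + W1 ^ 2 + W2 ^ 2) := by
    have := h.cs.a0
    have : a / 2 ≤ a * B.R := by nlinarith
    gcongr
  have d2 : 0 ≤ b * B.R * (V1 + W2) ^ 2 := by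
    have := h.cs.b0
    have : 0 ≤ B.R := by linarith
    positivity
  have d3 : κ / 4 * (B.i * (Θ1 ^ 2 + Θ2 ^ 2)) ≤ κ * B.i * B.R ^ 2 * (Θ1 ^ 2 + Θ2 ^ 2) := by
    have := h.cs.κ0
    have h5 : 1 / 4 ≤ B.R ^ 2 := by nlinarith
    calc κ / 4 * (B.i * (Θ1 ^ 2 + Θ2 ^ 2)) = κ * B.i * (1 / 4) * (Θ1 ^ 2 + Θ2 ^ 2) := by ring
      _ ≤ _ := by gcongr
  exact ⟨d1, d2, d3⟩

set_option maxHeartbeats 1000000 in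
theorem ED_int (k : ℕ) : ∃ k' : ℕ, ∀ {a b κ g K M : ℝ} {F : FD} (hF : Flow a b κ g K M F) {t : ℝ}
    (ht : t ∈ Set.Icc 0 F.T) {L : LF} (pΦ : Per L.Φ) (pV : Per L.V) (pW : Per L.W) (pΘ : Per L.Θ)
    (wV : W0 t L.V) (wW : W0 t L.W) (wΘ : W0 t L.Θ)
    (hL : ∀ x ∈ Ω, LB k a b κ g K M (F.bg (t, x)) (jq F.φ (t, x)) (jq F.v (t, x)) (jq F.w (t, x))
      (jq F.θ (t, x)) (jq L.Φ (t, x)) (jq L.V (t, x)) (jq L.W (t, x)) (jq L.Θ (t, x))),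
    I (Dt (L.e F g) + (cst (a / 2) * L.dψ + cst (κ / 4) * (cst F.i * L.dθ))) t
    ≤ I (cst (M ^ k') * cst F.ε * F.s) t := by
  obtain ⟨k', hk⟩ := ED_err k
  refine ⟨k', fun {a b κ g K M F} hF {t} ht {L} pΦ pV pW pΘ wV wW wΘ hL => ?_⟩
  have hw := hF.ww t ht
  refine I_le_of_local (f := L.f1 F a b κ g) (g := L.f2 F a b κ g) ?_ ?_ ?_
  · unfold LF.f1 LF.e FD.U FD.ρ FD.Tm
    repeat' first
      | exact pΦ | exact pV | exact pW | exact pΘ | exact hF.pv | exact hF.pw | exact hF.pθ | exact hF.pφ | exact hF.pR | exact hF.pτ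
      | exact Per.cst _ | exact Per_Yc | apply Per.sub | apply Per.neg | apply Per.add
      | apply Per.mul | apply Per.D1 | apply Per.D2 | apply Per.Dt
  · unfold LF.f2
    repeat' first
      | exact hw | exact wV | exact wW | exact wΘ | apply W0.sub | apply W0.neg | apply W0.add
      | apply W0.mulr
  · intro x hx
    have H := hL x hx
    have h := H.jb
    have hE := hk H
    have hR2 := h.R2e
    have lM := H.lM
    have l1 := H.l1
    have l2 := H.l2
    have lT := H.lT
    clear hL
    simp only [LF.e, LF.f1, LF.f2, LF.dψ, LF.dθ, FD.U, FD.ρ, FD.Tm, FD.d, Dt_add, Dt_sub, Dt_neg, Dt_mul, Dt_cst, D1_add, D1_sub, D1_neg, D1_mul, D1_cst, D2_add, D2_sub, D2_neg, D2_mul, D2_cst, D2_D1, Dt_D1, Dt_D2, D1_Yc, D2_Yc, Dt_Yc, ev_add, ev_sub, ev_neg, ev_mul, ev_pow, ev_cst, ev_zero, ev_one, hF.R1, hF.Rt, hF.τ1, hF.τt]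
    simp only [mul_zero, zero_mul, add_zero, zero_add, sub_zero]
    simp only [FD.jφ, FD.jφ1, FD.jφ2, FD.jφt, FD.jφ11, FD.jφ12, FD.jφ22, FD.jφ1t, FD.jφ2t, FD.jv, FD.jv1, FD.jv2, FD.jvt, FD.jv11, FD.jv12, FD.jv22, FD.jv1t, FD.jv2t, FD.jw, FD.jw1, FD.jw2, FD.jwt, FD.jw11, FD.jw12, FD.jw22, FD.jw1t, FD.jw2t, FD.jθ, FD.jθ1, FD.jθ2, FD.jθt, FD.jθ11, FD.jθ12, FD.jθ22, FD.jθ1t, FD.jθ2t, FD.jbR, FD.jbτ, FD.jbR2, FD.jbτ2, FD.jbR22, FD.jby F (t, x), LF.jΦ, LF.jΦ1, LF.jΦ2, LF.jΦt, LF.jΦ11, LF.jΦ12, LF.jΦ22, LF.jΦ1t, LF.jΦ2t, LF.jV, LF.jV1, LF.jV2, LF.jVt, LF.jV11, LF.jV12, LF.jV22, LF.jV1t, LF.jV2t, LF.jW, LF.jW1, LF.jW2, LF.jWt, LF.jW11, LF.jW12, LF.jW22, LF.jW1t, LF.jW2t, LF.jΘ, LF.jΘ1, LF.jΘ2, LF.jΘt,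 LF.jΘ11, LF.jΘ12, LF.jΘ22, LF.jΘ1t, LF.jΘ2t, FD.jbs, FD.jbi F (t, x), FD.jbe F (t, x)]
    generalize jq F.φ (t, x) = φ at *
    generalize jq F.v (t, x) = v at *
    generalize jq F.w (t, x) = w at *
    generalize jq F.θ (t, x) = θ at *
    generalize jq L.Φ (t, x) = Φ at *
    generalize jq L.V (t, x) = V at *
    generalize jq L.W (t, x) = W at *
    generalize jq L.Θ (t, x) = Θ at *
    generalize F.bg (t, x) = B at *
    obtain ⟨d1, d2, d3⟩ := ED_diss h V.f1 V.f2 W.f1 W.f2 Θ.f1 Θ.f2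
    linear_combination d1 + d2 + d3 + hE + ((B.R * V.f)) * l1 + ((B.R * W.f)) * l2 + ((((B.i * B.R) * B.R) * Θ.f)) * lT + (((B.i * B.τ) * Φ.f)) * lM + (((((1 / 2) * B.R) * ((V.f * V.f) + (W.f * W.f))) + ((((((1 / 2) * B.i) * g) * B.R) * B.R) * (Θ.f * Θ.f)))) * h.eM + (0) * hR2 + ((-1)*B.R*V.f1*B.i*Θ.f*φ.f + (-1)*B.R*W.f2*B.i*Θ.f*φ.f + (-1)*B.R^2*V.f1*B.i*Θ.f + (-1)*B.R^2*W.f2*B.i*Θ.f) * h.Rτ + (2*B.R^2*V.f1*a*v.f1*Θ.f + (-2)*B.R^2*V.f1*a*w.f2*Θ.f + 2*B.R^2*V.f1*b*v.f1*Θ.f + 2*B.R^2*V.f1*b*w.f2*Θ.f + 2*B.R^2*V.f2*a*v.f2*Θ.f + 2*B.R^2*V.f2*a*w.f1*Θ.f + 2*B.R^2*V.f2*a*Θ.f + 2*B.R^2*W.f1*a*v.f2*Θ.f + 2*B.R^2*W.f1*a*w.f1*Θ.f + 2*B.R^2*W.f1*a*Θ.f + (-2)*B.R^2*W.f2*a*v.f1*Θ.f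 + 2*B.R^2*W.f2*a*w.f2*Θ.f + 2*B.R^2*W.f2*b*v.f1*Θ.f + 2*B.R^2*W.f2*b*w.f2*Θ.f) * h.iε


theorem Flow.R12 {a b κ g K M : ℝ} {F : FD} (h : Flow a b κ g K M F) : D1 (D2 F.R) = 0 := by
  rw [← D2_D1, h.R1]; exact Dd_zero _
theorem Flow.τ12 {a b κ g K M : ℝ} {F : FD} (h : Flow a b κ g K M F) : D1 (D2 F.τ) = 0 := by
  rw [← D2_D1, h.τ1]; exact Dd_zero _
theorem Flow.R2t {a b κ g K M : ℝ} {F : FD} (h : Flow a b κ g K M F) : D2 (Dt F.R) = 0 := by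
  rw [h.Rt]; exact Dd_zero _
theorem Flow.τ2t {a b κ g K M : ℝ} {F : FD} (h : Flow a b κ g K M F) : D2 (Dt F.τ) = 0 := by
  rw [h.τt]; exact Dd_zero _
theorem D1_zero : D1 0 = 0 := Dd_zero _
theorem D2_zero : D2 0 = 0 := Dd_zero _
theorem Dt_zero : Dt 0 = 0 := Dd_zero _

def FD.L1 (F : FD) : LF := ⟨D1 F.φ, D1 F.v, D1 F.w, D1 F.θ⟩
def FD.Lt (F : FD) : LF := ⟨cst F.ε * Dt F.φ, cst F.ε * Dt F.v, cst F.ε * Dt F.w, cst F.ε * Dt F.θ⟩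

set_option maxHeartbeats 1000000 in
theorem Flow.lb1 {a b κ g K M : ℝ} {F : FD} (hF : Flow a b κ g K M F) (hT : 0 < F.T) {t : ℝ}
    (ht : t ∈ Set.Icc 0 F.T) {x : ℝ × ℝ} (hx : x ∈ Ω) :
    LB 1 a b κ g K M (F.bg (t, x)) (jq F.φ (t, x)) (jq F.v (t, x)) (jq F.w (t, x))
      (jq F.θ (t, x)) (jq F.L1.Φ (t, x)) (jq F.L1.V (t, x)) (jq F.L1.W (t, x)) (jq F.L1.Θ (t, x)) := by
  have h := hF.jb ht hx
  have qM := Dd_vanish hT hF.gM (0, (1, 0)) t ht x hx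
  change (D1 F.GM).1 (t, x) = 0 at qM
  simp only [FD.GM, FD.G1, FD.G2, FD.GT, FD.Qd, FD.P, FD.F1, FD.F2, FD.F3, FD.d, FD.U, FD.ρ, FD.Tm, Dt_add, Dt_sub, Dt_neg, Dt_mul, Dt_cst, D1_add, D1_sub, D1_neg, D1_mul, D1_cst, D2_add, D2_sub, D2_neg, D2_mul, D2_cst, D2_D1, Dt_D1, Dt_D2, D1_Yc, D2_Yc, Dt_Yc, ev_add, ev_sub, ev_neg, ev_mul, ev_pow, ev_cst, ev_zero, ev_one, D1_zero, D2_zero, Dt_zero, hF.R1, hF.Rt, hF.τ1, hF.τt, hF.R12, hF.τ12, hF.R2t, hF.τ2t] at qM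
  have q1 := Dd_vanish hT hF.g1 (0, (1, 0)) t ht x hx
  change (D1 (F.G1 a b)).1 (t, x) = 0 at q1
  simp only [FD.GM, FD.G1, FD.G2, FD.GT, FD.Qd, FD.P, FD.F1, FD.F2, FD.F3, FD.d, FD.U, FD.ρ, FD.Tm, Dt_add, Dt_sub, Dt_neg, Dt_mul, Dt_cst, D1_add, D1_sub, D1_neg, D1_mul, D1_cst, D2_add, D2_sub, D2_neg, D2_mul, D2_cst, D2_D1, Dt_D1, Dt_D2, D1_Yc, D2_Yc, Dt_Yc, ev_add, ev_sub, ev_neg, ev_mul, ev_pow, ev_cst, ev_zero, ev_one, D1_zero, D2_zero, Dt_zero, hF.R1, hF.Rt, hF.τ1, hF.τt, hF.R12, hF.τ12, hF.R2t, hF.τ2t] at q1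
  have q2 := Dd_vanish hT hF.g2 (0, (1, 0)) t ht x hx
  change (D1 (F.G2 a b)).1 (t, x) = 0 at q2
  simp only [FD.GM, FD.G1, FD.G2, FD.GT, FD.Qd, FD.P, FD.F1, FD.F2, FD.F3, FD.d, FD.U, FD.ρ, FD.Tm, Dt_add, Dt_sub, Dt_neg, Dt_mul, Dt_cst, D1_add, D1_sub, D1_neg, D1_mul, D1_cst, D2_add, D2_sub, D2_neg, D2_mul, D2_cst, D2_D1, Dt_D1, Dt_D2, D1_Yc, D2_Yc, Dt_Yc, ev_add, ev_sub, ev_neg, ev_mul, ev_pow, ev_cst, ev_zero, ev_one, D1_zero, D2_zero, Dt_zero, hF.R1, hF.Rt, hF.τ1, hF.τt, hF.R12, hF.τ12, hF.R2t, hF.τ2t] at q2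
  have qT := Dd_vanish hT hF.gT (0, (1, 0)) t ht x hx
  change (D1 (F.GT a b κ g)).1 (t, x) = 0 at qT
  simp only [FD.GM, FD.G1, FD.G2, FD.GT, FD.Qd, FD.P, FD.F1, FD.F2, FD.F3, FD.d, FD.U, FD.ρ, FD.Tm, Dt_add, Dt_sub, Dt_neg, Dt_mul, Dt_cst, D1_add, D1_sub, D1_neg, D1_mul, D1_cst, D2_add, D2_sub, D2_neg, D2_mul, D2_cst, D2_D1, Dt_D1, Dt_D2, D1_Yc, D2_Yc, Dt_Yc, ev_add, ev_sub, ev_neg, ev_mul, ev_pow, ev_cst, ev_zero, ev_one, D1_zero, D2_zero, Dt_zero, hF.R1, hF.Rt, hF.τ1, hF.τt, hF.R12, hF.τ12, hF.R2t, hF.τ2t] at qT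
  exact {
    jb := h
    ΦL := h.φ1L
    Φs := h.φ1s.kk (by norm_num)
    Vs := h.v1s
    Ws := h.w1s
    Θs := h.θ1s
    V1 := h.v11
    V2 := by simpa only [FD.L1, jq, D2_D1] using h.v12
    W1 := h.w11
    W2 := by simpa only [FD.L1, jq, D2_D1] using h.w12
    Θ1 := h.θ11
    Θ2 := by simpa only [FD.L1, jq, D2_D1] using h.θ12
    lM := by
      simp only [FD.L1, jq, FD.bg, Dt_add, Dt_sub, Dt_neg, Dt_mul, Dt_cst, D1_add, D1_sub, D1_neg, D1_mul, D1_cst, D2_add, D2_sub, D2_neg, D2_mul, D2_cst, D2_D1, Dt_D1, Dt_D2, D1_Yc, D2_Yc, Dt_Yc, ev_add, ev_sub, ev_neg, ev_mul, ev_pow, ev_cst, ev_zero, ev_one, D1_zero, D2_zero, Dt_zero]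
      linear_combination qM
    l1 := by
      simp only [FD.L1, jq, FD.bg, Dt_add, Dt_sub, Dt_neg, Dt_mul, Dt_cst, D1_add, D1_sub, D1_neg, D1_mul, D1_cst, D2_add, D2_sub, D2_neg, D2_mul, D2_cst, D2_D1, Dt_D1, Dt_D2, D1_Yc, D2_Yc, Dt_Yc, ev_add, ev_sub, ev_neg, ev_mul, ev_pow, ev_cst, ev_zero, ev_one, D1_zero, D2_zero, Dt_zero]
      linear_combination q1
    l2 := by
      simp only [FD.L1, jq, FD.bg, Dt_add, Dt_sub, Dt_neg, Dt_mul, Dt_cst, D1_add, D1_sub, D1_neg, D1_mul, D1_cst, D2_add, D2_sub, D2_neg, D2_mul, D2_cst, D2_D1, Dt_D1, Dt_D2, D1_Yc, D2_Yc, Dt_Yc, ev_add, ev_sub, ev_neg, ev_mul, ev_pow, ev_cst, ev_zero, ev_one, D1_zero, D2_zero, Dt_zero]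
      linear_combination q2
    lT := by
      simp only [FD.L1, jq, FD.bg, Dt_add, Dt_sub, Dt_neg, Dt_mul, Dt_cst, D1_add, D1_sub, D1_neg, D1_mul, D1_cst, D2_add, D2_sub, D2_neg, D2_mul, D2_cst, D2_D1, Dt_D1, Dt_D2, D1_Yc, D2_Yc, Dt_Yc, ev_add, ev_sub, ev_neg, ev_mul, ev_pow, ev_cst, ev_zero, ev_one, D1_zero, D2_zero, Dt_zero]
      linear_combination qT
  }

set_option maxHeartbeats 1000000 in
theorem Flow.lbt : ∃ k : ℕ, ∀ {a b κ g K M : ℝ} {F : FD} (hF : Flow a b κ g K M F) (hT : 0 < F.T) {t : ℝ}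
    (ht : t ∈ Set.Icc 0 F.T) {x : ℝ × ℝ} (hx : x ∈ Ω),
    LB k a b κ g K M (F.bg (t, x)) (jq F.φ (t, x)) (jq F.v (t, x)) (jq F.w (t, x))
      (jq F.θ (t, x)) (jq F.Lt.Φ (t, x)) (jq F.Lt.V (t, x)) (jq F.Lt.W (t, x)) (jq F.Lt.Θ (t, x)) := by
  obtain ⟨k₁, h₁⟩ := JB.φtL0
  obtain ⟨k₂, h₂⟩ := JB.φts0
  refine ⟨0 + k₁ + k₂, fun {a b κ g K M F} hF hT {t} ht {x} hx => ?_⟩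
  have h := hF.jb ht hx
  have hΦL := h.e.mul (h₁ h)
  have hΦs := h.e.mul (h₂ h)
  have qM := Dd_vanish hT hF.gM (1, (0, 0)) t ht x hx
  change (Dt F.GM).1 (t, x) = 0 at qM
  simp only [FD.GM, FD.G1, FD.G2, FD.GT, FD.Qd, FD.P, FD.F1, FD.F2, FD.F3, FD.d, FD.U, FD.ρ, FD.Tm, Dt_add, Dt_sub, Dt_neg, Dt_mul, Dt_cst, D1_add, D1_sub, D1_neg, D1_mul, D1_cst, D2_add, D2_sub, D2_neg, D2_mul, D2_cst, D2_D1, Dt_D1, Dt_D2, D1_Yc, D2_Yc, Dt_Yc, ev_add, ev_sub, ev_neg, ev_mul, ev_pow, ev_cst, ev_zero, ev_one, D1_zero, D2_zero, Dt_zero, hF.R1, hF.Rt, hF.τ1, hF.τt, hF.R12, hF.τ12, hF.R2t, hF.τ2t] at qM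
  have q1 := Dd_vanish hT hF.g1 (1, (0, 0)) t ht x hx
  change (Dt (F.G1 a b)).1 (t, x) = 0 at q1
  simp only [FD.GM, FD.G1, FD.G2, FD.GT, FD.Qd, FD.P, FD.F1, FD.F2, FD.F3, FD.d, FD.U, FD.ρ, FD.Tm, Dt_add, Dt_sub, Dt_neg, Dt_mul, Dt_cst, D1_add, D1_sub, D1_neg, D1_mul, D1_cst, D2_add, D2_sub, D2_neg, D2_mul, D2_cst, D2_D1, Dt_D1, Dt_D2, D1_Yc, D2_Yc, Dt_Yc, ev_add, ev_sub, ev_neg, ev_mul, ev_pow, ev_cst, ev_zero, ev_one, D1_zero, D2_zero, Dt_zero, hF.R1, hF.Rt, hF.τ1, hF.τt, hF.R12, hF.τ12, hF.R2t, hF.τ2t] at q1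
  have q2 := Dd_vanish hT hF.g2 (1, (0, 0)) t ht x hx
  change (Dt (F.G2 a b)).1 (t, x) = 0 at q2
  simp only [FD.GM, FD.G1, FD.G2, FD.GT, FD.Qd, FD.P, FD.F1, FD.F2, FD.F3, FD.d, FD.U, FD.ρ, FD.Tm, Dt_add, Dt_sub, Dt_neg, Dt_mul, Dt_cst, D1_add, D1_sub, D1_neg, D1_mul, D1_cst, D2_add, D2_sub, D2_neg, D2_mul, D2_cst, D2_D1, Dt_D1, Dt_D2, D1_Yc, D2_Yc, Dt_Yc, ev_add, ev_sub, ev_neg, ev_mul, ev_pow, ev_cst, ev_zero, ev_one, D1_zero, D2_zero, Dt_zero, hF.R1, hF.Rt, hF.τ1, hF.τt, hF.R12, hF.τ12, hF.R2t, hF.τ2t] at q2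
  have qT := Dd_vanish hT hF.gT (1, (0, 0)) t ht x hx
  change (Dt (F.GT a b κ g)).1 (t, x) = 0 at qT
  simp only [FD.GM, FD.G1, FD.G2, FD.GT, FD.Qd, FD.P, FD.F1, FD.F2, FD.F3, FD.d, FD.U, FD.ρ, FD.Tm, Dt_add, Dt_sub, Dt_neg, Dt_mul, Dt_cst, D1_add, D1_sub, D1_neg, D1_mul, D1_cst, D2_add, D2_sub, D2_neg, D2_mul, D2_cst, D2_D1, Dt_D1, Dt_D2, D1_Yc, D2_Yc, Dt_Yc, ev_add, ev_sub, ev_neg, ev_mul, ev_pow, ev_cst, ev_zero, ev_one, D1_zero, D2_zero, Dt_zero, hF.R1, hF.Rt, hF.τ1, hF.τt, hF.R12, hF.τ12, hF.R2t, hF.τ2t] at qT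
  exact {
    jb := h
    ΦL := (Bd.cv hΦL 0 0 (by decide) rfl).kk (by omega)
    Φs := (Bd.cv hΦs 2 1 (by decide) rfl).kk (by omega)
    Vs := Bd.cv (h.e.mul h.vt) 1 1 (by decide) rfl
    Ws := Bd.cv (h.e.mul h.wt) 1 1 (by decide) rfl
    Θs := Bd.cv (h.e.mul h.θt) 2 1 (by decide) rfl
    V1 := by simp only [FD.Lt, jq, Dt_add, Dt_sub, Dt_neg, Dt_mul, Dt_cst, D1_add, D1_sub, D1_neg, D1_mul, D1_cst, D2_add, D2_sub, D2_neg, D2_mul, D2_cst, D2_D1, Dt_D1, Dt_D2, D1_Yc, D2_Yc, Dt_Yc, ev_add, ev_sub, ev_neg, ev_mul, ev_pow, ev_cst, ev_zero, ev_one, D1_zero, D2_zero, Dt_zero, mul_zero, add_zero]; exact Bd.cv (h.e.mul h.v1t) 0 1 (by decide) rfl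
    V2 := by simp only [FD.Lt, jq, Dt_add, Dt_sub, Dt_neg, Dt_mul, Dt_cst, D1_add, D1_sub, D1_neg, D1_mul, D1_cst, D2_add, D2_sub, D2_neg, D2_mul, D2_cst, D2_D1, Dt_D1, Dt_D2, D1_Yc, D2_Yc, Dt_Yc, ev_add, ev_sub, ev_neg, ev_mul, ev_pow, ev_cst, ev_zero, ev_one, D1_zero, D2_zero, Dt_zero, mul_zero, add_zero]; exact Bd.cv (h.e.mul h.v2t) 0 1 (by decide) rfl
    W1 := by simp only [FD.Lt, jq, Dt_add, Dt_sub, Dt_neg, Dt_mul, Dt_cst, D1_add, D1_sub, D1_neg, D1_mul, D1_cst, D2_add, D2_sub, D2_neg, D2_mul, D2_cst, D2_D1, Dt_D1, Dt_D2, D1_Yc, D2_Yc, Dt_Yc, ev_add, ev_sub, ev_neg, ev_mul, ev_pow, ev_cst, ev_zero, ev_one, D1_zero, D2_zero, Dt_zero, mul_zero, add_zero]; exact Bd.cv (h.e.mul h.w1t) 0 1 (by decide) rfl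
    W2 := by simp only [FD.Lt, jq, Dt_add, Dt_sub, Dt_neg, Dt_mul, Dt_cst, D1_add, D1_sub, D1_neg, D1_mul, D1_cst, D2_add, D2_sub, D2_neg, D2_mul, D2_cst, D2_D1, Dt_D1, Dt_D2, D1_Yc, D2_Yc, Dt_Yc, ev_add, ev_sub, ev_neg, ev_mul, ev_pow, ev_cst, ev_zero, ev_one, D1_zero, D2_zero, Dt_zero, mul_zero, add_zero]; exact Bd.cv (h.e.mul h.w2t) 0 1 (by decide) rfl
    Θ1 := by simp only [FD.Lt, jq, Dt_add, Dt_sub, Dt_neg, Dt_mul, Dt_cst, D1_add, D1_sub, D1_neg, D1_mul, D1_cst, D2_add, D2_sub, D2_neg, D2_mul, D2_cst, D2_D1, Dt_D1, Dt_D2, D1_Yc, D2_Yc, Dt_Yc, ev_add, ev_sub, ev_neg, ev_mul, ev_pow, ev_cst, ev_zero, ev_one, D1_zero, D2_zero, Dt_zero, mul_zero, add_zero]; exact Bd.cv (h.e.mul h.θ1t) 1 1 (by decide) rfl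
    Θ2 := by simp only [FD.Lt, jq, Dt_add, Dt_sub, Dt_neg, Dt_mul, Dt_cst, D1_add, D1_sub, D1_neg, D1_mul, D1_cst, D2_add, D2_sub, D2_neg, D2_mul, D2_cst, D2_D1, Dt_D1, Dt_D2, D1_Yc, D2_Yc, Dt_Yc, ev_add, ev_sub, ev_neg, ev_mul, ev_pow, ev_cst, ev_zero, ev_one, D1_zero, D2_zero, Dt_zero, mul_zero, add_zero]; exact Bd.cv (h.e.mul h.θ2t) 1 1 (by decide) rfl
    lM := by
      simp only [FD.Lt, jq, FD.bg, Dt_add, Dt_sub, Dt_neg, Dt_mul, Dt_cst, D1_add, D1_sub, D1_neg, D1_mul, D1_cst, D2_add, D2_sub, D2_neg, D2_mul, D2_cst, D2_D1, Dt_D1, Dt_D2, D1_Yc, D2_Yc, Dt_Yc, ev_add, ev_sub, ev_neg, ev_mul, ev_pow, ev_cst, ev_zero, ev_one, D1_zero, D2_zero, Dt_zero]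
      linear_combination F.ε * qM
    l1 := by
      simp only [FD.Lt, jq, FD.bg, Dt_add, Dt_sub, Dt_neg, Dt_mul, Dt_cst, D1_add, D1_sub, D1_neg, D1_mul, D1_cst, D2_add, D2_sub, D2_neg, D2_mul, D2_cst, D2_D1, Dt_D1, Dt_D2, D1_Yc, D2_Yc, Dt_Yc, ev_add, ev_sub, ev_neg, ev_mul, ev_pow, ev_cst, ev_zero, ev_one, D1_zero, D2_zero, Dt_zero]
      linear_combination F.ε * q1
    l2 := by
      simp only [FD.Lt, jq, FD.bg, Dt_add, Dt_sub, Dt_neg, Dt_mul, Dt_cst, D1_add, D1_sub, D1_neg, D1_mul, D1_cst, D2_add, D2_sub, D2_neg, D2_mul, D2_cst, D2_D1, Dt_D1, Dt_D2, D1_Yc, D2_Yc, Dt_Yc, ev_add, ev_sub, ev_neg, ev_mul, ev_pow, ev_cst, ev_zero, ev_one, D1_zero, D2_zero, Dt_zero]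
      linear_combination F.ε * q2
    lT := by
      simp only [FD.Lt, jq, FD.bg, Dt_add, Dt_sub, Dt_neg, Dt_mul, Dt_cst, D1_add, D1_sub, D1_neg, D1_mul, D1_cst, D2_add, D2_sub, D2_neg, D2_mul, D2_cst, D2_D1, Dt_D1, Dt_D2, D1_Yc, D2_Yc, Dt_Yc, ev_add, ev_sub, ev_neg, ev_mul, ev_pow, ev_cst, ev_zero, ev_one, D1_zero, D2_zero, Dt_zero]
      linear_combination F.ε * qT
  }

theorem Flow.ed1 : ∃ k : ℕ, ∀ {a b κ g K M : ℝ} {F : FD} (hF : Flow a b κ g K M F) (hT : 0 < F.T) {t : ℝ}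
    (ht : t ∈ Set.Icc 0 F.T),
    I (Dt (F.L1.e F g) + (cst (a / 2) * F.L1.dψ + cst (κ / 4) * (cst F.i * F.L1.dθ))) t
    ≤ I (cst (M ^ k) * cst F.ε * F.s) t := by
  obtain ⟨k, hk⟩ := ED_int 1
  exact ⟨k, fun hF hT t ht => hk hF ht hF.pφ.D1 hF.pv.D1 hF.pw.D1 hF.pθ.D1 (hF.wv t ht).D1
    (hF.ww t ht).D1 (hF.wθ t ht).D1 fun x hx => hF.lb1 hT ht hx⟩

theorem Flow.edt : ∃ k : ℕ, ∀ {a b κ g K M : ℝ} {F : FD} (hF : Flow a b κ g K M F) (hT : 0 < F.T) {t : ℝ}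
    (ht : t ∈ Set.Icc 0 F.T),
    I (Dt (F.Lt.e F g) + (cst (a / 2) * F.Lt.dψ + cst (κ / 4) * (cst F.i * F.Lt.dθ))) t
    ≤ I (cst (M ^ k) * cst F.ε * F.s) t := by
  obtain ⟨k₀, h₀⟩ := Flow.lbt
  obtain ⟨k, hk⟩ := ED_int k₀
  exact ⟨k, fun hF hT t ht => hk hF ht ((Per.cst _).mul hF.pφ.Dt) ((Per.cst _).mul hF.pv.Dt)
    ((Per.cst _).mul hF.pw.Dt) ((Per.cst _).mul hF.pθ.Dt) ((W0.Dt hT hF.wv t ht).mull _)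
    ((W0.Dt hT hF.ww t ht).mull _) ((W0.Dt hT hF.wθ t ht).mull _) fun x hx => h₀ hF hT ht hx⟩

theorem E1_err : ∃ k : ℕ, ∀ {a b κ g K M : ℝ} {B : Bg} {φ v w θ : Q} (h : JB a b κ g K M B φ v w θ),
    ((((((((-(B.R + φ.f)) * v.ft) * ((((B.y + v.f) * v.f1) + (w.f * v.f2)) + w.f)) - (((B.R + φ.f) * w.ft) * (((B.y + v.f) * w.f1) + (w.f * w.f2)))) - ((((B.i * θ.ft) * g) * (B.R + φ.f)) * ((((B.y + v.f) * θ.f1) + (w.f * θ.f2)) + (w.f * B.τ2)))) + (θ.ft * (((2 * (a * ((v.f1 * v.f1) + (w.f2 * w.f2)))) + (a * ((w.f1 + v.f2) * (w.f1 + v.f2)))) + ((b - a) * ((v.f1 + w.f2) * (v.f1 + w.f2)))))) + (2 * ((θ.ft * a) * (w.f1 + v.f2)))) + (((B.i * (v.f1 + w.f2)) * (B.τ + θ.f)) * ((((B.y + v.f) * φ.f1) + (w.f * φ.f2)) + (w.f * B.R2))))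
      ≤ M ^ k * B.ε * B.σ ^ 2 :=
  ⟨_, fun {_ _ _ _ _ _ _ _ _ _ _} h => Bd.fin (Bd.cv (Bd.add (Bd.cv (Bd.add (Bd.cv (Bd.add (Bd.cv (Bd.sub (Bd.cv (Bd.sub (Bd.cv (Bd.mul (Bd.mul (Bd.neg (Bd.add (Bd.cv h.R (0) 0 (by decide) rfl) (Bd.cv h.φL (0) 0 (by decide) rfl))) h.vt) (Bd.add (Bd.cv (Bd.add (Bd.cv (Bd.mul (Bd.add (Bd.cv h.y (0) 0 (by decide) rfl) (Bd.cv h.vL (0) 0 (by decide) rfl)) h.v1s) (1) 1 (by decide) rfl) (Bd.cv (Bd.mul h.wL h.v2s) (1) 1 (by decide) rfl)) (1) 1 (by decide) rfl) (Bd.cv h.ws (1) 1 (by decide) rfl))) (1) 2 (by decide) rfl) (Bd.cv (Bd.mul (Bd.mul (Bd.add (Bd.cv h.R (0) 0 (by decide) rfl) (Bd.cv h.φL (0) 0 (by decide) rfl)) h.wt) (Bd.add (Bd.cv (Bd.mul (Bd.add (Bd.cv h.y (0) 0 (by decide) rfl) (Bd.cv h.vL (0) 0 (by decide) rfl)) h.w1s)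 (1) 1 (by decide) rfl) (Bd.cv (Bd.mul h.wL h.w2s) (1) 1 (by decide) rfl))) (1) 2 (by decide) rfl)) (1) 2 (by decide) rfl) (Bd.cv (Bd.mul (Bd.mul (Bd.mul (Bd.mul h.i h.θt) h.gB) (Bd.add (Bd.cv h.R (0) 0 (by decide) rfl) (Bd.cv h.φL (0) 0 (by decide) rfl))) (Bd.add (Bd.cv (Bd.add (Bd.cv (Bd.mul (Bd.add (Bd.cv h.y (0) 0 (by decide) rfl) (Bd.cv h.vL (0) 0 (by decide) rfl)) h.θ1s) (2) 1 (by decide) rfl) (Bd.cv (Bd.mul h.wL h.θ2s) (2) 1 (by decide) rfl)) (2) 1 (by decide) rfl) (Bd.cv (Bd.mul h.ws h.τ2) (2) 1 (by decide) rfl))) (1) 2 (by decide) rfl)) (1) 2 (by decide) rfl) (Bd.cv (Bd.mul h.θt (Bd.add (Bd.cv (Bd.add (Bd.cv (Bd.mul (bd_n h.bc (by norm_num)) (Bd.mul h.aB (Bd.add (Bd.cv (Bd.mul h.v1L h.v1s) (0) 1 (by decide) rfl) (Bd.cv (Bd.mul h.w2L h.w2s) (0) 1 (by decide) rfl)))) (0)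 1 (by decide) rfl) (Bd.cv (Bd.mul h.aB (Bd.mul (Bd.add (Bd.cv h.w1L (-1) 0 (by decide) rfl) (Bd.cv h.v2L (-1) 0 (by decide) rfl)) (Bd.add (Bd.cv h.w1s (1) 1 (by decide) rfl) (Bd.cv h.v2s (1) 1 (by decide) rfl)))) (0) 1 (by decide) rfl)) (0) 1 (by decide) rfl) (Bd.cv (Bd.mul h.ba (Bd.mul (Bd.add (Bd.cv h.v1L (-1) 0 (by decide) rfl) (Bd.cv h.w2L (-1) 0 (by decide) rfl)) (Bd.add (Bd.cv h.v1s (1) 1 (by decide) rfl) (Bd.cv h.w2s (1) 1 (by decide) rfl)))) (0) 1 (by decide) rfl))) (1) 2 (by decide) rfl)) (1) 2 (by decide) rfl) (Bd.cv (Bd.mul (bd_n h.bc (by norm_num)) (Bd.mul (Bd.mul h.θt h.aB) (Bd.add (Bd.cv h.w1s (1) 1 (by decide) rfl) (Bd.cv h.v2s (1) 1 (by decide) rfl)))) (1) 2 (by decide) rfl)) (1) 2 (by decide) rfl) (Bd.cv (Bd.mul (Bd.mul (Bd.mul h.i (Bd.add (Bd.cv h.v1s (1) 1 (by decide) rfl)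 (Bd.cv h.w2s (1) 1 (by decide) rfl))) (Bd.add (Bd.cv h.τ (0) 0 (by decide) rfl) (Bd.cv h.θL (0) 0 (by decide) rfl))) (Bd.add (Bd.cv (Bd.add (Bd.cv (Bd.mul (Bd.add (Bd.cv h.y (0) 0 (by decide) rfl) (Bd.cv h.vL (0) 0 (by decide) rfl)) h.φ1s) (2) 1 (by decide) rfl) (Bd.cv (Bd.mul h.wL h.φ2s) (2) 1 (by decide) rfl)) (2) 1 (by decide) rfl) (Bd.cv (Bd.mul h.ws h.R2) (2) 1 (by decide) rfl))) (1) 2 (by decide) rfl)) (1) 2 (by decide) rfl)⟩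

theorem E1_star {a b κ g K M : ℝ} {B : Bg} {φ v w θ : Q} (h : JB a b κ g K M B φ v w θ) : ((((B.i * (B.τ + θ.f)) * (B.R + φ.f)) * ((v.f1 + w.f2) * (v.f1 + w.f2))) - ((((B.i * (B.R + φ.f)) * ((B.τ + θ.f) + 1)) * (v.f1 + w.f2)) * θ.ft)) - ((B.R + φ.f) * (v.ft ^ 2 + w.ft ^ 2) + B.i * g * (B.R + φ.f) * θ.ft ^ 2)
    ≤ (32 + 1600 * g⁻¹) * (B.i * (v.f1 ^ 2 + v.f2 ^ 2 + w.f1 ^ 2 + w.f2 ^ 2))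
      - (1 / 4 * (v.ft ^ 2 + w.ft ^ 2) + g / 8 * (B.i * θ.ft ^ 2)) := by
  have hi := h.i0
  have hg := h.cs.g0
  have ρl := h.ρl
  have ρu := h.ρu
  have Tl := h.Tl
  have Tu := h.Tu
  generalize B.R + φ.f = r at *
  generalize B.τ + θ.f = T at *
  have n4 : (v.f1 + w.f2) ^ 2 ≤ 2 * (v.f1 ^ 2 + v.f2 ^ 2 + w.f1 ^ 2 + w.f2 ^ 2) := by
    nlinarith [sq_nonneg (v.f1 - w.f2), sq_nonneg v.f2, sq_nonneg w.f1]
  generalize v.f1 + w.f2 = D at *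
  have hTr : T * r ≤ 16 := by nlinarith
  have hTr0 : 0 ≤ r * (T + 1) := by nlinarith
  have hTr1 : r * (T + 1) ≤ 20 := by nlinarith
  have a1 : B.i * T * r * (D * D) ≤ 16 * (B.i * D ^ 2) := by
    calc B.i * T * r * (D * D) = T * r * (B.i * D ^ 2) := by ring
      _ ≤ _ := by gcongr
  have a2 : -(B.i * r * (T + 1) * D * θ.ft) ≤ g / 8 * (B.i * θ.ft ^ 2) + 800 * g⁻¹ * (B.i * D ^ 2) := by
    have q1 : |r * (T + 1) * (D * θ.ft)| ≤ 20 * (|D| * |θ.ft|) := by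
      rw [abs_mul, abs_of_nonneg hTr0, abs_mul]; gcongr
    have q2 : 20 * (|D| * |θ.ft|) ≤ g / 8 * θ.ft ^ 2 + 800 * g⁻¹ * D ^ 2 := by
      rw [← sq_abs D, ← sq_abs θ.ft]
      have : g / 8 * |θ.ft| ^ 2 + 800 * g⁻¹ * |D| ^ 2 - 20 * (|D| * |θ.ft|)
          = 8 * g⁻¹ * ((g / 8 * |θ.ft| - 10 * |D|) ^ 2) := by
        field_simp; ring
      have : 0 ≤ 8 * g⁻¹ * ((g / 8 * |θ.ft| - 10 * |D|) ^ 2) := by positivity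
      linarith
    have q3 := mul_le_mul_of_nonneg_left (((neg_le_abs _).trans q1).trans q2) hi.le
    linarith
  have a3 : 1 / 4 * (v.ft ^ 2 + w.ft ^ 2) ≤ r * (v.ft ^ 2 + w.ft ^ 2) := by gcongr
  have a4 : g / 4 * (B.i * θ.ft ^ 2) ≤ B.i * g * r * θ.ft ^ 2 := by
    calc g / 4 * (B.i * θ.ft ^ 2) = B.i * g * (1 / 4) * θ.ft ^ 2 := by ring
      _ ≤ _ := by gcongr
  have a5 : (16 + 800 * g⁻¹) * (B.i * D ^ 2)
      ≤ (16 + 800 * g⁻¹) * (B.i * (2 * (v.f1 ^ 2 + v.f2 ^ 2 + w.f1 ^ 2 + w.f2 ^ 2))) := by gcongr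
  linarith

def FD.e1e (F : FD) (a b κ : ℝ) : Sm := ((cst (1 / 2)) * (cst a)) * ((D1 F.v) * (D1 F.v) + ((D2 F.v) * (D2 F.v)) + ((D1 F.w) * (D1 F.w)) + ((D2 F.w) * (D2 F.w))) + (((cst (1 / 2)) * (cst b)) * ((F.d) * (F.d))) + ((((cst (1 / 2)) * (cst κ)) * (cst F.i)) * ((D1 F.θ) * (D1 F.θ) + ((D2 F.θ) * (D2 F.θ)))) - ((cst F.i) * (((F.ρ) * (F.Tm) - (cst 1)) * (F.d)))
def FD.e1f1 (F : FD) (a b κ : ℝ) : Sm := (cst a) * ((Dt F.v) * (D1 F.v) + ((Dt F.w) * (D1 F.w))) + ((cst b) * ((F.d) * (Dt F.v))) - ((cst F.i) * (((F.ρ) * (F.Tm) - (cst 1)) * (Dt F.v))) + (((cst κ) * (cst F.i)) * ((Dt F.θ) * (D1 F.θ)))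
def FD.e1f2 (F : FD) (a b κ : ℝ) : Sm := (Dt F.v) * ((cst a) * (D2 F.v)) + ((Dt F.w) * ((cst a) * (D2 F.w))) + ((Dt F.w) * ((cst b) * (F.d))) - ((Dt F.w) * ((cst F.i) * ((F.ρ) * (F.Tm) - (cst 1)))) + ((Dt F.θ) * (((cst κ) * (cst F.i)) * (D2 F.θ)))

set_option maxHeartbeats 1000000 in
theorem E1_int : ∃ k : ℕ, ∀ {a b κ g K M : ℝ} {F : FD} (hF : Flow a b κ g K M F) (hT : 0 < F.T) {t : ℝ}
    (ht : t ∈ Set.Icc 0 F.T),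
    I (Dt (F.e1e a b κ) + (cst (1 / 4) * ((Dt F.v) ^ 2 + (Dt F.w) ^ 2) + cst (g / 8) * (cst F.i * (Dt F.θ) ^ 2))) t
    ≤ I (cst (32 + 1600 * g⁻¹) * (cst F.i * F.gψ) + cst (M ^ k) * cst F.ε * F.s) t := by
  obtain ⟨k, hk⟩ := E1_err
  refine ⟨k, fun {a b κ g K M F} hF hT {t} ht => ?_⟩
  have hv := W0.Dt hT hF.wv t ht
  have hw := W0.Dt hT hF.ww t ht
  have hθ := W0.Dt hT hF.wθ t ht
  refine I_le_of_local (f := F.e1f1 a b κ) (g := F.e1f2 a b κ) ?_ ?_ ?_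
  · unfold FD.e1f1 FD.ρ FD.Tm FD.d
    repeat' first
      | exact hF.pv | exact hF.pw | exact hF.pθ | exact hF.pφ | exact hF.pR | exact hF.pτ
      | exact Per.cst _ | exact Per_Yc | apply Per.sub | apply Per.neg | apply Per.add
      | apply Per.mul | apply Per.D1 | apply Per.D2 | apply Per.Dt
  · unfold FD.e1f2
    repeat' first
      | exact hv | exact hw | exact hθ | apply W0.sub | apply W0.neg | apply W0.add
      | apply W0.mulr
  · intro x hx
    have h := hF.jb ht hx
    have hE := hk h
    have hS := E1_star h
    have hR2 := h.R2e
    simp only [FD.e1e, FD.e1f1, FD.e1f2, FD.gψ, FD.U, FD.ρ, FD.Tm, FD.d, Dt_add, Dt_sub, Dt_neg, Dt_mul, Dt_cst, D1_add, D1_sub, D1_neg, D1_mul, D1_cst, D2_add, D2_sub, D2_neg, D2_mul, D2_cst, D2_D1, Dt_D1, Dt_D2, D1_Yc, D2_Yc, Dt_Yc, ev_add, ev_sub, ev_neg, ev_mul, ev_pow, ev_cst, ev_zero, ev_one, hF.R1, hF.Rt, hF.τ1, hF.τt]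
    simp only [mul_zero, zero_mul, add_zero, zero_add, sub_zero]
    simp only [FD.jφ, FD.jφ1, FD.jφ2, FD.jφt, FD.jφ11, FD.jφ12, FD.jφ22, FD.jφ1t, FD.jφ2t, FD.jv, FD.jv1, FD.jv2, FD.jvt, FD.jv11, FD.jv12, FD.jv22, FD.jv1t, FD.jv2t, FD.jw, FD.jw1, FD.jw2, FD.jwt, FD.jw11, FD.jw12, FD.jw22, FD.jw1t, FD.jw2t, FD.jθ, FD.jθ1, FD.jθ2, FD.jθt, FD.jθ11, FD.jθ12, FD.jθ22, FD.jθ1t, FD.jθ2t, FD.jbR, FD.jbτ, FD.jbR2, FD.jbτ2, FD.jbR22, FD.jby F (t, x), FD.jbs, FD.jbi F (t, x), FD.jbe F (t, x)]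
    generalize jq F.φ (t, x) = φ at *
    generalize jq F.v (t, x) = v at *
    generalize jq F.w (t, x) = w at *
    generalize jq F.θ (t, x) = θ at *
    generalize F.bg (t, x) = B at *
    linear_combination hE + hS + (v.ft) * h.e1 + (w.ft) * h.e2 + ((B.i * θ.ft)) * h.eT + ((((-B.i) * (B.τ + θ.f)) * (v.f1 + w.f2))) * h.eM + (0) * hR2 + (0) * h.Rτ + ((-2)*a*v.f1*w.f2*θ.ft + 1*a*v.f1^2*θ.ft + 2*a*v.f2*w.f1*θ.ft + 2*a*v.f2*θ.ft + 1*a*v.f2^2*θ.ft + 2*a*w.f1*θ.ft + 1*a*w.f1^2*θ.ft + 1*a*w.f2^2*θ.ft + 2*b*v.f1*w.f2*θ.ft + 1*b*v.f1^2*θ.ft + 1*b*w.f2^2*θ.ft) * h.iε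

theorem E2_err : ∃ k : ℕ, ∀ {a b κ g K M : ℝ} {B : Bg} {φ v w θ : Q} (h : JB a b κ g K M B φ v w θ),
    (((((((1 / 2) * B.i) * (v.f1 + w.f2)) * (φ.f2 * φ.f2)) - ((B.i * φ.f2) * ((((((1 + v.f2) * φ.f1) + (w.f2 * φ.f2)) + ((B.R2 + φ.f2) * (v.f1 + w.f2))) + (w.f2 * B.R2)) + (w.f * B.R22)))) - ((a + b)⁻¹ * ((((B.i * φ.f2) * (B.R + φ.f)) * (B.R + φ.f)) * (((B.y + v.f) * w.f1) + (w.f * w.f2))))) - ((a + b)⁻¹ * ((((B.i * B.i) * φ.f2) * (B.R + φ.f)) * ((θ.f * B.R2) + (φ.f * B.τ2)))))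
      ≤ M ^ k * B.ε * B.σ ^ 2 :=
  ⟨_, fun {_ _ _ _ _ _ _ _ _ _ _} h => Bd.fin (Bd.cv (Bd.sub (Bd.cv (Bd.sub (Bd.cv (Bd.sub (Bd.cv (Bd.mul (Bd.mul (Bd.mul (bd_n h.bc (by norm_num)) h.i) (Bd.add (Bd.cv h.v1L (-1) 0 (by decide) rfl) (Bd.cv h.w2L (-1) 0 (by decide) rfl))) (Bd.mul h.φ2s h.φ2s)) (1) 2 (by decide) rfl) (Bd.cv (Bd.mul (Bd.mul h.i h.φ2s) (Bd.add (Bd.cv (Bd.add (Bd.cv (Bd.add (Bd.cv (Bd.add (Bd.cv (Bd.mul (Bd.add (Bd.cv (bd_n h.bc (by norm_num)) (-1) 0 (by decide) rfl) (Bd.cv h.v2L (-1) 0 (by decide) rfl)) h.φ1s) (1) 1 (by decide) rfl) (Bd.cv (Bd.mul h.w2L h.φ2s) (1) 1 (by decide) rfl)) (1) 1 (by decide) rfl) (Bd.cv (Bd.mul (Bd.add (Bd.cv h.R2 (0) 0 (by decide) rfl) (Bd.cv h.φ2L (0) 0 (by decide) rfl)) (Bd.add (Bd.cv h.v1s (1)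 1 (by decide) rfl) (Bd.cv h.w2s (1) 1 (by decide) rfl))) (1) 1 (by decide) rfl)) (1) 1 (by decide) rfl) (Bd.cv (Bd.mul h.w2s h.R2) (1) 1 (by decide) rfl)) (1) 1 (by decide) rfl) (Bd.cv (Bd.mul h.ws h.R22) (1) 1 (by decide) rfl))) (1) 2 (by decide) rfl)) (1) 2 (by decide) rfl) (Bd.cv (Bd.mul h.iab (Bd.mul (Bd.mul (Bd.mul (Bd.mul h.i h.φ2s) (Bd.add (Bd.cv h.R (0) 0 (by decide) rfl) (Bd.cv h.φL (0) 0 (by decide) rfl))) (Bd.add (Bd.cv h.R (0) 0 (by decide) rfl) (Bd.cv h.φL (0) 0 (by decide) rfl))) (Bd.add (Bd.cv (Bd.mul (Bd.add (Bd.cv h.y (0) 0 (by decide) rfl) (Bd.cv h.vL (0) 0 (by decide) rfl)) h.w1s) (1) 1 (by decide) rfl) (Bd.cv (Bd.mul h.wL h.w2s) (1) 1 (by decide) rfl)))) (1) 2 (by decide) rfl)) (1) 2 (by decide) rfl) (Bd.cv (Bd.mul h.iab (Bd.mul (Bd.mul (Bd.mul (Bd.mul h.i h.i) h.φ2s) (Bd.add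 (Bd.cv h.R (0) 0 (by decide) rfl) (Bd.cv h.φL (0) 0 (by decide) rfl))) (Bd.add (Bd.cv (Bd.mul h.θs h.R2) (3) 1 (by decide) rfl) (Bd.cv (Bd.mul h.φs h.τ2) (3) 1 (by decide) rfl)))) (1) 2 (by decide) rfl)) (1) 2 (by decide) rfl)⟩

theorem E2_star {a b κ g K M : ℝ} {B : Bg} {φ v w θ : Q} (h : JB a b κ g K M B φ v w θ) : ((-(a + b)⁻¹) * (((B.i * φ.f2) * (B.R + φ.f)) * ((((B.R + φ.f) * w.ft) - (a * (w.f11 - v.f12))) + ((B.i * (B.R + φ.f)) * θ.f2)))) - ((a + b)⁻¹ * (((B.i * B.i) * ((B.R + φ.f) * (B.τ + θ.f))) * (φ.f2 * φ.f2)))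
    ≤ (a + b)⁻¹ * (512 * (16 * w.ft ^ 2 + a ^ 2 * (w.f11 ^ 2 + v.f12 ^ 2) + 16 * (B.i * (B.i * θ.f2 ^ 2))))
      - (a + b)⁻¹ * (1 / 32 * (B.i * (B.i * φ.f2 ^ 2))) := by
  have hj : 0 < (a + b)⁻¹ := inv_pos.2 (by linarith [h.cs.a0, h.cs.b0])
  have ρl := h.ρl
  have ρu := h.ρu
  have Tl := h.Tl
  have Tu := h.Tu
  generalize B.R + φ.f = r at *
  generalize B.τ + θ.f = T at *
  have key : ∀ z y : ℝ, -(z * r * y) - r * T * z ^ 2 ≤ 128 * y ^ 2 - 1 / 32 * z ^ 2 := by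
    intro z y
    have q1 : 1 / 16 * z ^ 2 ≤ r * T * z ^ 2 := by
      have : 1 / 16 ≤ r * T := by nlinarith
      gcongr
    have q2 : |z * r * y| ≤ 4 * (|z| * |y|) := by
      rw [abs_mul, abs_mul, abs_of_nonneg (by linarith : 0 ≤ r)]
      nlinarith [mul_nonneg (abs_nonneg z) (abs_nonneg y)]
    have q3 : 4 * (|z| * |y|) ≤ 1 / 32 * z ^ 2 + 128 * y ^ 2 := by
      rw [← sq_abs z, ← sq_abs y]; nlinarith [sq_nonneg (|z| - 64 * |y|)]
    have := neg_le_abs (z * r * y)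
    linarith
  have k1 := key (B.i * φ.f2) (r * w.ft - a * (w.f11 - v.f12) + B.i * r * θ.f2)
  have y1 : (r * w.ft - a * (w.f11 - v.f12) + B.i * r * θ.f2) ^ 2
      ≤ 4 * (16 * w.ft ^ 2 + a ^ 2 * (w.f11 ^ 2 + v.f12 ^ 2) + 16 * (B.i * (B.i * θ.f2 ^ 2))) := by
    have hr : r ^ 2 ≤ 16 := by nlinarith
    have c4 : ∀ x y z u : ℝ, (x - (y - z) + u) ^ 2 ≤ 4 * (x ^ 2 + y ^ 2 + z ^ 2 + u ^ 2) := by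
      intro x y z u
      nlinarith [sq_nonneg (x + y), sq_nonneg (x - z), sq_nonneg (x - u), sq_nonneg (y + z),
        sq_nonneg (y + u), sq_nonneg (z - u)]
    have c5 := c4 (r * w.ft) (a * w.f11) (a * v.f12) (B.i * r * θ.f2)
    have c6 : r ^ 2 * w.ft ^ 2 ≤ 16 * w.ft ^ 2 := by gcongr
    have c7 : r ^ 2 * (B.i * θ.f2) ^ 2 ≤ 16 * (B.i * θ.f2) ^ 2 := by gcongr
    have c8 : r * w.ft - a * (w.f11 - v.f12) + B.i * r * θ.f2
      = r * w.ft - (a * w.f11 - a * v.f12) + B.i * r * θ.f2 := by ring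
    rw [c8]
    linarith
  have k2 : -(B.i * φ.f2 * r * (r * w.ft - a * (w.f11 - v.f12) + B.i * r * θ.f2)) - r * T * (B.i * φ.f2) ^ 2
    ≤ 512 * (16 * w.ft ^ 2 + a ^ 2 * (w.f11 ^ 2 + v.f12 ^ 2) + 16 * (B.i * (B.i * θ.f2 ^ 2)))
      - 1 / 32 * (B.i * φ.f2) ^ 2 := by linarith
  have k3 := mul_le_mul_of_nonneg_left k2 hj.le
  linarith

def FD.e2e (F : FD) : Sm := ((cst (1 / 2)) * (cst F.i)) * ((D2 F.φ) * (D2 F.φ))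
def FD.e2f1 (F : FD) : Sm := -((F.U) * (((cst (1 / 2)) * (cst F.i)) * ((D2 F.φ) * (D2 F.φ))))
def FD.e2f2 (F : FD) : Sm := -(F.w * (((cst (1 / 2)) * (cst F.i)) * ((D2 F.φ) * (D2 F.φ))))

set_option maxHeartbeats 1000000 in
theorem E2_int : ∃ k : ℕ, ∀ {a b κ g K M : ℝ} {F : FD} (hF : Flow a b κ g K M F) (hT : 0 < F.T) {t : ℝ}
    (ht : t ∈ Set.Icc 0 F.T),
    I (Dt F.e2e + cst ((a + b)⁻¹) * (cst (1 / 32) * (cst F.i * (cst F.i * (D2 F.φ) ^ 2)))) t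
    ≤ I (cst ((a + b)⁻¹) * (cst 512 * (cst 16 * (Dt F.w) ^ 2 + cst (a ^ 2) * ((D1 (D1 F.w)) ^ 2
      + (D1 (D2 F.v)) ^ 2) + cst 16 * (cst F.i * (cst F.i * (D2 F.θ) ^ 2)))) + cst (M ^ k) * cst F.ε * F.s) t := by
  obtain ⟨k, hk⟩ := E2_err
  refine ⟨k, fun {a b κ g K M F} hF hT {t} ht => ?_⟩
  have hw := hF.ww t ht
  refine I_le_of_local (f := F.e2f1) (g := F.e2f2) ?_ ?_ ?_
  · unfold FD.e2f1 FD.U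
    repeat' first
      | exact hF.pv | exact hF.pw | exact hF.pθ | exact hF.pφ | exact hF.pR | exact hF.pτ
      | exact Per.cst _ | exact Per_Yc | apply Per.sub | apply Per.neg | apply Per.add
      | apply Per.mul | apply Per.D1 | apply Per.D2 | apply Per.Dt
  · unfold FD.e2f2
    repeat' first
      | exact hw | apply W0.sub | apply W0.neg | apply W0.add
      | apply W0.mulr
  · intro x hx
    have h := hF.jb ht hx
    have hE := hk h
    have hS := E2_star h
    have hR2 := h.R2e
    have hab : (a + b) * (a + b)⁻¹ = 1 := mul_inv_cancel₀ (by linarith [h.cs.a0, h.cs.b0])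
    have qM := Dd_vanish hT hF.gM (0, (0, 1)) t ht x hx
    change (D2 F.GM).1 (t, x) = 0 at qM
    simp only [FD.GM, FD.U, FD.ρ, FD.d, Dt_add, Dt_sub, Dt_neg, Dt_mul, Dt_cst, D1_add, D1_sub, D1_neg, D1_mul, D1_cst, D2_add, D2_sub, D2_neg, D2_mul, D2_cst, D2_D1, Dt_D1, Dt_D2, D1_Yc, D2_Yc, Dt_Yc, ev_add, ev_sub, ev_neg, ev_mul, ev_pow, ev_cst, ev_zero, ev_one, hF.R1, hF.Rt, hF.τ1, hF.τt] at qM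
    simp only [FD.jφ, FD.jφ1, FD.jφ2, FD.jφt, FD.jφ11, FD.jφ12, FD.jφ22, FD.jφ1t, FD.jφ2t, FD.jv, FD.jv1, FD.jv2, FD.jvt, FD.jv11, FD.jv12, FD.jv22, FD.jv1t, FD.jv2t, FD.jw, FD.jw1, FD.jw2, FD.jwt, FD.jw11, FD.jw12, FD.jw22, FD.jw1t, FD.jw2t, FD.jθ, FD.jθ1, FD.jθ2, FD.jθt, FD.jθ11, FD.jθ12, FD.jθ22, FD.jθ1t, FD.jθ2t, FD.jbR, FD.jbτ, FD.jbR2, FD.jbτ2, FD.jbR22, FD.jby F (t, x)] at qM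
    simp only [FD.e2e, FD.e2f1, FD.e2f2, FD.U, FD.ρ, FD.Tm, FD.d, Dt_add, Dt_sub, Dt_neg, Dt_mul, Dt_cst, D1_add, D1_sub, D1_neg, D1_mul, D1_cst, D2_add, D2_sub, D2_neg, D2_mul, D2_cst, D2_D1, Dt_D1, Dt_D2, D1_Yc, D2_Yc, Dt_Yc, ev_add, ev_sub, ev_neg, ev_mul, ev_pow, ev_cst, ev_zero, ev_one, hF.R1, hF.Rt, hF.τ1, hF.τt]
    simp only [mul_zero, zero_mul, add_zero, zero_add, sub_zero]
    simp only [FD.jφ, FD.jφ1, FD.jφ2, FD.jφt, FD.jφ11, FD.jφ12, FD.jφ22, FD.jφ1t, FD.jφ2t, FD.jv, FD.jv1, FD.jv2, FD.jvt, FD.jv11, FD.jv12, FD.jv22, FD.jv1t, FD.jv2t, FD.jw, FD.jw1, FD.jw2, FD.jwt, FD.jw11, FD.jw12, FD.jw22, FD.jw1t, FD.jw2t, FD.jθ, FD.jθ1, FD.jθ2, FD.jθt, FD.jθ11, FD.jθ12, FD.jθ22, FD.jθ1t, FD.jθ2t, FD.jbR, FD.jbτ, FD.jbR2, FD.jbτ2,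 FD.jbR22, FD.jby F (t, x), FD.jbs, FD.jbi F (t, x), FD.jbe F (t, x)]
    generalize jq F.φ (t, x) = φ at *
    generalize jq F.v (t, x) = v at *
    generalize jq F.w (t, x) = w at *
    generalize jq F.θ (t, x) = θ at *
    generalize F.bg (t, x) = B at *
    linear_combination hE + hS + (B.i * φ.f2) * qM + (1) * ((((B.i * φ.f2) * (B.R + φ.f)) * (a + b)⁻¹)) * h.e2 + (1) * ((((B.i * φ.f2) * (B.R + φ.f)) * (v.f12 + w.f22))) * hab + ((-1)*B.R*B.i^2*(a + b)⁻¹*B.τ*φ.f2 + (-1)*B.i^2*(a + b)⁻¹*B.τ*φ.f*φ.f2) * hR2 + (1*B.R*B.i^2*(a + b)⁻¹*B.τ2*φ.f*φ.f2 + 1*B.R^2*B.i^2*(a + b)⁻¹*B.τ2*φ.f2) * h.Rτ + (0) * h.iε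


/-- blend of the two wall traces -/
def Hb (f : Sm) : Sm := (cst 1 - Yc) * cmp 0 (1 / 256) f + Yc * cmp (255 / 256) (1 / 256) f

theorem Per_Hb {f : Sm} (hf : Per f) : Per (Hb f) :=
  (((Per.cst 1).sub Per_Yc).mul (Per_cmp hf)).add (Per_Yc.mul (Per_cmp hf))

theorem Hb_wall (f : Sm) (t : ℝ) : W0 t (f - Hb f) := fun x => by
  constructor
  · simp [Hb, ev_sub, ev_add, ev_mul, ev_cst, ev_Yc, cmp_ev]
  · have : (255 / 256 + 1 / 256 * 1 : ℝ) = 1 := by norm_num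
    simp only [Hb, ev_sub, ev_add, ev_mul, ev_cst, ev_Yc, cmp_ev, this]
    ring

theorem D1_Hb (f : Sm) : D1 (Hb f) = Hb (D1 f) := by
  simp only [Hb, D1_add, D1_mul, D1_sub, D1_cst, D1_Yc, D1_cmp]
  ring

theorem D2_Hb (f : Sm) : D2 (Hb f) = cmp (255 / 256) (1 / 256) f - cmp 0 (1 / 256) f
    + cst (1 / 256) * Hb (D2 f) := by
  simp only [Hb, D2_add, D2_mul, D2_sub, D2_cst, D2_Yc, D2_cmp]
  ring

theorem I_Hb (f : Sm) (t : ℝ) : I ((Hb f) ^ 2) t ≤ 512 * I (f ^ 2) t := by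
  have h1 := I_cmp (c := 0) (l := 1 / 256) (by norm_num) (by norm_num) (by norm_num) f t
  have h2 := I_cmp (c := 255 / 256) (l := 1 / 256) (by norm_num) (by norm_num) (by norm_num) f t
  have h3 : I ((Hb f) ^ 2) t ≤ I ((cmp 0 (1 / 256) f) ^ 2 + (cmp (255 / 256) (1 / 256) f) ^ 2) t := by
    apply I_mono
    rintro ⟨x, y⟩ hx
    have hy : y ∈ Set.Ioo (0 : ℝ) 1 := hx.2
    simp only [Hb, ev_add, ev_mul, ev_pow, ev_sub, ev_cst, ev_Yc]
    generalize (cmp 0 (1 / 256) f).1 (t, (x, y)) = p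
    generalize (cmp (255 / 256) (1 / 256) f).1 (t, (x, y)) = q
    have := hy.1
    have := hy.2
    have e : p ^ 2 + q ^ 2 - ((1 - y) * p + y * q) ^ 2
      = (1 - y) * y * (p - q) ^ 2 + y * p ^ 2 + (1 - y) * q ^ 2 := by ring
    have : 0 ≤ (1 - y) * y * (p - q) ^ 2 + y * p ^ 2 + (1 - y) * q ^ 2 := by
      have : 0 ≤ 1 - y := by linarith
      positivity
    linarith
  rw [I_add] at h3
  norm_num at h1 h2
  linarith

theorem I_D2Hb (f : Sm) (t : ℝ) :
    I ((D2 (Hb f)) ^ 2) t ≤ 1536 * I (f ^ 2) t + 3 / 128 * I ((D2 f) ^ 2) t := by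
  have h1 := I_cmp (c := 0) (l := 1 / 256) (by norm_num) (by norm_num) (by norm_num) f t
  have h2 := I_cmp (c := 255 / 256) (l := 1 / 256) (by norm_num) (by norm_num) (by norm_num) f t
  have h4 := I_Hb (D2 f) t
  have h3 : I ((D2 (Hb f)) ^ 2) t ≤ I (cst 3 * (cmp 0 (1 / 256) f) ^ 2
      + cst 3 * (cmp (255 / 256) (1 / 256) f) ^ 2 + cst (3 / 65536) * (Hb (D2 f)) ^ 2) t := by
    apply I_mono
    intro x hx
    simp only [D2_Hb, ev_add, ev_mul, ev_pow, ev_sub, ev_cst]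
    generalize (cmp 0 (1 / 256) f).1 (t, x) = p
    generalize (cmp (255 / 256) (1 / 256) f).1 (t, x) = q
    generalize (Hb (D2 f)).1 (t, x) = r
    nlinarith [sq_nonneg (p + q), sq_nonneg (p + 1 / 256 * r), sq_nonneg (q - 1 / 256 * r)]
  rw [I_add, I_add, I_cst_mul, I_cst_mul, I_cst_mul] at h3
  norm_num at h1 h2
  linarith

theorem D_abs {t a : ℝ} (p v X : Sm) (pp : Per p) (pv : Per v)
    (hq : ∀ x ∈ Ω, (D1 p).1 (t, x) = X.1 (t, x) + a * (D2 (D2 v)).1 (t, x)) :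
    I ((D1 p) ^ 2) t ≤ 10000 * (I (X ^ 2) t + a ^ 2 * I ((D2 v) ^ 2) t + I ((D2 p) ^ 2) t
      + a ^ 2 * I ((D1 (D2 v)) ^ 2) t) := by
  have h1 : I ((D1 p) ^ 2) t ≤ I (cst (1 / 2) * (D1 p) ^ 2 + X ^ 2 + (D2 p) ^ 2
      + cst (a ^ 2) * (D2 (Hb (D2 v))) ^ 2 + cst (a ^ 2) * (D1 (D2 v)) ^ 2
      + cst (a ^ 2) * (Hb (D1 (D2 v))) ^ 2) t := by
    apply I_le_of_local (f := -(cst a * (D2 p * (D2 v - Hb (D2 v)))))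
      (g := (D2 v - Hb (D2 v)) * (cst a * D1 p))
      (((Per.cst a).mul (pp.D2.mul (pv.D2.sub (Per_Hb pv.D2)))).neg)
      ((Hb_wall (D2 v) t).mulr _)
    intro x hx
    have hq := hq x hx
    simp only [D1_neg, D1_mul, D2_mul, D1_sub, D2_sub, D1_cst, D2_cst, D1_Hb, D2_D1, ev_add, ev_mul,
      ev_sub, ev_neg, ev_pow, ev_cst, ev_zero]
    generalize (D1 p).1 (t, x) = q at *
    generalize (D2 p).1 (t, x) = q2
    generalize X.1 (t, x) = X at *
    generalize (D2 (D2 v)).1 (t, x) = v22 at *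
    generalize (D1 (D2 v)).1 (t, x) = v12 at *
    generalize (D2 v).1 (t, x) = v2 at *
    generalize (Hb (D2 v)).1 (t, x) = H at *
    generalize (Hb (D1 (D2 v))).1 (t, x) = H1 at *
    generalize (D2 (Hb (D2 v))).1 (t, x) = H2 at *
    generalize (D1 (D2 p)).1 (t, x) = p12 at *
    have e1 : q ^ 2 = q * X + q * (a * v22) := by rw [hq]; ring
    have e2 : q * X ≤ 1 / 4 * q ^ 2 + X ^ 2 := by nlinarith [sq_nonneg (q - 2 * X)]
    have e3 : q * (a * H2) ≤ 1 / 4 * q ^ 2 + (a * H2) ^ 2 := by nlinarith [sq_nonneg (q - 2 * (a * H2))]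
    have e4 : q2 * (a * v12) - q2 * (a * H1) ≤ q2 ^ 2 + (a * v12) ^ 2 + (a * H1) ^ 2 := by
      nlinarith [sq_nonneg (q2 - 2 * (a * v12)), sq_nonneg (q2 + 2 * (a * H1)), sq_nonneg (a * v12), sq_nonneg (a * H1), sq_nonneg q2]
    linarith
  have h2 : I (cst (a ^ 2) * (D2 (D2 v)) ^ 2) t ≤ I (cst 2 * (D1 p) ^ 2 + cst 2 * X ^ 2) t := by
    apply I_mono
    intro x hx
    have hq := hq x hx
    simp only [ev_add, ev_mul, ev_pow, ev_cst]
    rw [hq]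
    nlinarith [sq_nonneg (2 * X.1 (t, x) + a * (D2 (D2 v)).1 (t, x))]
  have h3 := I_D2Hb (D2 v) t
  have h4 := I_Hb (D1 (D2 v)) t
  simp only [I_add, I_cst_mul] at h1 h2
  have h3' := mul_le_mul_of_nonneg_left h3 (sq_nonneg a)
  have h4' := mul_le_mul_of_nonneg_left h4 (sq_nonneg a)
  have n1 := I_sq_nonneg X t
  have n2 := mul_nonneg (sq_nonneg a) (I_sq_nonneg (D2 v) t)
  have n3 := I_sq_nonneg (D2 p) t
  have n4 := mul_nonneg (sq_nonneg a) (I_sq_nonneg (D1 (D2 v)) t)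
  linarith
theorem DX_err : ∃ k : ℕ, ∀ {a b κ g K M : ℝ} {B : Bg} {φ v w θ : Q} (h : JB a b κ g K M B φ v w θ),
    (((((B.y + v.f) * v.f1) + (w.f * v.f2)) + w.f) ^ 2)
      ≤ M ^ k * B.ε * B.σ ^ 2 :=
  ⟨_, fun {_ _ _ _ _ _ _ _ _ _ _} h => Bd.fin (Bd.cv (bd_pow2 (Bd.mul (Bd.add (Bd.cv (Bd.add (Bd.cv (Bd.mul (Bd.add (Bd.cv h.y (0) 0 (by decide) rfl) (Bd.cv h.vL (0) 0 (by decide) rfl)) h.v1s) (1) 1 (by decide) rfl) (Bd.cv (Bd.mul h.wL h.v2s) (1) 1 (by decide) rfl)) (1) 1 (by decide) rfl) (Bd.cv h.ws (1) 1 (by decide) rfl)) (Bd.add (Bd.cv (Bd.add (Bd.cv (Bd.mul (Bd.add (Bd.cv h.y (0) 0 (by decide) rfl) (Bd.cv h.vL (0) 0 (by decide) rfl)) h.v1s) (1) 1 (by decide) rfl) (Bd.cv (Bd.mul h.wL h.v2s) (1) 1 (by decide) rfl)) (1) 1 (by decide) rfl) (Bd.cv h.ws (1) 1 (by decide) rfl))))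 (1) 2 (by decide) rfl)⟩
theorem DP_err : ∃ k : ℕ, ∀ {a b κ g K M : ℝ} {B : Bg} {φ v w θ : Q} (h : JB a b κ g K M B φ v w θ),
    ((B.i * ((θ.f * B.R2) + (φ.f * B.τ2))) ^ 2)
      ≤ M ^ k * B.ε * B.σ ^ 2 :=
  ⟨_, fun {_ _ _ _ _ _ _ _ _ _ _} h => Bd.fin (Bd.cv (bd_pow2 (Bd.mul (Bd.mul h.i (Bd.add (Bd.cv (Bd.mul h.θs h.R2) (3) 1 (by decide) rfl) (Bd.cv (Bd.mul h.φs h.τ2) (3) 1 (by decide) rfl))) (Bd.mul h.i (Bd.add (Bd.cv (Bd.mul h.θs h.R2) (3) 1 (by decide) rfl) (Bd.cv (Bd.mul h.φs h.τ2) (3) 1 (by decide) rfl))))) (1) 2 (by decide) rfl)⟩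
theorem DV_err : ∃ k : ℕ, ∀ {a b κ g K M : ℝ} {B : Bg} {φ v w θ : Q} (h : JB a b κ g K M B φ v w θ),
    ((a ^ 2) * (v.f2 ^ 2))
      ≤ M ^ k * B.ε * B.σ ^ 2 :=
  ⟨_, fun {_ _ _ _ _ _ _ _ _ _ _} h => Bd.fin (Bd.cv (Bd.mul (bd_pow2 (Bd.mul h.aB h.aB)) (bd_pow2 (Bd.mul h.v2s h.v2s))) (1) 2 (by decide) rfl)⟩

theorem sq3 (x y z : ℝ) : (x + y - z) ^ 2 ≤ 3 * (x ^ 2 + y ^ 2 + z ^ 2) := by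
  nlinarith [sq_nonneg (x - y), sq_nonneg (x + z), sq_nonneg (y + z)]
theorem sq2 (x y : ℝ) : (x + y) ^ 2 ≤ 2 * (x ^ 2 + y ^ 2) := by
  nlinarith [sq_nonneg (x - y)]

def FD.DX (F : FD) (a b : ℝ) : Sm := cst a * D1 (D1 F.v) + cst b * D1 F.d - F.ρ * F.F1
def FD.Dr (F : FD) : Sm := (D1 (D1 F.v)) ^ 2 + (D1 (D2 F.v)) ^ 2 + (D1 (D2 F.w)) ^ 2 + (Dt F.v) ^ 2
  + cst F.i * (cst F.i * (D1 F.θ) ^ 2 + cst F.i * (D2 F.θ) ^ 2 + cst F.i * (D2 F.φ) ^ 2)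

theorem D_pt : ∃ k : ℕ, ∀ {a b κ g K M : ℝ} {B : Bg} {φ v w θ : Q} (h : JB a b κ g K M B φ v w θ),
    (a * v.f11 + b * (v.f11 + w.f12) - (B.R + φ.f) * (v.ft + (((((B.y + v.f) * v.f1) + (w.f * v.f2)) + w.f)))) ^ 2 + a ^ 2 * v.f2 ^ 2
     + (B.i * ((B.R + φ.f) * (B.τ2 + θ.f2) + (B.τ + θ.f) * (B.R2 + φ.f2))) ^ 2 + a ^ 2 * v.f12 ^ 2
    ≤ (96 * M ^ 2) * (v.f11 ^ 2 + v.f12 ^ 2 + w.f12 ^ 2 + v.ft ^ 2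
        + B.i * (B.i * θ.f1 ^ 2 + B.i * θ.f2 ^ 2 + B.i * φ.f2 ^ 2)) + M ^ k * B.ε * B.σ ^ 2 := by
  obtain ⟨k₁, h₁⟩ := DX_err
  obtain ⟨k₂, h₂⟩ := DP_err
  obtain ⟨k₃, h₃⟩ := DV_err
  refine ⟨k₁ + k₂ + k₃ + 8, fun {a b κ g K M B φ v w θ} h => ?_⟩
  have g1 := h₁ h
  have g2 := h₂ h
  have g3 := h₃ h
  have ρl := h.ρl
  have ρu := h.ρu
  have Tl := h.Tl
  have Tu := h.Tu
  have hP : (B.R + φ.f) * (B.τ2 + θ.f2) + (B.τ + θ.f) * (B.R2 + φ.f2)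
      = (B.R + φ.f) * θ.f2 + (B.τ + θ.f) * φ.f2 + (θ.f * B.R2 + φ.f * B.τ2) := by
    linear_combination h.R2τ
  rw [hP]
  have M2 := h.cs.m2
  have am := h.cs.am
  have bm := h.cs.bm
  have a0 := h.cs.a0
  have b0 := h.cs.b0
  have he := h.bc.e0
  have kk : ∀ j : ℕ, j ≤ k₁ + k₂ + k₃ → M ^ j * B.ε * B.σ ^ 2 ≤ M ^ (k₁ + k₂ + k₃) * B.ε * B.σ ^ 2 := by
    intro j hj
    have : M ^ j ≤ M ^ (k₁ + k₂ + k₃) := pow_le_pow_right₀ (by linarith) hj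
    gcongr
  have g1' := g1.trans (kk k₁ (by omega))
  have g2' := g2.trans (kk k₂ (by omega))
  have g3' := g3.trans (kk k₃ (by omega))
  have hY : M ^ (k₁ + k₂ + k₃ + 8) * B.ε * B.σ ^ 2 = M ^ 8 * (M ^ (k₁ + k₂ + k₃) * B.ε * B.σ ^ 2) := by
    rw [pow_add]; ring
  have hY0 : 0 ≤ M ^ (k₁ + k₂ + k₃) * B.ε * B.σ ^ 2 := by positivity
  rw [hY]
  generalize M ^ (k₁ + k₂ + k₃) * B.ε * B.σ ^ 2 = Y at *
  generalize B.R + φ.f = r at *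
  generalize B.τ + θ.f = T at *
  generalize (B.y + v.f) * v.f1 + w.f * v.f2 + w.f = z1 at *
  generalize θ.f * B.R2 + φ.f * B.τ2 = z2 at *
  have M8 : (256 : ℝ) ≤ M ^ 8 := by
    calc (256 : ℝ) = 2 ^ 8 := by norm_num
      _ ≤ _ := by gcongr
  have hY8 : 256 * Y ≤ M ^ 8 * Y := by gcongr
  have hr : r ^ 2 ≤ 16 := by nlinarith
  have hT : T ^ 2 ≤ 16 := by nlinarith
  have ha2 : a ^ 2 ≤ M ^ 2 := by gcongr
  have hb2 : b ^ 2 ≤ M ^ 2 := by gcongr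
  have M4 : (4 : ℝ) ≤ M ^ 2 := by nlinarith
  have x1 : (a * v.f11 + b * (v.f11 + w.f12) - r * (v.ft + z1)) ^ 2
      ≤ 3 * (M ^ 2 * v.f11 ^ 2 + M ^ 2 * (2 * (v.f11 ^ 2 + w.f12 ^ 2)) + 16 * (2 * (v.ft ^ 2 + z1 ^ 2))) := by
    refine (sq3 _ _ _).trans ?_
    rw [mul_pow, mul_pow, mul_pow]
    gcongr
    · exact sq2 _ _
    · exact sq2 _ _
  have x2 : (B.i * (r * θ.f2 + T * φ.f2 + z2)) ^ 2
      ≤ 3 * (16 * (B.i * θ.f2) ^ 2 + 16 * (B.i * φ.f2) ^ 2 + (B.i * z2) ^ 2) := by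
    have : B.i * (r * θ.f2 + T * φ.f2 + z2) = r * (B.i * θ.f2) + T * (B.i * φ.f2) - -(B.i * z2) := by ring
    rw [this]
    refine (sq3 _ _ _).trans ?_
    rw [mul_pow r, mul_pow T, neg_sq]
    gcongr
  have x3 : a ^ 2 * v.f12 ^ 2 ≤ M ^ 2 * v.f12 ^ 2 := by gcongr
  have y1 : 4 * v.ft ^ 2 ≤ M ^ 2 * v.ft ^ 2 := by gcongr
  have y2 : 4 * (B.i * θ.f2) ^ 2 ≤ M ^ 2 * (B.i * θ.f2) ^ 2 := by gcongr
  have y3 : 4 * (B.i * φ.f2) ^ 2 ≤ M ^ 2 * (B.i * φ.f2) ^ 2 := by gcongr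
  have y4 : 0 ≤ M ^ 2 * (B.i * θ.f1) ^ 2 := by positivity
  have y5 : 0 ≤ M ^ 2 * v.f11 ^ 2 := by positivity
  have y6 : 0 ≤ M ^ 2 * v.f12 ^ 2 := by positivity
  have y7 : 0 ≤ M ^ 2 * w.f12 ^ 2 := by positivity
  have y8 := sq_nonneg v.ft
  have y9 := sq_nonneg (B.i * θ.f2)
  have y10 := sq_nonneg (B.i * φ.f2)
  have : B.i * (B.i * θ.f1 ^ 2 + B.i * θ.f2 ^ 2 + B.i * φ.f2 ^ 2)
    = (B.i * θ.f1) ^ 2 + (B.i * θ.f2) ^ 2 + (B.i * φ.f2) ^ 2 := by ring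
  rw [this]
  linarith

theorem D_pt2 {a b κ g K M : ℝ} {B : Bg} {φ v w θ : Q} (h : JB a b κ g K M B φ v w θ) : B.i * (B.i * φ.f1 ^ 2)
    ≤ 32 * (B.i * ((B.R + φ.f) * θ.f1 + (B.τ + θ.f) * φ.f1)) ^ 2 + 512 * (B.i * (B.i * θ.f1 ^ 2)) := by
  have ρl := h.ρl
  have ρu := h.ρu
  have Tl := h.Tl
  generalize B.R + φ.f = r at *
  generalize B.τ + θ.f = T at *
  have hr : r ^ 2 ≤ 16 := by nlinarith
  have hT : 1 / 16 ≤ T ^ 2 := by nlinarith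
  have e1 : 1 / 16 * (B.i * φ.f1) ^ 2 ≤ T ^ 2 * (B.i * φ.f1) ^ 2 := by gcongr
  have e2 : (T * (B.i * φ.f1)) ^ 2 ≤ 2 * ((B.i * (r * θ.f1 + T * φ.f1)) ^ 2 + (-(r * (B.i * θ.f1))) ^ 2) := by
    have : T * (B.i * φ.f1) = B.i * (r * θ.f1 + T * φ.f1) + -(r * (B.i * θ.f1)) := by ring
    rw [this]; exact sq2 _ _
  have e3 : r ^ 2 * (B.i * θ.f1) ^ 2 ≤ 16 * (B.i * θ.f1) ^ 2 := by gcongr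
  linarith

theorem D_int : ∃ k : ℕ, ∀ {a b κ g K M : ℝ} {F : FD} (hF : Flow a b κ g K M F) {t : ℝ}
    (ht : t ∈ Set.Icc 0 F.T),
    I (cst F.i * (cst F.i * (D1 F.φ) ^ 2)) t
    ≤ M ^ k * I F.Dr t + M ^ k * F.ε * I F.s t := by
  obtain ⟨k, hk⟩ := D_pt
  refine ⟨k + 30, fun {a b κ g K M F} hF {t} ht => ?_⟩
  have h1 : I (cst F.i * (cst F.i * (D1 F.φ) ^ 2)) t
      ≤ I (cst 32 * (D1 (cst F.i * F.P)) ^ 2 + cst 512 * F.Dr) t := by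
    apply I_mono
    intro x hx
    have h := hF.jb ht hx
    have hp := D_pt2 h
    simp only [FD.P, FD.ρ, FD.Tm, FD.Dr, Dt_add, Dt_sub, Dt_neg, Dt_mul, Dt_cst, D1_add, D1_sub, D1_neg, D1_mul, D1_cst, D2_add, D2_sub, D2_neg, D2_mul, D2_cst, D2_D1, Dt_D1, Dt_D2, D1_Yc, D2_Yc, Dt_Yc, ev_add, ev_sub, ev_neg, ev_mul, ev_pow, ev_cst, ev_zero, ev_one, hF.R1, hF.Rt, hF.τ1, hF.τt]
    simp only [mul_zero, zero_mul, add_zero, zero_add, sub_zero]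
    simp only [FD.jφ, FD.jφ1, FD.jφ2, FD.jφt, FD.jφ11, FD.jφ12, FD.jφ22, FD.jφ1t, FD.jφ2t, FD.jv, FD.jv1, FD.jv2, FD.jvt, FD.jv11, FD.jv12, FD.jv22, FD.jv1t, FD.jv2t, FD.jw, FD.jw1, FD.jw2, FD.jwt, FD.jw11, FD.jw12, FD.jw22, FD.jw1t, FD.jw2t, FD.jθ, FD.jθ1, FD.jθ2, FD.jθt, FD.jθ11, FD.jθ12, FD.jθ22, FD.jθ1t, FD.jθ2t, FD.jbR, FD.jbτ, FD.jbR2, FD.jbτ2, FD.jbR22, FD.jby F (t, x), FD.jbs, FD.jbi F (t, x), FD.jbe F (t, x)]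
    generalize jq F.φ (t, x) = φ at *
    generalize jq F.v (t, x) = v at *
    generalize jq F.w (t, x) = w at *
    generalize jq F.θ (t, x) = θ at *
    generalize F.bg (t, x) = B at *
    have e : 0 ≤ v.f11 ^ 2 + v.f12 ^ 2 + w.f12 ^ 2 + v.ft ^ 2 := by positivity
    have e2 : 0 ≤ (B.i * θ.f2) ^ 2 + (B.i * φ.f2) ^ 2 := by positivity
    linarith
  have h2 := D_abs (a := a) (t := t) (cst F.i * F.P) F.v (F.DX a b)
    ((Per.cst _).mul ((hF.pR.add hF.pφ).mul (hF.pτ.add hF.pθ))) hF.pv (by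
      intro x hx
      have h := hF.jb ht hx
      have e1 := h.e1
      simp only [FD.DX, FD.F1, FD.U, FD.d, FD.P, FD.ρ, FD.Tm, Dt_add, Dt_sub, Dt_neg, Dt_mul, Dt_cst, D1_add, D1_sub, D1_neg, D1_mul, D1_cst, D2_add, D2_sub, D2_neg, D2_mul, D2_cst, D2_D1, Dt_D1, Dt_D2, D1_Yc, D2_Yc, Dt_Yc, ev_add, ev_sub, ev_neg, ev_mul, ev_pow, ev_cst, ev_zero, ev_one, hF.R1, hF.Rt, hF.τ1, hF.τt]
      simp only [mul_zero, zero_mul, add_zero, zero_add, sub_zero]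
      simp only [FD.jφ, FD.jφ1, FD.jφ2, FD.jφt, FD.jφ11, FD.jφ12, FD.jφ22, FD.jφ1t, FD.jφ2t, FD.jv, FD.jv1, FD.jv2, FD.jvt, FD.jv11, FD.jv12, FD.jv22, FD.jv1t, FD.jv2t, FD.jw, FD.jw1, FD.jw2, FD.jwt, FD.jw11, FD.jw12, FD.jw22, FD.jw1t, FD.jw2t, FD.jθ, FD.jθ1, FD.jθ2, FD.jθt, FD.jθ11, FD.jθ12, FD.jθ22, FD.jθ1t, FD.jθ2t, FD.jbR, FD.jbτ, FD.jbR2, FD.jbτ2, FD.jbR22, FD.jby F (t, x), FD.jbs, FD.jbi F (t, x), FD.jbe F (t, x)]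

      linear_combination e1)
  have h3 : I ((F.DX a b) ^ 2 + cst (a ^ 2) * (D2 F.v) ^ 2 + (D2 (cst F.i * F.P)) ^ 2
      + cst (a ^ 2) * (D1 (D2 F.v)) ^ 2) t ≤ I (cst (96 * M ^ 2) * F.Dr + cst (M ^ k * F.ε) * F.s) t := by
    apply I_mono
    intro x hx
    have h := hF.jb ht hx
    have hp := hk h
    simp only [FD.DX, FD.F1, FD.U, FD.d, FD.P, FD.ρ, FD.Tm, FD.Dr, Dt_add, Dt_sub, Dt_neg, Dt_mul, Dt_cst, D1_add, D1_sub, D1_neg, D1_mul, D1_cst, D2_add, D2_sub, D2_neg, D2_mul, D2_cst, D2_D1, Dt_D1, Dt_D2, D1_Yc, D2_Yc, Dt_Yc, ev_add, ev_sub, ev_neg, ev_mul, ev_pow, ev_cst, ev_zero, ev_one, hF.R1, hF.Rt, hF.τ1, hF.τt]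
    simp only [mul_zero, zero_mul, add_zero, zero_add, sub_zero]
    simp only [FD.jφ, FD.jφ1, FD.jφ2, FD.jφt, FD.jφ11, FD.jφ12, FD.jφ22, FD.jφ1t, FD.jφ2t, FD.jv, FD.jv1, FD.jv2, FD.jvt, FD.jv11, FD.jv12, FD.jv22, FD.jv1t, FD.jv2t, FD.jw, FD.jw1, FD.jw2, FD.jwt, FD.jw11, FD.jw12, FD.jw22, FD.jw1t, FD.jw2t, FD.jθ, FD.jθ1, FD.jθ2, FD.jθt, FD.jθ11, FD.jθ12, FD.jθ22, FD.jθ1t, FD.jθ2t, FD.jbR, FD.jbτ, FD.jbR2, FD.jbτ2, FD.jbR22, FD.jby F (t, x), FD.jbs, FD.jbi F (t, x), FD.jbe F (t, x)]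
    generalize jq F.φ (t, x) = φ at *
    generalize jq F.v (t, x) = v at *
    generalize jq F.w (t, x) = w at *
    generalize jq F.θ (t, x) = θ at *
    generalize F.bg (t, x) = B at *
    linear_combination hp
  simp only [I_add, I_cst_mul] at h1 h2 h3
  have n1 : 0 ≤ I F.s t := I_nonneg fun x _ => F.s_nonneg _
  have n2 : 0 ≤ I F.Dr t := I_nonneg fun x _ => by
    have : 0 ≤ F.i := by have := hF.e0; unfold FD.i; positivity
    simp only [FD.Dr, ev_add, ev_mul, ev_pow, ev_cst]; positivity
  have h4 : I (cst F.i * (cst F.i * (D1 F.φ) ^ 2)) t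
    ≤ 320000 * ((96 * M ^ 2) * I F.Dr t + M ^ k * F.ε * I F.s t) + 512 * I F.Dr t := by
    simp only [I_cst_mul]; linarith
  have M2 := hF.cs.m2
  have he := hF.e0
  have m1 : (1 : ℝ) ≤ M ^ k := one_le_pow₀ (by linarith)
  have m2 : (536870912 : ℝ) ≤ M ^ 29 := by
    calc (536870912 : ℝ) = 2 ^ 29 := by norm_num
      _ ≤ _ := by gcongr
  have m3 : (67108864 : ℝ) * M ^ 2 ≤ M ^ 30 := by
    calc (67108864 : ℝ) * M ^ 2 ≤ 2 ^ 28 * M ^ 2 := by gcongr; norm_num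
      _ ≤ M ^ 28 * M ^ 2 := by gcongr
      _ = _ := by ring
  have m4 : (4 : ℝ) ≤ M ^ 2 := by nlinarith
  have m5 : M ^ 30 ≤ M ^ (k + 30) := pow_le_pow_right₀ (by linarith) (by omega)
  have m6 : 320000 * M ^ k ≤ M ^ (k + 30) := by
    rw [pow_add, mul_comm]; gcongr; nlinarith
  have c1 : 320000 * (96 * M ^ 2) + 512 ≤ M ^ (k + 30) := by linarith
  have c2 := mul_le_mul_of_nonneg_right c1 n2
  have c3 := mul_le_mul_of_nonneg_right m6 (mul_nonneg he.le n1)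
  linarith

theorem comb_arith {c N K0 K1 ε X0 X1 Xt Y1 Z2 Zf S d0 d1 dd1 ddt d2 : ℝ} (hc : 0 < c) (hc1 : c ≤ 1)
    (hN : 1 ≤ N) (hK1 : K1 * c = N + 1) (hK1' : 0 ≤ K1) (hK0 : K1 * N + N + 1 ≤ K0) (hε : 0 ≤ ε)
    (x0 : 0 ≤ X0) (x1 : 0 ≤ X1) (xt : 0 ≤ Xt) (y1 : 0 ≤ Y1) (z2 : 0 ≤ Z2) (hS0 : 0 ≤ S)
    (e1 : N ^ 2 * ε ≤ 1 / 2) (e2 : (K0 + 2 * K1 + 2) * N * ε * (2 * N * (1 + N)) ≤ c / 2)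
    (h0 : d0 + X0 ≤ N * ε * S) (h1 : d1 + c * Y1 ≤ N * X0 + N * ε * S)
    (hd1 : dd1 + c * X1 ≤ N * ε * S) (hdt : ddt + c * Xt ≤ N * ε * S)
    (h2 : d2 + c * Z2 ≤ N * (Y1 + X1 + X0) + N * ε * S)
    (hf : Zf ≤ N * (X1 + Y1 + X0 + Z2) + N * ε * S)
    (hS : S ≤ N * (X0 + X1 + Xt + Y1 + Z2 + Zf)) :
    K0 * d0 + K1 * (d1 + dd1) + ddt + d2 ≤ -(c / 2) * Xt := by
  set Q := X0 + X1 + Xt + Y1 + Z2 with hQ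
  have q0 : 0 ≤ Q := by positivity
  have f1 : Zf ≤ N * Q + N * ε * S := by
    have : 0 ≤ N * Xt := by positivity
    linarith
  have f2 : N * Zf ≤ N * (N * Q) + N ^ 2 * ε * S := by
    have := mul_le_mul_of_nonneg_left f1 (by linarith : 0 ≤ N)
    linarith
  have f3 : N ^ 2 * ε * S ≤ 1 / 2 * S := by gcongr
  have f4 : S ≤ 2 * N * (1 + N) * Q := by linarith
  have hK0' : 0 ≤ K0 := le_trans (by positivity) hK0
  have f5 : (K0 + 2 * K1 + 2) * (N * ε * S) ≤ c / 2 * Q := by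
    calc (K0 + 2 * K1 + 2) * (N * ε * S) = ((K0 + 2 * K1 + 2) * N * ε) * S := by ring
      _ ≤ ((K0 + 2 * K1 + 2) * N * ε) * (2 * N * (1 + N) * Q) := by gcongr
      _ = ((K0 + 2 * K1 + 2) * N * ε * (2 * N * (1 + N))) * Q := by ring
      _ ≤ _ := by gcongr
  have g0 := mul_le_mul_of_nonneg_left h0 hK0'
  have g1 := mul_le_mul_of_nonneg_left h1 hK1'
  have g2 := mul_le_mul_of_nonneg_left hd1 hK1'
  have g3 := mul_le_mul_of_nonneg_right hK0 x0
  have a1 : K1 * (d1 + c * Y1) = K1 * d1 + (N + 1) * Y1 := by rw [← hK1]; ring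
  have a2 : K1 * (dd1 + c * X1) = K1 * dd1 + (N + 1) * X1 := by rw [← hK1]; ring
  rw [a1] at g1
  rw [a2] at g2
  have b0 : c * X0 ≤ 1 * X0 := by gcongr
  have b1 : c * X1 ≤ 1 * X1 := by gcongr
  have b2 : c * Y1 ≤ 1 * Y1 := by gcongr
  have b3 : c / 2 * Xt ≤ c / 2 * Q := by
    have : Xt ≤ Q := by linarith
    gcongr
  have f6 : c * Q = c * X0 + c * X1 + c * Xt + c * Y1 + c * Z2 := by rw [hQ]; ring
  linarith

namespace FD
variable (F : FD) (t : ℝ)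
def X0 : ℝ := F.i * I F.gψ t + F.i * (F.i * I F.gθ t)
def X1 : ℝ := I F.L1.dψ t + F.i * I F.L1.dθ t
def Xt : ℝ := I F.Lt.dψ t + F.i * I F.Lt.dθ t
def Y1 : ℝ := I ((Dt F.v) ^ 2) t + I ((Dt F.w) ^ 2) t + F.i * I ((Dt F.θ) ^ 2) t
def Z2 : ℝ := F.i * (F.i * I ((D2 F.φ) ^ 2) t)
def Zf : ℝ := F.i * (F.i * I ((D1 F.φ) ^ 2) t)
end FD

theorem FD.i_nonneg (F : FD) : 0 ≤ F.i := by unfold FD.i; positivity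

theorem nn4 (a b c d : Sm) (t : ℝ) : 0 ≤ I (a ^ 2 + b ^ 2 + c ^ 2 + d ^ 2) t := by
  simp only [I_add]
  have := I_sq_nonneg a t; have := I_sq_nonneg b t; have := I_sq_nonneg c t; have := I_sq_nonneg d t
  positivity
theorem nn2 (a b : Sm) (t : ℝ) : 0 ≤ I (a ^ 2 + b ^ 2) t := by
  simp only [I_add]
  have := I_sq_nonneg a t; have := I_sq_nonneg b t
  positivity

theorem FD.X0_nn (F : FD) (t : ℝ) : 0 ≤ F.X0 t := by
  have := F.i_nonneg
  have h1 : 0 ≤ I F.gψ t := nn4 _ _ _ _ t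
  have h2 : 0 ≤ I F.gθ t := nn2 _ _ t
  unfold FD.X0; positivity
theorem FD.X1_nn (F : FD) (t : ℝ) : 0 ≤ F.X1 t := by
  have := F.i_nonneg
  have h1 : 0 ≤ I F.L1.dψ t := nn4 _ _ _ _ t
  have h2 : 0 ≤ I F.L1.dθ t := nn2 _ _ t
  unfold FD.X1; positivity
theorem FD.Xt_nn (F : FD) (t : ℝ) : 0 ≤ F.Xt t := by
  have := F.i_nonneg
  have h1 : 0 ≤ I F.Lt.dψ t := nn4 _ _ _ _ t
  have h2 : 0 ≤ I F.Lt.dθ t := nn2 _ _ t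
  unfold FD.Xt; positivity
theorem FD.Y1_nn (F : FD) (t : ℝ) : 0 ≤ F.Y1 t := by
  have := F.i_nonneg
  have h1 := I_sq_nonneg (Dt F.v) t
  have h2 := I_sq_nonneg (Dt F.w) t
  have h3 := I_sq_nonneg (Dt F.θ) t
  unfold FD.Y1; positivity
theorem FD.Z2_nn (F : FD) (t : ℝ) : 0 ≤ F.Z2 t := by
  have := F.i_nonneg
  have h1 := I_sq_nonneg (D2 F.φ) t
  unfold FD.Z2; positivity
theorem FD.Zf_nn (F : FD) (t : ℝ) : 0 ≤ F.Zf t := by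
  have := F.i_nonneg
  have h1 := I_sq_nonneg (D1 F.φ) t
  unfold FD.Zf; positivity
theorem FD.S_nn (F : FD) (t : ℝ) : 0 ≤ I F.s t := I_nonneg fun x _ => F.s_nonneg _

theorem FD.iab (F : FD) : (F.ε ^ 4)⁻¹ = F.i * F.i := by
  unfold FD.i; rw [← mul_inv]; congr 1; ring

theorem S_le {a b κ g K M : ℝ} {F : FD} (hF : Flow a b κ g K M F) (hT : 0 < F.T) {t : ℝ}
    (ht : t ∈ Set.Icc 0 F.T) :
    I F.s t ≤ 101 * (F.X0 t + F.X1 t + F.Xt t + F.Y1 t + F.Z2 t + F.Zf t) := by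
  have i0 := F.i_nonneg
  have hie : F.i * F.ε ^ 2 = 1 := inv_mul_cancel₀ (pow_ne_zero 2 hF.e0.ne')
  have pv := mul_le_mul_of_nonneg_left (poincareD (hF.wv t ht)) i0
  have pw := mul_le_mul_of_nonneg_left (poincareD (hF.ww t ht)) i0
  have pθ := mul_le_mul_of_nonneg_left (poincareD (hF.wθ t ht)) (mul_nonneg i0 i0)
  have pφ := mul_le_mul_of_nonneg_left (poincareM F.φ (hF.mean hT t ht)) (mul_nonneg i0 i0)
  have hs : I F.s t = F.i * (I (F.v ^ 2) t + I (F.w ^ 2) t) + F.i * F.i * I (F.θ ^ 2) t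
      + F.i * F.i * I (F.φ ^ 2) t + F.X0 t + F.X1 t + F.Xt t + F.Y1 t + F.Z2 t + F.Zf t := by
    have e1 : F.Lt.dψ = cst (F.ε ^ 2) * ((D1 (Dt F.v)) ^ 2 + (D2 (Dt F.v)) ^ 2 + (D1 (Dt F.w)) ^ 2 + (D2 (Dt F.w)) ^ 2) := by
      apply Sm.ext'; intro p
      simp only [LF.dψ, FD.Lt, D1_mul, D2_mul, D1_cst, D2_cst, ev_add, ev_mul, ev_pow, ev_cst, ev_zero]
      ring
    have e2 : F.Lt.dθ = cst (F.ε ^ 2) * ((D1 (Dt F.θ)) ^ 2 + (D2 (Dt F.θ)) ^ 2) := by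
      apply Sm.ext'; intro p
      simp only [LF.dθ, FD.Lt, D1_mul, D2_mul, D1_cst, D2_cst, ev_add, ev_mul, ev_pow, ev_cst, ev_zero]
      ring
    simp only [FD.X0, FD.X1, FD.Xt, FD.Y1, FD.Z2, FD.Zf, e1, e2]
    simp only [FD.s, FD.gψ, FD.gθ, LF.dψ, LF.dθ, FD.L1, D2_D1, I_add, I_cst_mul, F.iab]
    rw [show (F.ε ^ 2)⁻¹ = F.i from rfl]
    linear_combination (-(I ((D1 (Dt F.θ)) ^ 2) t + I ((D2 (Dt F.θ)) ^ 2) t)) * hie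
  have u1 : 4 * (F.i * (I ((D2 F.v) ^ 2) t + I ((D2 F.w) ^ 2) t)) + 4 * (F.i * (F.i * I ((D2 F.θ) ^ 2) t)) ≤ 4 * F.X0 t := by
    simp only [FD.X0, FD.gψ, FD.gθ, I_add]
    have a1 := mul_nonneg i0 (I_sq_nonneg (D1 F.v) t)
    have a2 := mul_nonneg i0 (I_sq_nonneg (D1 F.w) t)
    have a3 := mul_nonneg i0 (mul_nonneg i0 (I_sq_nonneg (D1 F.θ) t))
    linarith
  have u2 : F.i * F.i * (100 * (I ((D1 F.φ) ^ 2) t + I ((D2 F.φ) ^ 2) t)) = 100 * (F.Z2 t + F.Zf t) := by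
    simp only [FD.Z2, FD.Zf]; ring
  have := F.X0_nn t
  have := F.X1_nn t
  have := F.Xt_nn t
  have := F.Y1_nn t
  rw [hs]
  linarith

/-- pointwise comparison of the weighted energy with the norm -/
def FD.en (F : FD) (a b κ g K0 K1 : ℝ) : Sm :=
  cst K0 * (cst F.i * F.e0 g) + cst K1 * (F.e1e a b κ + F.L1.e F g) + F.Lt.e F g + F.e2e

theorem c0_arith {a κ A i θ v w v1 v2 w1 w2 t1 t2 d E N : ℝ} (hA : 0 ≤ A) (i0 : 0 ≤ i)
    (ha : 5 * A + 1 ≤ a / 2) (hκ : 4 * A + 1 ≤ κ / 4)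
    (v10 : 0 ≤ v1) (v20 : 0 ≤ v2) (w10 : 0 ≤ w1) (w20 : 0 ≤ w2) (t10 : 0 ≤ t1) (t20 : 0 ≤ t2)
    (pv : v ≤ 4 * v2) (pw : w ≤ 4 * w2) (pt : θ ≤ 4 * t2)
    (h : d + (a / 2 * (i * (v1 + v2 + w1 + w2)) + κ / 4 * (i * (i * (t1 + t2))))
      ≤ A * (i * (i * θ + v + w + v1 + w2)) + E) (hE : E ≤ N) :
    d + (i * (v1 + v2 + w1 + w2) + i * (i * (t1 + t2))) ≤ N := by
  have h1 : (5 * A + 1) * (i * (v1 + v2 + w1 + w2)) ≤ a / 2 * (i * (v1 + v2 + w1 + w2)) := by gcongr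
  have h2 : (4 * A + 1) * (i * (i * (t1 + t2))) ≤ κ / 4 * (i * (i * (t1 + t2))) := by gcongr
  have h3 : A * (i * (i * θ + v + w + v1 + w2))
      ≤ A * (i * (i * (4 * t2) + 4 * v2 + 4 * w2 + v1 + w2)) := by gcongr
  have h4 : A * (i * (i * (4 * t2) + 4 * v2 + 4 * w2 + v1 + w2))
      ≤ A * (i * (i * (4 * (t1 + t2)) + 5 * (v1 + v2 + w1 + w2))) := by
    have : i * (4 * t2) ≤ i * (4 * (t1 + t2)) := mul_le_mul_of_nonneg_left (by linarith) i0
    refine mul_le_mul_of_nonneg_left (mul_le_mul_of_nonneg_left (by linarith) i0) hA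
  linarith

theorem c0 : ∃ k : ℕ, ∀ {a b κ g K M : ℝ} {F : FD} (hF : Flow a b κ g K M F)
    (ha : 5 * (4 + 2 * K + 8 * g * K + 16 * K) + 1 ≤ a / 2)
    (hκ : 4 * (4 + 2 * K + 8 * g * K + 16 * K) + 1 ≤ κ / 4) {N : ℝ} (hN : M ^ k ≤ N) {t : ℝ}
    (ht : t ∈ Set.Icc 0 F.T),
    F.i * I (Dt (F.e0 g)) t + F.X0 t ≤ N * F.ε * I F.s t := by
  obtain ⟨k, hk⟩ := E0_int
  refine ⟨k, fun {a b κ g K M F} hF ha hκ {N} hN {t} ht => ?_⟩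
  have h := hk hF ht
  have e0 := hF.e0
  have g0 := hF.cs.g0
  have k1 := hF.cs.k1
  simp only [mul_assoc (cst (M ^ k)), I_add, I_cst_mul, FD.gψ, FD.gθ, mul_assoc (M ^ k)] at h
  simp only [FD.X0, FD.gψ, FD.gθ, I_add]
  refine c0_arith ?_ F.i_nonneg ha hκ (I_sq_nonneg _ _) (I_sq_nonneg _ _) (I_sq_nonneg _ _)
    (I_sq_nonneg _ _) (I_sq_nonneg _ _) (I_sq_nonneg _ _) (poincareD (hF.wv t ht))
    (poincareD (hF.ww t ht)) (poincareD (hF.wθ t ht)) h ?_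
  · positivity
  · rw [mul_assoc N]
    have := F.S_nn t
    gcongr

theorem ErrN {k : ℕ} {M N : ℝ} {F : FD} {t : ℝ} (e0 : 0 < F.ε) (hN : M ^ k ≤ N) :
    I (cst (M ^ k) * cst F.ε * F.s) t ≤ N * F.ε * I F.s t := by
  simp only [mul_assoc (cst (M ^ k)), I_cst_mul]
  rw [mul_assoc N]
  have := F.S_nn t
  gcongr

theorem c1_arith {c N i A a1 a2 a3 q X d E : ℝ} (i0 : 0 ≤ i) (h1 : 0 ≤ a1) (h2 : 0 ≤ a2) (h3 : 0 ≤ a3)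
    (hc : c ≤ 1 / 4) {g : ℝ} (hg : c ≤ g / 8) (hA : A ≤ N) (hA0 : 0 ≤ A) (q0 : q ≤ X) (X0 : 0 ≤ X)
    (h : d + (1 / 4 * (a1 + a2) + g / 8 * (i * a3)) ≤ A * q + E) :
    d + c * (a1 + a2 + i * a3) ≤ N * X + E := by
  have u1 : c * (a1 + a2) ≤ 1 / 4 * (a1 + a2) := by gcongr
  have u2 : c * (i * a3) ≤ g / 8 * (i * a3) := by gcongr
  have u3 : A * q ≤ A * X := by gcongr
  have u4 : A * X ≤ N * X := by gcongr
  linarith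

theorem c1 : ∃ k : ℕ, ∀ {a b κ g K M : ℝ} {F : FD} (hF : Flow a b κ g K M F) (hT : 0 < F.T)
    {N c : ℝ} (hN : M ^ k ≤ N) (hN' : 32 + 1600 * g⁻¹ ≤ N) (hc : c ≤ 1 / 4) (hg : c ≤ g / 8) {t : ℝ}
    (ht : t ∈ Set.Icc 0 F.T),
    I (Dt (F.e1e a b κ)) t + c * F.Y1 t ≤ N * F.X0 t + N * F.ε * I F.s t := by
  obtain ⟨k, hk⟩ := E1_int
  refine ⟨k, fun {a b κ g K M F} hF hT {N c} hN hN' hc hg {t} ht => ?_⟩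
  have h := hk hF hT ht
  have g0 := hF.cs.g0
  have i0 := F.i_nonneg
  rw [I_add, I_add (cst _ * (cst _ * _))] at h
  have h' := h.trans (add_le_add_right (ErrN hF.e0 hN) _)
  clear h
  simp only [I_add, I_cst_mul] at h'
  have hq : 0 ≤ I F.gθ t := nn2 _ _ t
  have hq' : 0 ≤ I F.gψ t := nn4 _ _ _ _ t
  refine c1_arith i0 (I_sq_nonneg _ _) (I_sq_nonneg _ _) (I_sq_nonneg _ _) hc hg hN' (by positivity)
    ?_ (F.X0_nn t) h'
  unfold FD.X0
  have : 0 ≤ F.i * (F.i * I F.gθ t) := by positivity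
  linarith

theorem cd_arith {c i p q d E a κ : ℝ} (i0 : 0 ≤ i) (p0 : 0 ≤ p) (q0 : 0 ≤ q) (ha : c ≤ a / 2) (hκ : c ≤ κ / 4)
    (h : d + (a / 2 * p + κ / 4 * (i * q)) ≤ E) : d + c * (p + i * q) ≤ E := by
  have u1 : c * p ≤ a / 2 * p := by gcongr
  have u2 : c * (i * q) ≤ κ / 4 * (i * q) := by gcongr
  linarith

theorem cd1 : ∃ k : ℕ, ∀ {a b κ g K M : ℝ} {F : FD} (hF : Flow a b κ g K M F) (hT : 0 < F.T)
    {N c : ℝ} (hN : M ^ k ≤ N) (ha : c ≤ a / 2) (hκ : c ≤ κ / 4) {t : ℝ}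
    (ht : t ∈ Set.Icc 0 F.T),
    I (Dt (F.L1.e F g)) t + c * F.X1 t ≤ N * F.ε * I F.s t := by
  obtain ⟨k, hk⟩ := Flow.ed1
  refine ⟨k, fun {a b κ g K M F} hF hT {N c} hN ha hκ {t} ht => ?_⟩
  have h := (hk hF hT ht).trans (ErrN hF.e0 hN)
  simp only [I_add, I_cst_mul] at h
  exact cd_arith F.i_nonneg (nn4 _ _ _ _ t) (nn2 _ _ t) ha hκ h

theorem cdt : ∃ k : ℕ, ∀ {a b κ g K M : ℝ} {F : FD} (hF : Flow a b κ g K M F) (hT : 0 < F.T)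
    {N c : ℝ} (hN : M ^ k ≤ N) (ha : c ≤ a / 2) (hκ : c ≤ κ / 4) {t : ℝ}
    (ht : t ∈ Set.Icc 0 F.T),
    I (Dt (F.Lt.e F g)) t + c * F.Xt t ≤ N * F.ε * I F.s t := by
  obtain ⟨k, hk⟩ := Flow.edt
  refine ⟨k, fun {a b κ g K M F} hF hT {N c} hN ha hκ {t} ht => ?_⟩
  have h := (hk hF hT ht).trans (ErrN hF.e0 hN)
  simp only [I_add, I_cst_mul] at h
  exact cd_arith F.i_nonneg (nn4 _ _ _ _ t) (nn2 _ _ t) ha hκ h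

theorem c2_arith {c N m a d z y p q t X Y1 X1 E : ℝ} (m0 : 0 ≤ m) (hm : c ≤ m * (1 / 32)) (z0 : 0 ≤ z)
    (hN : m * (512 * (16 + a ^ 2)) ≤ N) (hy : y ≤ Y1) (hp : p + q ≤ X1) (ht : t ≤ X)
    (X0 : 0 ≤ X) (Y0 : 0 ≤ Y1) (X10 : 0 ≤ X1)
    (h : d + m * (1 / 32 * z) ≤ m * (512 * (16 * y + a ^ 2 * (p + q) + 16 * t)) + E) :
    d + c * z ≤ N * (Y1 + X1 + X) + E := by
  have u1 : c * z ≤ m * (1 / 32) * z := by gcongr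
  have u2 : m * (512 * (16 * y + a ^ 2 * (p + q) + 16 * t)) ≤ m * (512 * (16 * Y1 + a ^ 2 * X1 + 16 * X)) := by
    gcongr
  have u3 : 16 * Y1 + a ^ 2 * X1 + 16 * X ≤ (16 + a ^ 2) * (Y1 + X1 + X) := by
    have : 0 ≤ a ^ 2 * (Y1 + X) := by positivity
    linarith
  have u4 : m * (512 * (16 * Y1 + a ^ 2 * X1 + 16 * X)) ≤ m * (512 * ((16 + a ^ 2) * (Y1 + X1 + X))) := by gcongr
  have u5 : m * (512 * (16 + a ^ 2)) * (Y1 + X1 + X) ≤ N * (Y1 + X1 + X) := by gcongr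
  linarith

theorem c2 : ∃ k : ℕ, ∀ {a b κ g K M : ℝ} {F : FD} (hF : Flow a b κ g K M F) (hT : 0 < F.T)
    {N c : ℝ} (hN : M ^ k ≤ N) (hN' : (a + b)⁻¹ * (512 * (16 + a ^ 2)) ≤ N)
    (hc : c ≤ (a + b)⁻¹ * (1 / 32)) {t : ℝ} (ht : t ∈ Set.Icc 0 F.T),
    I (Dt F.e2e) t + c * F.Z2 t ≤ N * (F.Y1 t + F.X1 t + F.X0 t) + N * F.ε * I F.s t := by
  obtain ⟨k, hk⟩ := E2_int
  refine ⟨k, fun {a b κ g K M F} hF hT {N c} hN hN' hc {t} ht => ?_⟩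
  have h := hk hF hT ht
  have a0 := hF.cs.a0
  have b0 := hF.cs.b0
  have i0 := F.i_nonneg
  rw [I_add, I_add (cst _ * (cst _ * _))] at h
  have h' := h.trans (add_le_add_right (ErrN hF.e0 hN) _)
  clear h
  simp only [I_add, I_cst_mul] at h'
  have n1 := I_sq_nonneg (D1 F.v) t
  have n2 := I_sq_nonneg (D2 F.v) t
  have n3 := I_sq_nonneg (D1 F.w) t
  have n4 := I_sq_nonneg (D2 F.w) t
  have n5 := I_sq_nonneg (D1 F.θ) t
  have n6 := I_sq_nonneg (Dt F.v) t
  have n7 := I_sq_nonneg (Dt F.θ) t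
  have n8 := I_sq_nonneg (D1 (D1 F.v)) t
  have n9 := I_sq_nonneg (D1 (D2 F.w)) t
  have n10 : 0 ≤ I F.L1.dθ t := nn2 _ _ t
  have n11 := I_sq_nonneg (D2 F.φ) t
  refine c2_arith (by positivity) hc (F.Z2_nn t) hN' ?_ ?_ ?_ (F.X0_nn t) (F.Y1_nn t) (F.X1_nn t) h'
  · unfold FD.Y1
    have : 0 ≤ F.i * I ((Dt F.θ) ^ 2) t := by positivity
    linarith
  · unfold FD.X1
    have : 0 ≤ F.i * I F.L1.dθ t := by positivity
    simp only [LF.dψ, FD.L1, I_add, D2_D1] at *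
    linarith
  · unfold FD.X0 FD.gψ FD.gθ
    simp only [I_add]
    have : 0 ≤ F.i * (I ((D1 F.v) ^ 2) t + I ((D2 F.v) ^ 2) t + I ((D1 F.w) ^ 2) t + I ((D2 F.w) ^ 2) t) := by positivity
    have : 0 ≤ F.i * (F.i * I ((D1 F.θ) ^ 2) t) := by positivity
    linarith

theorem cf : ∃ k : ℕ, ∀ {a b κ g K M : ℝ} {F : FD} (hF : Flow a b κ g K M F)
    {N : ℝ} (hN : M ^ k ≤ N) {t : ℝ} (ht : t ∈ Set.Icc 0 F.T),
    F.Zf t ≤ N * (F.X1 t + F.Y1 t + F.X0 t + F.Z2 t) + N * F.ε * I F.s t := by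
  obtain ⟨k, hk⟩ := D_int
  refine ⟨k, fun {a b κ g K M F} hF {N} hN {t} ht => ?_⟩
  have h := hk hF ht
  have e0 := hF.e0
  have i0 := F.i_nonneg
  have m0 : 0 ≤ M := by linarith [hF.cs.m2]
  have s0 := F.S_nn t
  have hD : I F.Dr t ≤ F.X1 t + F.Y1 t + F.X0 t + F.Z2 t := by
    have n1 := I_sq_nonneg (D1 F.v) t
    have n2 := I_sq_nonneg (D2 F.v) t
    have n3 := I_sq_nonneg (D1 F.w) t
    have n4 := I_sq_nonneg (D2 F.w) t
    have n6 := I_sq_nonneg (Dt F.w) t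
    have n7 := I_sq_nonneg (Dt F.θ) t
    have n8 := I_sq_nonneg (D1 (D1 F.w)) t
    have n10 := I_sq_nonneg (D1 (D1 F.θ)) t
    have n11 := I_sq_nonneg (D1 (D2 F.θ)) t
    have q1 : 0 ≤ F.i * (I ((D1 F.v) ^ 2) t + I ((D2 F.v) ^ 2) t + I ((D1 F.w) ^ 2) t + I ((D2 F.w) ^ 2) t) := by positivity
    have q2 : 0 ≤ F.i * (I ((D1 (D1 F.θ)) ^ 2) t + I ((D1 (D2 F.θ)) ^ 2) t) := by positivity
    have q3 : 0 ≤ F.i * I ((Dt F.θ) ^ 2) t := by positivity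
    simp only [FD.Dr, FD.X0, FD.X1, FD.Y1, FD.Z2, FD.gψ, FD.gθ, LF.dψ, LF.dθ, FD.L1, I_add, I_cst_mul, D2_D1]
    linarith
  have hX : 0 ≤ F.X1 t + F.Y1 t + F.X0 t + F.Z2 t := by
    have := F.X0_nn t; have := F.X1_nn t; have := F.Y1_nn t; have := F.Z2_nn t
    positivity
  simp only [I_cst_mul] at h
  refine h.trans (add_le_add ?_ ?_)
  · calc M ^ k * I F.Dr t ≤ M ^ k * (F.X1 t + F.Y1 t + F.X0 t + F.Z2 t) := by gcongr
      _ ≤ _ := by gcongr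
  · gcongr

theorem Dt_cmul (c : ℝ) (f : Sm) : Dt (cst c * f) = cst c * Dt f := by
  rw [Dt_mul, Dt_cst, mul_zero, add_zero]

theorem quadL {ρ R x y : ℝ} (hρ : 1 / 4 ≤ ρ) (hR : 1 / 2 ≤ R) :
    1 / 16 * (x ^ 2 + y ^ 2) ≤ 1 / 2 * (ρ * R * (x * x + y * y)) := by
  have : 1 / 8 ≤ ρ * R := by nlinarith
  have h : 1 / 8 * (x * x + y * y) ≤ ρ * R * (x * x + y * y) := by gcongr; nlinarith
  linarith
theorem quadU {ρ R x y : ℝ} (hρ : 1 / 4 ≤ ρ) (hR : 1 / 2 ≤ R) (hρ' : ρ ≤ 4) (hR' : R ≤ 2) :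
    1 / 2 * (ρ * R * (x * x + y * y)) ≤ 4 * (x ^ 2 + y ^ 2) := by
  have : ρ * R ≤ 8 := by nlinarith
  have h : ρ * R * (x * x + y * y) ≤ 8 * (x * x + y * y) := by gcongr; nlinarith
  linarith
theorem quadθL {i g ρ R x : ℝ} (i0 : 0 ≤ i) (g0 : 0 ≤ g) (hρ : 1 / 4 ≤ ρ) (hR : 1 / 2 ≤ R) :
    g / 32 * (i * x ^ 2) ≤ 1 / 2 * i * g * (ρ * (R * R) * (x * x)) := by
  have h1 : 1 / 4 ≤ R * R := by nlinarith
  have : 1 / 16 ≤ ρ * (R * R) := by nlinarith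
  have h : 1 / 2 * i * g * (1 / 16 * (x * x)) ≤ 1 / 2 * i * g * (ρ * (R * R) * (x * x)) := by
    have := mul_self_nonneg x
    gcongr
  linarith
theorem quadθU {i g ρ R x : ℝ} (i0 : 0 ≤ i) (g0 : 0 ≤ g) (hρ : 1 / 4 ≤ ρ) (hR : 1 / 2 ≤ R) (hρ' : ρ ≤ 4)
    (hR' : R ≤ 2) :
    1 / 2 * i * g * (ρ * (R * R) * (x * x)) ≤ 8 * g * (i * x ^ 2) := by
  have h1 : R * R ≤ 4 := by nlinarith
  have : ρ * (R * R) ≤ 16 := by nlinarith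
  have h : 1 / 2 * i * g * (ρ * (R * R) * (x * x)) ≤ 1 / 2 * i * g * (16 * (x * x)) := by
    have := mul_self_nonneg x
    gcongr
  linarith
theorem quadφL {τ φ : ℝ} (hτ : 1 / 2 ≤ τ) (hτ' : τ ≤ 2) (hφ : |φ| ≤ 1 / 4) :
    1 / 8 * φ ^ 2 ≤ 1 / 2 * (τ * (φ * φ)) - 1 / 6 * (τ * τ * (φ * φ * φ)) := by
  obtain ⟨h1, h2⟩ := abs_le.1 hφ
  have hz : τ * φ ≤ 1 / 2 := by nlinarith
  have h3 : 5 / 12 ≤ 1 / 2 - 1 / 6 * (τ * φ) := by linarith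
  have h4 : 1 / 8 ≤ τ * (1 / 2 - 1 / 6 * (τ * φ)) := by nlinarith
  have h5 : 1 / 8 * φ ^ 2 ≤ τ * (1 / 2 - 1 / 6 * (τ * φ)) * φ ^ 2 := by gcongr
  linarith
theorem quadφU {τ φ : ℝ} (hτ : 1 / 2 ≤ τ) (hτ' : τ ≤ 2) (hφ : |φ| ≤ 1 / 4) :
    1 / 2 * (τ * (φ * φ)) - 1 / 6 * (τ * τ * (φ * φ * φ)) ≤ 2 * φ ^ 2 := by
  obtain ⟨h1, h2⟩ := abs_le.1 hφ
  have hz : -(1 / 2) ≤ τ * φ := by nlinarith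
  have h3 : 1 / 2 - 1 / 6 * (τ * φ) ≤ 1 := by linarith
  have h4 : τ * (1 / 2 - 1 / 6 * (τ * φ)) ≤ 2 := by nlinarith
  have h5 : τ * (1 / 2 - 1 / 6 * (τ * φ)) * φ ^ 2 ≤ 2 * φ ^ 2 := by gcongr
  linarith

theorem coer_e0 {i g ρ R τ φ v w θ : ℝ} (i0 : 0 ≤ i) (g0 : 0 ≤ g) (hρ : 1 / 4 ≤ ρ) (hR : 1 / 2 ≤ R)
    (hρ' : ρ ≤ 4) (hR' : R ≤ 2) (hτ : 1 / 2 ≤ τ) (hτ' : τ ≤ 2) (hφ : |φ| ≤ 1 / 4)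
    {c0 : ℝ} (hc : c0 ≤ 1 / 16) (hcg : c0 ≤ g / 32) {e : ℝ}
    (he : e = 1 / 2 * (ρ * R * (v * v + w * w)) + i * (1 / 2 * (τ * (φ * φ)) - 1 / 6 * (τ * τ * (φ * φ * φ)))
      + 1 / 2 * i * g * (ρ * (R * R) * (θ * θ))) :
    c0 * (i * (v ^ 2 + w ^ 2) + i * i * (φ ^ 2 + θ ^ 2)) ≤ i * e ∧
    i * e ≤ (4 + 8 * g) * (i * (v ^ 2 + w ^ 2) + i * i * (φ ^ 2 + θ ^ 2)) := by
  have a1 := quadL (x := v) (y := w) hρ hR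
  have a2 := quadU (x := v) (y := w) hρ hR hρ' hR'
  have a3 := quadθL (x := θ) i0 g0 hρ hR
  have a4 := quadθU (x := θ) i0 g0 hρ hR hρ' hR'
  have a5 := mul_le_mul_of_nonneg_left (quadφL hτ hτ' hφ) i0
  have a6 := mul_le_mul_of_nonneg_left (quadφU hτ hτ' hφ) i0
  rw [he]
  constructor
  · have b1 : c0 * (v ^ 2 + w ^ 2) ≤ 1 / 16 * (v ^ 2 + w ^ 2) := by gcongr
    have b2 : c0 * (i * θ ^ 2) ≤ g / 32 * (i * θ ^ 2) := by gcongr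
    have b3 : c0 * (i * φ ^ 2) ≤ 1 / 8 * (i * φ ^ 2) := by gcongr; linarith
    have key : c0 * (v ^ 2 + w ^ 2) + c0 * (i * φ ^ 2) + c0 * (i * θ ^ 2) ≤ 1 / 2 * (ρ * R * (v * v + w * w)) + i * (1 / 2 * (τ * (φ * φ)) - 1 / 6 * (τ * τ * (φ * φ * φ)))
      + 1 / 2 * i * g * (ρ * (R * R) * (θ * θ)) := by linarith
    have := mul_le_mul_of_nonneg_left key i0
    refine le_trans (le_of_eq ?_) this
    ring
  · have b1 : 4 * (v ^ 2 + w ^ 2) ≤ (4 + 8 * g) * (v ^ 2 + w ^ 2) := by gcongr; linarith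
    have b2 : 8 * g * (i * θ ^ 2) ≤ (4 + 8 * g) * (i * θ ^ 2) := by gcongr; linarith
    have b3 : 2 * (i * φ ^ 2) ≤ (4 + 8 * g) * (i * φ ^ 2) := by gcongr; linarith
    have key : 1 / 2 * (ρ * R * (v * v + w * w)) + i * (1 / 2 * (τ * (φ * φ)) - 1 / 6 * (τ * τ * (φ * φ * φ)))
      + 1 / 2 * i * g * (ρ * (R * R) * (θ * θ)) ≤ (4 + 8 * g) * (v ^ 2 + w ^ 2) + (4 + 8 * g) * (i * φ ^ 2) + (4 + 8 * g) * (i * θ ^ 2) := by linarith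
    have := mul_le_mul_of_nonneg_left key i0
    refine this.trans (le_of_eq ?_)
    ring

theorem coer_L {i g ρ R τ φ v w θ : ℝ} (i0 : 0 ≤ i) (g0 : 0 ≤ g) (hρ : 1 / 4 ≤ ρ) (hR : 1 / 2 ≤ R)
    (hρ' : ρ ≤ 4) (hR' : R ≤ 2) (hτ : 1 / 2 ≤ τ) (hτ' : τ ≤ 2)
    {c0 : ℝ} (hc : c0 ≤ 1 / 16) (hcg : c0 ≤ g / 32) {e : ℝ}
    (he : e = 1 / 2 * (ρ * R * (v * v + w * w)) + 1 / 2 * i * (τ * (φ * φ))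
      + 1 / 2 * i * g * (ρ * (R * R) * (θ * θ))) :
    c0 * (v ^ 2 + w ^ 2 + i * (φ ^ 2 + θ ^ 2)) ≤ e ∧
    e ≤ (4 + 8 * g) * (v ^ 2 + w ^ 2 + i * (φ ^ 2 + θ ^ 2)) := by
  have a1 := quadL (x := v) (y := w) hρ hR
  have a2 := quadU (x := v) (y := w) hρ hR hρ' hR'
  have a3 := quadθL (x := θ) i0 g0 hρ hR
  have a4 := quadθU (x := θ) i0 g0 hρ hR hρ' hR'
  have p0 : 0 ≤ i * φ ^ 2 := by positivity
  have a5 := mul_le_mul_of_nonneg_right hτ p0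
  have a6 := mul_le_mul_of_nonneg_right hτ' p0
  rw [he]
  constructor
  · have b1 : c0 * (v ^ 2 + w ^ 2) ≤ 1 / 16 * (v ^ 2 + w ^ 2) := by gcongr
    have b2 : c0 * (i * θ ^ 2) ≤ g / 32 * (i * θ ^ 2) := by gcongr
    have b3 : c0 * (i * φ ^ 2) ≤ 1 / 16 * (i * φ ^ 2) := by gcongr
    linarith
  · have b1 : 4 * (v ^ 2 + w ^ 2) ≤ (4 + 8 * g) * (v ^ 2 + w ^ 2) := by gcongr; linarith
    have b2 : 8 * g * (i * θ ^ 2) ≤ (4 + 8 * g) * (i * θ ^ 2) := by gcongr; linarith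
    have b3 : 4 * (i * φ ^ 2) ≤ (4 + 8 * g) * (i * φ ^ 2) := by gcongr; linarith
    linarith

theorem coer_e1 {i a b κ R φ θ T P v1 v2 w1 w2 t1 t2 : ℝ} (i0 : 0 ≤ i) (a0 : 0 ≤ a) (b0 : 0 < b) (κ0 : 0 ≤ κ)
    (hR : 1 / 2 ≤ R) (hR' : R ≤ 2) (hT : 1 / 4 ≤ T) (hT' : T ≤ 4) (hP : P = R * θ + φ * T)
    {e : ℝ} (he : e = 1 / 2 * a * (v1 * v1 + v2 * v2 + w1 * w1 + w2 * w2) + 1 / 2 * b * ((v1 + w2) * (v1 + w2))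
      + 1 / 2 * κ * i * (t1 * t1 + t2 * t2) - i * (P * (v1 + w2))) :
    a / 2 * (v1 ^ 2 + v2 ^ 2 + w1 ^ 2 + w2 ^ 2) + κ / 2 * (i * (t1 ^ 2 + t2 ^ 2))
      - 16 * b⁻¹ * (i * i * (φ ^ 2 + θ ^ 2)) ≤ e ∧
    e ≤ (a / 2 + 2 * b) * (v1 ^ 2 + v2 ^ 2 + w1 ^ 2 + w2 ^ 2) + κ / 2 * (i * (t1 ^ 2 + t2 ^ 2))
      + 16 * b⁻¹ * (i * i * (φ ^ 2 + θ ^ 2)) := by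
  have hP2 : P ^ 2 ≤ 32 * (φ ^ 2 + θ ^ 2) := by
    have h1 : R ^ 2 ≤ 4 := by nlinarith
    have h2 : T ^ 2 ≤ 16 := by nlinarith
    have h3 : R ^ 2 * θ ^ 2 ≤ 4 * θ ^ 2 := by gcongr
    have h4 : T ^ 2 * φ ^ 2 ≤ 16 * φ ^ 2 := by gcongr
    rw [hP]
    have := sq_nonneg (R * θ - φ * T)
    have := sq_nonneg θ
    linarith
  have hk : b⁻¹ * (i * i * P ^ 2) ≤ b⁻¹ * (i * i * (32 * (φ ^ 2 + θ ^ 2))) := by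
    have : 0 ≤ b⁻¹ := by positivity
    have := mul_nonneg i0 i0
    gcongr
  have hb : b * b⁻¹ = 1 := mul_inv_cancel₀ b0.ne'
  have q1 : 0 ≤ b⁻¹ * (b * (v1 + w2) - i * P) ^ 2 := by positivity
  have q2 : 0 ≤ b⁻¹ * (b * (v1 + w2) + i * P) ^ 2 := by positivity
  have r1 : b⁻¹ * (b * (v1 + w2) - i * P) ^ 2 = b * (v1 + w2) ^ 2 - 2 * (i * (P * (v1 + w2))) + b⁻¹ * (i * i * P ^ 2) := by
    linear_combination (b * (v1 + w2) ^ 2 - 2 * (i * (P * (v1 + w2)))) * hb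
  have r2 : b⁻¹ * (b * (v1 + w2) + i * P) ^ 2 = b * (v1 + w2) ^ 2 + 2 * (i * (P * (v1 + w2))) + b⁻¹ * (i * i * P ^ 2) := by
    linear_combination (b * (v1 + w2) ^ 2 + 2 * (i * (P * (v1 + w2)))) * hb
  have d2 : b * (v1 + w2) ^ 2 ≤ b * (2 * (v1 ^ 2 + v2 ^ 2 + w1 ^ 2 + w2 ^ 2)) := by
    gcongr; nlinarith [sq_nonneg (v1 - w2), sq_nonneg v2, sq_nonneg w1]
  rw [he]
  constructor <;> linarith

theorem coer_arith {c0 K0 K1 a κ : ℝ} {A Aφ G Gt F1 F2 Ft b16 e0 e1 el et e2 cc : ℝ}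
    (hA : 0 ≤ A) (hAφ : 0 ≤ Aφ) (hG : 0 ≤ G) (hGt : 0 ≤ Gt) (hF1 : 0 ≤ F1) (hF2 : 0 ≤ F2) (hFt : 0 ≤ Ft)
    (c00 : 0 ≤ c0) (hK1 : 1 ≤ K1) (hb : 0 ≤ b16) (hK0 : K1 * b16 + 1 ≤ K0 * c0) (a0 : 0 ≤ a) (κ0 : 0 ≤ κ)
    (h0 : c0 * (A + Aφ) ≤ e0) (h1 : a * G + κ * Gt - b16 * Aφ ≤ e1) (hl : c0 * F1 ≤ el) (ht : c0 * Ft ≤ et)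
    (h2 : e2 = 1 / 2 * F2) (K00 : 0 ≤ K0)
    (k1 : cc ≤ 1) (k2 : cc ≤ a) (k3 : cc ≤ κ) (k4 : cc ≤ c0) (k5 : cc ≤ 1 / 2) :
    cc * (A + Aφ + G + Gt + F1 + F2 + Ft) ≤ K0 * e0 + K1 * (e1 + el) + et + e2 := by
  have g0 := mul_le_mul_of_nonneg_left h0 K00
  have g1 := mul_le_mul_of_nonneg_left h1 (by linarith : 0 ≤ K1)
  have g2 := mul_le_mul_of_nonneg_left hl (by linarith : 0 ≤ K1)
  have g3 := mul_le_mul_of_nonneg_right hK0 (add_nonneg hA hAφ)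
  have g4 : 0 ≤ K1 * b16 * A := by positivity
  have g5 : a * G ≤ K1 * (a * G) := by
    have : 0 ≤ (K1 - 1) * (a * G) := mul_nonneg (by linarith) (by positivity)
    linarith
  have g6 : κ * Gt ≤ K1 * (κ * Gt) := by
    have : 0 ≤ (K1 - 1) * (κ * Gt) := mul_nonneg (by linarith) (by positivity)
    linarith
  have g7 : c0 * F1 ≤ K1 * (c0 * F1) := by
    have : 0 ≤ (K1 - 1) * (c0 * F1) := mul_nonneg (by linarith) (by positivity)
    linarith
  have m1 : cc * (A + Aφ) ≤ 1 * (A + Aφ) := by gcongr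
  have m2 : cc * G ≤ a * G := by gcongr
  have m3 : cc * Gt ≤ κ * Gt := by gcongr
  have m4 : cc * F1 ≤ c0 * F1 := by gcongr
  have m5 : cc * F2 ≤ 1 / 2 * F2 := by gcongr
  have m6 : cc * Ft ≤ c0 * Ft := by gcongr
  linarith

theorem coerU_arith {C0 K0 K1 a κ : ℝ} {A Aφ G Gt F1 F2 Ft b16 e0 e1 el et e2 : ℝ}
    (hA : 0 ≤ A) (hAφ : 0 ≤ Aφ) (hG : 0 ≤ G) (hGt : 0 ≤ Gt) (hF1 : 0 ≤ F1) (hF2 : 0 ≤ F2) (hFt : 0 ≤ Ft)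
    (hC0 : 0 ≤ C0) (hK1 : 0 ≤ K1) (hb : 0 ≤ b16) (a0 : 0 ≤ a) (κ0 : 0 ≤ κ)
    (h0 : e0 ≤ C0 * (A + Aφ)) (h1 : e1 ≤ a * G + κ * Gt + b16 * Aφ) (hl : el ≤ C0 * (G + F1 + Gt))
    (ht : et ≤ C0 * Ft) (h2 : e2 = 1 / 2 * F2) (K00 : 0 ≤ K0) :
    K0 * e0 + K1 * (e1 + el) + et + e2
      ≤ (K0 * C0 + K1 * (a + κ + b16 + C0) + C0 + 1) * (A + Aφ + G + Gt + F1 + F2 + Ft) := by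
  set n := A + Aφ + G + Gt + F1 + F2 + Ft with hn
  have g0 : e0 ≤ C0 * n := h0.trans (mul_le_mul_of_nonneg_left (by linarith) hC0)
  have g1 : e1 ≤ (a + κ + b16) * n := by
    have u1 : a * G ≤ a * n := mul_le_mul_of_nonneg_left (by linarith) a0
    have u2 : κ * Gt ≤ κ * n := mul_le_mul_of_nonneg_left (by linarith) κ0
    have u3 : b16 * Aφ ≤ b16 * n := mul_le_mul_of_nonneg_left (by linarith) hb
    linarith
  have g2 : el ≤ C0 * n := hl.trans (mul_le_mul_of_nonneg_left (by linarith) hC0)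
  have g3 : et ≤ C0 * n := ht.trans (mul_le_mul_of_nonneg_left (by linarith) hC0)
  have g4 : e2 ≤ n := by linarith
  have k0 := mul_le_mul_of_nonneg_left g0 K00
  have k1 := mul_le_mul_of_nonneg_left (add_le_add g1 g2) hK1
  linarith

theorem en_bd {a b κ g K M : ℝ} {F : FD} (hF : Flow a b κ g K M F) (hKε : K * F.ε ≤ 1 / 4) {t : ℝ}
    (ht : t ∈ Set.Icc 0 F.T) {x : ℝ × ℝ} (hx : x ∈ Ω) {K0 K1 c0 cc : ℝ}
    (c00 : 0 < c0) (hc : c0 ≤ 1 / 16) (hcg : c0 ≤ g / 32) (hK1 : 1 ≤ K1) (K00 : 0 ≤ K0)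
    (hK0 : K1 * (16 * b⁻¹) + 1 ≤ K0 * c0) (k2 : cc ≤ a / 2) (k3 : cc ≤ κ / 2) (k4 : cc ≤ c0) :
    cc * F.nrm.1 (t, x) ≤ (F.en a b κ g K0 K1).1 (t, x) ∧
    (F.en a b κ g K0 K1).1 (t, x) ≤ (K0 * (4 + 8 * g) + K1 * ((a / 2 + 2 * b) + κ / 2 + 16 * b⁻¹ + (4 + 8 * g))
      + (4 + 8 * g) + 1) * F.nrm.1 (t, x) := by
  obtain ⟨Rl, Ru⟩ := hF.Rb t ht x hx
  obtain ⟨τl, τu⟩ := hF.τb t ht x hx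
  obtain ⟨ρl, ρu⟩ := hF.ρb t ht x hx
  obtain ⟨Tl, Tu⟩ := hF.Tb t ht x hx
  have hφ : |F.φ.1 (t, x)| ≤ 1 / 4 := (hF.Lφ t ht x hx).1.trans hKε
  have hRτ := hF.Rτ t ht x hx
  rw [ev_mul] at hRτ
  have i0 := F.i_nonneg
  have g0 := hF.cs.g0.le
  have a0 := hF.cs.a0.le
  have b0 := hF.cs.b0
  have κ0 := hF.cs.κ0.le
  have e0 := hF.e0
  have hie : F.i * F.ε ^ 2 = 1 := inv_mul_cancel₀ (pow_ne_zero 2 hF.e0.ne')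
  obtain ⟨l0, u0⟩ := coer_e0 (e := (F.e0 g).1 (t, x)) i0 g0 ρl Rl ρu Ru τl τu hφ hc hcg
    (v := F.v.1 (t, x)) (w := F.w.1 (t, x)) (θ := F.θ.1 (t, x)) rfl
  obtain ⟨l1, u1⟩ := coer_L (e := (F.L1.e F g).1 (t, x)) i0 g0 ρl Rl ρu Ru τl τu hc hcg
    (φ := (D1 F.φ).1 (t, x)) (v := (D1 F.v).1 (t, x)) (w := (D1 F.w).1 (t, x)) (θ := (D1 F.θ).1 (t, x)) rfl
  obtain ⟨lt, ut⟩ := coer_L (e := (F.Lt.e F g).1 (t, x)) i0 g0 ρl Rl ρu Ru τl τu hc hcg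
    (φ := F.ε * (Dt F.φ).1 (t, x)) (v := F.ε * (Dt F.v).1 (t, x)) (w := F.ε * (Dt F.w).1 (t, x))
    (θ := F.ε * (Dt F.θ).1 (t, x)) rfl
  obtain ⟨le, ue⟩ := coer_e1 (e := (F.e1e a b κ).1 (t, x)) i0 a0 b0 κ0 Rl Ru Tl Tu
    (P := F.ρ.1 (t, x) * F.Tm.1 (t, x) - 1) (φ := F.φ.1 (t, x)) (θ := F.θ.1 (t, x))
    (v1 := (D1 F.v).1 (t, x)) (v2 := (D2 F.v).1 (t, x)) (w1 := (D1 F.w).1 (t, x)) (w2 := (D2 F.w).1 (t, x))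
    (t1 := (D1 F.θ).1 (t, x)) (t2 := (D2 F.θ).1 (t, x))
    (by simp only [FD.ρ, FD.Tm, ev_add]; linear_combination hRτ) rfl
  have e2 : F.e2e.1 (t, x) = 1 / 2 * (F.i * (D2 F.φ).1 (t, x) ^ 2) := by
    simp only [FD.e2e, ev_mul, ev_cst]; ring
  have ha : (F.en a b κ g K0 K1).1 (t, x) = K0 * (F.i * (F.e0 g).1 (t, x))
      + K1 * ((F.e1e a b κ).1 (t, x) + (F.L1.e F g).1 (t, x)) + (F.Lt.e F g).1 (t, x) + F.e2e.1 (t, x) := rfl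
  have hn : F.nrm.1 (t, x) = F.i * (F.v.1 (t, x) ^ 2 + F.w.1 (t, x) ^ 2)
      + F.i * F.i * (F.φ.1 (t, x) ^ 2 + F.θ.1 (t, x) ^ 2)
      + ((D1 F.v).1 (t, x) ^ 2 + (D2 F.v).1 (t, x) ^ 2 + (D1 F.w).1 (t, x) ^ 2 + (D2 F.w).1 (t, x) ^ 2)
      + F.i * ((D1 F.θ).1 (t, x) ^ 2 + (D2 F.θ).1 (t, x) ^ 2)
      + F.i * (D1 F.φ).1 (t, x) ^ 2 + F.i * (D2 F.φ).1 (t, x) ^ 2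
      + (F.ε ^ 2 * ((Dt F.v).1 (t, x) ^ 2 + (Dt F.w).1 (t, x) ^ 2) + ((Dt F.φ).1 (t, x) ^ 2 + (Dt F.θ).1 (t, x) ^ 2)) := by
    simp only [FD.nrm, ev_add, ev_mul, ev_cst, ev_pow, F.iab]
    rw [show (F.ε ^ 2)⁻¹ = F.i from rfl]
    ring
  have hFt : (F.ε * (Dt F.v).1 (t, x)) ^ 2 + (F.ε * (Dt F.w).1 (t, x)) ^ 2
      + F.i * ((F.ε * (Dt F.φ).1 (t, x)) ^ 2 + (F.ε * (Dt F.θ).1 (t, x)) ^ 2)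
      = F.ε ^ 2 * ((Dt F.v).1 (t, x) ^ 2 + (Dt F.w).1 (t, x) ^ 2) + ((Dt F.φ).1 (t, x) ^ 2 + (Dt F.θ).1 (t, x) ^ 2) := by
    linear_combination ((Dt F.φ).1 (t, x) ^ 2 + (Dt F.θ).1 (t, x) ^ 2) * hie
  rw [hFt] at lt ut
  rw [ha, hn]
  have ii0 := mul_nonneg i0 i0
  have bi : 0 ≤ 16 * b⁻¹ := by positivity
  constructor
  · refine coer_arith (by positivity) (by positivity) (by positivity) (by positivity) (by positivity)
      (by positivity) (by positivity) c00.le hK1 bi hK0 (by positivity) (by positivity) l0 le ?_ lt e2 K00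
      (by linarith) k2 k3 k4 (by linarith)
    refine le_trans ?_ l1
    have : 0 ≤ F.i * (D1 F.θ).1 (t, x) ^ 2 := by positivity
    have := sq_nonneg ((D1 F.v).1 (t, x))
    have := sq_nonneg ((D1 F.w).1 (t, x))
    refine mul_le_mul_of_nonneg_left ?_ c00.le
    linarith
  · refine coerU_arith (by positivity) (by positivity) (by positivity) (by positivity) (by positivity)
      (by positivity) (by positivity) (by positivity) (by linarith) bi (by positivity) (by positivity) u0 ue ?_ ut e2 K00
    refine u1.trans ?_
    have : 0 ≤ F.i * (D2 F.θ).1 (t, x) ^ 2 := by positivity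
    have := sq_nonneg ((D2 F.v).1 (t, x))
    have := sq_nonneg ((D2 F.w).1 (t, x))
    refine mul_le_mul_of_nonneg_left ?_ (by positivity)
    linarith

theorem decay : ∃ k : ℕ, ∀ {a b κ g K M : ℝ} {F : FD} (hF : Flow a b κ g K M F) (hT : 0 < F.T)
    (ha : 5 * (4 + 2 * K + 8 * g * K + 16 * K) + 1 ≤ a / 2)
    (hκ : 4 * (4 + 2 * K + 8 * g * K + 16 * K) + 1 ≤ κ / 4) {N c K0 K1 : ℝ} (hN : M ^ k ≤ N)
    (hN1 : 32 + 1600 * g⁻¹ ≤ N) (hN2 : (a + b)⁻¹ * (512 * (16 + a ^ 2)) ≤ N) (hN3 : 101 ≤ N)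
    (hc0 : 0 < c) (hc : c ≤ 1 / 4) (hcg : c ≤ g / 8) (hca : c ≤ a / 2) (hcκ : c ≤ κ / 4)
    (hcab : c ≤ (a + b)⁻¹ * (1 / 32)) (hK1 : K1 * c = N + 1) (hK1' : 0 ≤ K1) (hK0 : K1 * N + N + 1 ≤ K0)
    (e1 : N ^ 2 * F.ε ≤ 1 / 2) (e2 : (K0 + 2 * K1 + 2) * N * F.ε * (2 * N * (1 + N)) ≤ c / 2)
    {t : ℝ} (ht : t ∈ Set.Icc 0 F.T),
    I (Dt (F.en a b κ g K0 K1)) t ≤ -(c / 2) * F.Xt t := by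
  obtain ⟨k0, h0⟩ := c0
  obtain ⟨k1, h1⟩ := c1
  obtain ⟨k2, h2⟩ := cd1
  obtain ⟨k3, h3⟩ := cdt
  obtain ⟨k4, h4⟩ := c2
  obtain ⟨k5, h5⟩ := cf
  refine ⟨k0 + k1 + k2 + k3 + k4 + k5, ?_⟩
  intro a b κ g K M F hF hT ha hκ N c K0 K1 hN hN1 hN2 hN3 hc0 hc hcg hca hcκ hcab hK1 hK1' hK0 e1 e2 t ht
  have hM : 1 ≤ M := by linarith [hF.cs.m2]
  have hm : ∀ j, j ≤ k0 + k1 + k2 + k3 + k4 + k5 → M ^ j ≤ N := fun j hj => (pow_le_pow_right₀ hM hj).trans hN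
  have hE : I (Dt (F.en a b κ g K0 K1)) t = K0 * (F.i * I (Dt (F.e0 g)) t)
      + K1 * (I (Dt (F.e1e a b κ)) t + I (Dt (F.L1.e F g)) t) + I (Dt (F.Lt.e F g)) t + I (Dt F.e2e) t := by
    simp only [FD.en, Dt_add, Dt_cmul, I_add, I_cst_mul]
  rw [hE]
  have hS := S_le hF hT ht
  have x0 := F.X0_nn t
  have x1 := F.X1_nn t
  have xt := F.Xt_nn t
  have y1 := F.Y1_nn t
  have z2 := F.Z2_nn t
  have zf := F.Zf_nn t
  refine comb_arith hc0 (by linarith) (by linarith) hK1 hK1' hK0 hF.e0.le x0 x1 xt y1 z2 (F.S_nn t) e1 e2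
    (h0 hF ha hκ (hm _ (by omega)) ht) (h1 hF hT (hm _ (by omega)) hN1 hc hcg ht)
    (h2 hF hT (hm _ (by omega)) hca hcκ ht) (h3 hF hT (hm _ (by omega)) hca hcκ ht)
    (h4 hF hT (hm _ (by omega)) hN2 hcab ht) (h5 hF (hm _ (by omega)) ht) (hS.trans ?_)
  gcongr

set_option maxHeartbeats 1000000 in
theorem energy {a b κ g K M : ℝ} (cs : Cs a b κ g K M)
    (ha : 5 * (4 + 2 * K + 8 * g * K + 16 * K) + 1 ≤ a / 2)
    (hκ : 4 * (4 + 2 * K + 8 * g * K + 16 * K) + 1 ≤ κ / 4) :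
    ∃ ε₂ C : ℝ, 0 < ε₂ ∧ 1 ≤ C ∧ ∀ F : FD, Flow a b κ g K M F → F.ε ≤ ε₂ → 0 < F.T →
      ∀ t ∈ Set.Icc 0 F.T, I F.nrm t ≤ C * I F.nrm 0 ∧ ∫ s in (0:ℝ)..t, F.Xt s ≤ C * I F.nrm 0 := by
  obtain ⟨k, hk⟩ := decay
  have a0 := cs.a0
  have b0 := cs.b0
  have κ0 := cs.κ0
  have g0 := cs.g0
  have k1 := cs.k1
  have m2 := cs.m2
  have ab : 0 < (a + b)⁻¹ := by positivity
  set N := M ^ k + (32 + 1600 * g⁻¹) + (a + b)⁻¹ * (512 * (16 + a ^ 2)) + 101 with hNdef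
  have hM0 : 0 ≤ M ^ k := by positivity
  have hg1 : 0 ≤ 1600 * g⁻¹ := by positivity
  have hab1 : 0 ≤ (a + b)⁻¹ * (512 * (16 + a ^ 2)) := by positivity
  obtain ⟨c, c0, c1, c2, c3, c4, c5⟩ : ∃ c : ℝ, 0 < c ∧ c ≤ 1 / 4 ∧ c ≤ g / 8 ∧ c ≤ a / 2 ∧ c ≤ κ / 4 ∧
      c ≤ (a + b)⁻¹ * (1 / 32) := by
    refine ⟨min (1 / 4) (min (g / 8) (min (a / 2) (min (κ / 4) ((a + b)⁻¹ * (1 / 32))))), by positivity, ?_⟩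
    simp
  obtain ⟨q, q0, q1, q2⟩ : ∃ q : ℝ, 0 < q ∧ q ≤ 1 / 16 ∧ q ≤ g / 32 :=
    ⟨min (1 / 16) (g / 32), by positivity, by simp, by simp⟩
  obtain ⟨cc, cc0, cc1, cc2, cc3⟩ : ∃ cc : ℝ, 0 < cc ∧ cc ≤ a / 2 ∧ cc ≤ κ / 2 ∧ cc ≤ q :=
    ⟨min (a / 2) (min (κ / 2) q), by positivity, by simp, by simp, by simp⟩
  have hN1 : 101 ≤ N := by linarith
  set K1 := (N + 1) / c with hK1
  have K1c : K1 * c = N + 1 := div_mul_cancel₀ _ c0.ne'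
  have K1l : 1 ≤ K1 := by rw [hK1, le_div_iff₀ c0]; linarith
  set K0 := K1 * N + N + 1 + (K1 * (16 * b⁻¹) + 1) / q with hK0
  have hb1 : 0 ≤ b⁻¹ := by positivity
  have K0q : K1 * (16 * b⁻¹) + 1 ≤ K0 * q := by
    have : (K1 * (16 * b⁻¹) + 1) / q * q = K1 * (16 * b⁻¹) + 1 := div_mul_cancel₀ _ q0.ne'
    have : 0 ≤ (K1 * N + N + 1) * q := by positivity
    rw [hK0, add_mul]; linarith
  have K0l : K1 * N + N + 1 ≤ K0 := by
    have : 0 ≤ (K1 * (16 * b⁻¹) + 1) / q := by positivity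
    linarith
  have K0p : 0 ≤ K0 := le_trans (by positivity) K0l
  set L := N ^ 2 * 2 + (K0 + 2 * K1 + 2) * N * (2 * N * (1 + N)) * (2 / c) + 4 * K with hL
  have L0 : 0 < L := by positivity
  clear_value L K0 K1 N
  set C3 := K0 * (4 + 8 * g) + K1 * ((a / 2 + 2 * b) + κ / 2 + 16 * b⁻¹ + (4 + 8 * g))
      + (4 + 8 * g) + 1 with hC3
  have C31 : 1 ≤ C3 := by
    have : 0 ≤ K0 * (4 + 8 * g) + K1 * ((a / 2 + 2 * b) + κ / 2 + 16 * b⁻¹ + (4 + 8 * g)) := by positivity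
    linarith
  refine ⟨L⁻¹, C3 / cc + C3 * (2 / c), by positivity, ?_, ?_⟩
  · have h1 : 1 ≤ C3 / cc := by rw [le_div_iff₀ cc0]; linarith
    have : 0 ≤ C3 * (2 / c) := by positivity
    linarith
  intro F hF hε hT t ht
  have e0 := hF.e0
  have hLε : L * F.ε ≤ 1 := by
    calc L * F.ε ≤ L * L⁻¹ := by gcongr
      _ = 1 := mul_inv_cancel₀ L0.ne'
  have p1 : 0 ≤ N ^ 2 * 2 * F.ε := by positivity
  have p2 : 0 ≤ (K0 + 2 * K1 + 2) * N * (2 * N * (1 + N)) * (2 / c) * F.ε := by positivity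
  have p3 : 0 ≤ 4 * K * F.ε := by positivity
  have hsum : N ^ 2 * 2 * F.ε + (K0 + 2 * K1 + 2) * N * (2 * N * (1 + N)) * (2 / c) * F.ε + 4 * K * F.ε ≤ 1 := by
    rw [hL] at hLε; linarith
  have e1 : N ^ 2 * F.ε ≤ 1 / 2 := by linarith
  have e3 : K * F.ε ≤ 1 / 4 := by linarith
  have e2 : (K0 + 2 * K1 + 2) * N * F.ε * (2 * N * (1 + N)) ≤ c / 2 := by
    have h : (K0 + 2 * K1 + 2) * N * (2 * N * (1 + N)) * (2 / c) * F.ε ≤ 1 := by linarith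
    have h2 := mul_le_mul_of_nonneg_right h (by positivity : 0 ≤ c / 2)
    have h3 : (2 / c) * (c / 2) = 1 := by field_simp
    calc _ = (K0 + 2 * K1 + 2) * N * (2 * N * (1 + N)) * F.ε * ((2 / c) * (c / 2)) := by rw [h3]; ring
      _ = (K0 + 2 * K1 + 2) * N * (2 * N * (1 + N)) * (2 / c) * F.ε * (c / 2) := by ring
      _ ≤ _ := by linarith
  have hd : ∀ s ∈ Set.Icc 0 F.T, I (Dt (F.en a b κ g K0 K1)) s ≤ -(c / 2) * F.Xt s := fun s hs =>
    hk hF hT ha hκ (by linarith) (by linarith) (by linarith) hN1 c0 c1 c2 c3 c4 c5 K1c (by linarith) K0l e1 e2 hs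
  have hXc : Continuous F.Xt := by
    unfold FD.Xt
    exact (I_cont _).add (continuous_const.mul (I_cont _))
  set h : ℝ → ℝ := fun s => I (F.en a b κ g K0 K1) s + (c / 2) * ∫ r in (0:ℝ)..s, F.Xt r with hh
  have hder : ∀ s, HasDerivAt h (I (Dt (F.en a b κ g K0 K1)) s + (c / 2) * F.Xt s) s := fun s =>
    (I_hasDeriv _ s).add ((intervalIntegral.integral_hasDerivAt_right (hXc.intervalIntegrable _ _)
      hXc.stronglyMeasurable.stronglyMeasurableAtFilter hXc.continuousAt).const_mul _)
  have hanti : AntitoneOn h (Set.Icc 0 F.T) := by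
    refine antitoneOn_of_deriv_nonpos (convex_Icc _ _) (fun s _ => (hder s).continuousAt.continuousWithinAt)
      (fun s _ => (hder s).differentiableAt.differentiableWithinAt) fun s hs => ?_
    rw [(hder s).deriv]
    linarith [hd s (interior_subset hs)]
  have z0 : (0:ℝ) ∈ Set.Icc 0 F.T := ⟨le_rfl, hT.le⟩
  have h1 := hanti z0 ht ht.1
  simp only [hh, intervalIntegral.integral_same, mul_zero, add_zero] at h1
  have hlow : cc * I F.nrm t ≤ I (F.en a b κ g K0 K1) t := by
    rw [← I_cst_mul]
    exact I_mono fun x hx => (en_bd hF e3 ht hx q0 q1 q2 K1l K0p K0q cc1 cc2 cc3).1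
  have hup : I (F.en a b κ g K0 K1) 0 ≤ C3 * I F.nrm 0 := by
    rw [← I_cst_mul]
    exact I_mono fun x hx => (en_bd hF e3 z0 hx q0 q1 q2 K1l K0p K0q cc1 cc2 cc3).2
  have hn : ∀ s, 0 ≤ I F.nrm s := fun s => I_nonneg fun x _ => by
    simp only [FD.nrm, ev_add, ev_mul, ev_cst, ev_pow]; positivity
  have hX : 0 ≤ ∫ r in (0:ℝ)..t, F.Xt r := intervalIntegral.integral_nonneg ht.1 fun s _ => F.Xt_nn s
  have n0 := hn 0
  have r1 : cc * I F.nrm t ≤ C3 * I F.nrm 0 := by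
    have : 0 ≤ c / 2 * ∫ r in (0:ℝ)..t, F.Xt r := by positivity
    linarith
  have r2 : (c / 2) * ∫ r in (0:ℝ)..t, F.Xt r ≤ C3 * I F.nrm 0 := by
    have : 0 ≤ cc * I F.nrm t := mul_nonneg cc0.le (hn t)
    linarith
  have y1 : 0 ≤ C3 / cc * I F.nrm 0 := by positivity
  have y2 : 0 ≤ C3 * (2 / c) * I F.nrm 0 := by positivity
  constructor
  · have : I F.nrm t ≤ C3 / cc * I F.nrm 0 := by
      rw [div_mul_eq_mul_div, le_div_iff₀ cc0]; linarith
    linarith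
  · have : ∫ r in (0:ℝ)..t, F.Xt r ≤ C3 * (2 / c) * I F.nrm 0 := by
      have h2 := mul_le_mul_of_nonneg_right r2 (by positivity : 0 ≤ 2 / c)
      have h3 : (c / 2) * (2 / c) = 1 := by field_simp
      calc ∫ r in (0:ℝ)..t, F.Xt r = ((c / 2) * (2 / c)) * ∫ r in (0:ℝ)..t, F.Xt r := by rw [h3, one_mul]
        _ = (c / 2 * ∫ r in (0:ℝ)..t, F.Xt r) * (2 / c) := by ring
        _ ≤ _ := by linarith
    linarith

/-! Elliptic estimates at a fixed time. -/

theorem bd_4 {ε σ M x : ℝ} (h : BC ε σ M) (h1 : 1 / 4 ≤ x) (h2 : x ≤ 4) : Bd ε σ M 2 0 0 x := ⟨h, by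
  have := h.m2
  rw [abs_of_pos (by linarith)]; simp; nlinarith⟩

set_option maxHeartbeats 1000000 in
theorem ell_pt : ∃ k : ℕ, ∀ {a b κ g K M σ : ℝ} {B : Bg} {φ v w θ : Q} (h : JB a b κ g K M B φ v w θ)
    (hs0 : 0 ≤ σ)
    (hs : B.i * (v.f ^ 2 + w.f ^ 2) + (B.ε ^ 4)⁻¹ * (φ.f ^ 2 + θ.f ^ 2)
      + (v.f1 ^ 2 + v.f2 ^ 2 + w.f1 ^ 2 + w.f2 ^ 2)
      + B.i * (θ.f1 ^ 2 + θ.f2 ^ 2 + φ.f1 ^ 2 + φ.f2 ^ 2)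
      + B.ε ^ 2 * (v.ft ^ 2 + w.ft ^ 2) + φ.ft ^ 2 + θ.ft ^ 2 = σ ^ 2) (hi : B.i = (B.ε ^ 2)⁻¹),
    Bd B.ε σ M k (-1) 1 (a * (v.f11 + v.f22) + b * (v.f11 + w.f12)) ∧
    Bd B.ε σ M k (-1) 1 (a * (w.f11 + w.f22) + b * (v.f12 + w.f22)) ∧
    Bd B.ε σ M k 0 1 (κ * (θ.f11 + θ.f22)) := by
  refine ⟨60, ?_⟩
  intro a b κ g K M σ B φ v w θ h hs0 hs hi
  have e0 := h.bc.e0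
  have cs := h.cs
  have km := cs.km
  have H : BC B.ε σ M := ⟨h.bc.e0, h.bc.e1, hs0, h.bc.m2⟩
  have P0 : ∀ z : ℝ, 0 ≤ z ^ 2 := fun z => sq_nonneg z
  have P1 : ∀ z : ℝ, 0 ≤ (B.ε ^ 2)⁻¹ * z ^ 2 := fun z => by positivity
  have P2 : ∀ z : ℝ, 0 ≤ (B.ε ^ 4)⁻¹ * z ^ 2 := fun z => by positivity
  have P3 : ∀ z : ℝ, 0 ≤ B.ε ^ 2 * z ^ 2 := fun z => by positivity
  simp only [mul_add, hi] at hs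
  have E1 := h.e1
  have E2 := h.e2
  have ET := h.eT
  rw [hi] at E1 E2
  have q1 := P1 v.f
  have q2 := P0 v.f1
  have q3 := P0 v.f2
  have q4 := P3 v.ft
  have r1 := P1 w.f
  have r2 := P0 w.f1
  have r3 := P0 w.f2
  have r4 := P3 w.ft
  have s1 := P2 θ.f
  have s2 := P1 θ.f1
  have s3 := P1 θ.f2
  have s4 := P0 θ.ft
  have t1 := P2 φ.f
  have t2 := P1 φ.f1
  have t3 := P1 φ.f2
  have t4 := P0 φ.ft
  clear P0 P1 P2 P3
  have Sv : (B.ε ^ 2)⁻¹ * v.f ^ 2 ≤ σ ^ 2 ∧ v.f1 ^ 2 ≤ σ ^ 2 ∧ v.f2 ^ 2 ≤ σ ^ 2 ∧ B.ε ^ 2 * v.ft ^ 2 ≤ σ ^ 2 ∧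
      (B.ε ^ 2)⁻¹ * w.f ^ 2 ≤ σ ^ 2 ∧ w.f1 ^ 2 ≤ σ ^ 2 ∧ w.f2 ^ 2 ≤ σ ^ 2 ∧ B.ε ^ 2 * w.ft ^ 2 ≤ σ ^ 2 ∧
      (B.ε ^ 4)⁻¹ * θ.f ^ 2 ≤ σ ^ 2 ∧ (B.ε ^ 2)⁻¹ * θ.f1 ^ 2 ≤ σ ^ 2 ∧ (B.ε ^ 2)⁻¹ * θ.f2 ^ 2 ≤ σ ^ 2 ∧
      θ.ft ^ 2 ≤ σ ^ 2 ∧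
      (B.ε ^ 4)⁻¹ * φ.f ^ 2 ≤ σ ^ 2 ∧ (B.ε ^ 2)⁻¹ * φ.f1 ^ 2 ≤ σ ^ 2 ∧ (B.ε ^ 2)⁻¹ * φ.f2 ^ 2 ≤ σ ^ 2 := by
    refine ⟨?_, ?_, ?_, ?_, ?_, ?_, ?_, ?_, ?_, ?_, ?_, ?_, ?_, ?_, ?_⟩ <;>
      linarith only [hs, q1, q2, q3, q4, r1, r2, r3, r4, s1, s2, s3, s4, t1, t2, t3, t4]
  obtain ⟨v_0, v_1, v_2, v_t, w_0, w_1, w_2, w_t, θ_0, θ_1, θ_2, θ_t, φ_0, φ_1, φ_2⟩ := Sv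
  have hi2 := bd_i2 H
  have y := bd_c H (by simpa using h.y.2 : |B.y| ≤ M)
  have ρ : Bd B.ε σ M 2 0 0 (B.R + φ.f) := bd_4 H h.ρl h.ρu
  have Tm : Bd B.ε σ M 2 0 0 (B.τ + θ.f) := bd_4 H h.Tl h.Tu
  have vL := bd_L0 H km h.vK
  have wL := bd_L0 H km h.wK
  have vs := bd_s1 H v_0
  have ws := bd_s1 H w_0
  have v1 := bd_s0 H v_1
  have v2 := bd_s0 H v_2
  have vt := bd_sm H v_t
  have w1 := bd_s0 H w_1
  have w2 := bd_s0 H w_2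
  have wt := bd_sm H w_t
  have θs := bd_s2 H θ_0
  have θ1 := bd_s1 H θ_1
  have θ2 := bd_s1 H θ_2
  have θt := bd_s0 H θ_t
  have φs := bd_s2 H φ_0
  have φ1 := bd_s1 H φ_1
  have φ2 := bd_s1 H φ_2
  have R2 := bd_L1 H km h.R2K
  have τ2 := bd_L1 H km h.τ2K
  have v1L := bd_Lm H km h.v1K
  have v2L := bd_Lm H km h.v2K
  have w1L := bd_Lm H km h.w1K
  have w2L := bd_Lm H km h.w2K
  have aB := bd_c H (by rw [abs_of_pos cs.a0]; exact cs.am : |a| ≤ M)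
  have ba := bd_c H cs.bam
  have gB := bd_c H (by rw [abs_of_pos cs.g0]; exact cs.gm : |g| ≤ M)
  have two := bd_n H (by norm_num : |(2:ℝ)| ≤ 2)
  have ee := bd_e2 H
  have U := y.add vL
  refine ⟨?_, ?_, ?_⟩
  · have e : a * (v.f11 + v.f22) + b * (v.f11 + w.f12)
      = (B.R + φ.f) * (v.ft + (B.y + v.f) * v.f1 + w.f * v.f2 + w.f)
        + (B.ε ^ 2)⁻¹ * ((B.R + φ.f) * θ.f1 + (B.τ + θ.f) * φ.f1) := by linarith
    rw [e]
    exact ((ρ.mul (((vt.add ((U.mul v1).w (m' := -1) (by norm_num))).add ((wL.mul v2).w (m' := -1) (by norm_num))).add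
      (ws.w (m' := -1) (by norm_num)))).add ((hi2.mul ((ρ.mul θ1).add ((Tm.mul φ1).w (by norm_num)))).w (by norm_num))).kk (by norm_num)
  · have e : a * (w.f11 + w.f22) + b * (v.f12 + w.f22)
      = (B.R + φ.f) * (w.ft + (B.y + v.f) * w.f1 + w.f * w.f2)
        + (B.ε ^ 2)⁻¹ * ((B.R + φ.f) * θ.f2 + (B.τ + θ.f) * φ.f2 + (φ.f * B.τ2 + θ.f * B.R2)) := by
      have := h.R2τ
      have : (B.ε ^ 2)⁻¹ * (B.R2 * B.τ + B.R * B.τ2) = 0 := by rw [this, mul_zero]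
      linarith
    rw [e]
    exact ((ρ.mul ((wt.add ((U.mul w1).w (m' := -1) (by norm_num))).add ((wL.mul w2).w (m' := -1) (by norm_num)))).add
      ((hi2.mul (((ρ.mul θ2).add ((Tm.mul φ2).w (by norm_num))).add
        (((φs.mul τ2).w (by norm_num)).add ((θs.mul R2).w (by norm_num))))).w (by norm_num))).kk (by norm_num)
  · have e : κ * (θ.f11 + θ.f22)
      = g * ((B.R + φ.f) * (θ.ft + (B.y + v.f) * θ.f1 + w.f * θ.f2 + w.f * B.τ2))
    + (B.R + φ.f) * (B.τ + θ.f) * (v.f1 + w.f2)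
    - B.ε ^ 2 * (2 * a * (v.f1 * v.f1 + w.f2 * w.f2) + a * ((w.f1 + v.f2) * (w.f1 + v.f2))
      + 2 * a * (w.f1 + v.f2) + (b - a) * ((v.f1 + w.f2) * (v.f1 + w.f2))) := by linarith
    rw [e]
    have z1 : Bd B.ε σ M _ 0 1 _ := ((((θt.add ((U.mul θ1).w (m' := 0) (by norm_num)))).add
      ((wL.mul θ2).w (m' := 0) (by norm_num))).add ((ws.mul τ2).w (m' := 0) (by norm_num)))
    have z2 : Bd B.ε σ M _ (-1) 1 _ := (((two.mul aB).mul ((v1L.mul v1).add (w2L.mul w2))).add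
      (aB.mul ((w1L.add v2L).mul (w1.add v2)))).add (((two.mul aB).mul (w1.add v2)).w (by norm_num))
    have z3 := z2.add (ba.mul ((v1L.add w2L).mul (v1.add w2)))
    exact ((((gB.mul (ρ.mul z1)).add ((ρ.mul Tm).mul (v1.add w2)))).sub ((ee.mul z3).w (m' := 0) (by norm_num))).kk (by norm_num)

theorem bd_sqm {ε σ M x : ℝ} {k : ℕ} (h : Bd ε σ M k (-1) 1 x) : ε ^ 2 * x ^ 2 ≤ (M ^ k) ^ 2 * σ ^ 2 := by
  obtain ⟨⟨e0, e1, s0, m2⟩, h⟩ := h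
  have h1 : |ε * x| ≤ M ^ k * σ := by
    rw [abs_mul, abs_of_pos e0]
    calc ε * |x| ≤ ε * (M ^ k * ε ^ (-1:ℤ) * σ ^ 1) := by gcongr
      _ = M ^ k * σ * (ε * ε⁻¹) := by simp; ring
      _ = _ := by rw [mul_inv_cancel₀ e0.ne', mul_one]
  have h2 := pow_le_pow_left₀ (abs_nonneg _) h1 2
  rw [sq_abs, mul_pow ε x, mul_pow (M ^ k)] at h2
  exact h2

theorem bd_sq0 {ε σ M x : ℝ} {k : ℕ} (h : Bd ε σ M k 0 1 x) : x ^ 2 ≤ (M ^ k) ^ 2 * σ ^ 2 := by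
  obtain ⟨⟨e0, e1, s0, m2⟩, h⟩ := h
  have h1 : |x| ≤ M ^ k * σ := by simpa using h
  have h2 := pow_le_pow_left₀ (abs_nonneg _) h1 2
  rw [sq_abs, mul_pow (M ^ k)] at h2
  exact h2

theorem ell_S {a b v11 v12 v22 w11 w12 w22 L1 L2 X : ℝ} (a0 : 0 < a) (b0 : 0 < b)
    (hL1 : L1 = a * (v11 + v22) + b * (v11 + w12)) (hL2 : L2 = a * (w11 + w22) + b * (v12 + w22))
    (hX : X = a * (v12 ^ 2 - v11 * v22) + a * (w12 ^ 2 - w11 * w22)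
      + b * ((v11 + w12) * w12 - (v12 + w22) * w11)) :
    v11 ^ 2 + v12 ^ 2 + w11 ^ 2 + w12 ^ 2 ≤ 2 / a * X + (a ^ 2)⁻¹ * (L1 ^ 2 + L2 ^ 2) := by
  have e : a * (v11 ^ 2 + v12 ^ 2 + w11 ^ 2 + w12 ^ 2) + b * (v11 + w12) ^ 2 = L1 * v11 + L2 * w11 + X := by
    rw [hL1, hL2, hX]; ring
  have p : 0 ≤ b * (v11 + w12) ^ 2 := by positivity
  have y1 : 2 * a * (L1 * v11) ≤ L1 ^ 2 + a ^ 2 * v11 ^ 2 := by nlinarith [sq_nonneg (L1 - a * v11)]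
  have y2 : 2 * a * (L2 * w11) ≤ L2 ^ 2 + a ^ 2 * w11 ^ 2 := by nlinarith [sq_nonneg (L2 - a * w11)]
  have h1 : 2 * a * (a * (v11 ^ 2 + v12 ^ 2 + w11 ^ 2 + w12 ^ 2)) ≤ 2 * a * (L1 * v11 + L2 * w11 + X) :=
    mul_le_mul_of_nonneg_left (by linarith) (by positivity)
  have h2 : a ^ 2 * (v11 ^ 2 + v12 ^ 2 + w11 ^ 2 + w12 ^ 2) ≤ 2 * a * X + (L1 ^ 2 + L2 ^ 2) := by
    nlinarith [mul_nonneg (sq_nonneg a) (sq_nonneg v12), mul_nonneg (sq_nonneg a) (sq_nonneg w12)]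
  have h3 : (a ^ 2)⁻¹ * (a ^ 2 * (v11 ^ 2 + v12 ^ 2 + w11 ^ 2 + w12 ^ 2))
      ≤ (a ^ 2)⁻¹ * (2 * a * X + (L1 ^ 2 + L2 ^ 2)) := mul_le_mul_of_nonneg_left h2 (by positivity)
  rw [inv_mul_cancel_left₀ (by positivity), mul_add] at h3
  have : (a ^ 2)⁻¹ * (2 * a * X) = 2 / a * X := by field_simp
  linarith

theorem ell_22 {a b v11 v12 v22 w11 w12 w22 L1 L2 : ℝ} (a0 : 0 < a) (b0 : 0 < b)
    (hL1 : L1 = a * (v11 + v22) + b * (v11 + w12)) (hL2 : L2 = a * (w11 + w22) + b * (v12 + w22)) :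
    v22 ^ 2 + w22 ^ 2 ≤ 3 * (a ^ 2)⁻¹ * (L1 ^ 2 + L2 ^ 2)
      + 3 * (a ^ 2)⁻¹ * (a + b) ^ 2 * (v11 ^ 2 + v12 ^ 2 + w11 ^ 2 + w12 ^ 2) := by
  have e1 : a * v22 = L1 - (a + b) * v11 - b * w12 := by rw [hL1]; ring
  have e2 : (a + b) * w22 = L2 - a * w11 - b * v12 := by rw [hL2]; ring
  have t3 : ∀ x y z : ℝ, (x - y - z) ^ 2 ≤ 3 * (x ^ 2 + y ^ 2 + z ^ 2) := fun x y z => by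
    nlinarith [sq_nonneg (x + y), sq_nonneg (x + z), sq_nonneg (y - z)]
  have f1 := t3 L1 ((a + b) * v11) (b * w12)
  have f2 := t3 L2 (a * w11) (b * v12)
  rw [← e1, mul_pow a, mul_pow (a + b), mul_pow b] at f1
  rw [← e2, mul_pow (a + b), mul_pow a, mul_pow b] at f2
  have ha : a ^ 2 ≤ (a + b) ^ 2 := by gcongr; linarith
  have hb : b ^ 2 ≤ (a + b) ^ 2 := by gcongr; linarith
  have g1 := mul_le_mul_of_nonneg_right hb (sq_nonneg w12)
  have g2 := mul_le_mul_of_nonneg_right hb (sq_nonneg v12)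
  have g3 := mul_le_mul_of_nonneg_right ha (sq_nonneg w11)
  have g4 := mul_le_mul_of_nonneg_right ha (sq_nonneg w22)
  have h : a ^ 2 * (v22 ^ 2 + w22 ^ 2) ≤ 3 * (L1 ^ 2 + L2 ^ 2)
      + 3 * (a + b) ^ 2 * (v11 ^ 2 + v12 ^ 2 + w11 ^ 2 + w12 ^ 2) := by linarith
  have h3 := mul_le_mul_of_nonneg_left h (by positivity : 0 ≤ (a ^ 2)⁻¹)
  rw [inv_mul_cancel_left₀ (by positivity)] at h3
  linarith

theorem ell_fin {a b κ e n N v11 v12 v22 w11 w12 w22 θ11 θ12 θ22 L1 L2 X c1 : ℝ} (a0 : 0 < a) (b0 : 0 < b)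
    (κ0 : 0 < κ) (e0 : 0 ≤ e) (hc : c1 = 1 + 3 * (a ^ 2)⁻¹ * (a + b) ^ 2)
    (hL1 : L1 = a * (v11 + v22) + b * (v11 + w12)) (hL2 : L2 = a * (w11 + w22) + b * (v12 + w22))
    (hX : X = a * (v12 ^ 2 - v11 * v22) + a * (w12 ^ 2 - w11 * w22)
      + b * ((v11 + w12) * w12 - (v12 + w22) * w11))
    (h1 : e * L1 ^ 2 ≤ N * n) (h2 : e * L2 ^ 2 ≤ N * n) (h3 : (κ * (θ11 + θ22)) ^ 2 ≤ N * n) :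
    e * (v11 ^ 2 + v12 ^ 2 + v22 ^ 2 + (w11 ^ 2 + w12 ^ 2 + w22 ^ 2)) + (θ11 ^ 2 + θ12 ^ 2 + θ22 ^ 2)
     ≤ (e * c1 * (2 / a)) * X + 2 * (θ12 ^ 2 - θ11 * θ22)
       + (N * (2 * (c1 * (a ^ 2)⁻¹ + 3 * (a ^ 2)⁻¹) + (κ ^ 2)⁻¹)) * n := by
  have s := ell_S a0 b0 hL1 hL2 hX
  have q := ell_22 a0 b0 hL1 hL2
  have c0 : 0 ≤ c1 := by rw [hc]; positivity
  set S := v11 ^ 2 + v12 ^ 2 + w11 ^ 2 + w12 ^ 2 with hS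
  have r : v11 ^ 2 + v12 ^ 2 + v22 ^ 2 + (w11 ^ 2 + w12 ^ 2 + w22 ^ 2)
      ≤ c1 * (2 / a) * X + (c1 * (a ^ 2)⁻¹ + 3 * (a ^ 2)⁻¹) * (L1 ^ 2 + L2 ^ 2) := by
    have := mul_le_mul_of_nonneg_left s c0
    have e : c1 * S = S + 3 * (a ^ 2)⁻¹ * (a + b) ^ 2 * S := by rw [hc]; ring
    linarith
  have r' := mul_le_mul_of_nonneg_left r e0
  have m0 : 0 ≤ c1 * (a ^ 2)⁻¹ + 3 * (a ^ 2)⁻¹ := by positivity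
  have r2 := mul_le_mul_of_nonneg_left (add_le_add h1 h2) m0
  have r3 := mul_le_mul_of_nonneg_left h3 (by positivity : 0 ≤ (κ ^ 2)⁻¹)
  rw [mul_pow κ, inv_mul_cancel_left₀ (by positivity)] at r3
  nlinarith [sq_nonneg θ12]

def H2 (f : Sm) : Sm := (D1 (D1 f)) ^ 2 + (D1 (D2 f)) ^ 2 + (D2 (D2 f)) ^ 2

theorem ell {a b κ g K M : ℝ} (cs : Cs a b κ g K M) : ∃ C : ℝ, 0 ≤ C ∧ ∀ F : FD, Flow a b κ g K M F →
    ∀ t ∈ Set.Icc 0 F.T, I (cst (F.ε ^ 2) * (H2 F.v + H2 F.w) + H2 F.θ) t ≤ C * I F.nrm t := by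
  obtain ⟨k, hk⟩ := ell_pt
  have a0 := cs.a0
  have b0 := cs.b0
  have κ0 := cs.κ0
  obtain ⟨c1, hc1⟩ : ∃ c1, c1 = 1 + 3 * (a ^ 2)⁻¹ * (a + b) ^ 2 := ⟨_, rfl⟩
  have c0 : 0 ≤ c1 := by rw [hc1]; positivity
  refine ⟨(M ^ k) ^ 2 * (2 * (c1 * (a ^ 2)⁻¹ + 3 * (a ^ 2)⁻¹) + (κ ^ 2)⁻¹), by positivity, ?_⟩
  intro F hF t ht
  have e0 := hF.e0
  have pv := hF.pv
  have pw := hF.pw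
  have pθ := hF.pθ
  have pd : Per F.d := pv.D1.add pw.D2
  have wv := (hF.wv t ht).D1.D1
  have ww := (hF.ww t ht).D1.D1
  have wθ := (hF.wθ t ht).D1.D1
  rw [← I_cst_mul]
  set m := F.ε ^ 2 * c1 * (2 / a) with hm
  refine I_le_of_local
    (f := cst (m * a) * (D2 F.v * D1 (D2 F.v)) + cst (m * a) * (D2 F.w * D1 (D2 F.w))
      + cst (m * b) * (F.d * D1 (D2 F.w)) + cst 2 * (D2 F.θ * D1 (D2 F.θ)))
    (g := cst (-(m * a)) * (D2 F.v * D1 (D1 F.v)) + cst (-(m * a)) * (D2 F.w * D1 (D1 F.w))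
      + cst (-(m * b)) * (F.d * D1 (D1 F.w)) + cst (-2) * (D2 F.θ * D1 (D1 F.θ)))
    (((((Per.cst _).mul (pv.D2.mul pv.D2.D1)).add ((Per.cst _).mul (pw.D2.mul pw.D2.D1))).add
      ((Per.cst _).mul (pd.mul pw.D2.D1))).add ((Per.cst _).mul (pθ.D2.mul pθ.D2.D1)))
    ((((((wv.mull _).mull _).add ((ww.mull _).mull _)).add ((ww.mull _).mull _)).add ((wθ.mull _).mull _))) ?_
  intro x hx
  have hn0 : 0 ≤ F.nrm.1 (t, x) := by
    simp only [FD.nrm, ev_add, ev_mul, ev_cst, ev_pow]; positivity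
  have hsq : F.nrm.1 (t, x) = √(F.nrm.1 (t, x)) ^ 2 := (Real.sq_sqrt hn0).symm
  obtain ⟨p1, p2, p3⟩ := hk (hF.jb ht hx) (σ := √(F.nrm.1 (t, x))) (Real.sqrt_nonneg _)
    (by rw [← hsq]; rfl) rfl
  have q1 := bd_sqm p1
  have q2 := bd_sqm p2
  have q3 := bd_sq0 p3
  rw [← hsq] at q1 q2 q3
  have fin := ell_fin a0 b0 κ0 (e := F.ε ^ 2) (by positivity) hc1 rfl rfl rfl q1 q2 q3 (θ12 := (D1 (D2 F.θ)).1 (t, x))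
  simp only [jq] at fin
  simp only [H2, FD.d, D1_add, D2_add, D1_mul, D2_mul, D1_cst, D2_cst, D2_D1, ev_add, ev_mul, ev_cst, ev_pow, ev_zero]
  rw [← hm] at fin
  refine fin.trans (le_of_eq ?_)
  ring

/-! Comparison of the Sobolev seminorms with partial derivatives. -/

theorem slice_smooth (f : Sm) (t : ℝ) : ContDiff ℝ (⊤ : ℕ∞) fun y : ℝ × ℝ => f.1 (t, y) :=
  (Sm_smooth f).comp (contDiff_const.prodMk contDiff_id)

theorem slice_fderiv (f : Sm) (t : ℝ) (x e : ℝ × ℝ) :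
    fderiv ℝ (fun y : ℝ × ℝ => f.1 (t, y)) x e = (Dd (0, e) f).1 (t, x) := by
  have h := (Sm_diff f (t, x)).hasFDerivAt
  have h2 : HasFDerivAt (fun y : ℝ × ℝ => (t, y)) (ContinuousLinearMap.inr ℝ ℝ (ℝ × ℝ)) x := by
    exact hasFDerivAt_prodMk_right t x
  have h3 : HasFDerivAt (fun y : ℝ × ℝ => f.1 (t, y)) _ x := h.comp x h2
  rw [h3.fderiv]
  rfl

theorem slice_d1 (f : Sm) (t : ℝ) : d1 (fun y : ℝ × ℝ => f.1 (t, y)) = fun y => (D1 f).1 (t, y) :=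
  funext fun x => slice_fderiv f t x _
theorem slice_d2 (f : Sm) (t : ℝ) : d2 (fun y : ℝ × ℝ => f.1 (t, y)) = fun y => (D2 f).1 (t, y) :=
  funext fun x => slice_fderiv f t x _

def nj (j : ℕ) (f : Sm) (t : ℝ) (x : ℝ × ℝ) : ℝ := ‖iteratedFDeriv ℝ j (fun y : ℝ × ℝ => f.1 (t, y)) x‖

def np (j : ℕ) (f g : Sm) (t : ℝ) (x : ℝ × ℝ) : ℝ :=
  ‖iteratedFDeriv ℝ j (fun y : ℝ × ℝ => (f.1 (t, y), g.1 (t, y))) x‖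

theorem nj_nn (j : ℕ) (f : Sm) (t : ℝ) (x : ℝ × ℝ) : 0 ≤ nj j f t x := norm_nonneg _
theorem np_nn (j : ℕ) (f g : Sm) (t : ℝ) (x : ℝ × ℝ) : 0 ≤ np j f g t x := norm_nonneg _

theorem nj_zero (f : Sm) (t : ℝ) (x : ℝ × ℝ) : nj 0 f t x = |f.1 (t, x)| := by
  rw [nj, norm_iteratedFDeriv_zero]; rfl

theorem nj_D (j : ℕ) (f : Sm) (t : ℝ) (x e : ℝ × ℝ) (he : ‖e‖ ≤ 1) :
    nj j (Dd (0, e) f) t x ≤ nj (j + 1) f t x := by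
  have hs := slice_smooth f t
  have e1 : (fun y : ℝ × ℝ => (Dd (0, e) f).1 (t, y))
      = (ContinuousLinearMap.apply ℝ ℝ e) ∘ fderiv ℝ (fun y : ℝ × ℝ => f.1 (t, y)) := by
    funext y; exact (slice_fderiv f t y e).symm
  have hd : ContDiff ℝ (⊤ : ℕ∞) (fderiv ℝ (fun y : ℝ × ℝ => f.1 (t, y))) := hs.fderiv_right (by simp)
  unfold nj
  rw [e1, ← norm_iteratedFDeriv_fderiv]
  refine (ContinuousLinearMap.norm_iteratedFDeriv_comp_left _ (hd.contDiffAt (x := x)) (by exact_mod_cast le_top)).trans ?_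
  refine mul_le_of_le_one_left (norm_nonneg _) ?_
  refine ContinuousLinearMap.opNorm_le_bound _ zero_le_one fun L => ?_
  rw [one_mul, ContinuousLinearMap.apply_apply]
  exact (L.le_opNorm e).trans (mul_le_of_le_one_right (norm_nonneg _) he)

theorem nj_D1 (j : ℕ) (f : Sm) (t : ℝ) (x : ℝ × ℝ) : nj j (D1 f) t x ≤ nj (j + 1) f t x :=
  nj_D j f t x (1, 0) (by simp [Prod.norm_def])
theorem nj_D2 (j : ℕ) (f : Sm) (t : ℝ) (x : ℝ × ℝ) : nj j (D2 f) t x ≤ nj (j + 1) f t x :=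
  nj_D j f t x (0, 1) (by simp [Prod.norm_def])

theorem nj_up (j : ℕ) (f : Sm) (t : ℝ) (x : ℝ × ℝ) :
    nj (j + 1) f t x ≤ nj j (D1 f) t x + nj j (D2 f) t x := by
  have hs := slice_smooth f t
  set A : ℝ →L[ℝ] (ℝ × ℝ →L[ℝ] ℝ) := ContinuousLinearMap.smulRightL ℝ (ℝ × ℝ) ℝ (ContinuousLinearMap.fst ℝ ℝ ℝ) with hA
  set B : ℝ →L[ℝ] (ℝ × ℝ →L[ℝ] ℝ) := ContinuousLinearMap.smulRightL ℝ (ℝ × ℝ) ℝ (ContinuousLinearMap.snd ℝ ℝ ℝ) with hB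
  have hA' : ∀ c z, A c z = z.1 * c := fun _ _ => rfl
  have hB' : ∀ c z, B c z = z.2 * c := fun _ _ => rfl
  clear_value A B
  have e1 : fderiv ℝ (fun y : ℝ × ℝ => f.1 (t, y))
      = (A ∘ fun y => (D1 f).1 (t, y)) + (B ∘ fun y => (D2 f).1 (t, y)) := by
    funext y
    refine ContinuousLinearMap.ext fun z => ?_
    have hz : z = z.1 • ((1:ℝ), (0:ℝ)) + z.2 • ((0:ℝ), (1:ℝ)) := by ext <;> simp
    have h1 := slice_fderiv f t y (1, 0)
    have h2 := slice_fderiv f t y (0, 1)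
    rw [Pi.add_apply, ContinuousLinearMap.add_apply, Function.comp, Function.comp, hA', hB']
    conv_lhs => rw [hz]
    rw [map_add, map_smul, map_smul, h1, h2]
    rfl
  have nA : ‖A‖ ≤ 1 := by
    refine ContinuousLinearMap.opNorm_le_bound _ zero_le_one fun c => ?_
    refine ContinuousLinearMap.opNorm_le_bound _ (by positivity) fun z => ?_
    rw [hA', norm_mul, one_mul, mul_comm]
    exact mul_le_mul_of_nonneg_left (norm_fst_le z) (norm_nonneg _)
  have nB : ‖B‖ ≤ 1 := by
    refine ContinuousLinearMap.opNorm_le_bound _ zero_le_one fun c => ?_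
    refine ContinuousLinearMap.opNorm_le_bound _ (by positivity) fun z => ?_
    rw [hB', norm_mul, one_mul, mul_comm]
    exact mul_le_mul_of_nonneg_left (norm_snd_le z) (norm_nonneg _)
  have s1 := slice_smooth (D1 f) t
  have s2 := slice_smooth (D2 f) t
  unfold nj
  rw [← norm_iteratedFDeriv_fderiv, e1,
    iteratedFDeriv_add_apply ((A.contDiff.comp s1).of_le (by exact_mod_cast le_top)).contDiffAt
      ((B.contDiff.comp s2).of_le (by exact_mod_cast le_top)).contDiffAt]
  refine (norm_add_le _ _).trans (add_le_add ?_ ?_)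
  · refine (A.norm_iteratedFDeriv_comp_left (s1.contDiffAt (x := x)) (by exact_mod_cast le_top)).trans ?_
    exact mul_le_of_le_one_left (norm_nonneg _) nA
  · refine (B.norm_iteratedFDeriv_comp_left (s2.contDiffAt (x := x)) (by exact_mod_cast le_top)).trans ?_
    exact mul_le_of_le_one_left (norm_nonneg _) nB

theorem np_fst (j : ℕ) (f g : Sm) (t : ℝ) (x : ℝ × ℝ) : nj j f t x ≤ np j f g t x := by
  have s := (slice_smooth f t).prodMk (slice_smooth g t)
  refine ((ContinuousLinearMap.fst ℝ ℝ ℝ).norm_iteratedFDeriv_comp_left (s.contDiffAt (x := x))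
    (by exact_mod_cast le_top)).trans ?_
  exact mul_le_of_le_one_left (norm_nonneg _) (ContinuousLinearMap.norm_fst_le _ _ _)

theorem np_snd (j : ℕ) (f g : Sm) (t : ℝ) (x : ℝ × ℝ) : nj j g t x ≤ np j f g t x := by
  have s := (slice_smooth f t).prodMk (slice_smooth g t)
  refine ((ContinuousLinearMap.snd ℝ ℝ ℝ).norm_iteratedFDeriv_comp_left (s.contDiffAt (x := x))
    (by exact_mod_cast le_top)).trans ?_
  exact mul_le_of_le_one_left (norm_nonneg _) (ContinuousLinearMap.norm_snd_le _ _ _)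

theorem np_up (j : ℕ) (f g : Sm) (t : ℝ) (x : ℝ × ℝ) : np j f g t x ≤ nj j f t x + nj j g t x := by
  have s1 := slice_smooth f t
  have s2 := slice_smooth g t
  have e : (fun y : ℝ × ℝ => (f.1 (t, y), g.1 (t, y)))
      = (ContinuousLinearMap.inl ℝ ℝ ℝ ∘ fun y => f.1 (t, y)) + (ContinuousLinearMap.inr ℝ ℝ ℝ ∘ fun y => g.1 (t, y)) := by
    funext y; simp
  unfold np nj
  rw [e, iteratedFDeriv_add_apply
    (((ContinuousLinearMap.inl ℝ ℝ ℝ).contDiff.comp s1).of_le (by exact_mod_cast le_top)).contDiffAt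
    (((ContinuousLinearMap.inr ℝ ℝ ℝ).contDiff.comp s2).of_le (by exact_mod_cast le_top)).contDiffAt]
  refine (norm_add_le _ _).trans (add_le_add ?_ ?_)
  · refine ((ContinuousLinearMap.inl ℝ ℝ ℝ).norm_iteratedFDeriv_comp_left (s1.contDiffAt (x := x))
      (by exact_mod_cast le_top)).trans ?_
    exact mul_le_of_le_one_left (norm_nonneg _) (ContinuousLinearMap.norm_inl_le_one _ _ _)
  · refine ((ContinuousLinearMap.inr ℝ ℝ ℝ).norm_iteratedFDeriv_comp_left (s2.contDiffAt (x := x))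
      (by exact_mod_cast le_top)).trans ?_
    exact mul_le_of_le_one_left (norm_nonneg _) (ContinuousLinearMap.norm_inr_le_one _ _ _)

theorem nj_cont (j : ℕ) (f : Sm) (t : ℝ) : Continuous (nj j f t) :=
  ((slice_smooth f t).continuous_iteratedFDeriv (by exact_mod_cast le_top)).norm

theorem np_cont (j : ℕ) (f g : Sm) (t : ℝ) : Continuous (np j f g t) :=
  (((slice_smooth f t).prodMk (slice_smooth g t)).continuous_iteratedFDeriv (by exact_mod_cast le_top)).norm

def Dj (j : ℕ) (f : Sm) (t : ℝ) : ℝ := dSq j (fun y : ℝ × ℝ => f.1 (t, y))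
def Dp (j : ℕ) (f g : Sm) (t : ℝ) : ℝ := dSq j (fun y : ℝ × ℝ => (f.1 (t, y), g.1 (t, y)))

theorem Dj_eq (j : ℕ) (f : Sm) (t : ℝ) : Dj j f t = ∫ x in Ω, nj j f t x ^ 2 := rfl
theorem Dp_eq (j : ℕ) (f g : Sm) (t : ℝ) : Dp j f g t = ∫ x in Ω, np j f g t x ^ 2 := rfl

theorem dSq_nn {F : Type*} [NormedAddCommGroup F] [NormedSpace ℝ F] (j : ℕ) (f : ℝ × ℝ → F) : 0 ≤ dSq j f :=
  integral_nonneg fun _ => by positivity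

theorem Dj_zero (f : Sm) (t : ℝ) : Dj 0 f t = I (f ^ 2) t := by
  rw [Dj_eq]; unfold I
  congr 1; funext x
  rw [nj_zero, sq_abs, ev_pow]

theorem Dj_D1 (j : ℕ) (f : Sm) (t : ℝ) : Dj j (D1 f) t ≤ Dj (j + 1) f t := by
  rw [Dj_eq, Dj_eq]
  refine setIntegral_mono_on (intOn_of_cont ((nj_cont _ _ _).pow 2)) (intOn_of_cont ((nj_cont _ _ _).pow 2)) Ω_meas
    fun x _ => pow_le_pow_left₀ (nj_nn _ _ _ _) (nj_D1 _ _ _ _) 2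
theorem Dj_D2 (j : ℕ) (f : Sm) (t : ℝ) : Dj j (D2 f) t ≤ Dj (j + 1) f t := by
  rw [Dj_eq, Dj_eq]
  refine setIntegral_mono_on (intOn_of_cont ((nj_cont _ _ _).pow 2)) (intOn_of_cont ((nj_cont _ _ _).pow 2)) Ω_meas
    fun x _ => pow_le_pow_left₀ (nj_nn _ _ _ _) (nj_D2 _ _ _ _) 2
theorem Dp_fst (j : ℕ) (f g : Sm) (t : ℝ) : Dj j f t ≤ Dp j f g t := by
  rw [Dj_eq, Dp_eq]
  refine setIntegral_mono_on (intOn_of_cont ((nj_cont _ _ _).pow 2)) (intOn_of_cont ((np_cont _ _ _ _).pow 2)) Ω_meas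
    fun x _ => pow_le_pow_left₀ (nj_nn _ _ _ _) (np_fst _ _ _ _ _) 2
theorem Dp_snd (j : ℕ) (f g : Sm) (t : ℝ) : Dj j g t ≤ Dp j f g t := by
  rw [Dj_eq, Dp_eq]
  refine setIntegral_mono_on (intOn_of_cont ((nj_cont _ _ _).pow 2)) (intOn_of_cont ((np_cont _ _ _ _).pow 2)) Ω_meas
    fun x _ => pow_le_pow_left₀ (nj_nn _ _ _ _) (np_snd _ _ _ _ _) 2

theorem sq_le_two {x y z : ℝ} (hx : 0 ≤ x) (h : x ≤ y + z) : x ^ 2 ≤ 2 * y ^ 2 + 2 * z ^ 2 := by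
  nlinarith [sq_nonneg (y - z), pow_le_pow_left₀ hx h 2]

theorem Dj_up (j : ℕ) (f : Sm) (t : ℝ) : Dj (j + 1) f t ≤ 2 * Dj j (D1 f) t + 2 * Dj j (D2 f) t := by
  have i1 : IntegrableOn (fun x => nj j (D1 f) t x ^ 2) Ω := intOn_of_cont ((nj_cont j (D1 f) t).pow 2)
  have i2 : IntegrableOn (fun x => nj j (D2 f) t x ^ 2) Ω := intOn_of_cont ((nj_cont j (D2 f) t).pow 2)
  rw [Dj_eq, Dj_eq, Dj_eq, ← integral_const_mul, ← integral_const_mul, ← integral_add (i1.const_mul 2) (i2.const_mul 2)]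
  exact setIntegral_mono_on (intOn_of_cont ((nj_cont _ _ _).pow 2)) ((i1.const_mul 2).add (i2.const_mul 2)) Ω_meas
    fun x _ => sq_le_two (nj_nn _ _ _ _) (nj_up _ _ _ _)
theorem Dp_up (j : ℕ) (f g : Sm) (t : ℝ) : Dp j f g t ≤ 2 * Dj j f t + 2 * Dj j g t := by
  have i1 : IntegrableOn (fun x => nj j f t x ^ 2) Ω := intOn_of_cont ((nj_cont j f t).pow 2)
  have i2 : IntegrableOn (fun x => nj j g t x ^ 2) Ω := intOn_of_cont ((nj_cont j g t).pow 2)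
  rw [Dj_eq, Dj_eq, Dp_eq, ← integral_const_mul, ← integral_const_mul, ← integral_add (i1.const_mul 2) (i2.const_mul 2)]
  exact setIntegral_mono_on (intOn_of_cont ((np_cont _ _ _ _).pow 2)) ((i1.const_mul 2).add (i2.const_mul 2)) Ω_meas
    fun x _ => sq_le_two (np_nn _ _ _ _ _) (np_up _ _ _ _ _)

theorem Dj_bdd (j : ℕ) (f : Sm) (T : ℝ) : ∃ B, ∀ s ∈ Set.Icc 0 T, Dj j f s ≤ B := by
  induction j generalizing f with
  | zero =>
    obtain ⟨B, hB⟩ := (isCompact_Icc (a := (0:ℝ)) (b := T)).bddAbove_image (I_cont (f ^ 2)).continuousOn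
    exact ⟨B, fun s hs => by rw [Dj_zero]; exact hB ⟨s, hs, rfl⟩⟩
  | succ j ih =>
    obtain ⟨B1, h1⟩ := ih (D1 f)
    obtain ⟨B2, h2⟩ := ih (D2 f)
    exact ⟨2 * B1 + 2 * B2, fun s hs => by linarith [Dj_up j f s, h1 s hs, h2 s hs]⟩
theorem Dp_bdd (j : ℕ) (f g : Sm) (T : ℝ) : ∃ B, ∀ s ∈ Set.Icc 0 T, Dp j f g s ≤ B := by
  obtain ⟨B1, h1⟩ := Dj_bdd j f T
  obtain ⟨B2, h2⟩ := Dj_bdd j g T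
  exact ⟨2 * B1 + 2 * B2, fun s hs => by linarith [Dp_up j f g s, h1 s hs, h2 s hs]⟩

theorem le_bsup {f : ℝ → ℝ} {T B : ℝ} (hB : ∀ s ∈ Set.Icc 0 T, f s ≤ B) (h0 : ∀ s, 0 ≤ f s) {s : ℝ}
    (hs : s ∈ Set.Icc 0 T) : f s ≤ ⨆ r ∈ Set.Icc (0:ℝ) T, f r := by
  have hb : BddAbove (Set.range fun r => ⨆ _ : r ∈ Set.Icc (0:ℝ) T, f r) := by
    refine ⟨B, ?_⟩
    rintro _ ⟨r, rfl⟩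
    exact Real.iSup_le (fun h => hB r h) ((h0 s).trans (hB s hs))
  refine le_ciSup_of_le hb s ?_
  rw [ciSup_pos hs]

theorem bsup_le {f : ℝ → ℝ} {T B : ℝ} (hB : ∀ s ∈ Set.Icc 0 T, f s ≤ B) (h0 : 0 ≤ B) :
    ⨆ r ∈ Set.Icc (0:ℝ) T, f r ≤ B :=
  Real.iSup_le (fun r => Real.iSup_le (fun h => hB r h) h0) h0

theorem bsup_nn {f : ℝ → ℝ} {T : ℝ} (h0 : ∀ s, 0 ≤ f s) : 0 ≤ ⨆ r ∈ Set.Icc (0:ℝ) T, f r :=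
  Real.iSup_nonneg fun r => Real.iSup_nonneg fun _ => h0 r

/-! The background profile. -/

/-- A function of the vertical variable only. -/
def ySm (g : ℝ → ℝ) (hg : ContDiff ℝ (⊤ : ℕ∞) g) : Sm :=
  ⟨fun p => g p.2.2, mem_Sm.2 (hg.comp (contDiff_snd.comp contDiff_snd))⟩

theorem ev_ySm (g : ℝ → ℝ) (hg : ContDiff ℝ (⊤ : ℕ∞) g) (t x y : ℝ) : (ySm g hg).1 (t, (x, y)) = g y := rfl

theorem D1_ySm (g : ℝ → ℝ) (hg : ContDiff ℝ (⊤ : ℕ∞) g) : D1 (ySm g hg) = 0 := by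
  refine Sm.ext' fun p => ?_
  obtain ⟨t, x, y⟩ := p
  exact (D1_hasDeriv (ySm g hg) t x y).unique (hasDerivAt_const x (g y))

theorem Dt_ySm (g : ℝ → ℝ) (hg : ContDiff ℝ (⊤ : ℕ∞) g) : Dt (ySm g hg) = 0 := by
  refine Sm.ext' fun p => ?_
  obtain ⟨t, x, y⟩ := p
  exact (Dt_hasDeriv (ySm g hg) t (x, y)).unique (hasDerivAt_const t (g y))

theorem Per_ySm (g : ℝ → ℝ) (hg : ContDiff ℝ (⊤ : ℕ∞) g) : Per (ySm g hg) := fun _ _ _ => rfl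

/-- The background temperature. -/
def tauS (χ c : ℝ) : Sm := cst χ + cst (1 - χ) * Yc - cst c * (Yc * Yc - Yc)

theorem ev_tauS (χ c t x y : ℝ) : (tauS χ c).1 (t, (x, y)) = χ + (1 - χ) * y - c * (y ^ 2 - y) := by
  simp only [tauS, ev_add, ev_sub, ev_mul, ev_cst, ev_Yc]; ring

theorem Per_tauS (χ c : ℝ) : Per (tauS χ c) := fun t x y => by rw [ev_tauS, ev_tauS]

theorem D1_tauS (χ c : ℝ) : D1 (tauS χ c) = 0 := by
  simp only [tauS, D1_add, D1_sub, D1_mul, D1_cst, D1_Yc]; ring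
theorem Dt_tauS (χ c : ℝ) : Dt (tauS χ c) = 0 := by
  simp only [tauS, Dt_add, Dt_sub, Dt_mul, Dt_cst, Dt_Yc]; ring
theorem D2_tauS (χ c : ℝ) : D2 (tauS χ c) = cst (1 - χ) - cst c * (2 * Yc - 1) := by
  simp only [tauS, D2_add, D2_sub, D2_mul, D2_cst, D2_Yc]; ring
theorem D22_tauS (χ c : ℝ) : D2 (D2 (tauS χ c)) = - cst (2 * c) := by
  have h1 : D2 (1 : Sm) = 0 := by rw [← cst_one]; exact D2_cst 1
  have h2 : cst (2 * c) = 2 * cst c := by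
    refine Sm.ext' fun p => ?_
    rw [two_mul, two_mul, ev_add]; rfl
  rw [D2_tauS, h2, two_mul Yc]
  simp only [D2_add, D2_sub, D2_mul, D2_cst, D2_Yc, h1]; ring

theorem exists_R (χ c : ℝ) (h : ∀ y ∈ Set.Icc (-1:ℝ) 2, |χ + (1 - χ) * y - c * (y ^ 2 - y) - 1| ≤ 1 / 2) :
    ∃ R : Sm, Per R ∧ D1 R = 0 ∧ Dt R = 0 ∧ ∀ t x y, y ∈ Set.Icc (0:ℝ) 1 →
      R.1 (t, (x, y)) = (χ + (1 - χ) * y - c * (y ^ 2 - y))⁻¹ := by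
  let β : ContDiffBump (1 / 2 : ℝ) := ⟨1 / 2, 3 / 2, by norm_num, by norm_num⟩
  have hpos : ∀ y, 1 + β y * (χ + (1 - χ) * y - c * (y ^ 2 - y) - 1) ≠ 0 := by
    intro y
    have h0 : 0 ≤ β y := β.nonneg
    have h1 : β y ≤ 1 := β.le_one
    by_cases hy : y ∈ Set.Icc (-1:ℝ) 2
    · have := abs_le.1 (h y hy)
      nlinarith
    · have hz : β y = 0 := by
        apply β.zero_of_le_dist
        change 3 / 2 ≤ dist y (1 / 2)
        rw [Real.dist_eq]
        by_contra hc
        push Not at hc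
        rw [abs_lt] at hc
        exact hy ⟨by linarith, by linarith⟩
      rw [hz]; norm_num
  have hs : ContDiff ℝ (⊤ : ℕ∞) fun y => (1 + β y * (χ + (1 - χ) * y - c * (y ^ 2 - y) - 1))⁻¹ := by
    refine ContDiff.inv ?_ hpos
    have hb : ContDiff ℝ (⊤ : ℕ∞) (β : ℝ → ℝ) := β.contDiff
    fun_prop
  refine ⟨ySm _ hs, Per_ySm _ hs, D1_ySm _ hs, Dt_ySm _ hs, fun t x y hy => ?_⟩
  rw [ev_ySm]
  have h1 : β y = 1 := by
    apply β.one_of_mem_closedBall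
    change dist y (1 / 2) ≤ 1 / 2
    rw [Real.dist_eq, abs_le]
    exact ⟨by linarith [hy.1], by linarith [hy.2]⟩
  rw [h1]; ring_nf

/-- Pointwise bounds for the background. -/
theorem R_bounds {L e R t R2 t2 R22 t22 : ℝ} (hL : 0 ≤ L) (he : 0 < e) (hLe : L * e ≤ 1 / 400)
    (ht : |t - 1| ≤ 2 * (L * e)) (h2 : |t2| ≤ L * e) (h22 : |t22| ≤ L * e)
    (h : R * t = 1) (h' : R * t2 + t * R2 = 0) (h'' : R * t22 + 2 * (R2 * t2) + t * R22 = 0) :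
    1 / 2 ≤ R ∧ R ≤ 2 ∧ 1 / 2 ≤ t ∧ t ≤ 2 ∧ |R2| ≤ 4 * (L * e) ∧ |R22| ≤ 10 * (L * e) := by
  have hx0 : 0 ≤ L * e := by positivity
  set x := L * e with hx
  obtain ⟨ta, tb⟩ := abs_le.1 ht
  have tl : 1 / 2 ≤ t := by linarith
  have tu : t ≤ 2 := by linarith
  have t0 : t ≠ 0 := by linarith
  have hR : R = t⁻¹ := eq_inv_of_mul_eq_one_left h
  have Rl : 1 / 2 ≤ R := by
    rw [hR, le_inv_comm₀ (by norm_num) (by linarith)]; norm_num; exact tu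
  have Ru : R ≤ 2 := by
    rw [hR, inv_le_comm₀ (by linarith) (by norm_num)]; norm_num; linarith
  have e1 : R2 = - (R * R * t2) := by
    have : R * (R * t2 + t * R2) = 0 := by rw [h', mul_zero]
    linear_combination this - R2 * h
  have e2 : R22 = - (R * (R * t22 + 2 * (R2 * t2))) := by
    have : R * (R * t22 + 2 * (R2 * t2) + t * R22) = 0 := by rw [h'', mul_zero]
    linear_combination this - R22 * h
  have b1 : |R2| ≤ 4 * x := by
    rw [e1, abs_neg, abs_mul, abs_mul, abs_of_nonneg (by linarith : 0 ≤ R)]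
    have : R * R ≤ 4 := by nlinarith
    exact mul_le_mul this h2 (abs_nonneg _) (by norm_num)
  refine ⟨Rl, Ru, tl, tu, b1, ?_⟩
  have b3 : |R2 * t2| ≤ 4 * x * x := by
    rw [abs_mul]; exact mul_le_mul b1 h2 (abs_nonneg _) (by positivity)
  have b4 : |R * t22| ≤ 2 * x := by
    rw [abs_mul, abs_of_nonneg (by linarith : 0 ≤ R)]; exact mul_le_mul Ru h22 (abs_nonneg _) (by norm_num)
  have b5 : |R * t22 + 2 * (R2 * t2)| ≤ 5 * x := by
    refine (abs_add_le _ _).trans ?_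
    rw [abs_mul 2, abs_two]
    nlinarith
  rw [e2, abs_neg, abs_mul, abs_of_nonneg (by linarith : 0 ≤ R)]
  calc R * |R * t22 + 2 * (R2 * t2)| ≤ 2 * (5 * x) := mul_le_mul Ru b5 (abs_nonneg _) (by norm_num)
    _ = 10 * x := by ring

theorem background (χ c L e : ℝ) (hL : 0 ≤ L) (he : 0 < e) (hLe : L * e ≤ 1 / 400)
    (hχ : |1 - χ| + c ≤ L * e) (h2c : 2 * c ≤ L * e) (hc : 0 ≤ c) :
    ∃ R : Sm, Per R ∧ D1 R = 0 ∧ Dt R = 0 ∧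
      (∀ t x y, y ∈ Set.Icc (0:ℝ) 1 → R.1 (t, (x, y)) = ((tauS χ c).1 (t, (x, y)))⁻¹) ∧
      ∀ t, 0 ≤ t → ∀ x ∈ Ω, R.1 (t, x) * (tauS χ c).1 (t, x) = 1 ∧
        1 / 2 ≤ R.1 (t, x) ∧ R.1 (t, x) ≤ 2 ∧ 1 / 2 ≤ (tauS χ c).1 (t, x) ∧ (tauS χ c).1 (t, x) ≤ 2 ∧
        |(D2 R).1 (t, x)| ≤ 4 * (L * e) ∧ |(D2 (D2 R)).1 (t, x)| ≤ 10 * (L * e) ∧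
        |(D2 (tauS χ c)).1 (t, x)| ≤ L * e := by
  have hx0 : 0 ≤ L * e := by positivity
  have hb : ∀ y ∈ Set.Icc (-1:ℝ) 2, |χ + (1 - χ) * y - c * (y ^ 2 - y) - 1| ≤ 2 * (L * e) := by
    intro y hy
    have e1 : χ + (1 - χ) * y - c * (y ^ 2 - y) - 1 = (1 - χ) * (y - 1) - c * (y ^ 2 - y) := by ring
    rw [e1]
    refine (abs_sub _ _).trans ?_
    rw [abs_mul, abs_mul, abs_of_nonneg hc]
    have h1 : |y - 1| ≤ 2 := abs_le.2 ⟨by linarith [hy.1], by linarith [hy.2]⟩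
    have h2 : |y ^ 2 - y| ≤ 2 := abs_le.2 ⟨by nlinarith [sq_nonneg (y - 1/2)], by nlinarith [hy.1, hy.2]⟩
    nlinarith [mul_le_mul_of_nonneg_left h1 (abs_nonneg (1 - χ)), mul_le_mul_of_nonneg_left h2 hc]
  obtain ⟨R, pR, R1, Rt, hR⟩ := exists_R χ c fun y hy => (hb y hy).trans (by linarith)
  have hR' : ∀ t x y, y ∈ Set.Icc (0:ℝ) 1 → R.1 (t, (x, y)) = ((tauS χ c).1 (t, (x, y)))⁻¹ := by
    intro t x y hy; rw [hR t x y hy, ev_tauS]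
  refine ⟨R, pR, R1, Rt, hR', ?_⟩
  intro t ht x hx
  have ht' : t ∈ Set.Icc 0 (t + 1) := ⟨ht, by linarith⟩
  have htau : ∀ t, ∀ x ∈ Ω, |(tauS χ c).1 (t, x) - 1| ≤ 2 * (L * e) := by
    rintro t ⟨x, y⟩ hx
    rw [ev_tauS]
    exact hb y ⟨by linarith [hx.2.1], by linarith [hx.2.2]⟩
  have hv : ∀ s ∈ Set.Icc 0 (t + 1), ∀ x ∈ Ω, (R * tauS χ c - 1).1 (s, x) = 0 := by
    rintro s _ ⟨x, y⟩ hx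
    have h0 := abs_le.1 (htau s (x, y) hx)
    have h1 : (tauS χ c).1 (s, (x, y)) ≠ 0 := by
      intro h; rw [h] at h0; linarith [h0.1]
    rw [ev_sub, ev_mul, ev_one, hR' s x y ⟨hx.2.1.le, hx.2.2.le⟩, inv_mul_cancel₀ h1, sub_self]
  have hD1 : D2 (1 : Sm) = 0 := by rw [← cst_one]; exact D2_cst 1
  have v2 : ∀ s ∈ Set.Icc 0 (t + 1), ∀ x ∈ Ω, (D2 (R * tauS χ c - 1)).1 (s, x) = 0 :=
    Dd_vanish (by linarith) hv (0, (0, 1))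
  have v22 : ∀ s ∈ Set.Icc 0 (t + 1), ∀ x ∈ Ω, (D2 (D2 (R * tauS χ c - 1))).1 (s, x) = 0 :=
    Dd_vanish (by linarith) v2 (0, (0, 1))
  have a0 := hv t ht' x hx
  have a1 := v2 t ht' x hx
  have a2 := v22 t ht' x hx
  simp only [D2_sub, D2_mul, D2_add, hD1, sub_zero, ev_add, ev_mul, ev_sub, ev_one] at a0 a1 a2
  have b2 : |(D2 (tauS χ c)).1 (t, x)| ≤ L * e := by
    obtain ⟨x, y⟩ := x
    have e1 : (D2 (tauS χ c)).1 (t, (x, y)) = (1 - χ) - c * (2 * y - 1) := by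
      rw [D2_tauS, two_mul Yc]; simp only [ev_sub, ev_mul, ev_add, ev_cst, ev_Yc, ev_one]; ring
    rw [e1]
    refine (abs_sub _ _).trans ?_
    rw [abs_mul, abs_of_nonneg hc]
    have h1 : |2 * y - 1| ≤ 1 := abs_le.2 ⟨by linarith [hx.2.1], by linarith [hx.2.2]⟩
    nlinarith [mul_le_mul_of_nonneg_left h1 hc]
  have b22 : |(D2 (D2 (tauS χ c))).1 (t, x)| ≤ L * e := by
    rw [D22_tauS, ev_neg, ev_cst, abs_neg, abs_of_nonneg (by linarith)]; exact h2c
  obtain ⟨c1, c2, c3, c4, c5, c6⟩ := R_bounds (R22 := (D2 (D2 R)).1 (t, x)) hL he hLe (htau t x hx) b2 b22 (sub_eq_zero.1 a0) a1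
    (by linear_combination a2)
  exact ⟨sub_eq_zero.1 a0, c1, c2, c3, c4, c5, c6, b2⟩

/-! The functionals in terms of smooth space-time functions. -/

def fn (f : Sm) : ℝ → ℝ × ℝ → ℝ := fun t x => f.1 (t, x)
def fp (f g : Sm) : ℝ → ℝ × ℝ → ℝ × ℝ := fun t x => (f.1 (t, x), g.1 (t, x))

theorem dt_fn (f : Sm) : dt (fn f) = fn (Dt f) :=
  funext fun t => funext fun x => (Dt_hasDeriv f t x).deriv
theorem dt_fp (f g : Sm) : dt (fp f g) = fp (Dt f) (Dt g) :=
  funext fun t => funext fun x => ((Dt_hasDeriv f t x).prodMk (Dt_hasDeriv g t x)).deriv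

theorem Dj_nn (j : ℕ) (f : Sm) (t : ℝ) : 0 ≤ Dj j f t := dSq_nn _ _
theorem Dp_nn (j : ℕ) (f g : Sm) (t : ℝ) : 0 ≤ Dp j f g t := dSq_nn _ _
theorem HSq_nn {F : Type*} [NormedAddCommGroup F] [NormedSpace ℝ F] (j : ℕ) (f : ℝ × ℝ → F) : 0 ≤ HSq j f :=
  Finset.sum_nonneg fun _ _ => dSq_nn _ _
theorem L2Sq_nn {F : Type*} [NormedAddCommGroup F] [NormedSpace ℝ F] (f : ℝ × ℝ → F) : 0 ≤ L2Sq f :=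
  dSq_nn _ _

def BI (T : ℝ) (f : ℝ → ℝ) : Prop := ∃ B, ∀ s ∈ Set.Icc 0 T, f s ≤ B
theorem BI.add {T : ℝ} {f g : ℝ → ℝ} (hf : BI T f) (hg : BI T g) : BI T fun s => f s + g s := by
  obtain ⟨B, hB⟩ := hf
  obtain ⟨C, hC⟩ := hg
  exact ⟨B + C, fun s hs => add_le_add (hB s hs) (hC s hs)⟩
theorem BI.mul {T c : ℝ} {f : ℝ → ℝ} (hf : BI T f) (hc : 0 ≤ c) : BI T fun s => c * f s := by
  obtain ⟨B, hB⟩ := hf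
  exact ⟨c * B, fun s hs => mul_le_mul_of_nonneg_left (hB s hs) hc⟩

theorem sup_int_ge {f g : ℝ → ℝ} {T s : ℝ} (hB : BI T f) (h0 : ∀ s, 0 ≤ f s) (g0 : ∀ s, 0 ≤ g s)
    (hs : s ∈ Set.Icc 0 T) : f s ≤ (⨆ r ∈ Set.Icc (0:ℝ) T, f r) + ∫ s in (0:ℝ)..T, g s := by
  obtain ⟨B, hB⟩ := hB
  have h1 := le_bsup hB h0 hs
  have h2 : 0 ≤ ∫ s in (0:ℝ)..T, g s := intervalIntegral.integral_nonneg (hs.1.trans hs.2) fun _ _ => g0 _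
  linarith

section
variable {ε T s : ℝ} (he : 0 < ε) (φ v w θ : Sm) (hs : s ∈ Set.Icc 0 T)

theorem A0_ge (he : 0 < ε) (φ v w θ : Sm) (hs : s ∈ Set.Icc 0 T) :
    Dp 0 v w s + (ε ^ 2)⁻¹ * Dj 0 φ s + (ε ^ 2)⁻¹ * Dj 0 θ s ≤ A0 ε (fn φ) (fp v w) (fn θ) T := by
  have hi : 0 ≤ (ε ^ 2)⁻¹ := by positivity
  refine sup_int_ge (f := fun s => Dp 0 v w s + (ε ^ 2)⁻¹ * Dj 0 φ s + (ε ^ 2)⁻¹ * Dj 0 θ s)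
    (g := fun s => HSq 1 (fp v w s) + (ε ^ 2)⁻¹ * HSq 1 (fn θ s)) ?_ ?_ ?_ hs
  · exact (BI.add (Dp_bdd 0 v w T) (BI.mul (Dj_bdd 0 φ T) hi)).add (BI.mul (Dj_bdd 0 θ T) hi)
  · intro s
    have := Dp_nn 0 v w s; have := Dj_nn 0 φ s; have := Dj_nn 0 θ s
    positivity
  · intro s
    have := HSq_nn 1 (fp v w s); have := HSq_nn 1 (fn θ s)
    positivity

theorem A1_ge (he : 0 < ε) (φ v w θ : Sm) (hs : s ∈ Set.Icc 0 T) :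
    Dp 1 v w s + (ε ^ 2)⁻¹ * Dj 1 θ s ≤ A1 ε (fn φ) (fp v w) (fn θ) T := by
  have hi : 0 ≤ (ε ^ 2)⁻¹ := by positivity
  refine sup_int_ge (f := fun s => Dp 1 v w s + (ε ^ 2)⁻¹ * Dj 1 θ s)
    (g := fun s => L2Sq (dt (fp v w) s) + (ε ^ 2)⁻¹ * L2Sq (dt (fn θ) s)) ?_ ?_ ?_ hs
  · exact (BI.add (Dp_bdd 1 v w T) (BI.mul (Dj_bdd 1 θ T) hi))
  · intro s
    have := Dp_nn 1 v w s; have := Dj_nn 1 θ s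
    positivity
  · intro s
    have := L2Sq_nn (dt (fp v w) s); have := L2Sq_nn (dt (fn θ) s)
    positivity

theorem A2_ge (he : 0 < ε) (φ v w θ : Sm) (hs : s ∈ Set.Icc 0 T) :
    (ε ^ 2)⁻¹ * Dj 1 φ s ≤ A2 ε (fn φ) (fp v w) (fn θ) T := by
  have hi : 0 ≤ (ε ^ 2)⁻¹ := by positivity
  have h0 : (0:ℝ) ≤ T := hs.1.trans hs.2
  obtain ⟨B, hB⟩ := Dj_bdd 1 φ T
  have h1 : Dj 1 φ s ≤ ⨆ r ∈ Set.Icc (0:ℝ) T, dSq 1 (fn φ r) := le_bsup (f := fun s => Dj 1 φ s) hB (Dj_nn 1 φ) hs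
  have h2 : 0 ≤ ∫ s in (0:ℝ)..T, ((ε ^ 4)⁻¹ * HSq 1 (fn φ s) + (ε ^ 2)⁻¹ * L2Sq (dt (fn φ) s)) :=
    intervalIntegral.integral_nonneg h0 fun s _ => by
      have := HSq_nn 1 (fn φ s); have := L2Sq_nn (dt (fn φ) s)
      positivity
  have h3 : 0 ≤ ∫ s in (0:ℝ)..T, (HSq 2 (fp v w s) + (ε ^ 2)⁻¹ * HSq 2 (fn θ s)) :=
    intervalIntegral.integral_nonneg h0 fun s _ => by
      have := HSq_nn 2 (fp v w s); have := HSq_nn 2 (fn θ s)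
      positivity
  have h4 := mul_le_mul_of_nonneg_left h1 hi
  unfold A2
  linarith

theorem A3_ge (he : 0 < ε) (φ v w θ : Sm) (hs : s ∈ Set.Icc 0 T) :
    (ε ^ 2)⁻¹ * Dj 0 (Dt φ) s + Dp 0 (Dt v) (Dt w) s + (ε ^ 2)⁻¹ * Dj 0 (Dt θ) s
      ≤ A3 ε (fn φ) (fp v w) (fn θ) T := by
  have hi : 0 ≤ (ε ^ 2)⁻¹ := by positivity
  unfold A3
  rw [dt_fn, dt_fn, dt_fp]
  refine sup_int_ge (f := fun s => (ε ^ 2)⁻¹ * Dj 0 (Dt φ) s + Dp 0 (Dt v) (Dt w) s + (ε ^ 2)⁻¹ * Dj 0 (Dt θ) s)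
    (g := fun s => dSq 1 (fp (Dt v) (Dt w) s) + (ε ^ 2)⁻¹ * dSq 1 (fn (Dt θ) s)) ?_ ?_ ?_ hs
  · exact (BI.add (BI.mul (Dj_bdd 0 (Dt φ) T) hi) (Dp_bdd 0 (Dt v) (Dt w) T)).add (BI.mul (Dj_bdd 0 (Dt θ) T) hi)
  · intro s
    have := Dp_nn 0 (Dt v) (Dt w) s; have := Dj_nn 0 (Dt φ) s; have := Dj_nn 0 (Dt θ) s
    positivity
  · intro s
    have := dSq_nn 1 (fp (Dt v) (Dt w) s); have := dSq_nn 1 (fn (Dt θ) s)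
    positivity

theorem A4_ge (he : 0 < ε) (φ v w θ : Sm) (hs : s ∈ Set.Icc 0 T) :
    (ε ^ 2)⁻¹ * Dj 2 φ s + Dp 2 v w s + (ε ^ 2)⁻¹ * Dj 2 θ s ≤ A4 ε (fn φ) (fp v w) (fn θ) T := by
  have hi : 0 ≤ (ε ^ 2)⁻¹ := by positivity
  refine sup_int_ge (f := fun s => (ε ^ 2)⁻¹ * Dj 2 φ s + Dp 2 v w s + (ε ^ 2)⁻¹ * Dj 2 θ s)
    (g := fun s => (ε ^ 4)⁻¹ * HSq 2 (fn φ s) + HSq 3 (fp v w s) + (ε ^ 2)⁻¹ * HSq 3 (fn θ s)) ?_ ?_ ?_ hs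
  · exact (BI.add (BI.mul (Dj_bdd 2 φ T) hi) (Dp_bdd 2 v w T)).add (BI.mul (Dj_bdd 2 θ T) hi)
  · intro s
    have := Dp_nn 2 v w s; have := Dj_nn 2 φ s; have := Dj_nn 2 θ s
    positivity
  · intro s
    have := HSq_nn 2 (fn φ s); have := HSq_nn 3 (fp v w s); have := HSq_nn 3 (fn θ s)
    positivity

theorem A5_ge (he : 0 < ε) (φ v w θ : Sm) (hs : s ∈ Set.Icc 0 T) :
    (ε ^ 2)⁻¹ * Dj 3 φ s + (Dp 3 v w s + Dp 1 (Dt v) (Dt w) s) + (ε ^ 2)⁻¹ * (Dj 3 θ s + Dj 1 (Dt θ) s)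
      ≤ A5 ε (fn φ) (fp v w) (fn θ) T := by
  have hi : 0 ≤ (ε ^ 2)⁻¹ := by positivity
  unfold A5
  rw [dt_fn, dt_fp]
  refine sup_int_ge (f := fun s => (ε ^ 2)⁻¹ * Dj 3 φ s + (Dp 3 v w s + Dp 1 (Dt v) (Dt w) s)
      + (ε ^ 2)⁻¹ * (Dj 3 θ s + Dj 1 (Dt θ) s))
    (g := fun s => L2Sq (dt (fp (Dt v) (Dt w)) s) + (ε ^ 2)⁻¹ * L2Sq (dt (fn (Dt θ)) s)) ?_ ?_ ?_ hs
  · exact (BI.add (BI.mul (Dj_bdd 3 φ T) hi) (BI.add (Dp_bdd 3 v w T) (Dp_bdd 1 (Dt v) (Dt w) T))).add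
      (BI.mul (BI.add (Dj_bdd 3 θ T) (Dj_bdd 1 (Dt θ) T)) hi)
  · intro s
    have := Dp_nn 3 v w s; have := Dj_nn 3 φ s; have := Dj_nn 3 θ s
    have := Dp_nn 1 (Dt v) (Dt w) s; have := Dj_nn 1 (Dt θ) s
    positivity
  · intro s
    have := L2Sq_nn (dt (fp (Dt v) (Dt w)) s); have := L2Sq_nn (dt (fn (Dt θ)) s)
    positivity

end

theorem scale_arith {e i p0 f0 h0 p1 h1 f1 x3 f2 p2 h2 f3 p3 h3 : ℝ} (he : 0 < e) (hi : i * e ^ 2 = 1)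
    (hp0 : 0 ≤ p0) (hf0 : 0 ≤ f0) (hh0 : 0 ≤ h0) (hp1 : 0 ≤ p1) (hh1 : 0 ≤ h1) (hf1 : 0 ≤ f1) (hx3 : 0 ≤ x3)
    (hf2 : 0 ≤ f2) (hp2 : 0 ≤ p2) (hh2 : 0 ≤ h2) (hf3 : 0 ≤ f3) (hp3 : 0 ≤ p3) (hh3 : 0 ≤ h3)
    (h : i * (p0 + i * f0 + i * h0) + (p1 + i * h1) + i * f1 + x3 + e ^ 2 * (i * f2 + p2 + i * h2)
      + e ^ 4 * (i * f3 + p3 + i * h3) ≤ 1) :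
    (f0 ≤ (e * e) ^ 2 ∧ e ^ 2 * f1 ≤ (e * e) ^ 2 ∧ e ^ 4 * f2 ≤ (e * e) ^ 2 ∧ e ^ 6 * f3 ≤ (e * e) ^ 2) ∧
    (h0 ≤ (e * e) ^ 2 ∧ e ^ 2 * h1 ≤ (e * e) ^ 2 ∧ e ^ 4 * h2 ≤ (e * e) ^ 2 ∧ e ^ 6 * h3 ≤ (e * e) ^ 2) ∧
    (p0 ≤ (e * 1) ^ 2 ∧ e ^ 2 * p1 ≤ (e * 1) ^ 2 ∧ e ^ 4 * p2 ≤ (e * 1) ^ 2 ∧ e ^ 6 * p3 ≤ (e * 1) ^ 2) := by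
  have i0 : 0 ≤ i := by
    by_contra hc
    push Not at hc
    have : i * e ^ 2 < 0 := mul_neg_of_neg_of_pos hc (by positivity)
    linarith
  have q0 : 0 ≤ i * p0 := by positivity
  have q1 : 0 ≤ i * (i * f0) := by positivity
  have q2 : 0 ≤ i * (i * h0) := by positivity
  have q3 : 0 ≤ i * h1 := by positivity
  have q4 : 0 ≤ i * f1 := by positivity
  have z2 : e ^ 2 * (i * f2) = f2 := by linear_combination f2 * hi
  have z2' : e ^ 2 * (i * h2) = h2 := by linear_combination h2 * hi
  have z3 : e ^ 4 * (i * f3) = e ^ 2 * f3 := by linear_combination e ^ 2 * f3 * hi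
  have z3' : e ^ 4 * (i * h3) = e ^ 2 * h3 := by linear_combination e ^ 2 * h3 * hi
  have q5 : 0 ≤ e ^ 2 * f3 := by positivity
  have q6 : 0 ≤ e ^ 2 * h3 := by positivity
  have q7 : 0 ≤ e ^ 2 * p2 := by positivity
  have q8 : 0 ≤ e ^ 4 * p3 := by positivity
  have h' : i * p0 + i * (i * f0) + i * (i * h0) + p1 + i * h1 + i * f1 + x3 + f2 + e ^ 2 * p2 + h2
      + e ^ 2 * f3 + e ^ 4 * p3 + e ^ 2 * h3 ≤ 1 := by
    linear_combination h - z2 - z2' - z3 - z3'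
  have e2 : 0 ≤ e ^ 2 := by positivity
  have e4 : 0 ≤ e ^ 4 := by positivity
  have m : ∀ {x c : ℝ}, 0 ≤ c → x ≤ 1 → c * x ≤ c := fun hc hx => mul_le_of_le_one_right hc hx
  refine ⟨⟨?_, ?_, ?_, ?_⟩, ⟨?_, ?_, ?_, ?_⟩, ?_, ?_, ?_, ?_⟩
  · have := m e4 (show i * (i * f0) ≤ 1 by linarith)
    linear_combination this - f0 * (i * e ^ 2 + 1) * hi
  · have := m e4 (show i * f1 ≤ 1 by linarith)
    linear_combination this - f1 * e ^ 2 * hi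
  · have := m e4 (show f2 ≤ 1 by linarith)
    linear_combination this
  · have := m e4 (show e ^ 2 * f3 ≤ 1 by linarith)
    linear_combination this
  · have := m e4 (show i * (i * h0) ≤ 1 by linarith)
    linear_combination this - h0 * (i * e ^ 2 + 1) * hi
  · have := m e4 (show i * h1 ≤ 1 by linarith)
    linear_combination this - h1 * e ^ 2 * hi
  · have := m e4 (show h2 ≤ 1 by linarith)
    linear_combination this
  · have := m e4 (show e ^ 2 * h3 ≤ 1 by linarith)
    linear_combination this
  · have := m e2 (show i * p0 ≤ 1 by linarith)
    linear_combination this - p0 * hi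
  · have := m e2 (show p1 ≤ 1 by linarith)
    linear_combination this
  · have := m e2 (show e ^ 2 * p2 ≤ 1 by linarith)
    linear_combination this
  · have := m e2 (show e ^ 4 * p3 ≤ 1 by linarith)
    linear_combination this

/-- Scaled bounds. -/
def SB (e Z : ℝ) (f : Sm) (t : ℝ) : Prop :=
  Dj 0 f t ≤ (e * Z) ^ 2 ∧ e ^ 2 * Dj 1 f t ≤ (e * Z) ^ 2 ∧ e ^ 4 * Dj 2 f t ≤ (e * Z) ^ 2 ∧
    e ^ 6 * Dj 3 f t ≤ (e * Z) ^ 2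

theorem N_bounds {ε T : ℝ} (he : 0 < ε) {φ v w θ : Sm} (h : Nfun ε (fn φ) (fp v w) (fn θ) T ≤ 1) {s : ℝ}
    (hs : s ∈ Set.Icc 0 T) : SB ε ε φ s ∧ SB ε ε θ s ∧ SB ε 1 v s ∧ SB ε 1 w s := by
  have a0 := A0_ge he φ v w θ hs
  have a1 := A1_ge he φ v w θ hs
  have a2 := A2_ge he φ v w θ hs
  have a3 := A3_ge he φ v w θ hs
  have a4 := A4_ge he φ v w θ hs
  have a5 := A5_ge he φ v w θ hs
  unfold Nfun at h
  have hi : (ε ^ 2)⁻¹ * ε ^ 2 = 1 := inv_mul_cancel₀ (by positivity)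
  have i0 : 0 ≤ (ε ^ 2)⁻¹ := by positivity
  set i := (ε ^ 2)⁻¹ with hidef
  have a0' := mul_le_mul_of_nonneg_left a0 i0
  have a3' : 0 ≤ ε ^ 2 * A3 ε (fn φ) (fp v w) (fn θ) T := by
    refine mul_nonneg (by positivity) (le_trans ?_ a3)
    have := Dj_nn 0 (Dt φ) s; have := Dp_nn 0 (Dt v) (Dt w) s; have := Dj_nn 0 (Dt θ) s
    positivity
  have a4' := mul_le_mul_of_nonneg_left a4 (show 0 ≤ ε ^ 2 by positivity)
  have a5b : i * Dj 3 φ s + Dp 3 v w s + i * Dj 3 θ s ≤ A5 ε (fn φ) (fp v w) (fn θ) T := by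
    have := Dp_nn 1 (Dt v) (Dt w) s
    have := mul_nonneg i0 (Dj_nn 1 (Dt θ) s)
    linarith
  have a5' := mul_le_mul_of_nonneg_left a5b (show 0 ≤ ε ^ 4 by positivity)
  obtain ⟨r1, r2, r3⟩ := scale_arith he hi (Dp_nn 0 v w s) (Dj_nn 0 φ s) (Dj_nn 0 θ s) (Dp_nn 1 v w s) (Dj_nn 1 θ s)
    (Dj_nn 1 φ s) le_rfl (Dj_nn 2 φ s) (Dp_nn 2 v w s) (Dj_nn 2 θ s) (Dj_nn 3 φ s) (Dp_nn 3 v w s) (Dj_nn 3 θ s)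
    (by linarith)
  have m2 : 0 ≤ ε ^ 2 := by positivity
  have m4 : 0 ≤ ε ^ 4 := by positivity
  have m6 : 0 ≤ ε ^ 6 := by positivity
  refine ⟨r1, r2, ⟨?_, ?_, ?_, ?_⟩, ?_, ?_, ?_, ?_⟩
  · exact (Dp_fst 0 v w s).trans r3.1
  · exact (mul_le_mul_of_nonneg_left (Dp_fst 1 v w s) m2).trans r3.2.1
  · exact (mul_le_mul_of_nonneg_left (Dp_fst 2 v w s) m4).trans r3.2.2.1
  · exact (mul_le_mul_of_nonneg_left (Dp_fst 3 v w s) m6).trans r3.2.2.2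
  · exact (Dp_snd 0 v w s).trans r3.1
  · exact (mul_le_mul_of_nonneg_left (Dp_snd 1 v w s) m2).trans r3.2.1
  · exact (mul_le_mul_of_nonneg_left (Dp_snd 2 v w s) m4).trans r3.2.2.1
  · exact (mul_le_mul_of_nonneg_left (Dp_snd 3 v w s) m6).trans r3.2.2.2

theorem agm_arith {e l F a b c d Y : ℝ} (he : 0 < e) (he1 : e ≤ 1) (hl : l = e⁻¹) (hY : 0 ≤ Y)
    (a0 : 0 ≤ a) (b0 : 0 ≤ b) (c0 : 0 ≤ c) (d0 : 0 ≤ d)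
    (ha : a ≤ Y ^ 2) (hb : e ^ 2 * b ≤ Y ^ 2) (hc : e ^ 2 * c ≤ Y ^ 2) (hd : e ^ 4 * d ≤ Y ^ 2)
    (h : F ^ 2 ≤ (1 + l) * ((1 + l) * a + l⁻¹ * b) + l⁻¹ * ((1 + l) * c + l⁻¹ * d)) : e * |F| ≤ 3 * Y := by
  have hl' : l⁻¹ = e := by rw [hl, inv_inv]
  have hel : e * l = 1 := by rw [hl]; exact mul_inv_cancel₀ he.ne'
  rw [hl'] at h
  apply abs_le_of_sq_le_sq' _ (by positivity) |>.2
  rw [mul_pow e, sq_abs]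
  have h1 := mul_le_mul_of_nonneg_left h (show 0 ≤ e ^ 2 by positivity)
  have e1 : e ^ 2 * ((1 + l) * ((1 + l) * a + e * b) + e * ((1 + l) * c + e * d))
      = (1 + e) ^ 2 * a + (1 + e) * (e ^ 2 * b) + (1 + e) * (e ^ 2 * c) + e ^ 4 * d := by
    linear_combination (a * (2 * e + e * l + 1) + e ^ 2 * b + e ^ 2 * c) * hel
  have g1 : (1 + e) ^ 2 * a ≤ 4 * Y ^ 2 := mul_le_mul (by nlinarith) ha a0 (by norm_num)
  have g2 : (1 + e) * (e ^ 2 * b) ≤ 2 * Y ^ 2 := mul_le_mul (by linarith) hb (by positivity) (by norm_num)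
  have g3 : (1 + e) * (e ^ 2 * c) ≤ 2 * Y ^ 2 := mul_le_mul (by linarith) hc (by positivity) (by norm_num)
  rw [e1] at h1
  linarith

theorem linf1 {e Y : ℝ} (he : 0 < e) (he1 : e ≤ 1) (hY : 0 ≤ Y) {f : Sm} {t : ℝ}
    (h0 : Dj 0 f t ≤ Y ^ 2) (h1 : e ^ 2 * Dj 1 f t ≤ Y ^ 2) (h2 : e ^ 4 * Dj 2 f t ≤ Y ^ 2) {x : ℝ × ℝ} (hx : x ∈ Ω) :
    e * |f.1 (t, x)| ≤ 3 * Y := by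
  have m2 : 0 ≤ e ^ 2 := by positivity
  have m4 : 0 ≤ e ^ 4 := by positivity
  refine agm_arith he he1 rfl hY (I_sq_nonneg f t) (I_sq_nonneg (D2 f) t) (I_sq_nonneg (D1 f) t)
    (I_sq_nonneg (D1 (D2 f)) t) ?_ ?_ ?_ ?_ (agmon f (inv_pos.2 he) (Ω_sub hx))
  · rw [← Dj_zero]; exact h0
  · rw [← Dj_zero]; exact (mul_le_mul_of_nonneg_left (Dj_D2 0 f t) m2).trans h1
  · rw [← Dj_zero]; exact (mul_le_mul_of_nonneg_left (Dj_D1 0 f t) m2).trans h1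
  · rw [← Dj_zero]; exact (mul_le_mul_of_nonneg_left ((Dj_D1 0 (D2 f) t).trans (Dj_D2 1 f t)) m4).trans h2

theorem linf {e Z : ℝ} (he : 0 < e) (he1 : e ≤ 1) (hZ : 0 ≤ Z) {f : Sm} {t : ℝ} (h : SB e Z f t) {x : ℝ × ℝ}
    (hx : x ∈ Ω) : |f.1 (t, x)| ≤ 3 * Z ∧ |(D1 f).1 (t, x)| ≤ 3 * (Z * e⁻¹) ∧ |(D2 f).1 (t, x)| ≤ 3 * (Z * e⁻¹) := by
  obtain ⟨h0, h1, h2, h3⟩ := h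
  have e2 : 0 < e ^ 2 := by positivity
  have k1 : Dj 1 f t ≤ Z ^ 2 := by
    refine le_of_mul_le_mul_left (h1.trans (le_of_eq ?_)) e2; ring
  have k2 : e ^ 2 * Dj 2 f t ≤ Z ^ 2 := by
    refine le_of_mul_le_mul_left (le_trans (le_of_eq ?_) (h2.trans (le_of_eq ?_))) e2 <;> ring
  have k3 : e ^ 4 * Dj 3 f t ≤ Z ^ 2 := by
    refine le_of_mul_le_mul_left (le_trans (le_of_eq ?_) (h3.trans (le_of_eq ?_))) e2 <;> ring
  have m4 : 0 ≤ e ^ 4 := by positivity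
  have fin : ∀ {y}, e * y ≤ 3 * Z → y ≤ 3 * (Z * e⁻¹) := by
    intro y hy
    rw [← mul_assoc, ← div_eq_mul_inv, le_div_iff₀ he]; linarith
  refine ⟨?_, fin ?_, fin ?_⟩
  · have := linf1 he he1 (show 0 ≤ e * Z by positivity) h0 h1 h2 hx
    refine le_of_mul_le_mul_left (this.trans (le_of_eq ?_)) he; ring
  · exact linf1 he he1 hZ ((Dj_D1 0 f t).trans k1) ((mul_le_mul_of_nonneg_left (Dj_D1 1 f t) e2.le).trans k2)
      ((mul_le_mul_of_nonneg_left (Dj_D1 2 f t) m4).trans k3) hx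
  · exact linf1 he he1 hZ ((Dj_D2 0 f t).trans k1) ((mul_le_mul_of_nonneg_left (Dj_D2 1 f t) e2.le).trans k2)
      ((mul_le_mul_of_nonneg_left (Dj_D2 2 f t) m4).trans k3) hx

/-! From solutions of the perturbation system to the abstract flow. -/

theorem d1_of_eqOn {g : ℝ × ℝ → ℝ} {f : Sm} {t : ℝ} (h : ∀ y ∈ Ω, g y = f.1 (t, y)) {x : ℝ × ℝ} (hx : x ∈ Ω) :
    d1 g x = (D1 f).1 (t, x) := by
  have e : g =ᶠ[𝓝 x] fun y => f.1 (t, y) := Filter.eventuallyEq_of_mem (Ω_open.mem_nhds hx) h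
  unfold d1
  rw [e.fderiv_eq]
  exact slice_fderiv f t x _
theorem d2_of_eqOn {g : ℝ × ℝ → ℝ} {f : Sm} {t : ℝ} (h : ∀ y ∈ Ω, g y = f.1 (t, y)) {x : ℝ × ℝ} (hx : x ∈ Ω) :
    d2 g x = (D2 f).1 (t, x) := by
  have e : g =ᶠ[𝓝 x] fun y => f.1 (t, y) := Filter.eventuallyEq_of_mem (Ω_open.mem_nhds hx) h
  unfold d2
  rw [e.fderiv_eq]
  exact slice_fderiv f t x _

theorem d1_fn (f : Sm) (t : ℝ) : d1 (fn f t) = fn (D1 f) t := slice_d1 f t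
theorem d2_fn (f : Sm) (t : ℝ) : d2 (fn f t) = fn (D2 f) t := slice_d2 f t
theorem fp_1 (v w : Sm) (t : ℝ) : (fun y => (fp v w t y).1) = fn v t := rfl
theorem fp_2 (v w : Sm) (t : ℝ) : (fun y => (fp v w t y).2) = fn w t := rfl
theorem ev_fn (f : Sm) (t : ℝ) (x : ℝ × ℝ) : fn f t x = f.1 (t, x) := rfl
theorem divv_fp (v w : Sm) (t : ℝ) : divv (fp v w t) = fn (D1 v + D2 w) t := by
  funext x
  unfold divv
  rw [fp_1, fp_2, d1_fn, d2_fn]; rfl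
theorem lap_fn (f : Sm) (t : ℝ) : lap (fn f t) = fn (D1 (D1 f) + D2 (D2 f)) t := by
  funext x
  unfold lap
  rw [d1_fn, d1_fn, d2_fn, d2_fn]; rfl

theorem mean_zero {T : ℝ} {φ v w R : Sm} (pφ : Per φ) (pv : Per v) (pR : Per R) (R1 : D1 R = 0)
    (ww : ∀ t ∈ Set.Icc 0 T, W0 t w)
    (gM : ∀ t ∈ Set.Icc 0 T, ∀ x ∈ Ω, (Dt φ + (Yc + v) * D1 φ + w * D2 φ + (R + φ) * (D1 v + D2 w) + w * D2 R).1 (t, x) = 0)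
    (h0 : I φ 0 = 0) : ∀ t ∈ Set.Icc 0 T, I φ t = 0 := by
  have hd : ∀ t ∈ Set.Icc 0 T, I (Dt φ) t = 0 := by
    intro t ht
    have e1 : I (Dt φ) t = I (-(D1 ((R + φ) * (Yc + v)) + D2 ((R + φ) * w))) t := by
      refine I_congr fun x hx => ?_
      have := gM t ht x hx
      simp only [D1_mul, D2_mul, D1_add, D2_add, R1, D1_Yc, ev_add, ev_mul, ev_neg, ev_zero] at this ⊢
      linear_combination this
    rw [e1, I_neg, I_div _ _ _ ((pR.add pφ).mul (Per_Yc.add pv)) ((ww t ht).mull _), neg_zero]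
  intro t ht
  rw [← h0]
  refine constant_of_has_deriv_right_zero (I_cont φ).continuousOn (fun s hs => ?_) t ht
  have := I_hasDeriv φ s
  rw [hd s ⟨hs.1, hs.2.le⟩] at this
  exact this.hasDerivWithinAt

theorem mkFlow {γ Pr r Kχ Re ε χ T K M : ℝ} (hγ : 1 < γ) (hPr : 0 < Pr) (hKχ : 0 < Kχ)
    (hKdef : K = 100 * (1 + Kχ + Pr))
    (cs : Cs Re⁻¹ (Re⁻¹ + r * Re⁻¹) (γ / (γ - 1) / (Re * Pr)) (γ - 1)⁻¹ K M)
    (S : PerturbSol γ Pr r Re ε χ T) (he : 0 < ε) (he1 : ε ≤ 1) (heK : K * ε ≤ 1 / 4) (hχ : |1 - χ| ≤ Kχ * ε)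
    (hT : 0 ≤ T) (hS : SmoothSol S) (hstd : StdHyp S) (hN : Nfun ε S.φ S.ψ S.θ T ≤ 1) :
    ∃ F : FD, Flow Re⁻¹ (Re⁻¹ + r * Re⁻¹) (γ / (γ - 1) / (Re * Pr)) (γ - 1)⁻¹ K M F ∧ F.ε = ε ∧ F.T = T ∧
      S.φ = fn F.φ ∧ S.ψ = fp F.v F.w ∧ S.θ = fn F.θ := by
  obtain ⟨sφ, sψ, sθ⟩ := hS
  obtain ⟨φ, hφ⟩ : ∃ f : Sm, S.φ = fn f := ⟨⟨Function.uncurry S.φ, mem_Sm.2 sφ⟩, rfl⟩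
  obtain ⟨θ, hθ⟩ : ∃ f : Sm, S.θ = fn f := ⟨⟨Function.uncurry S.θ, mem_Sm.2 sθ⟩, rfl⟩
  obtain ⟨v, w, hψ⟩ : ∃ f g : Sm, S.ψ = fp f g :=
    ⟨⟨fun p => (Function.uncurry S.ψ p).1, mem_Sm.2 (contDiff_fst.comp sψ)⟩,
      ⟨fun p => (Function.uncurry S.ψ p).2, mem_Sm.2 (contDiff_snd.comp sψ)⟩, rfl⟩
  have hm := hstd.2.2.2.1
  have bψ := S.bc_ψ
  have bθ := S.bc_θ
  have pφ := S.periodic_φ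
  have pψ := S.periodic_ψ
  have pθ := S.periodic_θ
  have qM := S.mass_eq
  have q1 := S.mom_eq1
  have q2 := S.mom_eq2
  have qE := S.energy_eq
  rw [hφ] at hm pφ
  rw [hψ] at bψ pψ
  rw [hθ] at bθ pθ
  rw [hφ, hψ] at qM
  rw [hφ, hψ, hθ] at q1 q2 qE hN
  clear sφ sψ sθ
  -- background
  have hγ1 : 0 < γ - 1 := by linarith
  set c := ε ^ 2 * Pr / (2 * (γ / (γ - 1))) with hc
  have hcp : 1 ≤ γ / (γ - 1) := by rw [le_div_iff₀ hγ1]; linarith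
  have hc0 : 0 ≤ c := by positivity
  have hc2 : 2 * c ≤ Pr * ε := by
    have h1 : c ≤ ε ^ 2 * Pr / 2 := by
      rw [hc]; exact div_le_div_of_nonneg_left (by positivity) (by norm_num) (by linarith)
    have h2 : ε ^ 2 * Pr ≤ Pr * ε := by nlinarith [mul_pos hPr he]
    linarith
  have hPe : 0 < Pr * ε := mul_pos hPr he
  have hKe : 0 < Kχ * ε := mul_pos hKχ he
  have hLe : (Kχ + Pr) * ε ≤ 1 / 400 := by
    rw [hKdef] at heK; nlinarith
  obtain ⟨R, pR, R1, Rt, hR, hRb⟩ := background χ c (Kχ + Pr) ε (by positivity) he hLe (by linarith) (by linarith) hc0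
  have htT : ∀ t x, tT γ Pr ε χ x = (tauS χ c).1 (t, x) := by
    rintro t ⟨x, y⟩; rw [ev_tauS]; rfl
  have htρ : ∀ t, ∀ x ∈ Ω, tρ γ Pr ε χ x = R.1 (t, x) := by
    rintro t ⟨x, y⟩ hx
    rw [hR t x y ⟨hx.2.1.le, hx.2.2.le⟩, ← htT t]; rfl
  have htu1 : ∀ t x, (fun y => (tu y).1) x = Yc.1 (t, x) := fun _ _ => rfl
  have htu2 : ∀ t x, (fun y => (tu y).2) x = (0 : Sm).1 (t, x) := fun _ _ => rfl
  have D10 : D1 (0 : Sm) = 0 := Dd_zero _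
  have D20 : D2 (0 : Sm) = 0 := Dd_zero _
  have hpρ : ∀ t, ∀ x ∈ Ω, pρ γ Pr ε χ (fn φ) t x = (R + φ).1 (t, x) := by
    intro t x hx; unfold pρ; rw [htρ t x hx, ev_add]; rfl
  have hpT : ∀ t, ∀ x ∈ Ω, pT γ Pr ε χ (fn θ) t x = (tauS χ c + θ).1 (t, x) := by
    intro t x hx; unfold pT; rw [htT t x, ev_add]; rfl
  have hP : ∀ t, ∀ x ∈ Ω, (fun y => pρ γ Pr ε χ (fn φ) t y * pT γ Pr ε χ (fn θ) t y) x
      = ((R + φ) * (tauS χ c + θ)).1 (t, x) := by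
    intro t x hx; simp only; rw [hpρ t x hx, hpT t x hx, ev_mul]
  have wv : ∀ t ∈ Set.Icc 0 T, W0 t v := fun t ht x =>
    ⟨congrArg Prod.fst (bψ t ht (x, 0) (Or.inl rfl)), congrArg Prod.fst (bψ t ht (x, 1) (Or.inr rfl))⟩
  have ww : ∀ t ∈ Set.Icc 0 T, W0 t w := fun t ht x =>
    ⟨congrArg Prod.snd (bψ t ht (x, 0) (Or.inl rfl)), congrArg Prod.snd (bψ t ht (x, 1) (Or.inr rfl))⟩
  have wθ : ∀ t ∈ Set.Icc 0 T, W0 t θ := fun t ht x =>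
    ⟨bθ t ht (x, 0) (Or.inl rfl), bθ t ht (x, 1) (Or.inr rfl)⟩
  have pφ' : Per φ := fun t x y => pφ t (x, y)
  have pθ' : Per θ := fun t x y => pθ t (x, y)
  have pv' : Per v := fun t x y => congrArg Prod.fst (pψ t (x, y))
  have pw' : Per w := fun t x y => congrArg Prod.snd (pψ t (x, y))
  have gM : ∀ t ∈ Set.Icc 0 T, ∀ x ∈ Ω,
      (Dt φ + (Yc + v) * D1 φ + w * D2 φ + (R + φ) * (D1 v + D2 w) + w * D2 R).1 (t, x) = 0 := by
    intro t ht x hx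
    have h := qM t ht x hx
    rw [hpρ t x hx, dt_fn, divv_fp] at h
    simp only [grad, dot, pu, d1_fn, d2_fn, d1_of_eqOn (htρ t) hx, d2_of_eqOn (htρ t) hx, R1, ev_fn, ev_add,
      ev_zero] at h
    simp only [ev_add, ev_mul]
    have e1 : (tu x + fp v w t x).1 = Yc.1 (t, x) + v.1 (t, x) := rfl
    have e2 : (tu x + fp v w t x).2 = w.1 (t, x) := zero_add _
    have e3 : (fp v w t x).1 = v.1 (t, x) := rfl
    have e4 : (fp v w t x).2 = w.1 (t, x) := rfl
    rw [e1, e2, e3, e4] at h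
    linear_combination h
  have hb : ∀ t ∈ Set.Icc 0 T, _ := fun t ht => N_bounds he hN ht
  have hK3 : 3 ≤ K := by rw [hKdef]; linarith
  refine ⟨⟨ε, T, φ, v, w, θ, R, tauS χ c⟩, ?_, rfl, rfl, hφ, hψ, hθ⟩
  constructor
  · exact cs
  · exact he
  · exact he1
  · exact hT
  · exact pφ'
  · exact pv'
  · exact pw'
  · exact pθ'
  · exact pR
  · exact Per_tauS χ c
  · exact R1
  · exact Rt
  · exact D1_tauS χ c
  · exact Dt_tauS χ c
  · exact wv
  · exact ww
  · exact wθ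
  · exact fun t ht x hx => (hRb t ht.1 x hx).1
  · exact gM
  · intro t ht x hx
    have h := q1 t ht x hx
    rw [hpρ t x hx, dt_fp, divv_fp, fp_1, lap_fn, d1_of_eqOn (hP t) hx] at h
    simp only [grad, dot, pu, d1_fn, d2_fn, d1_of_eqOn (fun y _ => htu1 t y) hx,
      d2_of_eqOn (fun y _ => htu1 t y) hx, D1_Yc, D2_Yc, ev_fn, ev_add, ev_one, ev_zero] at h
    simp only [FD.G1, FD.F1, FD.U, FD.P, FD.ρ, FD.Tm, FD.d, ev_add, ev_sub, ev_mul, ev_cst]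
    have e1 : (tu x + fp v w t x).1 = Yc.1 (t, x) + v.1 (t, x) := rfl
    have e2 : (tu x + fp v w t x).2 = w.1 (t, x) := zero_add _
    have e3 : (fp v w t x).1 = v.1 (t, x) := rfl
    have e4 : (fp v w t x).2 = w.1 (t, x) := rfl
    have e5 : (fp (Dt v) (Dt w) t x).1 = (Dt v).1 (t, x) := rfl
    rw [e1, e2, e3, e4, e5] at h
    linear_combination h
  · intro t ht x hx
    have h := q2 t ht x hx
    rw [hpρ t x hx, dt_fp, divv_fp, fp_2, lap_fn, d2_of_eqOn (hP t) hx] at h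
    simp only [grad, dot, pu, d1_fn, d2_fn, d1_of_eqOn (fun y _ => htu2 t y) hx,
      d2_of_eqOn (fun y _ => htu2 t y) hx, D10, D20, ev_fn, ev_add, ev_one, ev_zero] at h
    simp only [FD.G2, FD.F2, FD.U, FD.P, FD.ρ, FD.Tm, FD.d, ev_add, ev_sub, ev_mul, ev_cst]
    have e1 : (tu x + fp v w t x).1 = Yc.1 (t, x) + v.1 (t, x) := rfl
    have e2 : (tu x + fp v w t x).2 = w.1 (t, x) := zero_add _
    have e3 : (fp v w t x).1 = v.1 (t, x) := rfl
    have e4 : (fp v w t x).2 = w.1 (t, x) := rfl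
    have e5 : (fp (Dt v) (Dt w) t x).2 = (Dt w).1 (t, x) := rfl
    rw [e1, e2, e3, e4, e5] at h
    linear_combination h
  · intro t ht x hx
    have h := qE t ht x hx
    rw [hpρ t x hx, hpT t x hx, dt_fn, divv_fp, lap_fn] at h
    simp only [defContract, fp_1, fp_2, grad, dot, pu, d1_fn, d2_fn, d1_of_eqOn (fun y _ => htu2 t y) hx,
      d2_of_eqOn (fun y _ => htu2 t y) hx, d1_of_eqOn (fun y _ => htu1 t y) hx,
      d2_of_eqOn (fun y _ => htu1 t y) hx, d1_of_eqOn (fun y _ => htT t y) hx,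
      d2_of_eqOn (fun y _ => htT t y) hx, D1_tauS, D1_Yc, D2_Yc, D10, D20, ev_fn, ev_add, ev_one, ev_zero] at h
    simp only [FD.GT, FD.Qd, FD.F3, FD.U, FD.P, FD.ρ, FD.Tm, FD.d, ev_add, ev_sub, ev_mul, ev_cst]
    have e1 : (tu x + fp v w t x).1 = Yc.1 (t, x) + v.1 (t, x) := rfl
    have e2 : (tu x + fp v w t x).2 = w.1 (t, x) := zero_add _
    have e3 : (fp v w t x).1 = v.1 (t, x) := rfl
    have e4 : (fp v w t x).2 = w.1 (t, x) := rfl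
    rw [e1, e2, e3, e4, div_eq_mul_inv _ (γ - 1)] at h
    linear_combination h
  · exact fun t ht x hx => ⟨(hRb t ht.1 x hx).2.1, (hRb t ht.1 x hx).2.2.1⟩
  · exact fun t ht x hx => ⟨(hRb t ht.1 x hx).2.2.2.1, (hRb t ht.1 x hx).2.2.2.2.1⟩
  · intro t ht x hx
    obtain ⟨_, r1, r2, _⟩ := hRb t ht.1 x hx
    obtain ⟨hbφ, -⟩ := hb t ht
    have h1 := abs_le.1 (linf he he1 he.le hbφ hx).1
    change 1 / 4 ≤ R.1 (t, x) + φ.1 (t, x) ∧ R.1 (t, x) + φ.1 (t, x) ≤ 4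
    have : 3 * ε ≤ K * ε := by nlinarith
    constructor <;> linarith [h1.1, h1.2]
  · intro t ht x hx
    obtain ⟨_, _, _, r1, r2, _⟩ := hRb t ht.1 x hx
    obtain ⟨-, hbθ, -⟩ := hb t ht
    have h1 := abs_le.1 (linf he he1 he.le hbθ hx).1
    change 1 / 4 ≤ (tauS χ c).1 (t, x) + θ.1 (t, x) ∧ (tauS χ c).1 (t, x) + θ.1 (t, x) ≤ 4
    have : 3 * ε ≤ K * ε := by nlinarith
    constructor <;> linarith [h1.1, h1.2]
  · intro t ht x hx
    obtain ⟨_, _, _, _, _, r1, r2, r3⟩ := hRb t ht.1 x hx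
    obtain ⟨hbφ, hbθ, -⟩ := hb t ht
    have k1 := (linf he he1 he.le hbφ hx).1
    have k2 := (linf he he1 he.le hbθ hx).1
    have h3 : 3 * ε ≤ K * ε := by nlinarith
    have h4 : 10 * ((Kχ + Pr) * ε) ≤ K * ε := by rw [hKdef]; nlinarith
    have h5 : 0 ≤ (Kχ + Pr) * ε := by positivity
    exact ⟨k1.trans h3, k2.trans h3, by linarith, by linarith, by linarith⟩
  · intro t ht x hx
    obtain ⟨hbφ, hbθ, hbv, hbw⟩ := hb t ht
    have k1 := linf he he1 he.le hbφ hx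
    have k2 := linf he he1 he.le hbθ hx
    have k3 := linf he he1 zero_le_one hbv hx
    have k4 := linf he he1 zero_le_one hbw hx
    rw [mul_inv_cancel₀ he.ne'] at k1 k2
    simp only [mul_one] at k1 k2 k3 k4
    exact ⟨k1.2.1.trans hK3, k1.2.2.trans hK3, k2.2.1.trans hK3, k2.2.2.trans hK3, k3.1.trans hK3, k4.1.trans hK3⟩
  · intro t ht x hx
    obtain ⟨-, -, hbv, hbw⟩ := hb t ht
    have k3 := linf he he1 zero_le_one hbv hx
    have k4 := linf he he1 zero_le_one hbw hx
    rw [one_mul] at k3 k4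
    have hi : 3 * ε⁻¹ ≤ K * ε⁻¹ := mul_le_mul_of_nonneg_right hK3 (inv_nonneg.2 he.le)
    exact ⟨k3.2.1.trans hi, k3.2.2.trans hi, k4.2.1.trans hi, k4.2.2.trans hi⟩
  · exact fun _ => mean_zero pφ' pv' pR R1 ww gM hm

theorem I_nrm (F : FD) (t : ℝ) : I F.nrm t =
    (F.ε ^ 2)⁻¹ * (Dj 0 F.v t + Dj 0 F.w t) + (F.ε ^ 4)⁻¹ * (Dj 0 F.φ t + Dj 0 F.θ t)
    + (Dj 0 (D1 F.v) t + Dj 0 (D2 F.v) t + Dj 0 (D1 F.w) t + Dj 0 (D2 F.w) t)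
    + (F.ε ^ 2)⁻¹ * (Dj 0 (D1 F.θ) t + Dj 0 (D2 F.θ) t + Dj 0 (D1 F.φ) t + Dj 0 (D2 F.φ) t)
    + F.ε ^ 2 * (Dj 0 (Dt F.v) t + Dj 0 (Dt F.w) t) + Dj 0 (Dt F.φ) t + Dj 0 (Dt F.θ) t := by
  simp only [FD.nrm, I_add, I_cst_mul, Dj_zero]

theorem nrm0 (F : FD) (he : 0 < F.ε) : I F.nrm 0 ≤ 4 * (F.ε ^ 2 * A3 F.ε (fn F.φ) (fp F.v F.w) (fn F.θ) 0
      + A1 F.ε (fn F.φ) (fp F.v F.w) (fn F.θ) 0 + A2 F.ε (fn F.φ) (fp F.v F.w) (fn F.θ) 0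
      + (F.ε ^ 2)⁻¹ * A0 F.ε (fn F.φ) (fp F.v F.w) (fn F.θ) 0) := by
  have h00 : (0:ℝ) ∈ Set.Icc (0:ℝ) 0 := ⟨le_rfl, le_rfl⟩
  have a0 := A0_ge he F.φ F.v F.w F.θ h00
  have a1 := A1_ge he F.φ F.v F.w F.θ h00
  have a2 := A2_ge he F.φ F.v F.w F.θ h00
  have a3 := A3_ge he F.φ F.v F.w F.θ h00
  have e2 : 0 < F.ε ^ 2 := by positivity
  have i2 : 0 < (F.ε ^ 2)⁻¹ := inv_pos.2 e2
  have a0' := mul_le_mul_of_nonneg_left a0 i2.le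
  have a3' := mul_le_mul_of_nonneg_left a3 e2.le
  rw [I_nrm]
  have e4 : (F.ε ^ 4)⁻¹ = (F.ε ^ 2)⁻¹ * (F.ε ^ 2)⁻¹ := by rw [← mul_inv]; congr 1; ring
  have hi : F.ε ^ 2 * (F.ε ^ 2)⁻¹ = 1 := mul_inv_cancel₀ e2.ne'
  rw [e4]
  set i := (F.ε ^ 2)⁻¹ with hi'
  set e := F.ε ^ 2
  have b1 : e * (i * Dj 0 (Dt F.φ) 0 + Dp 0 (Dt F.v) (Dt F.w) 0 + i * Dj 0 (Dt F.θ) 0)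
      = Dj 0 (Dt F.φ) 0 + e * Dp 0 (Dt F.v) (Dt F.w) 0 + Dj 0 (Dt F.θ) 0 := by
    linear_combination (Dj 0 (Dt F.φ) 0 + Dj 0 (Dt F.θ) 0) * hi
  rw [b1] at a3'
  have c1 := mul_le_mul_of_nonneg_left (Dp_fst 0 (Dt F.v) (Dt F.w) 0) e2.le
  have c2 := mul_le_mul_of_nonneg_left (Dp_snd 0 (Dt F.v) (Dt F.w) 0) e2.le
  have c3 := mul_le_mul_of_nonneg_left (Dp_fst 0 F.v F.w 0) i2.le
  have c4 := mul_le_mul_of_nonneg_left (Dp_snd 0 F.v F.w 0) i2.le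
  have c5 := (Dj_D1 0 F.v 0).trans (Dp_fst 1 F.v F.w 0)
  have c6 := (Dj_D2 0 F.v 0).trans (Dp_fst 1 F.v F.w 0)
  have c7 := (Dj_D1 0 F.w 0).trans (Dp_snd 1 F.v F.w 0)
  have c8 := (Dj_D2 0 F.w 0).trans (Dp_snd 1 F.v F.w 0)
  have d1 := mul_le_mul_of_nonneg_left (Dj_D1 0 F.θ 0) i2.le
  have d2 := mul_le_mul_of_nonneg_left (Dj_D2 0 F.θ 0) i2.le
  have d3 := mul_le_mul_of_nonneg_left (Dj_D1 0 F.φ 0) i2.le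
  have d4 := mul_le_mul_of_nonneg_left (Dj_D2 0 F.φ 0) i2.le
  have n1 := mul_nonneg i2.le (Dj_nn 1 F.θ 0)
  have n2 := mul_nonneg i2.le (Dj_nn 1 F.φ 0)
  have n3 := Dj_nn 0 (Dt F.φ) 0
  have n4 := Dj_nn 0 (Dt F.θ) 0
  have n5 := mul_nonneg (mul_pos i2 i2).le (Dj_nn 0 F.φ 0)
  have n6 := mul_nonneg (mul_pos i2 i2).le (Dj_nn 0 F.θ 0)
  have n7 := mul_nonneg i2.le (Dp_nn 0 F.v F.w 0)
  have n8 := mul_nonneg e2.le (Dp_nn 0 (Dt F.v) (Dt F.w) 0)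
  have n9 := Dp_nn 1 F.v F.w 0
  nlinarith only [c1, c2, c3, c4, c5, c6, c7, c8, d1, d2, d3, d4, n1, n2, n3, n4, n5, n6, n7, n8, n9, a0', a1, a2, a3']

theorem RHS_nn (F : FD) (he : 0 < F.ε) : 0 ≤ A1 F.ε (fn F.φ) (fp F.v F.w) (fn F.θ) 0 + A2 F.ε (fn F.φ) (fp F.v F.w) (fn F.θ) 0
      + (F.ε ^ 2)⁻¹ * A0 F.ε (fn F.φ) (fp F.v F.w) (fn F.θ) 0 ∧ 0 ≤ A3 F.ε (fn F.φ) (fp F.v F.w) (fn F.θ) 0 := by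
  have h00 : (0:ℝ) ∈ Set.Icc (0:ℝ) 0 := ⟨le_rfl, le_rfl⟩
  have e2 : 0 < F.ε ^ 2 := by positivity
  have i2 : 0 < (F.ε ^ 2)⁻¹ := inv_pos.2 e2
  have a0 := A0_ge he F.φ F.v F.w F.θ h00
  have a1 := A1_ge he F.φ F.v F.w F.θ h00
  have a2 := A2_ge he F.φ F.v F.w F.θ h00
  have a3 := A3_ge he F.φ F.v F.w F.θ h00
  have b0 := (add_nonneg (add_nonneg (Dp_nn 0 F.v F.w 0) (mul_nonneg i2.le (Dj_nn 0 F.φ 0))) (mul_nonneg i2.le (Dj_nn 0 F.θ 0))).trans a0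
  have b1 := (add_nonneg (Dp_nn 1 F.v F.w 0) (mul_nonneg i2.le (Dj_nn 1 F.θ 0))).trans a1
  have b2 := (mul_nonneg i2.le (Dj_nn 1 F.φ 0)).trans a2
  have b3 := (add_nonneg (add_nonneg (mul_nonneg i2.le (Dj_nn 0 (Dt F.φ) 0)) (Dp_nn 0 (Dt F.v) (Dt F.w) 0)) (mul_nonneg i2.le (Dj_nn 0 (Dt F.θ) 0))).trans a3
  exact ⟨add_nonneg (add_nonneg b1 b2) (mul_nonneg i2.le b0), b3⟩

theorem Xt_eq (F : FD) (he : 0 < F.ε) (s : ℝ) : F.Xt s = F.ε ^ 2 * (Dj 0 (D1 (Dt F.v)) s + Dj 0 (D2 (Dt F.v)) s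
      + Dj 0 (D1 (Dt F.w)) s + Dj 0 (D2 (Dt F.w)) s) + (Dj 0 (D1 (Dt F.θ)) s + Dj 0 (D2 (Dt F.θ)) s) := by
  have e1 : F.Lt.dψ = cst (F.ε^2) * ((D1 (Dt F.v))^2+(D2 (Dt F.v))^2+(D1 (Dt F.w))^2+(D2 (Dt F.w))^2) := by
    apply Sm.ext'; intro p
    simp only [LF.dψ, FD.Lt, D1_mul, D2_mul, D1_cst, D2_cst, ev_add, ev_mul, ev_pow, ev_cst, ev_zero]; ring
  have e2 : F.Lt.dθ = cst (F.ε^2) * ((D1 (Dt F.θ))^2+(D2 (Dt F.θ))^2) := by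
    apply Sm.ext'; intro p
    simp only [LF.dθ, FD.Lt, D1_mul, D2_mul, D1_cst, D2_cst, ev_add, ev_mul, ev_pow, ev_cst, ev_zero]; ring
  have hi : (F.ε ^ 2)⁻¹ * F.ε ^ 2 = 1 := inv_mul_cancel₀ (by positivity)
  unfold FD.Xt FD.i
  rw [e1, e2]
  simp only [I_add, I_cst_mul, Dj_zero]
  rw [← mul_assoc, hi, one_mul]

theorem A3_le (F : FD) (he : 0 < F.ε) {t X : ℝ} (ht : 0 ≤ t) (hX : 0 ≤ X) (h1 : ∀ s ∈ Set.Icc 0 t, I F.nrm s ≤ X)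
    (h2 : ∫ s in (0:ℝ)..t, F.Xt s ≤ X) : F.ε ^ 2 * A3 F.ε (fn F.φ) (fp F.v F.w) (fn F.θ) t ≤ 6 * X := by
  have e2 : 0 < F.ε ^ 2 := by positivity
  have i2 : 0 < (F.ε ^ 2)⁻¹ := inv_pos.2 e2
  have e4 : 0 < (F.ε ^ 4)⁻¹ := by positivity
  have hi : F.ε ^ 2 * (F.ε ^ 2)⁻¹ = 1 := mul_inv_cancel₀ e2.ne'
  have hXc : Continuous F.Xt := by
    unfold FD.Xt; exact (I_cont _).add (continuous_const.mul (I_cont _))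
  unfold A3
  rw [dt_fn, dt_fn, dt_fp]
  have p1 : (⨆ s ∈ Set.Icc (0 : ℝ) t,
      ((F.ε ^ 2)⁻¹ * L2Sq (fn (Dt F.φ) s) + L2Sq (fp (Dt F.v) (Dt F.w) s) + (F.ε ^ 2)⁻¹ * L2Sq (fn (Dt F.θ) s)))
      ≤ (F.ε ^ 2)⁻¹ * (2 * X) := by
    refine bsup_le ?_ (by positivity)
    intro s hs
    have h := h1 s hs
    rw [I_nrm] at h
    change (F.ε ^ 2)⁻¹ * Dj 0 (Dt F.φ) s + Dp 0 (Dt F.v) (Dt F.w) s + (F.ε ^ 2)⁻¹ * Dj 0 (Dt F.θ) s ≤ _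
    have k := Dp_up 0 (Dt F.v) (Dt F.w) s
    have q1 : 0 ≤ (F.ε ^ 2)⁻¹ * (Dj 0 F.v s + Dj 0 F.w s) := mul_nonneg i2.le (add_nonneg (Dj_nn _ _ _) (Dj_nn _ _ _))
    have q2 : 0 ≤ (F.ε ^ 4)⁻¹ * (Dj 0 F.φ s + Dj 0 F.θ s) := mul_nonneg e4.le (add_nonneg (Dj_nn _ _ _) (Dj_nn _ _ _))
    have q3 : 0 ≤ Dj 0 (D1 F.v) s + Dj 0 (D2 F.v) s + Dj 0 (D1 F.w) s + Dj 0 (D2 F.w) s :=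
      add_nonneg (add_nonneg (add_nonneg (Dj_nn _ _ _) (Dj_nn _ _ _)) (Dj_nn _ _ _)) (Dj_nn _ _ _)
    have q4 : 0 ≤ (F.ε ^ 2)⁻¹ * (Dj 0 (D1 F.θ) s + Dj 0 (D2 F.θ) s + Dj 0 (D1 F.φ) s + Dj 0 (D2 F.φ) s) :=
      mul_nonneg i2.le (add_nonneg (add_nonneg (add_nonneg (Dj_nn _ _ _) (Dj_nn _ _ _)) (Dj_nn _ _ _)) (Dj_nn _ _ _))
    have n3 := Dj_nn 0 (Dt F.φ) s
    have n4 := Dj_nn 0 (Dt F.θ) s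
    have hh : F.ε ^ 2 * (Dj 0 (Dt F.v) s + Dj 0 (Dt F.w) s) + Dj 0 (Dt F.φ) s + Dj 0 (Dt F.θ) s ≤ X := by linarith
    have h' := mul_le_mul_of_nonneg_left hh i2.le
    have e : (F.ε ^ 2)⁻¹ * (F.ε ^ 2 * (Dj 0 (Dt F.v) s + Dj 0 (Dt F.w) s) + Dj 0 (Dt F.φ) s + Dj 0 (Dt F.θ) s)
       = (Dj 0 (Dt F.v) s + Dj 0 (Dt F.w) s) + (F.ε ^ 2)⁻¹ * Dj 0 (Dt F.φ) s + (F.ε ^ 2)⁻¹ * Dj 0 (Dt F.θ) s := by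
      linear_combination (Dj 0 (Dt F.v) s + Dj 0 (Dt F.w) s) * hi
    rw [e] at h'
    have n5 := mul_nonneg i2.le n3
    have n6 := mul_nonneg i2.le n4
    linarith
  have p2 : ∫ s in (0 : ℝ)..t, (dSq 1 (fp (Dt F.v) (Dt F.w) s) + (F.ε ^ 2)⁻¹ * dSq 1 (fn (Dt F.θ) s))
      ≤ (F.ε ^ 2)⁻¹ * (4 * X) := by
    have : ∫ s in (0 : ℝ)..t, (dSq 1 (fp (Dt F.v) (Dt F.w) s) + (F.ε ^ 2)⁻¹ * dSq 1 (fn (Dt F.θ) s))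
        ≤ ∫ s in (0:ℝ)..t, (4 * (F.ε ^ 2)⁻¹) * F.Xt s := by
      rw [intervalIntegral.integral_of_le ht, intervalIntegral.integral_of_le ht]
      refine MeasureTheory.integral_mono_of_nonneg ?_ ?_ ?_
      · exact Filter.Eventually.of_forall fun s => add_nonneg (dSq_nn _ _) (mul_nonneg i2.le (dSq_nn _ _))
      · exact ((continuous_const.mul hXc).intervalIntegrable 0 t).1
      · refine Filter.Eventually.of_forall fun s => ?_
        change Dp 1 (Dt F.v) (Dt F.w) s + (F.ε ^ 2)⁻¹ * Dj 1 (Dt F.θ) s ≤ 4 * (F.ε ^ 2)⁻¹ * F.Xt s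
        rw [Xt_eq F he]
        have k := Dp_up 1 (Dt F.v) (Dt F.w) s
        have k1 := Dj_up 0 (Dt F.v) s
        have k2 := Dj_up 0 (Dt F.w) s
        have k3 := mul_le_mul_of_nonneg_left (Dj_up 0 (Dt F.θ) s) i2.le
        have n1 := mul_nonneg i2.le (Dj_nn 0 (D1 (Dt F.θ)) s)
        have n2 := mul_nonneg i2.le (Dj_nn 0 (D2 (Dt F.θ)) s)
        have e : 4 * (F.ε ^ 2)⁻¹ * (F.ε ^ 2 * (Dj 0 (D1 (Dt F.v)) s + Dj 0 (D2 (Dt F.v)) s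
            + Dj 0 (D1 (Dt F.w)) s + Dj 0 (D2 (Dt F.w)) s) + (Dj 0 (D1 (Dt F.θ)) s + Dj 0 (D2 (Dt F.θ)) s))
            = 4 * (Dj 0 (D1 (Dt F.v)) s + Dj 0 (D2 (Dt F.v)) s
            + Dj 0 (D1 (Dt F.w)) s + Dj 0 (D2 (Dt F.w)) s) + 4 * ((F.ε ^ 2)⁻¹ * Dj 0 (D1 (Dt F.θ)) s)
             + 4 * ((F.ε ^ 2)⁻¹ * Dj 0 (D2 (Dt F.θ)) s) := by
          linear_combination 4 * (Dj 0 (D1 (Dt F.v)) s + Dj 0 (D2 (Dt F.v)) s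
            + Dj 0 (D1 (Dt F.w)) s + Dj 0 (D2 (Dt F.w)) s) * hi
        rw [e]
        linarith
    rw [intervalIntegral.integral_const_mul] at this
    refine this.trans ?_
    have := mul_le_mul_of_nonneg_left h2 (show 0 ≤ 4 * (F.ε ^ 2)⁻¹ by positivity)
    linarith
  have := mul_le_mul_of_nonneg_left (add_le_add p1 p2) e2.le
  refine this.trans (le_of_eq ?_)
  linear_combination 6 * X * hi

theorem Dj2_le (f : Sm) (t : ℝ) : Dj 2 f t ≤ 8 * I (H2 f) t := by
  have h := Dj_up 1 f t
  have h1 := Dj_up 0 (D1 f) t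
  have h2 := Dj_up 0 (D2 f) t
  rw [D2_D1] at h1
  simp only [H2, I_add]
  simp only [Dj_zero] at h1 h2
  have n1 := I_sq_nonneg (D1 (D1 f)) t
  have n2 := I_sq_nonneg (D2 (D2 f)) t
  have n3 := I_sq_nonneg (D1 (D2 f)) t
  norm_num at h h1 h2
  linarith

theorem second_le (F : FD) (t : ℝ) : F.ε ^ 2 * Dp 2 F.v F.w t + Dj 2 F.θ t
    ≤ 16 * I (cst (F.ε ^ 2) * (H2 F.v + H2 F.w) + H2 F.θ) t := by
  have h1 := Dj2_le F.v t
  have h2 := Dj2_le F.w t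
  have h3 := Dj2_le F.θ t
  have h4 := Dp_up 2 F.v F.w t
  have n := Dj_nn 2 F.θ t
  simp only [I_add, I_cst_mul]
  have e2 : 0 ≤ F.ε ^ 2 := by positivity
  have h5 : Dp 2 F.v F.w t ≤ 16 * (I (H2 F.v) t + I (H2 F.w) t) := by linarith
  have := mul_le_mul_of_nonneg_left h5 e2
  linarith

theorem final_FD {a b κ g K M : ℝ} (cs : Cs a b κ g K M)
    (ha : 5 * (4 + 2 * K + 8 * g * K + 16 * K) + 1 ≤ a / 2)
    (hκ : 4 * (4 + 2 * K + 8 * g * K + 16 * K) + 1 ≤ κ / 4) :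
    ∃ ε₂ C : ℝ, 0 < ε₂ ∧ 0 < C ∧ ∀ F : FD, Flow a b κ g K M F → F.ε ≤ ε₂ →
      ∀ t ∈ Set.Icc 0 F.T, F.ε ^ 2 * A3 F.ε (fn F.φ) (fp F.v F.w) (fn F.θ) t
        ≤ C * (F.ε ^ 2 * A3 F.ε (fn F.φ) (fp F.v F.w) (fn F.θ) 0
      + A1 F.ε (fn F.φ) (fp F.v F.w) (fn F.θ) 0 + A2 F.ε (fn F.φ) (fp F.v F.w) (fn F.θ) 0
      + (F.ε ^ 2)⁻¹ * A0 F.ε (fn F.φ) (fp F.v F.w) (fn F.θ) 0) ∧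
      F.ε ^ 2 * Dp 2 F.v F.w t + Dj 2 F.θ t ≤ C * (F.ε ^ 2 * A3 F.ε (fn F.φ) (fp F.v F.w) (fn F.θ) 0
      + A1 F.ε (fn F.φ) (fp F.v F.w) (fn F.θ) 0 + A2 F.ε (fn F.φ) (fp F.v F.w) (fn F.θ) 0
      + (F.ε ^ 2)⁻¹ * A0 F.ε (fn F.φ) (fp F.v F.w) (fn F.θ) 0) := by
  obtain ⟨ε₂, C, he2, hC, H⟩ := energy cs ha hκ
  obtain ⟨D, hD, HD⟩ := ell cs
  have hC0 : 0 ≤ C := by linarith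
  have hDC : 0 ≤ D * C := mul_nonneg hD hC0
  refine ⟨ε₂, 24 * C + 64 * (D * C), he2, by linarith, ?_⟩
  intro F hF hle t ht
  have he := hF.e0
  have hn0 := nrm0 F he
  obtain ⟨r1, r2⟩ := RHS_nn F he
  have e2 : 0 ≤ F.ε ^ 2 := by positivity
  have r3 := mul_nonneg e2 r2
  have hs := second_le F t
  have hl := HD F hF t ht
  obtain ⟨R, hR⟩ : ∃ R, R = F.ε ^ 2 * A3 F.ε (fn F.φ) (fp F.v F.w) (fn F.θ) 0
      + A1 F.ε (fn F.φ) (fp F.v F.w) (fn F.θ) 0 + A2 F.ε (fn F.φ) (fp F.v F.w) (fn F.θ) 0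
      + (F.ε ^ 2)⁻¹ * A0 F.ε (fn F.φ) (fp F.v F.w) (fn F.θ) 0 := ⟨_, rfl⟩
  rw [← hR] at hn0 ⊢
  have hR0 : 0 ≤ R := by linarith
  have hRA : F.ε ^ 2 * A3 F.ε (fn F.φ) (fp F.v F.w) (fn F.θ) 0 ≤ R := by linarith
  have hCR : 0 ≤ C * R := mul_nonneg hC0 hR0
  have hDCR : 0 ≤ D * C * R := mul_nonneg hDC hR0
  have hRC : R ≤ C * R := by nlinarith
  have key : I F.nrm t ≤ C * (4 * R) → F.ε ^ 2 * Dp 2 F.v F.w t + Dj 2 F.θ t ≤ (24 * C + 64 * (D * C)) * R := by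
    intro hk
    have := mul_le_mul_of_nonneg_left hk hD
    nlinarith only [this, hs, hl, hCR]
  rcases hF.hT.eq_or_lt with h0 | hT
  · have ht0 : t = 0 := by
      rw [← h0] at ht; exact le_antisymm ht.2 ht.1
    subst ht0
    refine ⟨by linarith, key (by linarith)⟩
  · have h := H F hF hle hT
    have hC4 := mul_le_mul_of_nonneg_left hn0 hC0
    refine ⟨?_, key ((h t ht).1.trans hC4)⟩
    have := A3_le F he ht.1 (X := C * (4 * R)) (by positivity)
      (fun s hs => (h s ⟨hs.1, hs.2.trans ht.2⟩).1.trans hC4) ((h t ht).2.trans hC4)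
    linarith

theorem time_derivative_estimates (γ Pr r Kχ : ℝ)
    (hγ : 1 < γ) (hPr : 0 < Pr) (hr : 0 < 1 + r) (hK : 0 < Kχ) :
    ∃ Re₀ ε₁ : ℝ, 0 < Re₀ ∧ 0 < ε₁ ∧
      ∀ Re : ℝ, 0 < Re → Re < Re₀ →
        ∃ ε₂ C : ℝ, 0 < ε₂ ∧ 0 < C ∧
          ∀ (ε χ T : ℝ) (S : PerturbSol γ Pr r Re ε χ T),
            0 < ε → ε ≤ 1 → ε < ε₁ → ε ≤ ε₂ → 0 < χ → |1 - χ| ≤ Kχ * ε →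
            |1 - χ| ≤ 1 / 2 → 0 ≤ T → SmoothSol S → StdHyp S →
            Nfun ε S.φ S.ψ S.θ T ≤ 1 →
            ∀ t ∈ Set.Icc (0 : ℝ) T,
              ε ^ 2 * A3 ε S.φ S.ψ S.θ t
                  ≤ C * (ε ^ 2 * A3 ε S.φ S.ψ S.θ 0 + A1 ε S.φ S.ψ S.θ 0
                      + A2 ε S.φ S.ψ S.θ 0 + (ε ^ 2)⁻¹ * A0 ε S.φ S.ψ S.θ 0) ∧
              ε ^ 2 * dSq 2 (S.ψ t) + dSq 2 (S.θ t)
                  ≤ C * (ε ^ 2 * A3 ε S.φ S.ψ S.θ 0 + A1 ε S.φ S.ψ S.θ 0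
                      + A2 ε S.φ S.ψ S.θ 0 + (ε ^ 2)⁻¹ * A0 ε S.φ S.ψ S.θ 0) := by
  obtain ⟨K, hKdef⟩ : ∃ K : ℝ, K = 100 * (1 + Kχ + Pr) := ⟨_, rfl⟩
  obtain ⟨g, hg⟩ : ∃ g : ℝ, g = (γ - 1)⁻¹ := ⟨_, rfl⟩
  have g0 : 0 < g := by rw [hg]; exact inv_pos.2 (by linarith)
  have K1 : 1 ≤ K := by rw [hKdef]; linarith
  have K0 : 0 < K := by linarith
  obtain ⟨A, hA⟩ : ∃ A : ℝ, A = 5 * (4 + 2 * K + 8 * g * K + 16 * K) + 1 := ⟨_, rfl⟩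
  have hq : 0 ≤ 4 + 2 * K + 8 * g * K + 16 * K := by positivity
  have A0' : 0 < A := by rw [hA]; linarith
  have hG : 0 < γ / (γ - 1) := div_pos (by linarith) (by linarith)
  refine ⟨min (1 / (2 * A)) (γ / (γ - 1) / (4 * A * Pr)), 1 / (4 * K), by positivity, by positivity, ?_⟩
  intro Re hRe hlt
  have l1 := hlt.trans_le (min_le_left _ _)
  have l2 := hlt.trans_le (min_le_right _ _)
  have ha : A ≤ Re⁻¹ / 2 := by
    rw [lt_div_iff₀ (by positivity)] at l1
    rw [le_div_iff₀ (by norm_num), ← one_div, le_div_iff₀ hRe]; linarith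
  have hκ : A ≤ γ / (γ - 1) / (Re * Pr) / 4 := by
    rw [lt_div_iff₀ (by positivity)] at l2
    rw [le_div_iff₀ (by norm_num), le_div_iff₀ (by positivity)]; linarith
  have a0 : 0 < Re⁻¹ := inv_pos.2 hRe
  have b0 : 0 < Re⁻¹ + r * Re⁻¹ := by
    have := mul_pos hr a0; linarith
  have κ0 : 0 < γ / (γ - 1) / (Re * Pr) := by positivity
  have ab0 : 0 < (Re⁻¹ + (Re⁻¹ + r * Re⁻¹))⁻¹ := by positivity
  have bb := abs_nonneg ((Re⁻¹ + r * Re⁻¹) - Re⁻¹)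
  have cs : Cs Re⁻¹ (Re⁻¹ + r * Re⁻¹) (γ / (γ - 1) / (Re * Pr)) g K
      (2 + K + Re⁻¹ + (Re⁻¹ + r * Re⁻¹) + |(Re⁻¹ + r * Re⁻¹) - Re⁻¹| + γ / (γ - 1) / (Re * Pr) + g
        + (Re⁻¹ + (Re⁻¹ + r * Re⁻¹))⁻¹) := by
    constructor <;> linarith
  obtain ⟨ε₂, C, h2, hC, H⟩ := final_FD cs (by rw [← hA]; exact ha) (by linarith)
  refine ⟨ε₂, C, h2, hC, ?_⟩
  intro ε χ T S he he1 hε1 hε2 _ hχ _ hT hS hstd hN t ht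
  have heK : K * ε ≤ 1 / 4 := by
    rw [lt_div_iff₀ (by positivity)] at hε1; linarith
  rw [hg] at cs H
  obtain ⟨F, hF, eε, eT, eφ, eψ, eθ⟩ := mkFlow hγ hPr hK hKdef cs S he he1 heK hχ hT hS hstd hN
  have := H F hF (by rw [eε]; exact hε2) t (by rw [eT]; exact ht)
  rw [eε] at this
  rw [eφ, eψ, eθ]
  exact this

end Couette
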